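/- Pointwise Riesz potential estimate (Theorem 1.1). Let u be a local weak solution of ∂_t u − div(𝒜(t,x,Du)) + ℒu = μ in Ω_T, where μ is a finite signed Radon measure on ℝ^{1+d}. Then for every q ∈ (1,2] there exists a constant C > 0 depending only on d, s, Λ, q such that for every R ∈ (0,1] and almost every (t₀,x₀) ∈ I × Ω with Q_{2R}(t₀,x₀) compactly contained in I × Ω one has |u(t₀,x₀)| ≤ C [ (⨍_{Q_R(t₀,x₀)} |u|^q dx dt)^{1/q} + (⨍_{I_R^⊖(t₀)} Tail(u(t); x₀, R)^q dt)^{1/q} + ℐ^μ_2(t₀,x₀; 2R) ]. -/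

import Mathlib

open MeasureTheory Set Filter Metric
open scoped ENNReal NNReal Topology RealInnerProductSpace

noncomputable section

/-- Euclidean space `ℝ^d`. -/
abbrev Ed (d : ℕ) : Type := EuclideanSpace ℝ (Fin d)

variable {d : ℕ}

/-- Backward time interval `I_r^⊖(t₀) = (t₀ - r², t₀)`. -/
def Iminus (t₀ r : ℝ) : Set ℝ := Set.Ioo (t₀ - r ^ 2) t₀

/-- Parabolic cylinder `Q_r(t₀,x₀) = I_r^⊖(t₀) × B_r(x₀)`. -/
def pCyl (t₀ : ℝ) (x₀ : Ed d) (r : ℝ) : Set (ℝ × Ed d) :=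
  (Iminus t₀ r) ×ˢ (Metric.ball x₀ r)

/-- Nonlocal tail `Tail(v; x₀, R) = R² ∫_{ℝ^d ∖ B_R(x₀)} |v(y)| |x₀ - y|^{-d-2s} dy`. -/
def Tail (s : ℝ) (v : Ed d → ℝ) (x₀ : Ed d) (R : ℝ) : ℝ :=
  R ^ 2 * ∫ y in (Metric.ball x₀ R)ᶜ, |v y| / ‖x₀ - y‖ ^ ((d : ℝ) + 2 * s)

/-- Caloric Riesz potential `ℐ^ν_α(t₀,x₀;R) = ∫₀^R ν(Q_ρ(t₀,x₀)) ρ^{-(d+2-α)} dρ/ρ`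
for a nonnegative measure `ν`. -/
def RieszPot (ν : Measure (ℝ × Ed d)) (α : ℝ) (t₀ : ℝ) (x₀ : Ed d) (R : ℝ) : ℝ :=
  ∫ ρ in Set.Ioo (0 : ℝ) R, (ν (pCyl t₀ x₀ ρ)).toReal / ρ ^ ((d : ℝ) + 2 - α) / ρ

/-- The structure conditions (1.2)-(1.3) on the vector field `𝒜`. -/
structure VectorFieldHyp (d : ℕ) (Λ : ℝ) (A : ℝ → Ed d → Ed d → Ed d) : Prop where
  meas : ∀ ξ : Ed d, Measurable fun p : ℝ × Ed d => A p.1 p.2 ξ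
  cont : ∀ t x, Continuous (A t x)
  growth : ∀ t x ξ, ‖A t x ξ‖ ≤ Λ * ‖ξ‖
  monotone : ∀ t x ξ η, Λ⁻¹ * ‖η - ξ‖ ^ 2 ≤ ⟪A t x η - A t x ξ, η - ξ⟫

/-- The ellipticity and symmetry conditions on the jump kernel `K`. -/
structure KernelHyp (d : ℕ) (s Λ : ℝ) (K : ℝ → Ed d → Ed d → ℝ) : Prop where
  meas : Measurable fun p : ℝ × Ed d × Ed d => K p.1 p.2.1 p.2.2
  symm : ∀ t x y, K t x y = K t y x
  lower : ∀ t x y, x ≠ y → Λ⁻¹ / ‖x - y‖ ^ ((d : ℝ) + 2 * s) ≤ K t x y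
  upper : ∀ t x y, x ≠ y → K t x y ≤ Λ / ‖x - y‖ ^ ((d : ℝ) + 2 * s)

/-- Membership of `v` (with weak spatial gradient `Dv`) in the function space
`L²_loc(J; W^{1,2}_loc(Ω)) ∩ L^∞_loc(J; L²_loc(Ω)) ∩ L²_loc(J; 𝓛¹_{2s}(ℝ^d))`. -/
structure LocalWeakReg (d : ℕ) (s : ℝ) (J : Set ℝ) (Ω : Set (Ed d))
    (v : ℝ → Ed d → ℝ) (Dv : ℝ → Ed d → Ed d) : Prop where
  meas : Measurable (Function.uncurry v)
  measD : Measurable (Function.uncurry Dv)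
  grad : ∀ t ∈ J, ∀ φ : Ed d → ℝ, ContDiff ℝ (⊤ : ℕ∞) φ → HasCompactSupport φ →
    tsupport φ ⊆ Ω → ∀ e : Ed d,
      ∫ x, v t x * (fderiv ℝ φ x) e = - ∫ x, φ x * ⟪Dv t x, e⟫
  l2w12 : ∀ t₁ t₂ : ℝ, Set.Icc t₁ t₂ ⊆ J → ∀ Kc : Set (Ed d), IsCompact Kc → Kc ⊆ Ω →
    MeasureTheory.IntegrableOn
      (fun p : ℝ × Ed d => (v p.1 p.2) ^ 2 + ‖Dv p.1 p.2‖ ^ 2) ((Set.Ioo t₁ t₂) ×ˢ Kc)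
  linfl2 : ∀ t₁ t₂ : ℝ, Set.Icc t₁ t₂ ⊆ J → ∀ Kc : Set (Ed d), IsCompact Kc → Kc ⊆ Ω →
    ∃ M : ℝ, ∀ᵐ t ∂(volume.restrict (Set.Ioo t₁ t₂)), (∫ x in Kc, (v t x) ^ 2) ≤ M
  tail_ae : ∀ᵐ t : ℝ, t ∈ J →
    MeasureTheory.Integrable fun y : Ed d => |v t y| / (1 + ‖y‖ ^ ((d : ℝ) + 2 * s))
  tail_l2 : ∀ t₁ t₂ : ℝ, Set.Icc t₁ t₂ ⊆ J →
    MeasureTheory.IntegrableOn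
      (fun t => (∫ y : Ed d, |v t y| / (1 + ‖y‖ ^ ((d : ℝ) + 2 * s))) ^ 2) (Set.Ioo t₁ t₂)

/-- Smooth test functions with compact spatial support contained in `Ω`. -/
def IsTestFunction (Ω : Set (Ed d)) (φ : ℝ → Ed d → ℝ) : Prop :=
  ContDiff ℝ (⊤ : ℕ∞) (Function.uncurry φ) ∧
    ∃ Kc : Set (Ed d), IsCompact Kc ∧ Kc ⊆ Ω ∧ ∀ t, tsupport (φ t) ⊆ Kc

/-- The left-hand side of the weak formulation of
`∂_t u - div(𝒜(t,x,Du)) + ℒu` tested against `φ` on `(t₁,t₂] × Ω`. -/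
def mixedLHS (A : ℝ → Ed d → Ed d → Ed d) (K : ℝ → Ed d → Ed d → ℝ)
    (Ω : Set (Ed d)) (u : ℝ → Ed d → ℝ) (Du : ℝ → Ed d → Ed d)
    (φ : ℝ → Ed d → ℝ) (t₁ t₂ : ℝ) : ℝ :=
  -(∫ t in Set.Ioc t₁ t₂, ∫ x in Ω, u t x * deriv (fun τ => φ τ x) t)
    + (∫ x in Ω, u t₂ x * φ t₂ x) - (∫ x in Ω, u t₁ x * φ t₁ x)
    + (∫ t in Set.Ioc t₁ t₂, ∫ x in Ω, ⟪A t x (Du t x), gradient (φ t) x⟫)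
    + ∫ t in Set.Ioc t₁ t₂, ∫ x : Ed d, ∫ y : Ed d,
        (u t x - u t y) * (φ t x - φ t y) * K t x y

/-- Integral of a function against a finite signed measure. -/
def signedIntegral (μ : MeasureTheory.SignedMeasure (ℝ × Ed d)) (f : ℝ × Ed d → ℝ) : ℝ :=
  (∫ p, f p ∂μ.toJordanDecomposition.posPart)
    - ∫ p, f p ∂μ.toJordanDecomposition.negPart

/-- Local weak solution of `∂_t u - div(𝒜(t,x,Du)) + ℒu = μ` in `J × Ω`. -/
def IsLocalWeakSolution (A : ℝ → Ed d → Ed d → Ed d) (K : ℝ → Ed d → Ed d → ℝ)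
    (J : Set ℝ) (Ω : Set (Ed d)) (μ : MeasureTheory.SignedMeasure (ℝ × Ed d))
    (u : ℝ → Ed d → ℝ) (Du : ℝ → Ed d → Ed d) : Prop :=
  ∀ t₁ t₂ : ℝ, t₁ ≤ t₂ → Set.Icc t₁ t₂ ⊆ J →
    ∀ φ : ℝ → Ed d → ℝ, IsTestFunction Ω φ →
      mixedLHS A K Ω u Du φ t₁ t₂ =
        signedIntegral μ (Set.indicator ((Set.Ioc t₁ t₂) ×ˢ Ω) fun p => φ p.1 p.2)

/-- Local weak solution of the homogeneous equation
`∂_t v - div(𝒜(t,x,Dv)) + ℒv = 0` in `J × Ω`. -/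
def IsLocalWeakSolutionHom (A : ℝ → Ed d → Ed d → Ed d) (K : ℝ → Ed d → Ed d → ℝ)
    (J : Set ℝ) (Ω : Set (Ed d))
    (v : ℝ → Ed d → ℝ) (Dv : ℝ → Ed d → Ed d) : Prop :=
  ∀ t₁ t₂ : ℝ, t₁ ≤ t₂ → Set.Icc t₁ t₂ ⊆ J →
    ∀ φ : ℝ → Ed d → ℝ, IsTestFunction Ω φ → mixedLHS A K Ω v Dv φ t₁ t₂ = 0

/-- Local weak subsolution of the homogeneous equation in `J × Ω`. -/
def IsLocalWeakSubsolutionHom (A : ℝ → Ed d → Ed d → Ed d) (K : ℝ → Ed d → Ed d → ℝ)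
    (J : Set ℝ) (Ω : Set (Ed d))
    (v : ℝ → Ed d → ℝ) (Dv : ℝ → Ed d → Ed d) : Prop :=
  ∀ t₁ t₂ : ℝ, t₁ ≤ t₂ → Set.Icc t₁ t₂ ⊆ J →
    ∀ φ : ℝ → Ed d → ℝ, IsTestFunction Ω φ → (∀ t x, 0 ≤ φ t x) →
      mixedLHS A K Ω v Dv φ t₁ t₂ ≤ 0

/-- Local weak supersolution of the homogeneous equation in `J × Ω`. -/
def IsLocalWeakSupersolutionHom (A : ℝ → Ed d → Ed d → Ed d) (K : ℝ → Ed d → Ed d → ℝ)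
    (J : Set ℝ) (Ω : Set (Ed d))
    (v : ℝ → Ed d → ℝ) (Dv : ℝ → Ed d → Ed d) : Prop :=
  ∀ t₁ t₂ : ℝ, t₁ ≤ t₂ → Set.Icc t₁ t₂ ⊆ J →
    ∀ φ : ℝ → Ed d → ℝ, IsTestFunction Ω φ → (∀ t x, φ t x ≤ 0) →
      mixedLHS A K Ω v Dv φ t₁ t₂ ≤ 0

/-- The global excess functional `E(u,t₀,x₀,R)`. -/
def Excess (s q : ℝ) (u : ℝ → Ed d → ℝ) (t₀ : ℝ) (x₀ : Ed d) (R : ℝ) : ℝ :=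
  (⨍ t in Iminus t₀ R, (⨍ x in Metric.ball x₀ R,
      |u t x - ⨍ p in pCyl t₀ x₀ R, u p.1 p.2|) ^ q) ^ (1 / q)
  + (⨍ t in Iminus t₀ R,
      (Tail s (fun y => u t y - ⨍ p in pCyl t₀ x₀ R, u p.1 p.2) x₀ R) ^ q) ^ (1 / q)

set_option linter.unusedSectionVars false

section Mollification

variable {G : Type*} [NormedAddCommGroup G] [NormedSpace ℝ G] [FiniteDimensional ℝ G]
  [MeasurableSpace G] [BorelSpace G] {F : Type*} [NormedAddCommGroup F] [NormedSpace ℝ F]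

/-- Translations are continuous in `L^q`. -/
lemma tendsto_eLpNorm_translation_sub (μ : Measure G) [μ.IsAddHaarMeasure] {q : ℝ≥0∞}
    [Fact (1 ≤ q)] (hq : q ≠ ∞) {f : G → F} (hf : MemLp f q μ) :
    Tendsto (fun w : G => eLpNorm (fun p => f (p - w) - f p) q μ) (𝓝 0) (𝓝 0) := by
  let g : G → C(G, G) := fun w => ⟨fun p => p - w, by fun_prop⟩
  have hgm : ∀ w, MeasurePreserving (g w) μ μ := fun w => measurePreserving_sub_right μ w
  have hg : Continuous g := by
    apply ContinuousMap.continuous_of_continuous_uncurry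
    change Continuous fun x : G × G => x.2 - x.1
    fun_prop
  have h := (continuous_const (y := hf.toLp f)).compMeasurePreservingLp hg hgm hq
  have h0 := (h.tendsto 0).sub_const (Lp.compMeasurePreserving (g 0) (hgm 0) (hf.toLp f))
  have h1 := h0.enorm
  rw [sub_self, enorm_zero] at h1
  refine h1.congr fun w => ?_
  rw [Lp.enorm_def]
  apply eLpNorm_congr_ae
  have e1 := Lp.coeFn_compMeasurePreserving (hf.toLp f) (hgm w)
  have e2 := Lp.coeFn_compMeasurePreserving (hf.toLp f) (hgm 0)
  have e3 := (hgm w).quasiMeasurePreserving.ae_eq_comp hf.coeFn_toLp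
  have e4 := (hgm 0).quasiMeasurePreserving.ae_eq_comp hf.coeFn_toLp
  filter_upwards [Lp.coeFn_sub (Lp.compMeasurePreserving (g w) (hgm w) (hf.toLp f))
    (Lp.compMeasurePreserving (g 0) (hgm 0) (hf.toLp f)), e1, e2, e3, e4] with p h1 h2 h3 h4 h5
  rw [h1, Pi.sub_apply, h2, h3, h4, h5]
  simp [g]

/-- Cauchy-Schwarz for the lower Lebesgue integral. -/
lemma lintegral_mul_sq_le {α : Type*} [MeasurableSpace α] (μ : Measure α) {f g : α → ℝ≥0∞}
    (hf : AEMeasurable f μ) (hg : AEMeasurable g μ) :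
    (∫⁻ a, f a * g a ∂μ) ^ 2 ≤ (∫⁻ a, f a ^ 2 ∂μ) * ∫⁻ a, g a ^ 2 ∂μ := by
  have h := ENNReal.lintegral_mul_le_Lp_mul_Lq μ Real.HolderConjugate.two_two hf hg
  calc (∫⁻ a, f a * g a ∂μ) ^ 2
      ≤ ((∫⁻ a, f a ^ (2:ℝ) ∂μ) ^ (1 / 2 : ℝ) * (∫⁻ a, g a ^ (2:ℝ) ∂μ) ^ (1 / 2 : ℝ)) ^ 2 := by
        gcongr; exact h
    _ = _ := by
        rw [mul_pow, ← ENNReal.rpow_natCast, ← ENNReal.rpow_natCast, ← ENNReal.rpow_mul,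
          ← ENNReal.rpow_mul]
        norm_num

/-- A smooth even nonnegative kernel of mass one supported in the ball of radius `ε`. -/
structure IsMollifier (μ : Measure G) (ε : ℝ) (ρ : G → ℝ) : Prop where
  smooth : ContDiff ℝ (⊤ : ℕ∞) ρ
  nonneg : ∀ z, 0 ≤ ρ z
  even : ∀ z, ρ (-z) = ρ z
  mass : ∫ z, ρ z ∂μ = 1
  supp : ∀ z, ε ≤ ‖z‖ → ρ z = 0

lemma exists_isMollifier (μ : Measure G) [μ.IsAddHaarMeasure] {ε : ℝ} (hε : 0 < ε) :
    ∃ ρ : G → ℝ, IsMollifier μ ε ρ := by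
  let b : ContDiffBump (0 : G) := ⟨ε / 2, ε, by positivity, by linarith⟩
  refine ⟨b.normed μ, b.contDiff_normed, b.nonneg_normed, b.normed_neg, b.integral_normed, ?_⟩
  intro z hz
  have : z ∉ Function.support (b.normed μ) := by
    rw [b.support_normed_eq]; simpa [b] using hz
  simpa using this

variable {μ : Measure G} {ε : ℝ} {ρ : G → ℝ}

lemma IsMollifier.hasCompactSupport (h : IsMollifier μ ε ρ) : HasCompactSupport ρ := by
  apply HasCompactSupport.intro (isCompact_closedBall (0 : G) ε)
  intro x hx
  apply h.supp
  simp at hx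
  exact hx.le

lemma IsMollifier.continuous (h : IsMollifier μ ε ρ) : Continuous ρ := h.smooth.continuous

/-- The convolution of `f` with the kernel `ρ`. -/
def mol (μ : Measure G) (ρ : G → ℝ) (f : G → F) (p : G) : F := ∫ z, ρ (p - z) • f z ∂μ

variable [μ.IsAddHaarMeasure]

lemma mol_eq_convolution (ρ : G → ℝ) (f : G → F) :
    mol μ ρ f = convolution ρ f (ContinuousLinearMap.lsmul ℝ ℝ) μ := by
  ext p
  rw [convolution_eq_swap]
  rfl

lemma IsMollifier.lintegral_eq_one (h : IsMollifier μ ε ρ) (p : G) :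
    ∫⁻ z, ENNReal.ofReal (ρ (p - z)) ∂μ = 1 := by
  have e : ∫⁻ z, ENNReal.ofReal (ρ (p - z)) ∂μ = ∫⁻ z, ENNReal.ofReal (ρ z) ∂μ :=
    lintegral_sub_left_eq_self (fun z => ENNReal.ofReal (ρ z)) p
  rw [e, ← ofReal_integral_eq_lintegral_ofReal, h.mass, ENNReal.ofReal_one]
  · exact h.continuous.integrable_of_hasCompactSupport h.hasCompactSupport
  · exact Eventually.of_forall h.nonneg

lemma hasCompactSupport_comp_sub {H : Type*} [Zero H] {k : G → H} (hk : HasCompactSupport k)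
    (p : G) : HasCompactSupport fun z => k (p - z) :=
  hk.comp_homeomorph (Homeomorph.subLeft p)

lemma integrable_kernel_smul {k : G → ℝ} (hk : Continuous k) (hk' : HasCompactSupport k)
    {f : G → F} (hf : LocallyIntegrable f μ) (p : G) :
    Integrable (fun z => k (p - z) • f z) μ :=
  hf.integrable_smul_left_of_hasCompactSupport (by fun_prop) (hasCompactSupport_comp_sub hk' p)

lemma IsMollifier.enorm_mol_sub_sq_le [CompleteSpace F] (h : IsMollifier μ ε ρ) {f : G → F}
    (hf : LocallyIntegrable f μ) (p : G) (c : F) :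
    ‖mol μ ρ f p - c‖ₑ ^ 2 ≤ ∫⁻ z, ENNReal.ofReal (ρ (p - z)) * ‖f z - c‖ₑ ^ 2 ∂μ := by
  have hc : mol μ ρ f p - c = ∫ z, ρ (p - z) • (f z - c) ∂μ := by
    have hm : ∫ z, ρ (p - z) ∂μ = 1 := by
      rw [integral_sub_left_eq_self ρ μ p, h.mass]
    have hi : Integrable (fun z => ρ (p - z)) μ :=
      (by have := h.continuous; fun_prop :
        Continuous fun z => ρ (p - z)).integrable_of_hasCompactSupport
        (hasCompactSupport_comp_sub h.hasCompactSupport p)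
    simp_rw [smul_sub]
    rw [integral_sub (integrable_kernel_smul h.continuous h.hasCompactSupport hf p)
      (hi.smul_const c), integral_smul_const, hm, one_smul, mol]
  have hρ : Measurable fun z => ρ (p - z) := by
    have := h.continuous.measurable; fun_prop
  have hfm := hf.aestronglyMeasurable
  have hs : ∀ x : ℝ, 0 ≤ x → ENNReal.ofReal (Real.sqrt x) ^ 2 = ENNReal.ofReal x := by
    intro x hx
    rw [← ENNReal.ofReal_pow (Real.sqrt_nonneg _), Real.sq_sqrt hx]
  calc ‖mol μ ρ f p - c‖ₑ ^ 2
      ≤ (∫⁻ z, ‖ρ (p - z) • (f z - c)‖ₑ ∂μ) ^ 2 := by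
        rw [hc]; gcongr; exact enorm_integral_le_lintegral_enorm _
    _ = (∫⁻ z, ENNReal.ofReal (Real.sqrt (ρ (p - z))) *
          (ENNReal.ofReal (Real.sqrt (ρ (p - z))) * ‖f z - c‖ₑ) ∂μ) ^ 2 := by
        congr 2; ext z
        rw [enorm_smul, Real.enorm_of_nonneg (h.nonneg _), ← hs _ (h.nonneg _)]
        ring
    _ ≤ _ := by
        have hm : AEMeasurable (fun z => ENNReal.ofReal (Real.sqrt (ρ (p - z)))) μ :=
          hρ.sqrt.ennreal_ofReal.aemeasurable
        refine (lintegral_mul_sq_le μ hm ?_).trans ?_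
        · exact AEMeasurable.mul hm (hfm.sub aestronglyMeasurable_const).enorm
        · simp_rw [mul_pow, hs _ (h.nonneg _), h.lintegral_eq_one p, one_mul]
          rfl

lemma IsMollifier.lintegral_mol_sq_le [CompleteSpace F] (h : IsMollifier μ ε ρ) {f : G → F}
    (hf : LocallyIntegrable f μ) :
    ∫⁻ p, ‖mol μ ρ f p‖ₑ ^ 2 ∂μ ≤ ∫⁻ p, ‖f p‖ₑ ^ 2 ∂μ := by
  have hρ := h.continuous.measurable
  calc ∫⁻ p, ‖mol μ ρ f p‖ₑ ^ 2 ∂μ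
      ≤ ∫⁻ p, ∫⁻ z, ENNReal.ofReal (ρ (p - z)) * ‖f z‖ₑ ^ 2 ∂μ ∂μ := by
        gcongr with p
        simpa using h.enorm_mol_sub_sq_le hf p 0
    _ = ∫⁻ z, ∫⁻ p, ENNReal.ofReal (ρ (p - z)) * ‖f z‖ₑ ^ 2 ∂μ ∂μ := by
        rw [lintegral_lintegral_swap]
        refine AEMeasurable.mul (f := fun x : G × G => ENNReal.ofReal (ρ (x.1 - x.2)))
          (g := fun x : G × G => ‖f x.2‖ₑ ^ 2) ?_ ?_
        · apply Measurable.aemeasurable; fun_prop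
        · exact (hf.aestronglyMeasurable.enorm.pow_const 2).comp_snd
    _ = _ := by
        congr 1; ext z
        rw [lintegral_mul_const _ (by fun_prop)]
        have : ∫⁻ p, ENNReal.ofReal (ρ (p - z)) ∂μ = 1 := by
          rw [← h.lintegral_eq_one z]
          congr 1; ext p; rw [← h.even (z - p)]; congr 2; abel
        rw [this, one_mul]

lemma exists_mollifier_radius [CompleteSpace F] {f : G → F} (hf : MemLp f 2 μ) {η : ℝ≥0∞}
    (hη : 0 < η) :
    ∃ ε₀ : ℝ, 0 < ε₀ ∧ ∀ ε ≤ ε₀, ∀ ρ, IsMollifier μ ε ρ →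
      ∫⁻ p, ‖mol μ ρ f p - f p‖ₑ ^ 2 ∂μ ≤ η := by
  have ht := tendsto_eLpNorm_translation_sub μ (q := 2) (by simp) hf
  have ht2 : Tendsto (fun w : G => ∫⁻ p, ‖f (p - w) - f p‖ₑ ^ 2 ∂μ) (𝓝 0) (𝓝 0) := by
    have := ENNReal.Tendsto.pow (n := 2) ht
    rw [zero_pow two_ne_zero] at this
    refine this.congr fun w => ?_
    rw [eLpNorm_eq_lintegral_rpow_enorm_toReal two_ne_zero (by simp), ← ENNReal.rpow_natCast,
      ← ENNReal.rpow_mul]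
    norm_num
  have he := (ht2.eventually (ge_mem_nhds hη))
  obtain ⟨ε₀, hε₀, hb⟩ := Metric.eventually_nhds_iff_ball.1 he
  refine ⟨ε₀, hε₀, fun ε hle ρ h => ?_⟩
  have hρ := h.continuous.measurable
  have hfl := hf.locallyIntegrable (by norm_num)
  calc ∫⁻ p, ‖mol μ ρ f p - f p‖ₑ ^ 2 ∂μ
      ≤ ∫⁻ p, ∫⁻ z, ENNReal.ofReal (ρ (p - z)) * ‖f z - f p‖ₑ ^ 2 ∂μ ∂μ := by
        gcongr with p
        exact h.enorm_mol_sub_sq_le hfl p _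
    _ = ∫⁻ p, ∫⁻ w, ENNReal.ofReal (ρ w) * ‖f (p - w) - f p‖ₑ ^ 2 ∂μ ∂μ := by
        congr 1; ext p
        rw [← lintegral_sub_left_eq_self _ p]
        simp
    _ = ∫⁻ w, ∫⁻ p, ENNReal.ofReal (ρ w) * ‖f (p - w) - f p‖ₑ ^ 2 ∂μ ∂μ := by
        rw [lintegral_lintegral_swap]
        refine AEMeasurable.mul (f := fun x : G × G => ENNReal.ofReal (ρ x.2))
          (g := fun x : G × G => ‖f (x.1 - x.2) - f x.1‖ₑ ^ 2) ?_ ?_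
        · apply Measurable.aemeasurable; fun_prop
        · have e1 : AEStronglyMeasurable (fun x : G × G => f (x.1 - x.2)) (μ.prod μ) :=
            hf.1.comp_quasiMeasurePreserving (quasiMeasurePreserving_sub μ μ)
          exact (e1.sub hf.1.comp_fst).enorm.pow_const 2
    _ ≤ ∫⁻ w, ENNReal.ofReal (ρ w) * η ∂μ := by
        gcongr with w
        by_cases hw : ε ≤ ‖w‖
        · simp [h.supp w hw]
        · rw [lintegral_const_mul' _ _ (by simp)]
          gcongr
          exact hb w (by simp; linarith)
    _ = η := by
        rw [lintegral_mul_const _ (by fun_prop)]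
        have := h.lintegral_eq_one (0 : G)
        simp only [zero_sub, h.even] at this
        rw [this, one_mul]

end Mollification

instance isAddHaarMeasure_timeSpace : (volume : Measure (ℝ × Ed d)).IsAddHaarMeasure :=
  Measure.prod.instIsAddHaarMeasure volume volume

set_option linter.unusedSectionVars false

section MolDeriv

variable {G : Type*} [NormedAddCommGroup G] [NormedSpace ℝ G] [FiniteDimensional ℝ G]
  [MeasurableSpace G] [BorelSpace G] {μ : Measure G} [μ.IsAddHaarMeasure] {ε : ℝ} {ρ : G → ℝ}

lemma IsMollifier.contDiff_mol (h : IsMollifier μ ε ρ) {f : G → ℝ} (hf : LocallyIntegrable f μ) :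
    ContDiff ℝ (⊤ : ℕ∞) (mol μ ρ f) := by
  rw [mol_eq_convolution]
  exact h.hasCompactSupport.contDiff_convolution_left _ h.smooth hf

lemma IsMollifier.fderiv_mol (h : IsMollifier μ ε ρ) {f : G → ℝ} (hf : LocallyIntegrable f μ)
    (p v : G) : fderiv ℝ (mol μ ρ f) p v = ∫ z, fderiv ℝ ρ (p - z) v * f z ∂μ := by
  have h1 : ContDiff ℝ 1 ρ := h.smooth.of_le (by simp)
  have hd := h.hasCompactSupport.hasFDerivAt_convolution_left
    (ContinuousLinearMap.lsmul ℝ ℝ) h1 hf p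
  rw [mol_eq_convolution, hd.fderiv, convolution_eq_swap]
  have hi : Integrable (fun t => ((ContinuousLinearMap.precompL G
      (ContinuousLinearMap.lsmul ℝ ℝ)) (fderiv ℝ ρ (p - t))) (f t)) μ := by
    have hh : ConvolutionExists (fderiv ℝ ρ) f
        (ContinuousLinearMap.precompL G (ContinuousLinearMap.lsmul ℝ ℝ)) μ :=
      (h.hasCompactSupport.fderiv ℝ).convolutionExists_left _
        (h1.continuous_fderiv one_ne_zero) hf
    exact (hh p).integrable_swap
  rw [ContinuousLinearMap.integral_apply hi]
  rfl

lemma IsMollifier.fderiv_mol_of_contDiff (h : IsMollifier μ ε ρ) {f : G → ℝ}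
    (hf : ContDiff ℝ 1 f) (hf' : HasCompactSupport f) (p v : G) :
    fderiv ℝ (mol μ ρ f) p v = mol μ ρ (fun z => fderiv ℝ f z v) p := by
  have hl : LocallyIntegrable ρ μ := h.continuous.locallyIntegrable
  have hd := hf'.hasFDerivAt_convolution_right (ContinuousLinearMap.lsmul ℝ ℝ) hl hf p
  rw [mol_eq_convolution, hd.fderiv, convolution_eq_swap]
  have hi : Integrable (fun t => ((ContinuousLinearMap.precompR G
      (ContinuousLinearMap.lsmul ℝ ℝ)) (ρ (p - t))) (fderiv ℝ f t)) μ := by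
    have hh : ConvolutionExists ρ (fderiv ℝ f)
        (ContinuousLinearMap.precompR G (ContinuousLinearMap.lsmul ℝ ℝ)) μ :=
      (hf'.fderiv ℝ).convolutionExists_right _ hl (hf.continuous_fderiv one_ne_zero)
    exact (hh p).integrable_swap
  rw [ContinuousLinearMap.integral_apply hi]
  rfl

lemma IsMollifier.mol_eq_zero (h : IsMollifier μ ε ρ) {F : Type*} [NormedAddCommGroup F]
    [NormedSpace ℝ F] {f : G → F} {p : G} (hf : ∀ z, ‖p - z‖ < ε → f z = 0) :
    mol μ ρ f p = 0 := by
  unfold mol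
  refine integral_eq_zero_of_ae (Eventually.of_forall fun z => ?_)
  rcases lt_or_ge ‖p - z‖ ε with hz | hz
  · simp [hf z hz]
  · simp [h.supp _ hz]

lemma IsMollifier.abs_mol_le (h : IsMollifier μ ε ρ) {f : G → ℝ} {M : ℝ}
    (hM : ∀ z, |f z| ≤ M) (p : G) : |mol μ ρ f p| ≤ M := by
  have hm : ∫ z, ρ (p - z) ∂μ = 1 := by rw [integral_sub_left_eq_self ρ μ p, h.mass]
  have hi : Integrable (fun z => ρ (p - z)) μ :=
    (by have := h.continuous; fun_prop :
      Continuous fun z => ρ (p - z)).integrable_of_hasCompactSupport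
        (hasCompactSupport_comp_sub h.hasCompactSupport p)
  calc |mol μ ρ f p| ≤ ∫ z, ρ (p - z) * M ∂μ := by
        rw [← Real.norm_eq_abs, mol]
        refine norm_integral_le_of_norm_le (μ := μ) (hi.mul_const M)
          (Eventually.of_forall fun z => ?_)
        rw [norm_smul, Real.norm_of_nonneg (h.nonneg _)]
        exact mul_le_mul_of_nonneg_left (hM z) (h.nonneg _)
    _ = M := by rw [integral_mul_const, hm, one_mul]

/-- Mollification with an even kernel is symmetric. -/
lemma IsMollifier.integral_mul_mol (h : IsMollifier μ ε ρ) {f g : G → ℝ} (hf : MemLp f 2 μ)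
    (hg : MemLp g 2 μ) : ∫ p, g p * mol μ ρ f p ∂μ = ∫ p, mol μ ρ g p * f p ∂μ := by
  have hfl := hf.locallyIntegrable (by norm_num)
  have hρ := h.continuous.measurable
  have hsq : ∀ {f : G → ℝ}, MemLp f 2 μ → ∫⁻ p, ‖f p‖ₑ ^ 2 ∂μ < ∞ := by
    intro f hf
    have := lintegral_rpow_enorm_lt_top_of_eLpNorm_lt_top (f := f) two_ne_zero (by simp) hf.2
    simpa using this
  have hprod : Integrable (Function.uncurry fun p z => g p * (ρ (p - z) * f z)) (μ.prod μ) := by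
    have hm : AEStronglyMeasurable (Function.uncurry fun p z => g p * (ρ (p - z) * f z))
        (μ.prod μ) := by
      refine AEStronglyMeasurable.mul (f := fun x : G × G => g x.1)
        (g := fun x : G × G => ρ (x.1 - x.2) * f x.2) hg.1.comp_fst
        (AEStronglyMeasurable.mul (f := fun x : G × G => ρ (x.1 - x.2))
        (g := fun x : G × G => f x.2) ?_ hf.1.comp_snd)
      apply Measurable.aestronglyMeasurable; fun_prop
    refine ⟨hm, ?_⟩
    rw [HasFiniteIntegral, lintegral_prod _ hm.enorm]
    have hfa : MemLp (fun z => |f z|) 2 μ := hf.norm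
    have hfal := hfa.locallyIntegrable (by norm_num)
    have e1 : ∀ p, ∫⁻ z, ‖Function.uncurry (fun p z => g p * (ρ (p - z) * f z)) (p, z)‖ₑ ∂μ =
        ‖g p‖ₑ * ‖mol μ ρ (fun z => |f z|) p‖ₑ := by
      intro p
      simp only [Function.uncurry, enorm_mul]
      have e0 : 0 ≤ ∫ z, ρ (p - z) • |f z| ∂μ :=
        integral_nonneg fun z => mul_nonneg (h.nonneg _) (abs_nonneg _)
      rw [lintegral_const_mul' _ _ (by simp), mol, Real.enorm_of_nonneg e0]
      · rw [ofReal_integral_eq_lintegral_ofReal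
          (integrable_kernel_smul h.continuous h.hasCompactSupport hfal p)]
        · congr 2
          ext z
          rw [smul_eq_mul, ENNReal.ofReal_mul (h.nonneg _), Real.enorm_of_nonneg (h.nonneg _),
            ← Real.norm_eq_abs, ofReal_norm]
        · exact Eventually.of_forall fun z => mul_nonneg (h.nonneg _) (abs_nonneg _)
    simp_rw [e1]
    have h2 := lintegral_mul_sq_le μ hg.1.enorm
      (h.contDiff_mol hfal).continuous.aestronglyMeasurable.enorm
    have h3 : (∫⁻ p, ‖g p‖ₑ ^ 2 ∂μ) * ∫⁻ p, ‖mol μ ρ (fun z => |f z|) p‖ₑ ^ 2 ∂μ < ∞ :=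
      ENNReal.mul_lt_top (hsq hg) ((h.lintegral_mol_sq_le hfal).trans_lt (hsq hfa))
    have h4 := h2.trans_lt h3
    by_contra hcon
    rw [not_lt, top_le_iff] at hcon
    rw [hcon] at h4
    simp at h4
  calc ∫ p, g p * mol μ ρ f p ∂μ = ∫ p, ∫ z, g p * (ρ (p - z) * f z) ∂μ ∂μ := by
        congr 1; ext p; rw [integral_const_mul]; rfl
    _ = ∫ z, ∫ p, g p * (ρ (p - z) * f z) ∂μ ∂μ := integral_integral_swap hprod
    _ = _ := by
        congr 1; ext z
        rw [mol, ← integral_mul_const]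
        congr 1; ext p
        rw [smul_eq_mul, ← h.even (z - p), neg_sub]
        ring

end MolDeriv

section DiffQuotient

/-- Cauchy-Schwarz on the unit interval. -/
lemma sq_setLIntegral_unit_le {f : ℝ → ℝ≥0∞} (hf : Measurable f) :
    (∫⁻ τ in Ioc (0 : ℝ) 1, f τ) ^ 2 ≤ ∫⁻ τ in Ioc (0 : ℝ) 1, f τ ^ 2 := by
  have := lintegral_mul_sq_le (volume.restrict (Ioc (0 : ℝ) 1)) hf.aemeasurable
    (aemeasurable_const (b := (1 : ℝ≥0∞)))
  simpa using this

/-- The `L²` bound for translations of a `C¹` function. -/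
lemma lintegral_sq_translate_le {f : Ed d → ℝ} (hf : ContDiff ℝ 1 f) (h : Ed d) :
    ∫⁻ x, ‖f (x + h) - f x‖ₑ ^ 2 ≤ ‖h‖ₑ ^ 2 * ∫⁻ x, ‖fderiv ℝ f x‖ₑ ^ 2 := by
  have hc : Continuous (fderiv ℝ f) := hf.continuous_fderiv one_ne_zero
  have key : ∀ x, ‖f (x + h) - f x‖ₑ ^ 2 ≤
      ∫⁻ τ in Ioc (0 : ℝ) 1, ‖h‖ₑ ^ 2 * ‖fderiv ℝ f (x + τ • h)‖ₑ ^ 2 := by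
    intro x
    have hd : ∀ τ : ℝ, HasDerivAt (fun τ : ℝ => f (x + τ • h)) (fderiv ℝ f (x + τ • h) h) τ := by
      intro τ
      have h1 : HasDerivAt (fun τ : ℝ => x + τ • h) h τ := by
        simpa using ((hasDerivAt_id τ).smul_const h).const_add x
      exact (hf.differentiable one_ne_zero _).hasFDerivAt.comp_hasDerivAt τ h1
    have hF : f (x + h) - f x = ∫ τ in (0 : ℝ)..1, fderiv ℝ f (x + τ • h) h := by
      rw [intervalIntegral.integral_eq_sub_of_hasDerivAt (fun τ _ => hd τ)]
      · simp
      · exact Continuous.intervalIntegrable (by fun_prop) _ _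
    rw [hF, intervalIntegral.integral_of_le zero_le_one]
    calc ‖∫ τ in Ioc (0 : ℝ) 1, fderiv ℝ f (x + τ • h) h‖ₑ ^ 2
        ≤ (∫⁻ τ in Ioc (0 : ℝ) 1, ‖h‖ₑ * ‖fderiv ℝ f (x + τ • h)‖ₑ) ^ 2 := by
          gcongr
          refine (enorm_integral_le_lintegral_enorm _).trans ?_
          gcongr with τ
          rw [mul_comm]
          exact ContinuousLinearMap.le_opENorm _ _
      _ ≤ _ := by
          refine (sq_setLIntegral_unit_le (by fun_prop)).trans (le_of_eq ?_)
          simp_rw [mul_pow]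
  calc ∫⁻ x, ‖f (x + h) - f x‖ₑ ^ 2
      ≤ ∫⁻ x, ∫⁻ τ in Ioc (0 : ℝ) 1, ‖h‖ₑ ^ 2 * ‖fderiv ℝ f (x + τ • h)‖ₑ ^ 2 :=
        lintegral_mono key
    _ = ∫⁻ τ in Ioc (0 : ℝ) 1, ∫⁻ x, ‖h‖ₑ ^ 2 * ‖fderiv ℝ f (x + τ • h)‖ₑ ^ 2 := by
        rw [lintegral_lintegral_swap]
        apply Measurable.aemeasurable
        exact (by fun_prop : Continuous fun z : Ed d × ℝ =>
          ‖fderiv ℝ f (z.1 + z.2 • h)‖ₑ ^ 2).measurable.const_mul _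
    _ = ∫⁻ τ in Ioc (0 : ℝ) 1, ‖h‖ₑ ^ 2 * ∫⁻ x, ‖fderiv ℝ f x‖ₑ ^ 2 := by
        congr 1; ext τ
        rw [lintegral_const_mul _ (by fun_prop),
          lintegral_add_right_eq_self (fun x => ‖fderiv ℝ f x‖ₑ ^ 2) (τ • h)]
    _ = _ := by simp

/-- The truncated singular kernel. -/
def nearK (s : ℝ) (h : Ed d) : ℝ≥0∞ :=
  (ball (0 : Ed d) 2).indicator (fun h => ENNReal.ofReal (1 / ‖h‖ ^ ((d : ℝ) + 2 * s))) h

lemma measurable_nearK (s : ℝ) : Measurable (nearK (d := d) s) := by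
  refine Measurable.indicator ?_ measurableSet_ball
  fun_prop

lemma nearK_neg (s : ℝ) (h : Ed d) : nearK s (-h) = nearK s h := by
  simp [nearK, indicator]

/-- The second moment of the truncated kernel. -/
def nearC (d : ℕ) (s : ℝ) : ℝ≥0∞ := ∫⁻ h : Ed d, ‖h‖ₑ ^ 2 * nearK s h

lemma nearC_lt_top (hd : 2 ≤ d) {s : ℝ} (hs : s < 1) : nearC d s < ∞ := by
  have h1 : IntegrableOn (fun h : Ed d => ‖h‖ ^ 2 * (1 / ‖h‖ ^ ((d : ℝ) + 2 * s))) (ball 0 2) := by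
    refine integrableOn_ball_of_norm_le_rpow (C := 1) (α := (d : ℝ) + 2 * s - 2) ?_ ?_ ?_ ?_
    · simp; omega
    · simp; linarith
    · refine Eventually.of_forall fun x => ?_
      rw [Real.norm_of_nonneg (by positivity)]
      rcases eq_or_ne x 0 with rfl | hx
      · simp; positivity
      · have hx' : 0 < ‖x‖ := norm_pos_iff.2 hx
        rw [one_mul, ← Real.rpow_natCast, one_div, ← Real.rpow_neg hx'.le, ← Real.rpow_add hx']
        apply le_of_eq; congr 1; push_cast; ring
    · apply Measurable.aestronglyMeasurable; fun_prop
  have h2 := h1.lintegral_lt_top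
  refine lt_of_le_of_lt (le_of_eq ?_) h2
  rw [nearC, ← lintegral_indicator measurableSet_ball]
  congr 1; ext h
  simp only [nearK, indicator]
  split_ifs
  · rw [ENNReal.ofReal_mul (by positivity), ENNReal.ofReal_pow (by positivity), ofReal_norm]
  · simp

/-- The fractional seminorm of a `C¹` function is controlled by its gradient. -/
lemma lintegral_diffQuot_le (s : ℝ) {f : Ed d → ℝ} (hf : ContDiff ℝ 1 f) :
    ∫⁻ x, ∫⁻ y, ‖f x - f y‖ₑ ^ 2 * nearK s (x - y) ≤
      nearC d s * ∫⁻ x, ‖fderiv ℝ f x‖ₑ ^ 2 := by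
  have hc := hf.continuous
  have hk := measurable_nearK (d := d) s
  calc ∫⁻ x, ∫⁻ y, ‖f x - f y‖ₑ ^ 2 * nearK s (x - y)
      = ∫⁻ x, ∫⁻ h, ‖f (x + h) - f x‖ₑ ^ 2 * nearK s h := by
        congr 1; ext x
        rw [← lintegral_add_left_eq_self _ x]
        congr 1; ext h
        rw [sub_add_cancel_left, nearK_neg, ← enorm_neg, neg_sub]
    _ = ∫⁻ h, ∫⁻ x, ‖f (x + h) - f x‖ₑ ^ 2 * nearK s h := by
        rw [lintegral_lintegral_swap]
        apply Measurable.aemeasurable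
        refine Measurable.mul (f := fun z : Ed d × Ed d => ‖f (z.1 + z.2) - f z.1‖ₑ ^ 2) ?_ ?_
        · exact (by fun_prop :
            Continuous fun z : Ed d × Ed d => ‖f (z.1 + z.2) - f z.1‖ₑ ^ 2).measurable
        · fun_prop
    _ ≤ ∫⁻ h, (‖h‖ₑ ^ 2 * nearK s h) * ∫⁻ x, ‖fderiv ℝ f x‖ₑ ^ 2 := by
        gcongr with h
        rw [lintegral_mul_const _ (by fun_prop)]
        calc _ ≤ (‖h‖ₑ ^ 2 * ∫⁻ x, ‖fderiv ℝ f x‖ₑ ^ 2) * nearK s h := by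
              gcongr; exact lintegral_sq_translate_le hf h
          _ = _ := by ring
    _ = _ := by
        rw [lintegral_mul_const _ (by fun_prop), nearC]

end DiffQuotient

section Truncation

lemma hasDerivAt_posPart_sq (v : ℝ) :
    HasDerivAt (fun v : ℝ => (max v 0) ^ 2) (2 * max v 0) v := by
  rcases lt_trichotomy v 0 with hv | rfl | hv
  · have h0 : (fun v : ℝ => (max v 0) ^ 2) =ᶠ[𝓝 v] fun _ => 0 := by
      filter_upwards [gt_mem_nhds hv] with x hx
      simp [max_eq_right hx.le]
    rw [max_eq_right hv.le, mul_zero]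
    exact (hasDerivAt_const v (0 : ℝ)).congr_of_eventuallyEq h0
  · simp only [max_self, mul_zero]
    rw [hasDerivAt_iff_isLittleO]
    simp only [max_self, ne_eq, OfNat.ofNat_ne_zero, not_false_eq_true, zero_pow, sub_zero,
      smul_zero]
    have : (fun x : ℝ => max x 0 ^ 2) =O[𝓝 0] fun x : ℝ => x ^ 2 := by
      refine Asymptotics.IsBigO.of_bound 1 (Eventually.of_forall fun x => ?_)
      rw [one_mul, Real.norm_of_nonneg (by positivity), Real.norm_of_nonneg (by positivity)]
      rcases le_total x 0 with h | h
      · simp [max_eq_right h]; positivity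
      · simp [max_eq_left h]
    exact this.trans_isLittleO (by
      simpa using Asymptotics.isLittleO_pow_pow (𝕜 := ℝ) (m := 1) (n := 2) (by norm_num))
  · have h0 : (fun v : ℝ => (max v 0) ^ 2) =ᶠ[𝓝 v] fun v => v ^ 2 := by
      filter_upwards [lt_mem_nhds hv] with x hx
      simp [max_eq_left hx.le]
    rw [max_eq_left hv.le]
    simpa using (hasDerivAt_pow 2 v).congr_of_eventuallyEq h0

lemma hasDerivAt_rpow_one_add_posPart_sq (e v : ℝ) :
    HasDerivAt (fun v : ℝ => (1 + (max v 0) ^ 2) ^ e)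
      (2 * e * max v 0 * (1 + (max v 0) ^ 2) ^ (e - 1)) v := by
  have h := ((hasDerivAt_posPart_sq v).const_add 1).rpow_const (p := e)
    (Or.inl (by positivity))
  convert h using 1
  ring

/-- The bounded truncation used in the energy estimate. -/
def trG (ε v : ℝ) : ℝ := 1 - (1 + (max v 0) ^ 2) ^ (-ε / 2)

/-- The derivative of `trG`. -/
def trG' (ε v : ℝ) : ℝ := ε * max v 0 * (1 + (max v 0) ^ 2) ^ (-ε / 2 - 1)

/-- The primitive of `trG`. -/
def trPsi (ε v : ℝ) : ℝ := ∫ w in (0 : ℝ)..v, trG ε w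

/-- The power-type function used with the Sobolev inequality. -/
def trF (ε v : ℝ) : ℝ := (1 + (max (v - 1) 0) ^ 2) ^ ((1 - ε) / 2) - 1

/-- The derivative of `trF`. -/
def trF' (ε v : ℝ) : ℝ :=
  (1 - ε) * max (v - 1) 0 * (1 + (max (v - 1) 0) ^ 2) ^ ((1 - ε) / 2 - 1)

lemma hasDerivAt_trG (ε v : ℝ) : HasDerivAt (trG ε) (trG' ε v) v := by
  have h := (hasDerivAt_rpow_one_add_posPart_sq (-ε / 2) v).const_sub 1
  exact h.congr_deriv (by unfold trG'; ring)

lemma hasDerivAt_trF (ε v : ℝ) : HasDerivAt (trF ε) (trF' ε v) v := by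
  have h := ((hasDerivAt_rpow_one_add_posPart_sq ((1 - ε) / 2) (v - 1)).comp v
    ((hasDerivAt_id v).sub_const 1)).sub_const 1
  exact h.congr_deriv (by unfold trF'; ring)

lemma continuous_trG (ε : ℝ) : Continuous (trG ε) :=
  continuous_iff_continuousAt.2 fun v => (hasDerivAt_trG ε v).continuousAt

lemma continuous_trF (ε : ℝ) : Continuous (trF ε) :=
  continuous_iff_continuousAt.2 fun v => (hasDerivAt_trF ε v).continuousAt

lemma continuous_rpow_one_add_posPart_sq (e : ℝ) :
    Continuous fun v : ℝ => (1 + (max v 0) ^ 2) ^ e :=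
  Continuous.rpow_const (by fun_prop) fun v => Or.inl (by positivity)

lemma continuous_trG' (ε : ℝ) : Continuous (trG' ε) :=
  (by fun_prop : Continuous fun v : ℝ => ε * max v 0).mul (continuous_rpow_one_add_posPart_sq _)

lemma continuous_trF' (ε : ℝ) : Continuous (trF' ε) :=
  (by fun_prop : Continuous fun v : ℝ => (1 - ε) * max (v - 1) 0).mul
    ((continuous_rpow_one_add_posPart_sq _).comp (continuous_sub_right 1))

lemma hasDerivAt_trPsi (ε v : ℝ) : HasDerivAt (trPsi ε) (trG ε v) v :=
  intervalIntegral.integral_hasDerivAt_right ((continuous_trG ε).intervalIntegrable _ _)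
    (continuous_trG ε).aestronglyMeasurable.stronglyMeasurableAtFilter
    (continuous_trG ε).continuousAt

lemma continuous_trPsi (ε : ℝ) : Continuous (trPsi ε) :=
  continuous_iff_continuousAt.2 fun v => (hasDerivAt_trPsi ε v).continuousAt

lemma trG_of_nonpos {ε v : ℝ} (hv : v ≤ 0) : trG ε v = 0 := by simp [trG, max_eq_right hv]

lemma trPsi_of_nonpos {ε v : ℝ} (hv : v ≤ 0) : trPsi ε v = 0 := by
  rw [trPsi, intervalIntegral.integral_symm, neg_eq_zero,
    intervalIntegral.integral_of_le hv]
  refine setIntegral_eq_zero_of_forall_eq_zero fun w hw => trG_of_nonpos hw.2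

lemma trF'_of_le_one {ε v : ℝ} (hv : v ≤ 1) : trF' ε v = 0 := by
  simp [trF', max_eq_right (sub_nonpos.2 hv)]

variable {ε : ℝ}

lemma trG'_nonneg (hε : 0 < ε) (v : ℝ) : 0 ≤ trG' ε v := by unfold trG'; positivity

lemma trG_nonneg (hε : 0 < ε) (v : ℝ) : 0 ≤ trG ε v := by
  have : (1 + (max v 0) ^ 2) ^ (-ε / 2) ≤ 1 :=
    Real.rpow_le_one_of_one_le_of_nonpos (by nlinarith [sq_nonneg (max v 0)]) (by linarith)
  unfold trG; linarith

lemma trG_le_one (v : ℝ) : trG ε v ≤ 1 := by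
  have : 0 ≤ (1 + (max v 0) ^ 2) ^ (-ε / 2) := by positivity
  unfold trG; linarith

lemma rpow_one_add_sq_le {w e : ℝ} (he : e ≤ -1) : (1 + w ^ 2) ^ e ≤ (1 + w ^ 2)⁻¹ := by
  rw [← Real.rpow_neg_one]
  exact Real.rpow_le_rpow_of_exponent_le (by nlinarith [sq_nonneg w]) he

lemma trG'_le_one (hε : 0 < ε) (hε1 : ε ≤ 1 / 2) (v : ℝ) : trG' ε v ≤ 1 := by
  have h := rpow_one_add_sq_le (w := max v 0) (e := -ε / 2 - 1) (by linarith)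
  have h0 : 0 ≤ max v 0 := le_max_right _ _
  calc trG' ε v ≤ 1 * max v 0 * (1 + (max v 0) ^ 2)⁻¹ := by unfold trG'; gcongr; linarith
    _ ≤ 1 := by
      rw [one_mul, ← div_eq_mul_inv, div_le_one (by positivity)]
      nlinarith [sq_nonneg (max v 0 - 1)]

lemma trF'_nonneg (hε : 0 < ε) (hε1 : ε ≤ 1 / 2) (v : ℝ) : 0 ≤ trF' ε v := by
  have : 0 ≤ 1 - ε := by linarith
  unfold trF'; positivity

lemma trF'_le_one (hε : 0 < ε) (hε1 : ε ≤ 1 / 2) (v : ℝ) : trF' ε v ≤ 1 := by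
  have h0 : 0 ≤ max (v - 1) 0 := le_max_right _ _
  have h1 : max (v - 1) 0 ≤ (1 + (max (v - 1) 0) ^ 2) ^ (1 / 2 : ℝ) := by
    rw [← Real.sqrt_eq_rpow]; exact Real.le_sqrt_of_sq_le (by linarith)
  have h2 : (1 + (max (v - 1) 0) ^ 2) ^ ((1 - ε) / 2 - 1) ≤
      (1 + (max (v - 1) 0) ^ 2) ^ (-(1 / 2) : ℝ) :=
    Real.rpow_le_rpow_of_exponent_le (by nlinarith [sq_nonneg (max (v - 1) 0)]) (by linarith)
  calc trF' ε v ≤ 1 * (1 + (max (v - 1) 0) ^ 2) ^ (1 / 2 : ℝ) *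
        (1 + (max (v - 1) 0) ^ 2) ^ (-(1 / 2) : ℝ) := by
          unfold trF'
          gcongr
          linarith
    _ = 1 := by rw [one_mul, ← Real.rpow_add (by positivity)]; norm_num

lemma trF_nonneg (hε : 0 < ε) (hε1 : ε ≤ 1 / 2) (v : ℝ) : 0 ≤ trF ε v := by
  have : 1 ≤ (1 + (max (v - 1) 0) ^ 2) ^ ((1 - ε) / 2) :=
    Real.one_le_rpow (by nlinarith [sq_nonneg (max (v - 1) 0)]) (by linarith)
  unfold trF; linarith

lemma trF_le (hε : 0 < ε) (hε1 : ε ≤ 1 / 2) (v : ℝ) : trF ε v ≤ max (v - 1) 0 := by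
  have h0 : 0 ≤ max (v - 1) 0 := le_max_right _ _
  have h1 : (1 + (max (v - 1) 0) ^ 2) ^ ((1 - ε) / 2) ≤ (1 + (max (v - 1) 0) ^ 2) ^ (1 / 2 : ℝ) :=
    Real.rpow_le_rpow_of_exponent_le (by nlinarith [sq_nonneg (max (v - 1) 0)]) (by linarith)
  have h2 : (1 + (max (v - 1) 0) ^ 2) ^ (1 / 2 : ℝ) ≤ 1 + max (v - 1) 0 := by
    rw [← Real.sqrt_eq_rpow, Real.sqrt_le_left (by linarith)]
    nlinarith
  unfold trF; linarith

lemma trG_monotone (hε : 0 < ε) : Monotone (trG ε) :=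
  monotone_of_deriv_nonneg (fun v => (hasDerivAt_trG ε v).differentiableAt) fun v => by
    rw [(hasDerivAt_trG ε v).deriv]; exact trG'_nonneg hε v

lemma trPsi_nonneg (hε : 0 < ε) (v : ℝ) : 0 ≤ trPsi ε v := by
  rcases le_total v 0 with h | h
  · rw [trPsi_of_nonpos h]
  · exact intervalIntegral.integral_nonneg h fun w _ => trG_nonneg hε w

lemma trPsi_le (v : ℝ) : trPsi ε v ≤ max v 0 := by
  rcases le_total v 0 with h | h
  · rw [trPsi_of_nonpos h]; exact le_max_right _ _
  · calc trPsi ε v ≤ ∫ _ in (0 : ℝ)..v, (1 : ℝ) :=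
        intervalIntegral.integral_mono_on h ((continuous_trG ε).intervalIntegrable _ _)
          (by simp) fun w _ => trG_le_one w
      _ ≤ _ := by simp

lemma trPsi_ge (hε : 0 < ε) (v : ℝ) : trG ε 1 * max (v - 1) 0 ≤ trPsi ε v := by
  rcases le_total v 1 with h | h
  · simpa [max_eq_right (sub_nonpos.2 h)] using trPsi_nonneg hε v
  · rw [max_eq_left (sub_nonneg.2 h), trPsi, ← intervalIntegral.integral_add_adjacent_intervals
      ((continuous_trG ε).intervalIntegrable 0 1) ((continuous_trG ε).intervalIntegrable 1 v)]
    have h1 : 0 ≤ ∫ w in (0 : ℝ)..1, trG ε w :=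
      intervalIntegral.integral_nonneg zero_le_one fun w _ => trG_nonneg hε w
    have h2 : ∫ _ in (1 : ℝ)..v, trG ε 1 ≤ ∫ w in (1 : ℝ)..v, trG ε w :=
      intervalIntegral.integral_mono_on h (by simp)
        ((continuous_trG ε).intervalIntegrable _ _) fun w hw => trG_monotone hε hw.1
    simp at h2
    linarith

lemma trG_one_pos (hε : 0 < ε) : 0 < trG ε 1 := by
  have : (1 + (max 1 0) ^ 2 : ℝ) ^ (-ε / 2) < 1 :=
    Real.rpow_lt_one_of_one_lt_of_neg (by norm_num) (by linarith)
  unfold trG; linarith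

lemma trG'_ge (hε : 0 < ε) {v : ℝ} (hv : 0 ≤ v) : ε * v * (1 + v) ^ (-ε - 2) ≤ trG' ε v := by
  rw [trG', max_eq_left hv]
  gcongr
  have : (1 + v) ^ (-ε - 2) = ((1 + v) ^ 2) ^ (-ε / 2 - 1) := by
    rw [← Real.rpow_natCast, ← Real.rpow_mul (by positivity)]; congr 1; push_cast; ring
  rw [this]
  exact Real.rpow_le_rpow_of_nonpos (by positivity) (by nlinarith) (by linarith)

lemma trG_le_self (hε : 0 < ε) (hε1 : ε ≤ 1 / 2) {v : ℝ} (hv : 0 ≤ v) : trG ε v ≤ v := by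
  have h : AntitoneOn (fun v => trG ε v - v) (Ici 0) := by
    apply Antitone.antitoneOn
    refine antitone_of_deriv_nonpos (by
      intro v; exact ((hasDerivAt_trG ε v).sub (hasDerivAt_id v)).differentiableAt) fun v => ?_
    have := ((hasDerivAt_trG ε v).sub (hasDerivAt_id v)).deriv
    change deriv (fun v => trG ε v - v) v = _ at this
    rw [this]
    linarith [trG'_le_one hε hε1 v]
  have := h (mem_Ici.2 le_rfl) (mem_Ici.2 hv) hv
  simp [trG_of_nonpos] at this
  linarith

lemma trG_sq_le (hε : 0 < ε) (hε1 : ε ≤ 1 / 2) {v : ℝ} (hv : 0 ≤ v) :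
    trG ε v ^ 2 ≤ 2 * (v / (1 + v)) := by
  have h1 := trG_le_one (ε := ε) v
  have h2 := trG_le_self hε hε1 hv
  have h0 := trG_nonneg hε v
  have : trG ε v ^ 2 ≤ trG ε v := by nlinarith
  rw [← mul_div_assoc, le_div_iff₀ (by positivity)]
  nlinarith

lemma trG_sq_le_trG' (hε : 0 < ε) (hε1 : ε ≤ 1 / 2) {v : ℝ} (hv : 0 ≤ v) :
    trG ε v ^ 2 ≤ 2 / ε * (1 + v) ^ (1 + ε) * trG' ε v := by
  refine (trG_sq_le hε hε1 hv).trans ?_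
  calc 2 * (v / (1 + v)) = 2 / ε * (1 + v) ^ (1 + ε) * (ε * v * (1 + v) ^ (-ε - 2)) := by
        have : (1 + v) ^ (1 + ε) * (1 + v) ^ (-ε - 2) = (1 + v)⁻¹ := by
          rw [← Real.rpow_add (by positivity), ← Real.rpow_neg_one]; congr 1; ring
        calc _ = 2 / ε * ε * v * ((1 + v)⁻¹) := by field_simp
          _ = _ := by rw [← this]; ring
    _ ≤ _ := by gcongr; exact trG'_ge hε hv

lemma mul_trG_sq_le (hε : 0 < ε) (hε1 : ε ≤ 1 / 2) {a b : ℝ} (hb : 0 ≤ b) (hab : b ≤ a) :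
    (a - b) * trG ε a ^ 2 ≤ 4 / ε * (1 + a) ^ (1 + ε) * (trG ε a - trG ε b) := by
  have ha : 0 ≤ a := hb.trans hab
  set κ := ε * (1 + a) ^ (-ε - 2) with hκ
  have hm : MonotoneOn (fun v => trG ε v - κ * v ^ 2 / 2) (Icc 0 a) := by
    have hd : ∀ v, HasDerivAt (fun v => trG ε v - κ * v ^ 2 / 2) (trG' ε v - κ * v) v := by
      intro v
      have := (hasDerivAt_trG ε v).sub (((hasDerivAt_pow 2 v).const_mul κ).div_const 2)
      exact this.congr_deriv (by push_cast; ring)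
    refine monotoneOn_of_deriv_nonneg (convex_Icc 0 a)
      (fun v _ => (hd v).continuousAt.continuousWithinAt)
      (fun v _ => (hd v).differentiableAt.differentiableWithinAt) fun v hv => ?_
    rw [interior_Icc] at hv
    rw [(hd v).deriv, sub_nonneg]
    refine le_trans ?_ (trG'_ge hε hv.1.le)
    rw [hκ, mul_right_comm]
    have h3 : (1 + a) ^ (-ε - 2) ≤ (1 + v) ^ (-ε - 2) :=
      Real.rpow_le_rpow_of_nonpos (by linarith [hv.1]) (by linarith [hv.2]) (by linarith)
    exact mul_le_mul_of_nonneg_left h3 (mul_nonneg hε.le hv.1.le)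
  have h1 := hm ⟨hb, hab⟩ ⟨ha, le_rfl⟩ hab
  simp only at h1
  have h2 : κ * (a - b) * a / 2 ≤ trG ε a - trG ε b := by
    have : 0 ≤ κ := by positivity
    nlinarith [mul_nonneg (mul_nonneg this (sub_nonneg.2 hab)) hb]
  calc (a - b) * trG ε a ^ 2 ≤ (a - b) * (2 * (a / (1 + a))) := by
        exact mul_le_mul_of_nonneg_left (trG_sq_le hε hε1 ha) (by linarith)
    _ = 4 / ε * (1 + a) ^ (1 + ε) * (κ * (a - b) * a / 2) := by
        have : (1 + a) ^ (1 + ε) * (1 + a) ^ (-ε - 2) = (1 + a)⁻¹ := by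
          rw [← Real.rpow_add (by positivity), ← Real.rpow_neg_one]; congr 1; ring
        calc _ = 2 * (ε / ε) * (a - b) * a * (1 + a)⁻¹ := by field_simp
          _ = _ := by rw [← this, hκ]; ring
    _ ≤ _ := by gcongr

lemma trF'_sq_le (hε : 0 < ε) (hε1 : ε ≤ 1 / 2) (v : ℝ) :
    trF' ε v ^ 2 ≤ 9 / (ε * trG ε 1) * (trPsi ε v * trG' ε v) := by
  have hG := trG_one_pos hε
  rcases le_total v 1 with h | h
  · rw [trF'_of_le_one h]
    have := trPsi_nonneg hε v
    have := trG'_nonneg hε v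
    rw [zero_pow two_ne_zero]
    exact mul_nonneg (by positivity) (mul_nonneg ‹_› ‹_›)
  set w := v - 1 with hw
  have hw0 : 0 ≤ w := by linarith
  have e1 : trF' ε v ^ 2 ≤ w ^ 2 * (1 + w ^ 2) ^ (-ε - 1) := by
    rw [trF', ← hw, max_eq_left hw0]
    have : ((1 + w ^ 2) ^ ((1 - ε) / 2 - 1)) ^ 2 = (1 + w ^ 2) ^ (-ε - 1) := by
      rw [← Real.rpow_natCast, ← Real.rpow_mul (by positivity)]; congr 1; push_cast; ring
    rw [mul_pow, mul_pow, this]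
    have : (1 - ε) ^ 2 ≤ 1 := by nlinarith
    have h3 : 0 ≤ w ^ 2 * (1 + w ^ 2) ^ (-ε - 1) := by positivity
    nlinarith
  have e2 : trG ε 1 * w ≤ trPsi ε v := by
    have := trPsi_ge hε v; rwa [← hw, max_eq_left hw0] at this
  have e3 : ε * v * (1 / 9 * (1 + w ^ 2) ^ (-ε - 1)) ≤ trG' ε v := by
    rw [trG', max_eq_left (by linarith)]
    gcongr
    calc 1 / 9 * (1 + w ^ 2) ^ (-ε - 1) ≤ 3 ^ (-ε / 2 - 1) * (1 + w ^ 2) ^ (-ε / 2 - 1) := by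
          gcongr
          · calc (1 / 9 : ℝ) = 3 ^ (-2 : ℝ) := by
                  rw [Real.rpow_neg (by norm_num)]; norm_num
              _ ≤ _ := Real.rpow_le_rpow_of_exponent_le (by norm_num) (by linarith)
          · nlinarith [sq_nonneg w]
          · linarith
      _ = (3 * (1 + w ^ 2)) ^ (-ε / 2 - 1) := by rw [Real.mul_rpow (by norm_num) (by positivity)]
      _ ≤ _ := Real.rpow_le_rpow_of_nonpos (by positivity) (by nlinarith [sq_nonneg (w - 1)])
          (by linarith)
  calc trF' ε v ^ 2 ≤ w ^ 2 * (1 + w ^ 2) ^ (-ε - 1) := e1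
    _ ≤ w * v * (1 + w ^ 2) ^ (-ε - 1) := by gcongr; nlinarith
    _ = 9 / (ε * trG ε 1) * ((trG ε 1 * w) * (ε * v * (1 / 9 * (1 + w ^ 2) ^ (-ε - 1)))) := by
        field_simp
    _ ≤ _ := by gcongr; exact trPsi_nonneg hε v

lemma trF_le_trPsi (hε : 0 < ε) (hε1 : ε ≤ 1 / 2) (v : ℝ) : trF ε v ≤ 1 / trG ε 1 * trPsi ε v := by
  have hG := trG_one_pos hε
  refine (trF_le hε hε1 v).trans ?_
  rw [one_div, inv_mul_eq_div, le_div_iff₀ hG, mul_comm]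
  exact trPsi_ge hε v

lemma exists_rpow_le_trF (hε : 0 < ε) (hε1 : ε ≤ 1 / 2) {p : ℝ} (hp : 1 + ε ≤ (1 - ε) * p) :
    ∃ C : ℝ, 0 < C ∧ ∀ v, 2 ≤ v → v ^ (1 + ε) ≤ C * trF ε v ^ p := by
  have hp0 : 0 ≤ p := by nlinarith
  set k : ℝ := 2 ^ ((1 - ε) / 2) with hk
  have hk1 : 1 < k := Real.one_lt_rpow (by norm_num) (by linarith)
  set c := (1 - 1 / k) * (1 / 2) ^ (1 - ε) with hc
  have hc0 : 0 < c := by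
    have : 1 / k < 1 := by rw [div_lt_one (by linarith)]; exact hk1
    have : 0 < 1 - 1 / k := by linarith
    positivity
  refine ⟨(c ^ p)⁻¹, by positivity, fun v hv => ?_⟩
  have hF : c * v ^ (1 - ε) ≤ trF ε v := by
    rw [trF, max_eq_left (by linarith)]
    set w := v - 1
    have hw1 : 1 ≤ w := by simp only [w]; linarith
    have hwv : 1 / 2 * v ≤ w := by simp only [w]; linarith
    set y := (1 + w ^ 2) ^ ((1 - ε) / 2) with hy
    have hky : k ≤ y := Real.rpow_le_rpow (by norm_num) (by nlinarith) (by linarith)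
    have hwy : (1 / 2 * v) ^ (1 - ε) ≤ y := by
      calc (1 / 2 * v) ^ (1 - ε) ≤ w ^ (1 - ε) :=
            Real.rpow_le_rpow (by linarith) hwv (by linarith)
        _ = (w ^ 2) ^ ((1 - ε) / 2) := by
            rw [← Real.rpow_natCast, ← Real.rpow_mul (by positivity)]; congr 1; push_cast; ring
        _ ≤ y := Real.rpow_le_rpow (by positivity) (by linarith) (by linarith)
    rw [Real.mul_rpow (by norm_num) (by linarith)] at hwy
    have h1k : 0 ≤ 1 - 1 / k := by
      have : 1 / k < 1 := by rw [div_lt_one (by linarith)]; exact hk1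
      linarith
    calc c * v ^ (1 - ε) = (1 - 1 / k) * ((1 / 2) ^ (1 - ε) * v ^ (1 - ε)) := by rw [hc]; ring
      _ ≤ (1 - 1 / k) * y := by gcongr
      _ ≤ y - 1 := by
          have : 1 ≤ 1 / k * y := by
            rw [one_div, inv_mul_eq_div, one_le_div (by linarith)]
            exact hky
          linarith
  rw [inv_mul_eq_div, le_div_iff₀ (by positivity)]
  calc v ^ (1 + ε) * c ^ p ≤ v ^ ((1 - ε) * p) * c ^ p := by
        gcongr
        linarith
    _ = (c * v ^ (1 - ε)) ^ p := by
        rw [Real.mul_rpow hc0.le (by positivity), ← Real.rpow_mul (by linarith), mul_comm]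
    _ ≤ _ := by gcongr

end Truncation

section LTwo

variable {α : Type*} [MeasurableSpace α] {μ : Measure α}
  {F : Type*} [NormedAddCommGroup F]

lemma MeasureTheory.MemLp.lintegral_enorm_sq_lt_top {f : α → F} (hf : MemLp f 2 μ) :
    ∫⁻ p, ‖f p‖ₑ ^ 2 ∂μ < ∞ := by
  have := lintegral_rpow_enorm_lt_top_of_eLpNorm_lt_top (f := f) two_ne_zero (by simp) hf.2
  simpa using this

lemma memLp_two_of_lintegral {f : α → F} (hf : AEStronglyMeasurable f μ)
    (h : ∫⁻ p, ‖f p‖ₑ ^ 2 ∂μ < ∞) : MemLp f 2 μ := by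
  refine ⟨hf, ?_⟩
  rw [eLpNorm_lt_top_iff_lintegral_rpow_enorm_lt_top two_ne_zero (by simp)]
  simpa using h

lemma enorm_add_sq_le (a b : F) : ‖a + b‖ₑ ^ 2 ≤ 2 * (‖a‖ₑ ^ 2 + ‖b‖ₑ ^ 2) := by
  have h : ‖a + b‖ ^ 2 ≤ 2 * (‖a‖ ^ 2 + ‖b‖ ^ 2) := by
    have := norm_add_le a b
    nlinarith [sq_nonneg (‖a‖ - ‖b‖), norm_nonneg a, norm_nonneg b, norm_nonneg (a + b)]
  have h2 := ENNReal.ofReal_le_ofReal h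
  rw [ENNReal.ofReal_mul (by norm_num), ENNReal.ofReal_add (by positivity) (by positivity),
    ENNReal.ofReal_pow (norm_nonneg _), ENNReal.ofReal_pow (norm_nonneg _),
    ENNReal.ofReal_pow (norm_nonneg _), ofReal_norm, ofReal_norm, ofReal_norm] at h2
  simpa using h2

lemma lintegral_enorm_add_sq_le {f g : α → F} (hf : AEStronglyMeasurable f μ) :
    ∫⁻ p, ‖f p + g p‖ₑ ^ 2 ∂μ ≤ 2 * (∫⁻ p, ‖f p‖ₑ ^ 2 ∂μ + ∫⁻ p, ‖g p‖ₑ ^ 2 ∂μ) := by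
  calc ∫⁻ p, ‖f p + g p‖ₑ ^ 2 ∂μ ≤ ∫⁻ p, 2 * (‖f p‖ₑ ^ 2 + ‖g p‖ₑ ^ 2) ∂μ :=
        lintegral_mono fun p => enorm_add_sq_le _ _
    _ = _ := by
        rw [lintegral_const_mul' _ _ (by simp), lintegral_add_left' (hf.enorm.pow_const 2)]

/-- Pairings with a fixed `L²` function pass to the limit under `L²` convergence. -/
lemma tendsto_integral_inner_of_sq [InnerProductSpace ℝ F] {f : ℕ → α → F} {f₀ g : α → F}
    (hf : ∀ n, AEStronglyMeasurable (f n) μ) (hf₀ : MemLp f₀ 2 μ) (hg : MemLp g 2 μ)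
    (h : Tendsto (fun n => ∫⁻ p, ‖f n p - f₀ p‖ₑ ^ 2 ∂μ) atTop (𝓝 0)) :
    Tendsto (fun n => ∫ p, ⟪f n p, g p⟫ ∂μ) atTop (𝓝 (∫ p, ⟪f₀ p, g p⟫ ∂μ)) := by
  have hfin : ∀ᶠ n in atTop, MemLp (f n) 2 μ := by
    filter_upwards [h.eventually (gt_mem_nhds zero_lt_one)] with n hn
    have h1 : MemLp (fun p => f n p - f₀ p) 2 μ :=
      memLp_two_of_lintegral ((hf n).sub hf₀.1) (hn.trans (by simp))
    have := h1.add hf₀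
    refine (memLp_congr_ae (Eventually.of_forall fun p => ?_)).1 this
    simp
  refine tendsto_integral_of_L1 _ (hf₀.1.inner hg.1) ?_ ?_
  · filter_upwards [hfin] with n hn
    refine ((hn.integrable_norm_pow two_ne_zero).add (hg.integrable_norm_pow two_ne_zero)).mono'
      (hn.1.inner hg.1) (Eventually.of_forall fun p => ?_)
    have := norm_inner_le_norm (𝕜 := ℝ) (f n p) (g p)
    simp only [Pi.add_apply]
    nlinarith [sq_nonneg (‖f n p‖ - ‖g p‖), norm_nonneg (f n p), norm_nonneg (g p)]
  have hb : ∀ n, (∫⁻ p, ‖⟪f n p, g p⟫ - ⟪f₀ p, g p⟫‖ₑ ∂μ) ^ 2 ≤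
      (∫⁻ p, ‖f n p - f₀ p‖ₑ ^ 2 ∂μ) * ∫⁻ p, ‖g p‖ₑ ^ 2 ∂μ := by
    intro n
    refine le_trans ?_ (lintegral_mul_sq_le μ ((hf n).sub hf₀.1).enorm hg.1.enorm)
    gcongr with p
    rw [← inner_sub_left, ← ofReal_norm, ← ofReal_norm, ← ofReal_norm,
      ← ENNReal.ofReal_mul (norm_nonneg _)]
    exact ENNReal.ofReal_le_ofReal (norm_inner_le_norm _ _)
  have h0 : Tendsto (fun n => (∫⁻ p, ‖⟪f n p, g p⟫ - ⟪f₀ p, g p⟫‖ₑ ∂μ) ^ 2) atTop (𝓝 0) := by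
    refine tendsto_of_tendsto_of_tendsto_of_le_of_le tendsto_const_nhds ?_ (fun _ => zero_le) hb
    have := ENNReal.Tendsto.mul_const h (Or.inr hg.lintegral_enorm_sq_lt_top.ne)
    simpa using this
  have h1 := ENNReal.Tendsto.pow (n := 2) tendsto_id (a := (0 : ℝ≥0∞))
  have h2 := (ENNReal.continuous_rpow_const (y := (1 / 2 : ℝ))).tendsto 0 |>.comp h0
  rw [ENNReal.zero_rpow_of_pos (by norm_num)] at h2
  refine h2.congr fun n => ?_
  simp only [Function.comp]
  rw [← ENNReal.rpow_natCast, ← ENNReal.rpow_mul]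
  norm_num

lemma summable_half_pow_ne_top : ∑' n : ℕ, (2 : ℝ≥0∞)⁻¹ ^ n ≠ ∞ := by
  rw [ENNReal.tsum_geometric, ENNReal.one_sub_inv_two, inv_inv]
  simp

lemma ae_tendsto_zero_of_lintegral_le {f : ℕ → α → ℝ≥0∞} (hf : ∀ n, AEMeasurable (f n) μ)
    (h : ∀ n, ∫⁻ p, f n p ∂μ ≤ 2⁻¹ ^ n) : ∀ᵐ p ∂μ, Tendsto (fun n => f n p) atTop (𝓝 0) := by
  have h1 : ∫⁻ p, ∑' n, f n p ∂μ ≠ ∞ := by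
    rw [lintegral_tsum hf]
    exact ne_top_of_le_ne_top summable_half_pow_ne_top (ENNReal.tsum_le_tsum h)
  filter_upwards [ae_lt_top' (AEMeasurable.tsum hf) h1] with p hp
  exact ENNReal.tendsto_atTop_zero_of_tsum_ne_top hp.ne

lemma tendsto_of_enorm_sq_sub {f : ℕ → F} {a : F}
    (h : Tendsto (fun n => ‖f n - a‖ₑ ^ 2) atTop (𝓝 0)) : Tendsto f atTop (𝓝 a) := by
  rw [tendsto_iff_norm_sub_tendsto_zero]
  have h2 := (ENNReal.continuous_rpow_const (y := (1 / 2 : ℝ))).tendsto 0 |>.comp h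
  rw [ENNReal.zero_rpow_of_pos (by norm_num)] at h2
  have h3 : Tendsto (fun n => ‖f n - a‖ₑ) atTop (𝓝 0) := by
    refine h2.congr fun n => ?_
    simp only [Function.comp]
    rw [← ENNReal.rpow_natCast, ← ENNReal.rpow_mul]
    norm_num
  have := (ENNReal.tendsto_toReal ENNReal.zero_ne_top).comp h3
  simpa [Function.comp_def] using this

end LTwo

section Sequence

/-- A sequence of mollifiers along which two given functions converge fast in `L²`. -/
structure IsMolSeq (f : ℝ × Ed d → ℝ) (g : ℝ × Ed d → Ed d) (e : ℕ → ℝ)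
    (ρ : ℕ → ℝ × Ed d → ℝ) : Prop where
  pos : ∀ n, 0 < e n
  lim : Tendsto e atTop (𝓝 0)
  isMol : ∀ n, IsMollifier volume (e n) (ρ n)
  convf : ∀ n, ∫⁻ p, ‖mol volume (ρ n) f p - f p‖ₑ ^ 2 ≤ 2⁻¹ ^ n
  convg : ∀ n, ∫⁻ p, ‖mol volume (ρ n) g p - g p‖ₑ ^ 2 ≤ 2⁻¹ ^ n

lemma exists_isMolSeq {f : ℝ × Ed d → ℝ} {g : ℝ × Ed d → Ed d} (hf : MemLp f 2 volume)
    (hg : MemLp g 2 volume) : ∃ e ρ, IsMolSeq f g e ρ := by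
  have h2 : ∀ n : ℕ, (0 : ℝ≥0∞) < 2⁻¹ ^ n := fun n => by
    apply ENNReal.pow_pos; simp
  have : ∀ n : ℕ, ∃ e : ℝ, ∃ ρ : ℝ × Ed d → ℝ, 0 < e ∧ e ≤ 1 / (n + 1) ∧
      IsMollifier volume e ρ ∧ ∫⁻ p, ‖mol volume ρ f p - f p‖ₑ ^ 2 ≤ 2⁻¹ ^ n ∧
      ∫⁻ p, ‖mol volume ρ g p - g p‖ₑ ^ 2 ≤ 2⁻¹ ^ n := by
    intro n
    obtain ⟨e1, he1, h1⟩ := exists_mollifier_radius hf (h2 n)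
    obtain ⟨e2, he2, h2⟩ := exists_mollifier_radius hg (h2 n)
    have hn : (0 : ℝ) < 1 / (n + 1) := by positivity
    have hpos : 0 < min (min e1 e2) (1 / ((n : ℝ) + 1)) := by positivity
    obtain ⟨ρ, hρ⟩ := exists_isMollifier (volume : Measure (ℝ × Ed d)) hpos
    exact ⟨_, ρ, hpos, min_le_right _ _, hρ,
      h1 _ ((min_le_left _ _).trans (min_le_left _ _)) ρ hρ,
      h2 _ ((min_le_left _ _).trans (min_le_right _ _)) ρ hρ⟩
  choose e ρ h1 h2 h3 h4 h5 using this
  refine ⟨e, ρ, h1, ?_, h3, h4, h5⟩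
  exact tendsto_of_tendsto_of_tendsto_of_le_of_le tendsto_const_nhds
    tendsto_one_div_add_atTop_nhds_zero_nat (fun n => (h1 n).le) h2

end Sequence

section Solution

/-- The data on a cylinder used in the local estimates: `a` is the flux of `u`, and the weak
formulation is tested with smooth functions compactly supported in the cylinder. -/
structure CylSol (s Λ : ℝ) (K : ℝ → Ed d → Ed d → ℝ) (ν : Measure (ℝ × Ed d))
    (t₀ : ℝ) (x₀ : Ed d) (R : ℝ) (u : ℝ × Ed d → ℝ) (Du a : ℝ × Ed d → Ed d) : Prop where
  meas_u : Measurable u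
  meas_D : Measurable Du
  meas_a : Measurable a
  growth : ∀ p, ‖a p‖ ≤ Λ * ‖Du p‖
  coercive : ∀ p, Λ⁻¹ * ‖Du p‖ ^ 2 ≤ ⟪a p, Du p⟫
  memLp_u : MemLp u 2 (volume.restrict (pCyl t₀ x₀ R))
  memLp_D : MemLp Du 2 (volume.restrict (pCyl t₀ x₀ R))
  tail : IntegrableOn (fun p : ℝ × Ed d => |u p| / (1 + ‖p.2‖ ^ ((d : ℝ) + 2 * s)))
    (Iminus t₀ R ×ˢ univ)
  grad : ∀ t ∈ Iminus t₀ R, ∀ φ : Ed d → ℝ, ContDiff ℝ (⊤ : ℕ∞) φ → HasCompactSupport φ →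
    tsupport φ ⊆ ball x₀ R → ∀ e : Ed d,
      ∫ x, u (t, x) * fderiv ℝ φ x e = -∫ x, φ x * ⟪Du (t, x), e⟫
  weak : ∀ φ : ℝ × Ed d → ℝ, ContDiff ℝ (⊤ : ℕ∞) φ → HasCompactSupport φ →
    tsupport φ ⊆ pCyl t₀ x₀ R →
      |-(∫ p, u p * fderiv ℝ φ p (1, 0)) + (∫ p, fderiv ℝ φ p (0, a p))
        + ∫ t, ∫ x, ∫ y, (u (t, x) - u (t, y)) * (φ (t, x) - φ (t, y)) * K t x y|
      ≤ ∫ p, |φ p| ∂ν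

lemma measurableSet_pCyl (t₀ : ℝ) (x₀ : Ed d) (R : ℝ) : MeasurableSet (pCyl t₀ x₀ R) :=
  measurableSet_Ioo.prod measurableSet_ball

lemma isOpen_pCyl (t₀ : ℝ) (x₀ : Ed d) (R : ℝ) : IsOpen (pCyl t₀ x₀ R) :=
  isOpen_Ioo.prod isOpen_ball

variable {s Λ : ℝ} {K : ℝ → Ed d → Ed d → ℝ} {ν : Measure (ℝ × Ed d)}
  {t₀ : ℝ} {x₀ : Ed d} {R : ℝ} {u : ℝ × Ed d → ℝ} {Du a : ℝ × Ed d → Ed d}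

lemma CylSol.neg (h : CylSol s Λ K ν t₀ x₀ R u Du a) :
    CylSol s Λ K ν t₀ x₀ R (fun p => -u p) (fun p => -Du p) (fun p => -a p) where
  meas_u := h.meas_u.neg
  meas_D := h.meas_D.neg
  meas_a := h.meas_a.neg
  growth p := by simpa using h.growth p
  coercive p := by simpa using h.coercive p
  memLp_u := h.memLp_u.neg
  memLp_D := h.memLp_D.neg
  tail := by simpa using h.tail
  grad t ht φ h1 h2 h3 e := by
    have := h.grad t ht φ h1 h2 h3 e
    simp only [neg_mul, integral_neg, inner_neg_left, mul_neg, neg_neg]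
    rw [this, neg_neg]
  weak φ h1 h2 h3 := by
    have := h.weak φ h1 h2 h3
    rw [← abs_neg] at this
    refine le_trans (le_of_eq ?_) this
    congr 1
    have e1 : ∀ p, fderiv ℝ φ p (0, -a p) = -fderiv ℝ φ p (0, a p) := by
      intro p; rw [← map_neg]; simp
    have e2 : ∀ t x y, (-u (t, x) - -u (t, y)) * (φ (t, x) - φ (t, y)) * K t x y =
        -((u (t, x) - u (t, y)) * (φ (t, x) - φ (t, y)) * K t x y) := by
      intros; ring
    simp only [e1, e2, neg_mul, integral_neg]
    ring

/-- The solution cut off outside the cylinder. -/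
def cutU (t₀ : ℝ) (x₀ : Ed d) (R : ℝ) {F : Type*} [Zero F] (f : ℝ × Ed d → F) :
    ℝ × Ed d → F := (pCyl t₀ x₀ R).indicator f

lemma CylSol.memLp_cutU (h : CylSol s Λ K ν t₀ x₀ R u Du a) :
    MemLp (cutU t₀ x₀ R u) 2 volume :=
  (memLp_indicator_iff_restrict (measurableSet_pCyl _ _ _)).2 h.memLp_u

lemma CylSol.memLp_cutD (h : CylSol s Λ K ν t₀ x₀ R u Du a) :
    MemLp (cutU t₀ x₀ R Du) 2 volume :=
  (memLp_indicator_iff_restrict (measurableSet_pCyl _ _ _)).2 h.memLp_D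

lemma CylSol.memLp_cuta (h : CylSol s Λ K ν t₀ x₀ R u Du a) :
    MemLp (cutU t₀ x₀ R a) 2 volume := by
  refine (memLp_indicator_iff_restrict (measurableSet_pCyl _ _ _)).2 ?_
  exact h.memLp_D.of_le_mul h.meas_a.aestronglyMeasurable (Eventually.of_forall h.growth)

/-- The spatial gradient of a mollification is the mollification of the weak gradient. -/
lemma CylSol.fderiv_mol_eq (h : CylSol s Λ K ν t₀ x₀ R u Du a) {ε : ℝ}
    {ρ : ℝ × Ed d → ℝ} (hρ : IsMollifier volume ε ρ) {p : ℝ × Ed d}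
    (hp : closedBall p ε ⊆ pCyl t₀ x₀ R) (v : Ed d) :
    fderiv ℝ (mol volume ρ (cutU t₀ x₀ R u)) p (0, v) =
      ⟪mol volume ρ (cutU t₀ x₀ R Du) p, v⟫ := by
  have hul := h.memLp_cutU.locallyIntegrable (by norm_num)
  have hDl := h.memLp_cutD.locallyIntegrable (by norm_num)
  have hρ1 : ContDiff ℝ 1 ρ := hρ.smooth.of_le (by simp)
  have hcf : Continuous fun z => fderiv ℝ ρ z (0, v) :=
    (hρ1.continuous_fderiv one_ne_zero).clm_apply continuous_const
  have hcs : HasCompactSupport fun z => fderiv ℝ ρ z (0, v) :=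
    hρ.hasCompactSupport.fderiv_apply ℝ _
  have i1 := integrable_kernel_smul hcf hcs hul p
  have i2 := integrable_kernel_smul hρ.continuous hρ.hasCompactSupport hDl p
  have i3 : Integrable (fun z => ρ (p - z) * ⟪cutU t₀ x₀ R Du z, v⟫) := by
    refine (i2.inner_const v).congr (Eventually.of_forall fun z => ?_)
    simp [real_inner_smul_left]
  rw [hρ.fderiv_mol hul]
  have e3 : ⟪mol volume ρ (cutU t₀ x₀ R Du) p, v⟫ = ∫ z, ρ (p - z) * ⟪cutU t₀ x₀ R Du z, v⟫ := by
    rw [mol, real_inner_comm, ← integral_inner i2 v]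
    congr 1; ext z
    rw [real_inner_comm, real_inner_smul_left]
  rw [e3]
  simp only [smul_eq_mul] at i1
  rw [Measure.volume_eq_prod, integral_prod _ i1, integral_prod _ i3]
  congr 1; ext t
  rcases lt_or_ge |p.1 - t| ε with ht | ht
  · have hsub : ∀ x, x ∈ closedBall p.2 ε → (t, x) ∈ pCyl t₀ x₀ R := by
      intro x hx
      apply hp
      rw [mem_closedBall, Prod.dist_eq, max_le_iff]
      refine ⟨?_, hx⟩
      rw [Real.dist_eq, abs_sub_comm]; exact ht.le
    have hε : 0 < ε := (abs_nonneg _).trans_lt ht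
    have htI : t ∈ Iminus t₀ R := (hsub p.2 (by simp [hε.le])).1
    set φ : Ed d → ℝ := fun x => ρ (p - (t, x)) with hφ
    have hφs : ContDiff ℝ (⊤ : ℕ∞) φ := hρ.smooth.comp (by fun_prop)
    have hφd : ∀ x, fderiv ℝ φ x v = -fderiv ℝ ρ (p - (t, x)) (0, v) := by
      intro x
      have h1 : HasFDerivAt (fun x : Ed d => p - (t, x))
          (-(ContinuousLinearMap.inr ℝ ℝ (Ed d))) x := by
        have := (hasFDerivAt_prodMk_right (𝕜 := ℝ) t x).const_sub p
        exact this
      have h2 := ((hρ1.differentiable one_ne_zero) (p - (t, x))).hasFDerivAt.comp x h1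
      have h3 : fderiv ℝ φ x = _ := h2.fderiv
      rw [h3]
      simp [← map_neg]
    have hφ0 : ∀ x, x ∉ closedBall p.2 ε → φ x = 0 := by
      intro x hx
      apply hρ.supp
      rw [mem_closedBall, not_le, dist_comm, dist_eq_norm] at hx
      exact hx.le.trans (norm_snd_le (p - (t, x)))
    have hts : tsupport φ ⊆ closedBall p.2 ε :=
      closure_minimal (fun x hx => by by_contra hc; exact hx (hφ0 x hc)) isClosed_closedBall
    have hφc : HasCompactSupport φ :=
      HasCompactSupport.intro (isCompact_closedBall p.2 ε) hφ0
    have hg := h.grad t htI φ hφs hφc (fun x hx => (hsub x (hts hx)).2) v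
    have a1 : ∀ x, fderiv ℝ ρ (p - (t, x)) (0, v) * cutU t₀ x₀ R u (t, x) =
        -(u (t, x) * fderiv ℝ φ x v) := by
      intro x
      rw [hφd]
      by_cases hx : (t, x) ∈ pCyl t₀ x₀ R
      · rw [cutU, indicator_of_mem hx]; ring
      · have hx' : x ∉ tsupport φ := fun hc => hx (hsub x (hts hc))
        have : fderiv ℝ φ x v = 0 := by
          rw [fderiv_of_notMem_tsupport ℝ hx']; rfl
        rw [hφd, neg_eq_zero] at this
        rw [this]; ring
    have a2 : ∀ x, ρ (p - (t, x)) * ⟪cutU t₀ x₀ R Du (t, x), v⟫ = φ x * ⟪Du (t, x), v⟫ := by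
      intro x
      by_cases hx : (t, x) ∈ pCyl t₀ x₀ R
      · rw [cutU, indicator_of_mem hx]
      · have : φ x = 0 := hφ0 x fun hc => hx (hsub x hc)
        rw [this, zero_mul]
        rw [show ρ (p - (t, x)) = φ x from rfl, this, zero_mul]
    simp_rw [a1, a2, integral_neg, hg, neg_neg]
  · have hz : ∀ x, ε ≤ ‖p - (t, x)‖ := fun x => ht.trans (norm_fst_le (p - (t, x)))
    have b1 : ∀ x, ρ (p - (t, x)) = 0 := fun x => hρ.supp _ (hz x)
    have b2 : ∀ x, fderiv ℝ ρ (p - (t, x)) = 0 := by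
      intro x
      have hmin : IsLocalMin ρ (p - (t, x)) :=
        Eventually.of_forall fun z => by rw [b1]; exact hρ.nonneg z
      exact hmin.fderiv_eq_zero
    simp [b1, b2]

end Solution

section JumpForm

lemma lintegral_triple {F : ℝ × Ed d × Ed d → ℝ≥0∞} (hF : Measurable F) :
    ∫⁻ z, F z = ∫⁻ t, ∫⁻ x, ∫⁻ y, F (t, x, y) := by
  rw [Measure.volume_eq_prod, lintegral_prod _ hF.aemeasurable]
  congr 1; ext t
  rw [Measure.volume_eq_prod, lintegral_prod _ (by fun_prop)]

/-- The truncated jump measure on `ℝ × ℝ^d × ℝ^d`. -/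
def jumpM (d : ℕ) (s : ℝ) : Measure (ℝ × Ed d × Ed d) :=
  volume.withDensity fun z => nearK s (z.2.1 - z.2.2)

lemma measurable_nearK_sub (s : ℝ) :
    Measurable fun z : ℝ × Ed d × Ed d => nearK s (z.2.1 - z.2.2) :=
  (measurable_nearK s).comp (by fun_prop)

/-- The truncated Gagliardo energy of a function on space-time. -/
def jumpE (s : ℝ) (f : ℝ × Ed d → ℝ) : ℝ≥0∞ :=
  ∫⁻ z, ‖f (z.1, z.2.1) - f (z.1, z.2.2)‖ₑ ^ 2 ∂jumpM d s

lemma measurable_jump {f : ℝ × Ed d → ℝ} (hf : Measurable f) :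
    Measurable fun z : ℝ × Ed d × Ed d => f (z.1, z.2.1) - f (z.1, z.2.2) := by
  fun_prop

lemma lintegral_jumpM (s : ℝ) {F : ℝ × Ed d × Ed d → ℝ≥0∞} (hF : Measurable F) :
    ∫⁻ z, F z ∂jumpM d s = ∫⁻ z, F z * nearK s (z.2.1 - z.2.2) := by
  rw [jumpM, lintegral_withDensity_eq_lintegral_mul _ (measurable_nearK_sub s) hF]
  congr 1; ext z
  simp only [Pi.mul_apply]
  rw [mul_comm]

lemma jumpE_le {s : ℝ} (hC : nearC d s ≠ ∞) {f : ℝ × Ed d → ℝ} (hf : Measurable f)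
    (hs : ∀ t, ContDiff ℝ 1 fun x => f (t, x)) :
    jumpE s f ≤ nearC d s * ∫⁻ t, ∫⁻ x, ‖fderiv ℝ (fun x => f (t, x)) x‖ₑ ^ 2 := by
  have hm : Measurable fun z : ℝ × Ed d × Ed d =>
      ‖f (z.1, z.2.1) - f (z.1, z.2.2)‖ₑ ^ 2 := (measurable_jump hf).enorm.pow_const 2
  have hm2 : Measurable fun z : ℝ × Ed d × Ed d =>
      ‖f (z.1, z.2.1) - f (z.1, z.2.2)‖ₑ ^ 2 * nearK s (z.2.1 - z.2.2) :=
    hm.mul (measurable_nearK_sub s)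
  rw [jumpE, lintegral_jumpM s hm, lintegral_triple hm2, ← lintegral_const_mul' _ _ hC]
  exact lintegral_mono fun t => lintegral_diffQuot_le s (hs t)

lemma ae_triple {P : ℝ × Ed d → Prop} (h : ∀ᵐ p, P p) :
    (∀ᵐ z : ℝ × Ed d × Ed d, P (z.1, z.2.1)) ∧ ∀ᵐ z : ℝ × Ed d × Ed d, P (z.1, z.2.2) := by
  have h1 : Measure.QuasiMeasurePreserving (Prod.map id Prod.fst : ℝ × Ed d × Ed d → ℝ × Ed d)
      volume volume :=
    MeasureTheory.QuasiMeasurePreserving.prodMap (.id _) Measure.quasiMeasurePreserving_fst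
  have h2 : Measure.QuasiMeasurePreserving (Prod.map id Prod.snd : ℝ × Ed d × Ed d → ℝ × Ed d)
      volume volume :=
    MeasureTheory.QuasiMeasurePreserving.prodMap (.id _) Measure.quasiMeasurePreserving_snd
  exact ⟨h1.ae h, h2.ae h⟩

/-- Lower semicontinuity: a bound on the gradients controls the jump energy of an a.e. limit. -/
lemma jumpE_le_of_tendsto {s : ℝ} (hC : nearC d s ≠ ∞) {f : ℕ → ℝ × Ed d → ℝ}
    {g : ℝ × Ed d → ℝ} (hf : ∀ n, Measurable (f n))
    (hs : ∀ n t, ContDiff ℝ 1 fun x => f n (t, x))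
    (hlim : ∀ᵐ p, Tendsto (fun n => f n p) atTop (𝓝 (g p))) {M : ℝ≥0∞}
    (hM : ∀ᶠ n in atTop, ∫⁻ t, ∫⁻ x, ‖fderiv ℝ (fun x => f n (t, x)) x‖ₑ ^ 2 ≤ M) :
    jumpE s g ≤ nearC d s * M := by
  have hm : ∀ n, Measurable fun z : ℝ × Ed d × Ed d =>
      ‖f n (z.1, z.2.1) - f n (z.1, z.2.2)‖ₑ ^ 2 := fun n =>
    (measurable_jump (hf n)).enorm.pow_const 2
  obtain ⟨h1, h2⟩ := ae_triple hlim
  have hac : jumpM d s ≪ volume := withDensity_absolutelyContinuous _ _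
  calc jumpE s g ≤ ∫⁻ z, liminf (fun n => ‖f n (z.1, z.2.1) - f n (z.1, z.2.2)‖ₑ ^ 2) atTop
        ∂jumpM d s := by
        refine lintegral_mono_ae ?_
        filter_upwards [hac.ae_le h1, hac.ae_le h2] with z hz1 hz2
        have : Tendsto (fun n => ‖f n (z.1, z.2.1) - f n (z.1, z.2.2)‖ₑ ^ 2) atTop
            (𝓝 (‖g (z.1, z.2.1) - g (z.1, z.2.2)‖ₑ ^ 2)) :=
          ENNReal.Tendsto.pow ((hz1.sub hz2).enorm)
        exact this.liminf_eq.ge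
    _ ≤ liminf (fun n => jumpE s (f n)) atTop := lintegral_liminf_le hm
    _ ≤ nearC d s * M := by
        refine liminf_le_of_frequently_le' (Eventually.frequently ?_)
        filter_upwards [hM] with n hn
        exact (jumpE_le hC (hf n) (hs n)).trans (by gcongr)

end JumpForm

section FarPart

variable {s Λ : ℝ} {K : ℝ → Ed d → Ed d → ℝ}

/-- The integrable weight controlling far interactions. -/
def farW (s : ℝ) (y : Ed d) : ℝ≥0∞ := ENNReal.ofReal (1 / (1 + ‖y‖ ^ ((d : ℝ) + 2 * s)))

lemma measurable_farW (s : ℝ) : Measurable (farW (d := d) s) := by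
  unfold farW; fun_prop

lemma lintegral_farW_lt_top (hs : 0 < s) : ∫⁻ y : Ed d, farW s y < ∞ := by
  have h1 : Integrable (fun y : Ed d => (1 + ‖y‖) ^ (-((d : ℝ) + 2 * s))) := by
    apply integrable_one_add_norm
    simp; linarith
  have hγ : 0 ≤ (d : ℝ) + 2 * s := by positivity
  have h2 : Integrable (fun y : Ed d => 1 / (1 + ‖y‖ ^ ((d : ℝ) + 2 * s))) := by
    refine (h1.const_mul (2 ^ ((d : ℝ) + 2 * s))).mono' (by
        have : Measurable fun y : Ed d => 1 / (1 + ‖y‖ ^ ((d : ℝ) + 2 * s)) := by fun_prop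
        exact this.aestronglyMeasurable)
      (Eventually.of_forall fun y => ?_)
    have hy := norm_nonneg y
    rw [Real.norm_of_nonneg (by positivity), Real.rpow_neg (by positivity), ← div_eq_mul_inv,
      div_le_div_iff₀ (by positivity) (by positivity), one_mul]
    rcases le_total ‖y‖ 1 with h | h
    · calc (1 + ‖y‖) ^ ((d : ℝ) + 2 * s) ≤ 2 ^ ((d : ℝ) + 2 * s) * 1 := by
            rw [mul_one]; exact Real.rpow_le_rpow (by positivity) (by linarith) hγ
        _ ≤ _ := by gcongr; linarith [Real.rpow_nonneg hy ((d : ℝ) + 2 * s)]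
    · calc (1 + ‖y‖) ^ ((d : ℝ) + 2 * s) ≤ (2 * ‖y‖) ^ ((d : ℝ) + 2 * s) :=
            Real.rpow_le_rpow (by positivity) (by linarith) hγ
        _ = 2 ^ ((d : ℝ) + 2 * s) * ‖y‖ ^ ((d : ℝ) + 2 * s) :=
            Real.mul_rpow (by norm_num) hy
        _ ≤ _ := by gcongr; linarith
  have h3 := h2.lintegral_lt_top
  exact h3

lemma exists_far_const (hs : 0 < s) (x₀ : Ed d) {r₂ r : ℝ} (hr2 : 0 ≤ r₂) (hr : r₂ < r) :
    ∃ C : ℝ, 0 ≤ C ∧ ∀ x ∈ closedBall x₀ r₂, ∀ y ∉ ball x₀ r,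
      1 / ‖x - y‖ ^ ((d : ℝ) + 2 * s) ≤ C * (1 / (1 + ‖y‖ ^ ((d : ℝ) + 2 * s))) := by
  set γ := (d : ℝ) + 2 * s with hγ
  have hγ0 : 0 ≤ γ := by positivity
  set c := r - r₂ with hc
  have hc0 : 0 < c := by simp [hc, hr]
  have hb : 0 ≤ (‖x₀‖ + r₂) / c := by positivity
  set C₁ := 1 + (‖x₀‖ + r₂) / c with hC1
  refine ⟨(1 / c) ^ γ + C₁ ^ γ, by positivity, fun x hx y hy => ?_⟩
  rw [mem_closedBall, dist_eq_norm] at hx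
  rw [mem_ball, not_lt, dist_eq_norm] at hy
  have h1 : c ≤ ‖x - y‖ := by
    have := norm_sub_le_norm_sub_add_norm_sub y x x₀
    rw [norm_sub_rev y x] at this
    linarith
  have hn : 0 < ‖x - y‖ := hc0.trans_le h1
  have h2 : ‖y‖ ≤ C₁ * ‖x - y‖ := by
    have a1 : ‖y‖ ≤ ‖x - y‖ + ‖x‖ := by
      have := norm_sub_norm_le y x
      rw [norm_sub_rev y x] at this; linarith
    have a2 : ‖x‖ ≤ r₂ + ‖x₀‖ := by
      have := norm_sub_norm_le x x₀; linarith
    have a3 : (‖x₀‖ + r₂) / c * c ≤ (‖x₀‖ + r₂) / c * ‖x - y‖ := by gcongr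
    rw [div_mul_cancel₀ _ hc0.ne'] at a3
    rw [hC1]; linarith
  have h3 : 1 ≤ 1 / c * ‖x - y‖ := by
    rw [one_div, ← div_eq_inv_mul, le_div_iff₀ hc0]; linarith
  rw [mul_one_div, div_le_div_iff₀ (by positivity) (by positivity), one_mul, add_mul,
    ← Real.mul_rpow (by positivity) hn.le, ← Real.mul_rpow (by positivity) hn.le]
  gcongr
  calc (1 : ℝ) = 1 ^ γ := (Real.one_rpow _).symm
    _ ≤ _ := Real.rpow_le_rpow zero_le_one h3 hγ0

lemma KernelHyp.nonneg (hK : KernelHyp d s Λ K) (hΛ : 1 ≤ Λ) {x y : Ed d} (hxy : x ≠ y) (t : ℝ) :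
    0 ≤ K t x y := le_trans (by positivity) (hK.lower t x y hxy)

/-- The integrand of the jump form. -/
def jumpI (K : ℝ → Ed d → Ed d → ℝ) (u f : ℝ × Ed d → ℝ) (z : ℝ × Ed d × Ed d) : ℝ :=
  (u (z.1, z.2.1) - u (z.1, z.2.2)) * (f (z.1, z.2.1) - f (z.1, z.2.2)) * K z.1 z.2.1 z.2.2

lemma measurable_jumpI (hK : KernelHyp d s Λ K) {u f : ℝ × Ed d → ℝ} (hu : Measurable u)
    (hf : Measurable f) : Measurable (jumpI K u f) :=
  ((measurable_jump hu).mul (measurable_jump hf)).mul hK.meas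

/-- The weight against which far interactions are integrated. -/
def farH (s : ℝ) (u : ℝ × Ed d → ℝ) (p : ℝ × Ed d) : ℝ≥0∞ :=
  ∫⁻ y, (‖u p‖ₑ + ‖u (p.1, y)‖ₑ) * farW s y

lemma enorm_jump_mul_le (hK : KernelHyp d s Λ K) (hΛ : 1 ≤ Λ) (u : ℝ × Ed d → ℝ)
    {t : ℝ} {x y : Ed d} {C : ℝ} (hC : 0 ≤ C)
    (h : 1 / ‖x - y‖ ^ ((d : ℝ) + 2 * s) ≤ C * (1 / (1 + ‖y‖ ^ ((d : ℝ) + 2 * s)))) :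
    ‖u (t, x) - u (t, y)‖ₑ * ‖K t x y‖ₑ ≤
      ENNReal.ofReal (Λ * C) * ((‖u (t, x)‖ₑ + ‖u (t, y)‖ₑ) * farW s y) := by
  rcases eq_or_ne x y with rfl | hxy
  · simp
  have hk : ‖K t x y‖ₑ ≤ ENNReal.ofReal (Λ * C) * farW s y := by
    rw [farW, ← ENNReal.ofReal_mul (by positivity), ← ofReal_norm,
      Real.norm_of_nonneg (hK.nonneg hΛ hxy t)]
    refine ENNReal.ofReal_le_ofReal ((hK.upper t x y hxy).trans ?_)
    rw [div_eq_mul_one_div, mul_assoc]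
    gcongr
  calc _ ≤ (‖u (t, x)‖ₑ + ‖u (t, y)‖ₑ) * (ENNReal.ofReal (Λ * C) * farW s y) := by
        gcongr; exact enorm_sub_le
    _ = _ := by ring

/-- The fundamental bound for the jump form of `u` against a localized function `f`; `w` is a
finite-energy function that agrees with `u` near the support of `f`. -/
lemma exists_lintegral_jumpI_le (hK : KernelHyp d s Λ K) (hΛ : 1 ≤ Λ) (hs : 0 < s)
    {u w : ℝ × Ed d → ℝ} (hu : Measurable u) (hw : Measurable w) {J : Set ℝ} {x₀ : Ed d}
    {r₂ r : ℝ} (hr2 : 0 ≤ r₂) (hr : r₂ < r) (hr1 : r ≤ 1)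
    (huw : ∀ t ∈ J, ∀ x ∈ ball x₀ r, w (t, x) = u (t, x)) :
    ∃ C : ℝ, ∀ f : ℝ × Ed d → ℝ, Measurable f →
      (∀ p, p ∉ J ×ˢ closedBall x₀ r₂ → f p = 0) →
      ∫⁻ z, ‖jumpI K u f z‖ₑ ≤ ENNReal.ofReal Λ *
        (∫⁻ z, ‖w (z.1, z.2.1) - w (z.1, z.2.2)‖ₑ * ‖f (z.1, z.2.1) - f (z.1, z.2.2)‖ₑ
          ∂jumpM d s) + ENNReal.ofReal C * ∫⁻ p, ‖f p‖ₑ * farH s u p := by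
  obtain ⟨C, hC0, hC⟩ := exists_far_const hs x₀ hr2 hr
  refine ⟨2 * (Λ * C), fun f hf hf0 => ?_⟩
  set B : ℝ≥0∞ := ENNReal.ofReal (Λ * C) with hB
  set h : ℝ × Ed d × Ed d → ℝ≥0∞ := fun z =>
    ‖f (z.1, z.2.1)‖ₑ * ((‖u (z.1, z.2.1)‖ₑ + ‖u (z.1, z.2.2)‖ₑ) * farW s z.2.2) with hh
  set h' : ℝ × Ed d × Ed d → ℝ≥0∞ := fun z => h (z.1, z.2.2, z.2.1) with hh'
  have hfW := measurable_farW (d := d) s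
  have mh : Measurable h := by fun_prop
  have mh' : Measurable h' := by fun_prop
  set N : ℝ × Ed d × Ed d → ℝ≥0∞ := fun z =>
    ‖w (z.1, z.2.1) - w (z.1, z.2.2)‖ₑ * ‖f (z.1, z.2.1) - f (z.1, z.2.2)‖ₑ with hN
  have mN : Measurable N := by fun_prop
  have mK := measurable_nearK_sub (d := d) s
  have hnear : ∀ t ∈ J, ∀ x ∈ ball x₀ r, ∀ y ∈ ball x₀ r,
      ‖jumpI K u f (t, x, y)‖ₑ ≤ ENNReal.ofReal Λ * (N (t, x, y) * nearK s (x - y)) := by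
    intro t ht x hx y hy
    rcases eq_or_ne x y with rfl | hxy
    · simp [jumpI]
    have hd : x - y ∈ ball (0 : Ed d) 2 := by
      rw [mem_ball_zero_iff, ← dist_eq_norm]
      have := dist_triangle_right x y x₀
      rw [mem_ball] at hx hy; linarith
    have hk : ‖K t x y‖ₑ ≤ ENNReal.ofReal Λ * nearK s (x - y) := by
      rw [nearK, indicator_of_mem hd, ← ENNReal.ofReal_mul (by positivity), ← ofReal_norm,
        Real.norm_of_nonneg (hK.nonneg hΛ hxy t), mul_one_div]
      exact ENNReal.ofReal_le_ofReal (hK.upper t x y hxy)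
    simp only [jumpI, hN, huw t ht x hx, huw t ht y hy, enorm_mul]
    calc _ ≤ ‖u (t, x) - u (t, y)‖ₑ * ‖f (t, x) - f (t, y)‖ₑ *
          (ENNReal.ofReal Λ * nearK s (x - y)) := by gcongr
      _ = _ := by ring
  have hfar : ∀ t x y, f (t, x) ≠ 0 → y ∉ ball x₀ r →
      ‖jumpI K u f (t, x, y)‖ₑ ≤ B * h (t, x, y) := by
    intro t x y hfx hy
    have hx : t ∈ J ∧ x ∈ closedBall x₀ r₂ := by
      by_contra hc; exact hfx (hf0 _ hc)
    have hfy : f (t, y) = 0 := hf0 _ fun hc => hy (closedBall_subset_ball hr hc.2)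
    have := enorm_jump_mul_le hK hΛ u (t := t) hC0 (hC x hx.2 y hy)
    simp only [jumpI, hh, hfy, sub_zero, enorm_mul]
    calc _ = ‖f (t, x)‖ₑ * (‖u (t, x) - u (t, y)‖ₑ * ‖K t x y‖ₑ) := by ring
      _ ≤ ‖f (t, x)‖ₑ * (ENNReal.ofReal (Λ * C) *
          ((‖u (t, x)‖ₑ + ‖u (t, y)‖ₑ) * farW s y)) := by gcongr
      _ = _ := by rw [hB]; ring
  have hmain : ∀ t x y, f (t, x) ≠ 0 → ‖jumpI K u f (t, x, y)‖ₑ ≤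
      ENNReal.ofReal Λ * (N (t, x, y) * nearK s (x - y)) + B * h (t, x, y) := by
    intro t x y hfx
    have hx : t ∈ J ∧ x ∈ closedBall x₀ r₂ := by
      by_contra hc; exact hfx (hf0 _ hc)
    by_cases hy : y ∈ ball x₀ r
    · exact (hnear t hx.1 x (closedBall_subset_ball hr hx.2) y hy).trans le_self_add
    · exact (hfar t x y hfx hy).trans le_add_self
  have hpt : ∀ z, ‖jumpI K u f z‖ₑ ≤
      ENNReal.ofReal Λ * (N z * nearK s (z.2.1 - z.2.2)) + (B * h z + B * h' z) := by
    rintro ⟨t, x, y⟩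
    by_cases hfx : f (t, x) = 0
    · by_cases hfy : f (t, y) = 0
      · simp [jumpI, hfx, hfy]
      · have h1 := hmain t y x hfy
        have h2 : jumpI K u f (t, y, x) = jumpI K u f (t, x, y) := by
          simp only [jumpI]; rw [hK.symm t y x]; ring
        have h3 : N (t, y, x) = N (t, x, y) := by
          simp only [hN]; rw [enorm_sub_rev, enorm_sub_rev (f _)]
        rw [h2, h3, ← neg_sub, nearK_neg] at h1
        refine h1.trans ?_
        gcongr
        exact le_add_self
    · refine (hmain t x y hfx).trans ?_
      gcongr
      exact le_self_add
  calc ∫⁻ z, ‖jumpI K u f z‖ₑ ≤ ∫⁻ z, (ENNReal.ofReal Λ * (N z * nearK s (z.2.1 - z.2.2)) +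
        (B * h z + B * h' z)) := lintegral_mono hpt
    _ = ENNReal.ofReal Λ * (∫⁻ z, N z ∂jumpM d s) + (B * (∫⁻ z, h z) + B * ∫⁻ z, h' z) := by
        rw [lintegral_add_left (by fun_prop), lintegral_add_left (by fun_prop),
          lintegral_const_mul _ (by fun_prop), lintegral_const_mul _ mh,
          lintegral_const_mul _ mh', lintegral_jumpM s mN]
    _ = _ := by
        have e1 : ∫⁻ z, h z = ∫⁻ p, ‖f p‖ₑ * farH s u p := by
          rw [lintegral_triple mh, Measure.volume_eq_prod, lintegral_prod]
          · congr 1; ext t; congr 1; ext x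
            exact lintegral_const_mul' ‖f (t, x)‖ₑ _ enorm_ne_top
          · unfold farH
            have : Measurable fun q : (ℝ × Ed d) × Ed d =>
              (‖u q.1‖ₑ + ‖u (q.1.1, q.2)‖ₑ) * farW s q.2 := by fun_prop
            exact (hf.enorm.mul this.lintegral_prod_right').aemeasurable
        have e2 : ∫⁻ z, h' z = ∫⁻ z, h z := by
          rw [lintegral_triple mh, lintegral_triple mh']
          congr 1; ext t
          exact lintegral_lintegral_swap (f := fun x y => h' (t, x, y)) (by
            have : Measurable fun q : Ed d × Ed d => h' (t, q.1, q.2) := by fun_prop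
            exact this.aemeasurable)
        rw [e2, e1, ENNReal.ofReal_mul (by norm_num)]
        simp only [ENNReal.ofReal_ofNat]
        ring

lemma measurable_farH {u : ℝ × Ed d → ℝ} (hu : Measurable u) : Measurable (farH s u) := by
  have h := measurable_farW (d := d) s
  have : Measurable fun q : (ℝ × Ed d) × Ed d =>
    (‖u q.1‖ₑ + ‖u (q.1.1, q.2)‖ₑ) * farW s q.2 := by fun_prop
  exact this.lintegral_prod_right'

lemma lintegral_farH_lt_top (hs : 0 < s) {u : ℝ × Ed d → ℝ} (hu : Measurable u) {J : Set ℝ}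
    {B : Set (Ed d)} (hB : volume B < ∞) (h1 : IntegrableOn u (J ×ˢ B))
    (h2 : IntegrableOn (fun p : ℝ × Ed d => |u p| / (1 + ‖p.2‖ ^ ((d : ℝ) + 2 * s)))
      (J ×ˢ univ)) : ∫⁻ p in J ×ˢ B, farH s u p < ∞ := by
  have hW := measurable_farW (d := d) s
  have e1 : ∀ p, farH s u p = ‖u p‖ₑ * (∫⁻ y : Ed d, farW s y) +
      ∫⁻ y, ‖u (p.1, y)‖ₑ * farW s y := by
    intro p
    rw [farH, ← lintegral_const_mul _ hW, ← lintegral_add_left (by fun_prop)]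
    simp only [add_mul]
  simp_rw [e1]
  rw [lintegral_add_left (by fun_prop), lintegral_mul_const _ (by fun_prop)]
  refine ENNReal.add_lt_top.2 ⟨ENNReal.mul_lt_top h1.2 (lintegral_farW_lt_top hs), ?_⟩
  have mT : Measurable fun t => ∫⁻ y, ‖u (t, y)‖ₑ * farW s y := by
    have : Measurable fun q : ℝ × Ed d => ‖u q‖ₑ * farW s q.2 := by fun_prop
    exact this.lintegral_prod_right'
  have mT' : Measurable fun p : ℝ × Ed d => ∫⁻ y, ‖u (p.1, y)‖ₑ * farW s y :=
    mT.comp measurable_fst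
  have h3 := h2.2
  rw [HasFiniteIntegral, Measure.volume_eq_prod, ← Measure.prod_restrict, lintegral_prod _
    (by
      have : Measurable fun p : ℝ × Ed d => |u p| / (1 + ‖p.2‖ ^ ((d : ℝ) + 2 * s)) := by fun_prop
      exact this.enorm.aemeasurable), Measure.restrict_univ] at h3
  rw [Measure.volume_eq_prod, ← Measure.prod_restrict, lintegral_prod _
    mT'.aemeasurable]
  simp only [lintegral_const, MeasurableSet.univ, Measure.restrict_apply, univ_inter]
  rw [lintegral_mul_const _ mT]
  refine ENNReal.mul_lt_top (lt_of_eq_of_lt ?_ h3) hB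
  congr 1; ext t; congr 1; ext y
  have : 0 ≤ ‖y‖ ^ ((d : ℝ) + 2 * s) := by positivity
  have h4 : (0 : ℝ) ≤ |u (t, y)| / (1 + ‖y‖ ^ ((d : ℝ) + 2 * s)) := by positivity
  rw [farW, ← ofReal_norm, ← ofReal_norm, Real.norm_of_nonneg h4,
    ← ENNReal.ofReal_mul (norm_nonneg _), mul_one_div, Real.norm_eq_abs]

lemma lintegral_jump_mul_sq_le {w f : ℝ × Ed d → ℝ} (hw : Measurable w) (hf : Measurable f) :
    (∫⁻ z, ‖w (z.1, z.2.1) - w (z.1, z.2.2)‖ₑ * ‖f (z.1, z.2.1) - f (z.1, z.2.2)‖ₑ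
      ∂jumpM d s) ^ 2 ≤ jumpE s w * jumpE s f :=
  lintegral_mul_sq_le _ (measurable_jump hw).enorm.aemeasurable
    (measurable_jump hf).enorm.aemeasurable

lemma jumpI_sub (u f g : ℝ × Ed d → ℝ) (z : ℝ × Ed d × Ed d) :
    jumpI K u (fun p => f p - g p) z = jumpI K u f z - jumpI K u g z := by
  simp only [jumpI]; ring

/-- The situation in which the jump form of `u` can be tested with functions supported in
`J × closedBall x₀ r₂`. -/
structure JumpAdm (s Λ : ℝ) (K : ℝ → Ed d → Ed d → ℝ) (u w : ℝ × Ed d → ℝ) (J : Set ℝ)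
    (x₀ : Ed d) (r₂ r : ℝ) : Prop where
  ker : KernelHyp d s Λ K
  one_le : 1 ≤ Λ
  pos : 0 < s
  meas_u : Measurable u
  meas_w : Measurable w
  meas_J : MeasurableSet J
  nonneg : 0 ≤ r₂
  lt : r₂ < r
  le_one : r ≤ 1
  eq : ∀ t ∈ J, ∀ x ∈ ball x₀ r, w (t, x) = u (t, x)
  energy : jumpE s w < ∞
  far : ∫⁻ p in J ×ˢ closedBall x₀ r₂, farH s u p < ∞

variable {u w : ℝ × Ed d → ℝ} {J : Set ℝ} {x₀ : Ed d} {r₂ r : ℝ}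

lemma JumpAdm.integrable (h : JumpAdm s Λ K u w J x₀ r₂ r) {f : ℝ × Ed d → ℝ}
    (hf : Measurable f) (hf0 : ∀ p, p ∉ J ×ˢ closedBall x₀ r₂ → f p = 0)
    (hf1 : ∀ p, |f p| ≤ 1) (hfE : jumpE s f < ∞) : Integrable (jumpI K u f) := by
  obtain ⟨C, hC⟩ := exists_lintegral_jumpI_le h.ker h.one_le h.pos h.meas_u h.meas_w h.nonneg h.lt
    h.le_one h.eq
  refine ⟨(measurable_jumpI h.ker h.meas_u hf).aestronglyMeasurable, (hC f hf hf0).trans_lt ?_⟩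
  have h1 := lintegral_jump_mul_sq_le (s := s) h.meas_w hf
  refine ENNReal.add_lt_top.2 ⟨ENNReal.mul_lt_top ENNReal.ofReal_lt_top ?_,
    ENNReal.mul_lt_top ENNReal.ofReal_lt_top ?_⟩
  · have := h1.trans_lt (ENNReal.mul_lt_top h.energy hfE)
    by_contra hc
    rw [not_lt, top_le_iff] at hc
    simp [hc] at this
  · refine lt_of_le_of_lt ?_ h.far
    rw [← lintegral_indicator (h.meas_J.prod measurableSet_closedBall)]
    refine lintegral_mono fun p => ?_
    by_cases hp : p ∈ J ×ˢ closedBall x₀ r₂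
    · rw [indicator_of_mem hp]
      have : ‖f p‖ₑ ≤ 1 := by
        rw [← ofReal_norm]
        exact ENNReal.ofReal_le_one.2 (hf1 p)
      calc ‖f p‖ₑ * farH s u p ≤ 1 * farH s u p := by gcongr
        _ = _ := one_mul _
    · simp [hf0 p hp]

lemma JumpAdm.tendsto (h : JumpAdm s Λ K u w J x₀ r₂ r) {f : ℕ → ℝ × Ed d → ℝ}
    {g : ℝ × Ed d → ℝ} (hf : ∀ n, Measurable (f n)) (hg : Measurable g)
    (hf0 : ∀ n p, p ∉ J ×ˢ closedBall x₀ r₂ → f n p = 0)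
    (hg0 : ∀ p, p ∉ J ×ˢ closedBall x₀ r₂ → g p = 0)
    (hf1 : ∀ n p, |f n p| ≤ 1) (hg1 : ∀ p, |g p| ≤ 1) (hfE : ∀ n, jumpE s (f n) < ∞)
    (hlim : ∀ᵐ p, Tendsto (fun n => f n p) atTop (𝓝 (g p)))
    (hE : Tendsto (fun n => jumpE s fun p => f n p - g p) atTop (𝓝 0)) :
    Tendsto (fun n => ∫ z, jumpI K u (f n) z) atTop (𝓝 (∫ z, jumpI K u g z)) := by
  obtain ⟨C, hC⟩ := exists_lintegral_jumpI_le h.ker h.one_le h.pos h.meas_u h.meas_w h.nonneg h.lt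
    h.le_one h.eq
  refine tendsto_integral_of_L1 _
    (measurable_jumpI h.ker h.meas_u hg).aestronglyMeasurable
    (Eventually.of_forall fun n => h.integrable (hf n) (hf0 n) (hf1 n) (hfE n)) ?_
  have hm : ∀ n, Measurable fun p => f n p - g p := fun n => (hf n).sub hg
  have hb : ∀ n, ∫⁻ z, ‖jumpI K u (f n) z - jumpI K u g z‖ₑ ≤ _ := fun n => by
    have := hC (fun p => f n p - g p) (hm n) fun p hp => by rw [hf0 n p hp, hg0 p hp, sub_zero]
    simpa only [jumpI_sub] using this
  refine tendsto_of_tendsto_of_tendsto_of_le_of_le tendsto_const_nhds ?_ (fun _ => zero_le) hb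
  rw [show (0 : ℝ≥0∞) = ENNReal.ofReal Λ * 0 + ENNReal.ofReal C * 0 by simp]
  refine Tendsto.add (ENNReal.Tendsto.const_mul ?_ (Or.inr ENNReal.ofReal_ne_top))
    (ENNReal.Tendsto.const_mul ?_ (Or.inr ENNReal.ofReal_ne_top))
  · have h0 := ENNReal.Tendsto.const_mul (a := jumpE s w) hE (Or.inr h.energy.ne)
    rw [mul_zero] at h0
    have h2 := (ENNReal.continuous_rpow_const (y := (1 / 2 : ℝ))).tendsto 0 |>.comp h0
    rw [ENNReal.zero_rpow_of_pos (by norm_num)] at h2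
    refine tendsto_of_tendsto_of_tendsto_of_le_of_le tendsto_const_nhds h2 (fun _ => zero_le)
      fun n => ?_
    have h1 := lintegral_jump_mul_sq_le (s := s) h.meas_w (hm n)
    simp only [Function.comp]
    rw [one_div, ENNReal.le_rpow_inv_iff (by norm_num)]
    simpa using h1
  · have hS := h.meas_J.prod (measurableSet_closedBall (x := x₀) (ε := r₂))
    have := tendsto_lintegral_of_dominated_convergence (μ := volume)
      (F := fun n p => ‖f n p - g p‖ₑ * (J ×ˢ closedBall x₀ r₂).indicator (farH s u) p)
      (f := fun _ => 0)
      (fun p => 2 * (J ×ˢ closedBall x₀ r₂).indicator (farH s u) p)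
      (fun n => (hm n).enorm.mul ((measurable_farH h.meas_u).indicator hS)) ?_ ?_ ?_
    · rw [lintegral_zero] at this
      refine this.congr fun n => ?_
      refine lintegral_congr fun p => ?_
      by_cases hp : p ∈ J ×ˢ closedBall x₀ r₂
      · rw [indicator_of_mem hp]
      · simp [hf0 n p hp, hg0 p hp]
    · refine fun n => Eventually.of_forall fun p => ?_
      have : ‖f n p - g p‖ₑ ≤ 2 := by
        rw [← ofReal_norm, ← ENNReal.ofReal_ofNat]
        refine ENNReal.ofReal_le_ofReal ((norm_sub_le _ _).trans ?_)
        have := hf1 n p; have := hg1 p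
        simp only [Real.norm_eq_abs]; linarith
      simp only
      gcongr
    · rw [lintegral_const_mul _ ((measurable_farH h.meas_u).indicator hS), lintegral_indicator hS]
      exact ENNReal.mul_ne_top (by simp) h.far.ne
    · have hfin : ∀ᵐ p, (J ×ˢ closedBall x₀ r₂).indicator (farH s u) p < ∞ := by
        refine ae_lt_top ((measurable_farH h.meas_u).indicator hS) ?_
        rw [lintegral_indicator hS]; exact h.far.ne
      filter_upwards [hlim, hfin] with p hp hp2
      have h3 : Tendsto (fun n => ‖f n p - g p‖ₑ) atTop (𝓝 0) := by
        have := (hp.sub_const (g p)).enorm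
        simpa using this
      have := ENNReal.Tendsto.mul_const h3 (Or.inr hp2.ne)
      simpa using this

end FarPart

section SpatialGradient

/-- The spatial gradient of a function of space and time. -/
def gradx (f : ℝ × Ed d → ℝ) (p : ℝ × Ed d) : Ed d :=
  (InnerProductSpace.toDual ℝ (Ed d)).symm
    ((fderiv ℝ f p).comp (ContinuousLinearMap.inr ℝ ℝ (Ed d)))

variable {f : ℝ × Ed d → ℝ}

lemma inner_gradx (f : ℝ × Ed d → ℝ) (p : ℝ × Ed d) (v : Ed d) :
    ⟪gradx f p, v⟫ = fderiv ℝ f p (0, v) := by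
  simp [gradx]

lemma gradx_eq_of_inner {p : ℝ × Ed d} {w : Ed d} (h : ∀ v, fderiv ℝ f p (0, v) = ⟪w, v⟫) :
    gradx f p = w :=
  ext_inner_right ℝ fun v => by rw [inner_gradx, h]

lemma continuous_gradx (hf : ContDiff ℝ 1 f) : Continuous (gradx f) :=
  (InnerProductSpace.toDual ℝ (Ed d)).symm.continuous.comp
    ((hf.continuous_fderiv one_ne_zero).clm_comp continuous_const)

lemma hasCompactSupport_gradx (hf : HasCompactSupport f) : HasCompactSupport (gradx f) := by
  refine (hf.fderiv ℝ).mono fun p hp hc => hp ?_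
  simp [gradx, hc]

lemma gradx_sub {g : ℝ × Ed d → ℝ} (hf : Differentiable ℝ f) (hg : Differentiable ℝ g)
    (p : ℝ × Ed d) : gradx (fun p => f p - g p) p = gradx f p - gradx g p := by
  refine gradx_eq_of_inner fun v => ?_
  rw [fderiv_fun_sub (hf p) (hg p), inner_sub_left, inner_gradx, inner_gradx]
  rfl

lemma gradx_mul_comp {Z W : ℝ × Ed d → ℝ} {g g' : ℝ → ℝ} {p : ℝ × Ed d}
    (hZ : DifferentiableAt ℝ Z p) (hW : DifferentiableAt ℝ W p)
    (hg : HasDerivAt g (g' (W p)) (W p)) :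
    gradx (fun p => Z p * g (W p)) p =
      g (W p) • gradx Z p + (Z p * g' (W p)) • gradx W p := by
  have h2 : HasFDerivAt (fun p => g (W p)) (g' (W p) • fderiv ℝ W p) p :=
    hg.comp_hasFDerivAt p hW.hasFDerivAt
  have h1 := (hZ.hasFDerivAt.mul h2).fderiv
  refine gradx_eq_of_inner fun v => ?_
  have h3 : fderiv ℝ (fun p => Z p * g (W p)) p = _ := h1
  rw [h3, inner_add_left, real_inner_smul_left, real_inner_smul_left, inner_gradx, inner_gradx]
  simp
  ring

lemma enorm_fderiv_slice (hf : ContDiff ℝ 1 f) (t : ℝ) (x : Ed d) :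
    ‖fderiv ℝ (fun x => f (t, x)) x‖ₑ = ‖gradx f (t, x)‖ₑ := by
  have h2 : HasFDerivAt (fun x => f (t, x)) ((fderiv ℝ f (t, x)).comp
      (ContinuousLinearMap.inr ℝ ℝ (Ed d))) x :=
    ((hf.differentiable one_ne_zero) (t, x)).hasFDerivAt.comp x
      (hasFDerivAt_prodMk_right (𝕜 := ℝ) t x)
  rw [h2.fderiv, gradx, ← ofReal_norm, ← ofReal_norm, LinearIsometryEquiv.norm_map]

lemma lintegral_fderiv_slice (hf : ContDiff ℝ 1 f) :
    ∫⁻ t, ∫⁻ x, ‖fderiv ℝ (fun x => f (t, x)) x‖ₑ ^ 2 = ∫⁻ p, ‖gradx f p‖ₑ ^ 2 := by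
  simp_rw [enorm_fderiv_slice hf]
  rw [Measure.volume_eq_prod, lintegral_prod]
  exact ((continuous_gradx hf).measurable.enorm.pow_const 2).aemeasurable

lemma contDiff_slice (hf : ContDiff ℝ 1 f) (t : ℝ) : ContDiff ℝ 1 fun x => f (t, x) :=
  hf.comp (by fun_prop)

end SpatialGradient

section CutFlux

/-- A `C¹` function with bounded derivative. -/
structure IsLipC1 (g g' : ℝ → ℝ) (L : ℝ) : Prop where
  deriv : ∀ v, HasDerivAt g (g' v) v
  cont : Continuous g'
  bound : ∀ v, |g' v| ≤ L

variable {g g' : ℝ → ℝ} {L : ℝ}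

lemma IsLipC1.abs_sub_le (h : IsLipC1 g g' L) (a b : ℝ) : |g a - g b| ≤ L * |a - b| := by
  have := Convex.norm_image_sub_le_of_norm_hasDerivWithin_le (f := g) (f' := g') (s := univ)
    (C := L) (x := b) (y := a) (fun x _ => (h.deriv x).hasDerivWithinAt) (fun x _ => h.bound x)
    convex_univ (mem_univ _) (mem_univ _)
  simpa using this

lemma IsLipC1.continuous (h : IsLipC1 g g' L) : Continuous g :=
  continuous_iff_continuousAt.2 fun v => (h.deriv v).continuousAt

lemma IsLipC1.contDiff (h : IsLipC1 g g' L) : ContDiff ℝ 1 g := by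
  rw [contDiff_one_iff_deriv]
  refine ⟨fun v => (h.deriv v).differentiableAt, ?_⟩
  have : _root_.deriv g = g' := funext fun v => (h.deriv v).deriv
  rw [this]; exact h.cont

lemma IsLipC1.id : IsLipC1 (fun v => v) (fun _ => 1) 1 where
  deriv v := hasDerivAt_id v
  cont := continuous_const
  bound v := by simp

lemma IsLipC1.nonneg (h : IsLipC1 g g' L) : 0 ≤ L := (abs_nonneg _).trans (h.bound 0)

/-- The spatial gradient of `Z g(U)` when `U` has spatial gradient `D`. -/
def cutG (Z : ℝ × Ed d → ℝ) (g g' : ℝ → ℝ) (U : ℝ × Ed d → ℝ) (D : ℝ × Ed d → Ed d)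
    (p : ℝ × Ed d) : Ed d :=
  g (U p) • gradx Z p + (Z p * g' (U p)) • D p

/-- A smooth cutoff function with values in `[0, 1]` and compact support. -/
structure IsSmoothCut (Z : ℝ × Ed d → ℝ) : Prop where
  smooth : ContDiff ℝ (⊤ : ℕ∞) Z
  supp : HasCompactSupport Z
  nonneg : ∀ p, 0 ≤ Z p
  le_one : ∀ p, Z p ≤ 1

variable {Z : ℝ × Ed d → ℝ}

lemma IsSmoothCut.contDiff_one (hZ : IsSmoothCut Z) : ContDiff ℝ 1 Z :=
  hZ.smooth.of_le (by simp)

lemma IsSmoothCut.exists_bound (hZ : IsSmoothCut Z) : ∃ M, ∀ p, ‖gradx Z p‖ ≤ M :=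
  (hasCompactSupport_gradx hZ.supp).exists_bound_of_continuous (continuous_gradx hZ.contDiff_one)

lemma IsSmoothCut.abs_le_one (hZ : IsSmoothCut Z) (p : ℝ × Ed d) : |Z p| ≤ 1 := by
  rw [abs_of_nonneg (hZ.nonneg p)]; exact hZ.le_one p

lemma measurable_cutG (hZ : IsSmoothCut Z) (hg : IsLipC1 g g' L) {U : ℝ × Ed d → ℝ}
    {D : ℝ × Ed d → Ed d} (hU : Measurable U) (hD : Measurable D) :
    Measurable (cutG Z g g' U D) := by
  have h1 := (continuous_gradx hZ.contDiff_one).measurable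
  have h2 := hZ.smooth.continuous.measurable
  have h3 := hg.continuous.measurable
  have h4 := hg.cont.measurable
  unfold cutG
  fun_prop

lemma memLp_cutG (hZ : IsSmoothCut Z) (hg : IsLipC1 g g' L) {U : ℝ × Ed d → ℝ}
    {D : ℝ × Ed d → Ed d} (hU : MemLp U 2) (hD : MemLp D 2) : MemLp (cutG Z g g' U D) 2 := by
  obtain ⟨M, hM⟩ := hZ.exists_bound
  have hM0 : 0 ≤ M := (norm_nonneg _).trans (hM 0)
  have h0 : MemLp (fun p => g 0 • gradx Z p) 2 :=
    ((continuous_gradx hZ.contDiff_one).memLp_of_hasCompactSupport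
      (hasCompactSupport_gradx hZ.supp)).const_smul (g 0)
  have h1 : MemLp (fun p => (g (U p) - g 0) • gradx Z p) 2 := by
    refine hU.of_le_mul (c := L * M) (((hg.continuous.comp_aestronglyMeasurable hU.1).sub
      aestronglyMeasurable_const).smul
      (continuous_gradx hZ.contDiff_one).aestronglyMeasurable) (Eventually.of_forall fun p => ?_)
    rw [norm_smul, Real.norm_eq_abs]
    have := hg.abs_sub_le (U p) 0
    rw [sub_zero] at this
    calc _ ≤ L * |U p| * M := mul_le_mul this (hM p) (norm_nonneg _)
          (by have := hg.nonneg; positivity)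
      _ = _ := by rw [Real.norm_eq_abs]; ring
  have h2 : MemLp (fun p => (Z p * g' (U p)) • D p) 2 := by
    refine hD.of_le_mul (c := L) ((hZ.smooth.continuous.aestronglyMeasurable.mul
      (hg.cont.comp_aestronglyMeasurable hU.1)).smul hD.1) (Eventually.of_forall fun p => ?_)
    rw [norm_smul, Real.norm_eq_abs, abs_mul]
    refine mul_le_mul_of_nonneg_right ?_ (norm_nonneg _)
    calc |Z p| * |g' (U p)| ≤ 1 * L :=
          mul_le_mul (hZ.abs_le_one p) (hg.bound _) (abs_nonneg _) zero_le_one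
      _ = L := one_mul L
  refine (memLp_congr_ae (Eventually.of_forall fun p => ?_)).1 ((h0.add h1).add h2)
  simp only [cutG, Pi.add_apply]
  module

lemma enorm_smul_sq_le {c : ℝ} {C : ℝ} (h : |c| ≤ C) {F : Type*} [NormedAddCommGroup F]
    [NormedSpace ℝ F] (v : F) : ‖c • v‖ₑ ^ 2 ≤ ENNReal.ofReal (C ^ 2) * ‖v‖ₑ ^ 2 := by
  have hC : 0 ≤ C := (abs_nonneg c).trans h
  rw [enorm_smul, mul_pow, ENNReal.ofReal_pow hC]
  gcongr
  rw [← ofReal_norm]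
  exact ENNReal.ofReal_le_ofReal h

/-- The gradients `cutG` depend continuously on `(U, D)` in `L²`. -/
lemma tendsto_cutG (hZ : IsSmoothCut Z) (hg : IsLipC1 g g' L) {U : ℝ × Ed d → ℝ}
    {D : ℝ × Ed d → Ed d} (hU : AEStronglyMeasurable U) (hD : MemLp D 2)
    {Un : ℕ → ℝ × Ed d → ℝ}
    {Dn : ℕ → ℝ × Ed d → Ed d} (hUn : ∀ n, AEStronglyMeasurable (Un n))
    (hDn : ∀ n, AEStronglyMeasurable (Dn n))
    (h1 : Tendsto (fun n => ∫⁻ p, ‖Un n p - U p‖ₑ ^ 2) atTop (𝓝 0))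
    (h2 : Tendsto (fun n => ∫⁻ p, ‖Dn n p - D p‖ₑ ^ 2) atTop (𝓝 0))
    (h3 : ∀ᵐ p, Tendsto (fun n => Un n p) atTop (𝓝 (U p))) :
    Tendsto (fun n => ∫⁻ p, ‖cutG Z g g' (Un n) (Dn n) p - cutG Z g g' U D p‖ₑ ^ 2)
      atTop (𝓝 0) := by
  obtain ⟨M, hM⟩ := hZ.exists_bound
  have hM0 : 0 ≤ M := (norm_nonneg _).trans (hM 0)
  have hL := hg.nonneg
  have mZ := hZ.smooth.continuous.aestronglyMeasurable (μ := (volume : Measure (ℝ × Ed d)))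
  have mZ' := (continuous_gradx hZ.contDiff_one).aestronglyMeasurable (μ := volume)
  have mg := hg.continuous.comp_aestronglyMeasurable hU
  have mg' := hg.cont.comp_aestronglyMeasurable hU
  have mgn := fun n => hg.continuous.comp_aestronglyMeasurable (hUn n)
  have mgn' := fun n => hg.cont.comp_aestronglyMeasurable (hUn n)
  let T1 : ℕ → ℝ × Ed d → Ed d := fun n p => (g (Un n p) - g (U p)) • gradx Z p
  let T2 : ℕ → ℝ × Ed d → Ed d := fun n p => (Z p * g' (Un n p)) • (Dn n p - D p)
  let T3 : ℕ → ℝ × Ed d → Ed d := fun n p => (Z p * (g' (Un n p) - g' (U p))) • D p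
  have m1 : ∀ n, AEStronglyMeasurable (T1 n) := fun n => ((mgn n).sub mg).smul mZ'
  have m2 : ∀ n, AEStronglyMeasurable (T2 n) := fun n =>
    (mZ.mul (mgn' n)).smul ((hDn n).sub hD.1)
  have m3 : ∀ n, AEStronglyMeasurable (T3 n) := fun n =>
    (mZ.mul ((mgn' n).sub mg')).smul hD.1
  have b1 : Tendsto (fun n => ∫⁻ p, ‖T1 n p‖ₑ ^ 2) atTop (𝓝 0) := by
    have hb := ENNReal.Tendsto.const_mul (a := ENNReal.ofReal ((L * M) ^ 2)) h1 (by simp)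
    rw [mul_zero] at hb
    refine tendsto_of_tendsto_of_tendsto_of_le_of_le tendsto_const_nhds hb (fun _ => zero_le)
      fun n => ?_
    dsimp only
    rw [← lintegral_const_mul' _ _ (by simp)]
    refine lintegral_mono fun p => ?_
    have : ‖T1 n p‖ ≤ (L * M) * ‖Un n p - U p‖ := by
      simp only [T1, norm_smul, Real.norm_eq_abs]
      calc _ ≤ L * |Un n p - U p| * M :=
            mul_le_mul (hg.abs_sub_le _ _) (hM p) (norm_nonneg _) (by positivity)
        _ = _ := by ring
    rw [← ofReal_norm, ← ofReal_norm, ← ENNReal.ofReal_pow (norm_nonneg _),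
      ← ENNReal.ofReal_pow (norm_nonneg _), ← ENNReal.ofReal_mul (by positivity), ← mul_pow]
    gcongr
  have b2 : Tendsto (fun n => ∫⁻ p, ‖T2 n p‖ₑ ^ 2) atTop (𝓝 0) := by
    have hb := ENNReal.Tendsto.const_mul (a := ENNReal.ofReal (L ^ 2)) h2 (by simp)
    rw [mul_zero] at hb
    refine tendsto_of_tendsto_of_tendsto_of_le_of_le tendsto_const_nhds hb (fun _ => zero_le)
      fun n => ?_
    dsimp only
    rw [← lintegral_const_mul' _ _ (by simp)]
    refine lintegral_mono fun p => enorm_smul_sq_le ?_ _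
    rw [abs_mul]
    calc |Z p| * |g' (Un n p)| ≤ 1 * L :=
          mul_le_mul (hZ.abs_le_one p) (hg.bound _) (abs_nonneg _) zero_le_one
      _ = L := one_mul L
  have b3 : Tendsto (fun n => ∫⁻ p, ‖T3 n p‖ₑ ^ 2) atTop (𝓝 0) := by
    have : Tendsto (fun n => ∫⁻ p, ‖T3 n p‖ₑ ^ 2) atTop
        (𝓝 (∫⁻ _ : ℝ × Ed d, 0)) := by
      refine tendsto_lintegral_of_dominated_convergence'
        (fun p => ENNReal.ofReal ((2 * L) ^ 2) * ‖D p‖ₑ ^ 2) (fun n => (m3 n).enorm.pow_const 2)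
        (fun n => Eventually.of_forall fun p => enorm_smul_sq_le ?_ _) ?_ ?_
      · rw [abs_mul]
        have e1 := hg.bound (Un n p)
        have e2 := hg.bound (U p)
        have e3 : |g' (Un n p) - g' (U p)| ≤ 2 * L := by
          rw [abs_le] at *; constructor <;> linarith
        calc _ ≤ 1 * (2 * L) :=
              mul_le_mul (hZ.abs_le_one p) e3 (abs_nonneg _) zero_le_one
          _ = 2 * L := one_mul _
      · rw [lintegral_const_mul' _ _ (by simp)]
        exact (ENNReal.mul_lt_top (by simp) hD.lintegral_enorm_sq_lt_top).ne
      · filter_upwards [h3] with p hp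
        have e1 := (hg.cont.tendsto (U p)).comp hp
        have e2 : Tendsto (fun n => (Z p * (g' (Un n p) - g' (U p))) • D p) atTop (𝓝 0) := by
          have := ((e1.sub_const (g' (U p))).const_mul (Z p)).smul_const (D p)
          simpa using this
        have e3 := (ENNReal.continuous_pow 2).tendsto _ |>.comp e2.enorm
        simpa [Function.comp_def, T3] using e3
    simpa using this
  have hb := ENNReal.Tendsto.const_mul (a := 2)
    ((ENNReal.Tendsto.const_mul (a := 2) (b1.add b2) (by simp)).add b3) (by simp)
  simp only [add_zero, mul_zero] at hb
  refine tendsto_of_tendsto_of_tendsto_of_le_of_le tendsto_const_nhds hb (fun _ => zero_le)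
    fun n => ?_
  calc ∫⁻ p, ‖cutG Z g g' (Un n) (Dn n) p - cutG Z g g' U D p‖ₑ ^ 2
      = ∫⁻ p, ‖(T1 n p + T2 n p) + T3 n p‖ₑ ^ 2 := by
        congr 1; ext p; congr 2
        simp only [cutG, T1, T2, T3]
        module
    _ ≤ 2 * ((∫⁻ p, ‖T1 n p + T2 n p‖ₑ ^ 2) + ∫⁻ p, ‖T3 n p‖ₑ ^ 2) :=
        lintegral_enorm_add_sq_le ((m1 n).add (m2 n))
    _ ≤ _ := by
        gcongr
        exact lintegral_enorm_add_sq_le (m1 n)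

end CutFlux

section Limits

lemma exists_subseq_ae_tendsto {α : Type*} [MeasurableSpace α] {μ : Measure α} {F : Type*}
    [NormedAddCommGroup F] {f : ℕ → α → F} {g : α → F} (hf : ∀ n, AEStronglyMeasurable (f n) μ)
    (hg : AEStronglyMeasurable g μ)
    (h : Tendsto (fun n => ∫⁻ p, ‖f n p - g p‖ₑ ^ 2 ∂μ) atTop (𝓝 0)) :
    ∃ k : ℕ → ℕ, StrictMono k ∧ ∀ᵐ p ∂μ, Tendsto (fun n => f (k n) p) atTop (𝓝 (g p)) := by
  have h2 : ∀ m : ℕ, ∀ᶠ n in atTop, ∫⁻ p, ‖f n p - g p‖ₑ ^ 2 ∂μ ≤ 2⁻¹ ^ m := fun m =>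
    h.eventually_le_const (ENNReal.pow_pos (by simp) m)
  obtain ⟨k, hk, hk2⟩ := extraction_forall_of_eventually h2
  refine ⟨k, hk, ?_⟩
  filter_upwards [ae_tendsto_zero_of_lintegral_le
    (fun n => (((hf (k n)).sub hg).enorm.pow_const 2)) hk2] with p hp
  exact tendsto_of_enorm_sq_sub hp

variable {s : ℝ} {f : ℕ → ℝ × Ed d → ℝ} {ψ : ℝ × Ed d → ℝ} {Γ : ℝ × Ed d → Ed d}

lemma jumpE_lt_top_of_tendsto (hC : nearC d s ≠ ∞) (hf : ∀ n, ContDiff ℝ 1 (f n))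
    (hΓ : MemLp Γ 2)
    (hlim : Tendsto (fun n => ∫⁻ p, ‖gradx (f n) p - Γ p‖ₑ ^ 2) atTop (𝓝 0))
    (hae : ∀ᵐ p, Tendsto (fun n => f n p) atTop (𝓝 (ψ p))) : jumpE s ψ < ∞ := by
  refine (jumpE_le_of_tendsto hC (fun n => (hf n).continuous.measurable)
    (fun n t => contDiff_slice (hf n) t) hae (M := 2 * (1 + ∫⁻ p, ‖Γ p‖ₑ ^ 2)) ?_).trans_lt ?_
  · filter_upwards [hlim.eventually_le_const zero_lt_one] with n hn
    rw [lintegral_fderiv_slice (hf n)]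
    have h1 := lintegral_enorm_add_sq_le (f := fun p => gradx (f n) p - Γ p) (g := Γ)
      ((continuous_gradx (hf n)).aestronglyMeasurable.sub hΓ.1)
    simp only [sub_add_cancel] at h1
    refine h1.trans ?_
    gcongr
  · exact ENNReal.mul_lt_top hC.lt_top (ENNReal.mul_lt_top (by simp)
      (ENNReal.add_lt_top.2 ⟨by simp, hΓ.lintegral_enorm_sq_lt_top⟩))

lemma tendsto_jumpE_sub (hC : nearC d s ≠ ∞) (hf : ∀ n, ContDiff ℝ 1 (f n)) (hΓ : MemLp Γ 2)
    (hlim : Tendsto (fun n => ∫⁻ p, ‖gradx (f n) p - Γ p‖ₑ ^ 2) atTop (𝓝 0))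
    (hae : ∀ᵐ p, Tendsto (fun n => f n p) atTop (𝓝 (ψ p))) :
    Tendsto (fun n => jumpE s fun p => f n p - ψ p) atTop (𝓝 0) := by
  have h2 : ∀ n : ℕ, (0 : ℝ≥0∞) < 2⁻¹ ^ n := fun n => ENNReal.pow_pos (by simp) n
  have hb : ∀ n, jumpE s (fun p => f n p - ψ p) ≤
      nearC d s * (2 * ((∫⁻ p, ‖gradx (f n) p - Γ p‖ₑ ^ 2) + 2⁻¹ ^ n)) := by
    intro n
    refine jumpE_le_of_tendsto hC (f := fun m p => f n p - f m p)
      (fun m => ((hf n).sub (hf m)).continuous.measurable)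
      (fun m t => contDiff_slice ((hf n).sub (hf m)) t) ?_ ?_
    · filter_upwards [hae] with p hp
      exact hp.const_sub _
    · filter_upwards [hlim.eventually_le_const (h2 n)] with m hm
      rw [lintegral_fderiv_slice (f := fun p => f n p - f m p) ((hf n).sub (hf m))]
      have h1 := lintegral_enorm_add_sq_le (μ := volume) (f := fun p => gradx (f n) p - Γ p)
        (g := fun p => -(gradx (f m) p - Γ p))
        ((continuous_gradx (hf n)).aestronglyMeasurable.sub hΓ.1)
      simp only [enorm_neg] at h1
      refine le_trans (le_of_eq ?_) (h1.trans (by gcongr))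
      congr 1; ext p
      rw [gradx_sub ((hf n).differentiable one_ne_zero) ((hf m).differentiable one_ne_zero)]
      congr 2
      abel
  refine tendsto_of_tendsto_of_tendsto_of_le_of_le tendsto_const_nhds ?_ (fun _ => zero_le) hb
  have h5 : Tendsto (fun k : ℕ => (2 : ℝ≥0∞)⁻¹ ^ k) atTop (𝓝 0) :=
    ENNReal.tendsto_pow_atTop_nhds_zero_of_lt_one (by simp)
  have := ENNReal.Tendsto.const_mul (a := nearC d s)
    (ENNReal.Tendsto.const_mul (a := 2) (hlim.add h5) (by simp)) (by simp [hC])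
  simpa using this

end Limits

section MollifiedTest

variable {F : Type*} [NormedAddCommGroup F] [InnerProductSpace ℝ F]
  {G : Type*} [NormedAddCommGroup G] [NormedSpace ℝ G] [FiniteDimensional ℝ G]
  [MeasurableSpace G] [BorelSpace G] {μ : Measure G} [μ.IsAddHaarMeasure]

lemma IsMollifier.mol_sub {ε : ℝ} {ρ : G → ℝ} (h : IsMollifier μ ε ρ) {f g : G → F}
    (hf : LocallyIntegrable f μ) (hg : LocallyIntegrable g μ) (p : G) :
    mol μ ρ (fun z => f z - g z) p = mol μ ρ f p - mol μ ρ g p := by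
  simp only [mol, smul_sub]
  exact integral_sub (integrable_kernel_smul h.continuous h.hasCompactSupport hf p)
    (integrable_kernel_smul h.continuous h.hasCompactSupport hg p)

lemma IsMollifier.aestronglyMeasurable_mol {ε : ℝ} {ρ : G → ℝ} (h : IsMollifier μ ε ρ)
    {f : G → F} (hf : LocallyIntegrable f μ) : AEStronglyMeasurable (mol μ ρ f) μ := by
  rw [mol_eq_convolution]
  exact (h.hasCompactSupport.continuous_convolution_left _ h.continuous
    hf).aestronglyMeasurable

lemma tendsto_mol_of_tendsto [CompleteSpace F] {e : ℕ → ℝ} {ρ : ℕ → G → ℝ}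
    (he : Tendsto e atTop (𝓝 0))
    (hρ : ∀ n, IsMollifier μ (e n) (ρ n)) {f : ℕ → G → F} {g : G → F}
    (hf : ∀ n, MemLp (f n) 2 μ) (hg : MemLp g 2 μ)
    (h : Tendsto (fun n => ∫⁻ p, ‖f n p - g p‖ₑ ^ 2 ∂μ) atTop (𝓝 0)) :
    Tendsto (fun n => ∫⁻ p, ‖mol μ (ρ n) (f n) p - g p‖ₑ ^ 2 ∂μ) atTop (𝓝 0) := by
  have hgl := hg.locallyIntegrable (by norm_num)
  have hfl := fun n => (hf n).locallyIntegrable (by norm_num)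
  have h1 : Tendsto (fun n => ∫⁻ p, ‖mol μ (ρ n) g p - g p‖ₑ ^ 2 ∂μ) atTop (𝓝 0) := by
    rw [ENNReal.tendsto_nhds_zero]
    intro η hη
    obtain ⟨ε₀, h0, h1⟩ := exists_mollifier_radius hg hη
    filter_upwards [he.eventually_le_const h0] with n hn
    exact h1 _ hn _ (hρ n)
  have hb := ENNReal.Tendsto.const_mul (a := 2) (h.add h1) (by simp)
  simp only [add_zero, mul_zero] at hb
  refine tendsto_of_tendsto_of_tendsto_of_le_of_le tendsto_const_nhds hb (fun _ => zero_le)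
    fun n => ?_
  have h2 := lintegral_enorm_add_sq_le (μ := μ) (f := fun p => mol μ (ρ n) (fun z => f n z - g z) p)
    (g := fun p => mol μ (ρ n) g p - g p) ((hρ n).aestronglyMeasurable_mol ((hfl n).sub hgl))
  have h3 := (hρ n).lintegral_mol_sq_le ((hfl n).sub hgl)
  calc _ = ∫⁻ p, ‖mol μ (ρ n) (fun z => f n z - g z) p + (mol μ (ρ n) g p - g p)‖ₑ ^ 2 ∂μ := by
        congr 1; ext p
        rw [(hρ n).mol_sub (hfl n) hgl]
        congr 2
        abel
    _ ≤ _ := h2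
    _ ≤ _ := by
      exact mul_le_mul_right (add_le_add_left h3 _) 2

lemma IsMollifier.gradx_mol {ε : ℝ} {ρ : ℝ × Ed d → ℝ} (h : IsMollifier volume ε ρ)
    {f : ℝ × Ed d → ℝ} (hf : ContDiff ℝ 1 f) (hf' : HasCompactSupport f) (p : ℝ × Ed d) :
    gradx (mol volume ρ f) p = mol volume ρ (gradx f) p := by
  refine gradx_eq_of_inner fun v => ?_
  have i2 := integrable_kernel_smul h.continuous h.hasCompactSupport
    ((continuous_gradx hf).locallyIntegrable (μ := volume)) p
  rw [h.fderiv_mol_of_contDiff hf hf', mol, mol, real_inner_comm, ← integral_inner i2 v]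
  congr 1; ext z
  rw [real_inner_comm, real_inner_smul_left, inner_gradx, smul_eq_mul]

lemma IsMollifier.integral_mul_fderiv_mol {ε : ℝ} {ρ : ℝ × Ed d → ℝ}
    (h : IsMollifier volume ε ρ) {U Z : ℝ × Ed d → ℝ} (hU : MemLp U 2) (hZ : IsSmoothCut Z)
    {g g' Ψ : ℝ → ℝ} {L : ℝ} (hg : IsLipC1 g g' L) (hΨ : ∀ v, HasDerivAt Ψ (g v) v)
    (v : ℝ × Ed d) :
    ∫ p, U p * fderiv ℝ (mol volume ρ fun z => Z z * g (mol volume ρ U z)) p v =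
      ∫ p, fderiv ℝ Z p v * Ψ (mol volume ρ U p) := by
  set W := mol volume ρ U with hW
  have hW1 : ContDiff ℝ 1 W := (h.contDiff_mol (hU.locallyIntegrable (by norm_num))).of_le (by simp)
  have hZ1 := hZ.contDiff_one
  set ψ : ℝ × Ed d → ℝ := fun z => Z z * g (W z) with hψ
  have hψ1 : ContDiff ℝ 1 ψ := hZ1.mul (hg.contDiff.comp hW1)
  have hψc : HasCompactSupport ψ := hZ.supp.mul_right
  have hΨ1 : ContDiff ℝ 1 Ψ := by
    rw [contDiff_one_iff_deriv]
    refine ⟨fun v => (hΨ v).differentiableAt, ?_⟩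
    rw [show _root_.deriv Ψ = g from funext fun v => (hΨ v).deriv]
    exact hg.continuous
  have cZ := hZ1.continuous
  have cW := hW1.continuous
  have cψ := hψ1.continuous
  have dW : Continuous fun p => fderiv ℝ W p v :=
    (hW1.continuous_fderiv one_ne_zero).clm_apply continuous_const
  have dZ : Continuous fun p => fderiv ℝ Z p v :=
    (hZ1.continuous_fderiv one_ne_zero).clm_apply continuous_const
  have dψ : Continuous fun p => fderiv ℝ ψ p v :=
    (hψ1.continuous_fderiv one_ne_zero).clm_apply continuous_const
  have sZ : HasCompactSupport fun p => fderiv ℝ Z p v := hZ.supp.fderiv_apply ℝ v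
  have sψ : HasCompactSupport fun p => fderiv ℝ ψ p v := hψc.fderiv_apply ℝ v
  have hV1 : ContDiff ℝ 1 fun p => Ψ (W p) := hΨ1.comp hW1
  have dV : ∀ p, fderiv ℝ (fun p => Ψ (W p)) p v = g (W p) * fderiv ℝ W p v := by
    intro p
    have := ((hΨ (W p)).comp_hasFDerivAt p
      ((hW1.differentiable one_ne_zero) p).hasFDerivAt).fderiv
    rw [show fderiv ℝ (fun p => Ψ (W p)) p = _ from this]
    simp
  have e1 : ∀ p, fderiv ℝ (mol volume ρ ψ) p v = mol volume ρ (fun z => fderiv ℝ ψ z v) p :=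
    fun p => h.fderiv_mol_of_contDiff hψ1 hψc p v
  simp_rw [e1]
  rw [h.integral_mul_mol (dψ.memLp_of_hasCompactSupport sψ) hU, ← hW]
  have e2 := integral_mul_fderiv_eq_neg_fderiv_mul_of_integrable (μ := volume) (f := W) (g := ψ)
    (v := v) ((dW.mul cψ).integrable_of_hasCompactSupport hψc.mul_left)
    ((cW.mul dψ).integrable_of_hasCompactSupport sψ.mul_left)
    ((cW.mul cψ).integrable_of_hasCompactSupport hψc.mul_left)
    (fun x _ => (hW1.differentiable one_ne_zero) x)
    (fun x _ => (hψ1.differentiable one_ne_zero) x)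
  have e3 := integral_mul_fderiv_eq_neg_fderiv_mul_of_integrable (μ := volume) (f := Z)
    (g := fun p => Ψ (W p)) (v := v)
    ((dZ.mul hV1.continuous).integrable_of_hasCompactSupport sZ.mul_right)
    ((cZ.mul ((hV1.continuous_fderiv one_ne_zero).clm_apply
      continuous_const)).integrable_of_hasCompactSupport hZ.supp.mul_right)
    ((cZ.mul hV1.continuous).integrable_of_hasCompactSupport hZ.supp.mul_right)
    (fun x _ => (hZ1.differentiable one_ne_zero) x)
    (fun x _ => (hV1.differentiable one_ne_zero) x)
  rw [e2, ← neg_eq_iff_eq_neg.2 e3.symm.symm]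
  congr 2; ext p
  rw [dV, hψ]
  ring

end MollifiedTest

section GradientOfCut

variable {s Λ : ℝ} {K : ℝ → Ed d → Ed d → ℝ} {ν : Measure (ℝ × Ed d)}
  {t₀ : ℝ} {x₀ : Ed d} {R : ℝ} {u : ℝ × Ed d → ℝ} {Du a : ℝ × Ed d → Ed d}

lemma CylSol.gradx_cut (h : CylSol s Λ K ν t₀ x₀ R u Du a) {ε : ℝ} {ρ : ℝ × Ed d → ℝ}
    (hρ : IsMollifier volume ε ρ) {Z : ℝ × Ed d → ℝ} (hZ : IsSmoothCut Z)
    (hin : ∀ p, Z p ≠ 0 → closedBall p ε ⊆ pCyl t₀ x₀ R) {g g' : ℝ → ℝ} {L : ℝ}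
    (hg : IsLipC1 g g' L) (p : ℝ × Ed d) :
    gradx (fun p => Z p * g (mol volume ρ (cutU t₀ x₀ R u) p)) p =
      cutG Z g g' (mol volume ρ (cutU t₀ x₀ R u)) (mol volume ρ (cutU t₀ x₀ R Du)) p := by
  have hW1 := hρ.contDiff_mol (h.memLp_cutU.locallyIntegrable (by norm_num))
  rw [gradx_mul_comp (g' := g') (hZ.contDiff_one.differentiable one_ne_zero p)
    (hW1.differentiable (by simp) p) (hg.deriv _), cutG]
  by_cases hp : Z p = 0
  · simp [hp]
  · rw [gradx_eq_of_inner fun v => h.fderiv_mol_eq hρ (hin p hp) v]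

end GradientOfCut

section Cutoffs

open scoped Manifold in
lemma exists_smooth_cutoff {E : Type*} [NormedAddCommGroup E] [NormedSpace ℝ E]
    [FiniteDimensional ℝ E] {C V : Set E} (hC : IsCompact C) (hV : IsOpen V) (h : C ⊆ V) :
    ∃ f : E → ℝ, ContDiff ℝ (⊤ : ℕ∞) f ∧ HasCompactSupport f ∧ (∀ p, 0 ≤ f p) ∧
      (∀ p, f p ≤ 1) ∧ (∀ p ∈ C, f p = 1) ∧ tsupport f ⊆ V := by
  obtain ⟨δ, hδ, hδV⟩ := hC.exists_cthickening_subset_open hV h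
  have hsub : C ⊆ interior (cthickening δ C) :=
    (self_subset_thickening hδ C).trans
      (interior_maximal (thickening_subset_cthickening δ C) isOpen_thickening)
  obtain ⟨f, h1, h2, h3⟩ := exists_contMDiffMap_one_nhds_of_subset_interior (n := (⊤ : ℕ∞))
    (I := 𝓘(ℝ, E)) hC.isClosed hsub
  have h4 : tsupport f ⊆ cthickening δ C :=
    closure_minimal (fun x hx => by by_contra hc; exact hx (h2 x hc)) isClosed_cthickening
  refine ⟨f, f.contMDiff.contDiff, ?_, fun p => (h3 p).1, fun p => (h3 p).2,
    fun p hp => h1.self_of_nhdsSet p hp, h4.trans hδV⟩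
  exact HasCompactSupport.of_support_subset_isCompact hC.cthickening
    ((subset_tsupport f).trans h4)

lemma IsMolSeq.exists_le {f : ℝ × Ed d → ℝ} {g : ℝ × Ed d → Ed d} {e : ℕ → ℝ}
    {ρ : ℕ → ℝ × Ed d → ℝ} (h : IsMolSeq f g e ρ) {δ : ℝ} (hδ : 0 < δ) :
    ∃ e' ρ', IsMolSeq f g e' ρ' ∧ ∀ n, e' n ≤ δ := by
  obtain ⟨N, hN⟩ := eventually_atTop.1 (h.lim.eventually_le_const hδ)
  have hp : ∀ n : ℕ, (2 : ℝ≥0∞)⁻¹ ^ (n + N) ≤ 2⁻¹ ^ n := fun n =>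
    pow_le_pow_of_le_one zero_le (by simp) (by omega)
  refine ⟨fun n => e (n + N), fun n => ρ (n + N), ⟨fun n => h.pos _,
    h.lim.comp (tendsto_add_atTop_nat N), fun n => h.isMol _, fun n => (h.convf _).trans (hp n),
    fun n => (h.convg _).trans (hp n)⟩, fun n => hN _ (by omega)⟩

lemma IsMolSeq.tendsto_f {f : ℝ × Ed d → ℝ} {g : ℝ × Ed d → Ed d} {e : ℕ → ℝ}
    {ρ : ℕ → ℝ × Ed d → ℝ} (h : IsMolSeq f g e ρ) :
    Tendsto (fun n => ∫⁻ p, ‖mol volume (ρ n) f p - f p‖ₑ ^ 2) atTop (𝓝 0) :=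
  tendsto_of_tendsto_of_tendsto_of_le_of_le tendsto_const_nhds
    (ENNReal.tendsto_pow_atTop_nhds_zero_of_lt_one (by simp)) (fun _ => zero_le) h.convf

lemma IsMolSeq.tendsto_g {f : ℝ × Ed d → ℝ} {g : ℝ × Ed d → Ed d} {e : ℕ → ℝ}
    {ρ : ℕ → ℝ × Ed d → ℝ} (h : IsMolSeq f g e ρ) :
    Tendsto (fun n => ∫⁻ p, ‖mol volume (ρ n) g p - g p‖ₑ ^ 2) atTop (𝓝 0) :=
  tendsto_of_tendsto_of_tendsto_of_le_of_le tendsto_const_nhds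
    (ENNReal.tendsto_pow_atTop_nhds_zero_of_lt_one (by simp)) (fun _ => zero_le) h.convg

lemma IsMolSeq.ae_tendsto {f : ℝ × Ed d → ℝ} {g : ℝ × Ed d → Ed d} {e : ℕ → ℝ}
    {ρ : ℕ → ℝ × Ed d → ℝ} (h : IsMolSeq f g e ρ) (hf : MemLp f 2) :
    ∀ᵐ p, Tendsto (fun n => mol volume (ρ n) f p) atTop (𝓝 (f p)) := by
  filter_upwards [ae_tendsto_zero_of_lintegral_le (fun n =>
    ((((h.isMol n).aestronglyMeasurable_mol (hf.locallyIntegrable (by norm_num))).sub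
      hf.1).enorm.pow_const 2)) h.convf] with p hp
  exact tendsto_of_enorm_sq_sub hp

end Cutoffs

section LocalEnergy

variable {s Λ : ℝ} {K : ℝ → Ed d → Ed d → ℝ} {ν : Measure (ℝ × Ed d)}
  {t₀ : ℝ} {x₀ : Ed d} {R : ℝ} {u : ℝ × Ed d → ℝ} {Du a : ℝ × Ed d → Ed d}
  {g g' : ℝ → ℝ} {L : ℝ} {Z : ℝ × Ed d → ℝ}

/-- Gradients of mollified truncations converge in `L²`. -/
lemma CylSol.tendsto_gradx_cut (h : CylSol s Λ K ν t₀ x₀ R u Du a) {e : ℕ → ℝ}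
    {ρ : ℕ → ℝ × Ed d → ℝ} (hm : IsMolSeq (cutU t₀ x₀ R u) (cutU t₀ x₀ R Du) e ρ)
    (hZ : IsSmoothCut Z) (hin : ∀ n p, Z p ≠ 0 → closedBall p (e n) ⊆ pCyl t₀ x₀ R)
    (hg : IsLipC1 g g' L) :
    Tendsto (fun n => ∫⁻ p, ‖gradx (fun p => Z p * g (mol volume (ρ n) (cutU t₀ x₀ R u) p)) p -
      cutG Z g g' (cutU t₀ x₀ R u) (cutU t₀ x₀ R Du) p‖ₑ ^ 2) atTop (𝓝 0) := by
  simp_rw [fun n p => h.gradx_cut (hm.isMol n) hZ (hin n) hg p]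
  exact tendsto_cutG hZ hg h.memLp_cutU.1 h.memLp_cutD
    (fun n => (hm.isMol n).aestronglyMeasurable_mol (h.memLp_cutU.locallyIntegrable (by norm_num)))
    (fun n => (hm.isMol n).aestronglyMeasurable_mol (h.memLp_cutD.locallyIntegrable (by norm_num)))
    hm.tendsto_f hm.tendsto_g (hm.ae_tendsto h.memLp_cutU)

lemma CylSol.contDiff_cut (h : CylSol s Λ K ν t₀ x₀ R u Du a) {ε : ℝ} {ρ : ℝ × Ed d → ℝ}
    (hρ : IsMollifier volume ε ρ) (hZ : IsSmoothCut Z) (hg : IsLipC1 g g' L) :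
    ContDiff ℝ 1 fun p => Z p * g (mol volume ρ (cutU t₀ x₀ R u) p) :=
  hZ.contDiff_one.mul (hg.contDiff.comp
    ((hρ.contDiff_mol (h.memLp_cutU.locallyIntegrable (by norm_num))).of_le (by simp)))

lemma CylSol.jumpE_cut_lt_top (h : CylSol s Λ K ν t₀ x₀ R u Du a) (hC : nearC d s ≠ ∞)
    (hZ : IsSmoothCut Z) (hZR : tsupport Z ⊆ pCyl t₀ x₀ R) (hg : IsLipC1 g g' L) :
    jumpE s (fun p => Z p * g (cutU t₀ x₀ R u p)) < ∞ := by
  obtain ⟨δ, hδ, hδV⟩ := hZ.supp.isCompact.exists_cthickening_subset_open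
    (isOpen_pCyl t₀ x₀ R) hZR
  obtain ⟨e, ρ, hm0⟩ := exists_isMolSeq h.memLp_cutU h.memLp_cutD
  obtain ⟨e, ρ, hm, he⟩ := hm0.exists_le hδ
  have hin : ∀ n p, Z p ≠ 0 → closedBall p (e n) ⊆ pCyl t₀ x₀ R := fun n p hp =>
    (closedBall_subset_closedBall (he n)).trans
      ((closedBall_subset_cthickening (subset_tsupport Z hp) δ).trans hδV)
  refine jumpE_lt_top_of_tendsto hC (fun n => h.contDiff_cut (hm.isMol n) hZ hg)
    (memLp_cutG hZ hg h.memLp_cutU h.memLp_cutD) (h.tendsto_gradx_cut hm hZ hin hg) ?_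
  filter_upwards [hm.ae_tendsto h.memLp_cutU] with p hp
  exact ((hg.continuous.tendsto _).comp hp).const_mul (Z p)

lemma CylSol.integrableOn_u (h : CylSol s Λ K ν t₀ x₀ R u Du a) :
    IntegrableOn u (pCyl t₀ x₀ R) := by
  have hfin : volume (pCyl t₀ x₀ R) < ∞ := by
    rw [pCyl, Iminus, Measure.volume_eq_prod, Measure.prod_prod]
    exact ENNReal.mul_lt_top (by simp) measure_ball_lt_top
  have : IsFiniteMeasure (volume.restrict (pCyl t₀ x₀ R)) := ⟨by simpa using hfin⟩
  exact h.memLp_u.integrable (by norm_num)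

lemma CylSol.jumpAdm (h : CylSol s Λ K ν t₀ x₀ R u Du a) (hC : nearC d s ≠ ∞)
    (hK : KernelHyp d s Λ K) (hΛ : 1 ≤ Λ) (hs : 0 < s) {r r₂ t₁ t₂ : ℝ} (h1 : t₀ - r ^ 2 < t₁)
    (h2 : t₂ < t₀) (hr2 : 0 ≤ r₂) (hr : r₂ < r) (hr1 : r ≤ 1) (hrR : r < R) :
    ∃ w, JumpAdm s Λ K u w (Icc t₁ t₂) x₀ r₂ r := by
  have hrr : r ^ 2 ≤ R ^ 2 := by nlinarith
  have hJ : Icc t₁ t₂ ⊆ Iminus t₀ R := fun t ht => ⟨by linarith [ht.1], ht.2.trans_lt h2⟩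
  obtain ⟨ζ, z1, z2, z3, z4, z5, z6⟩ := exists_smooth_cutoff
    (isCompact_Icc.prod (isCompact_closedBall x₀ r)) (isOpen_pCyl t₀ x₀ R)
    (prod_mono hJ (closedBall_subset_ball hrR))
  have hζ : IsSmoothCut ζ := ⟨z1, z2, z3, z4⟩
  have hE : jumpE s (fun p => ζ p * cutU t₀ x₀ R u p) < ∞ :=
    h.jumpE_cut_lt_top (g := fun v => v) (g' := fun _ => 1) hC hζ z6 IsLipC1.id
  refine ⟨fun p => ζ p * cutU t₀ x₀ R u p, hK, hΛ, hs, h.meas_u, ?_, measurableSet_Icc, hr2, hr,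
    hr1, ?_, hE, ?_⟩
  · exact z1.continuous.measurable.mul (h.meas_u.indicator (measurableSet_pCyl _ _ _))
  · intro t ht x hx
    rw [z5 (t, x) ⟨ht, ball_subset_closedBall hx⟩, one_mul, cutU, indicator_of_mem]
    exact ⟨hJ ht, ball_subset_ball hrR.le hx⟩
  · refine lintegral_farH_lt_top hs h.meas_u measure_closedBall_lt_top
      (h.integrableOn_u.mono_set (prod_mono hJ (closedBall_subset_ball (hr.trans hrR))))
      (h.tail.mono_set (prod_mono hJ subset_rfl))

end LocalEnergy

section Energy

variable {s Λ : ℝ} {K : ℝ → Ed d → Ed d → ℝ} {ν : Measure (ℝ × Ed d)}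
  {t₀ : ℝ} {x₀ : Ed d} {R : ℝ} {u : ℝ × Ed d → ℝ} {Du a : ℝ × Ed d → Ed d}
  {g g' Ψ : ℝ → ℝ} {L : ℝ} {Z : ℝ × Ed d → ℝ}

lemma integral_triple {f : ℝ × Ed d × Ed d → ℝ} (hf : Integrable f) :
    ∫ z, f z = ∫ t, ∫ x, ∫ y, f (t, x, y) := by
  rw [Measure.volume_eq_prod] at hf ⊢
  rw [integral_prod _ hf]
  refine integral_congr_ae ?_
  filter_upwards [hf.prod_right_ae] with t ht
  rw [Measure.volume_eq_prod] at ht ⊢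
  exact integral_prod (fun w : Ed d × Ed d => f (t, w)) ht

/-- A test function supported well inside the cylinder gives an inequality between integrals. -/
lemma CylSol.weak_le (h : CylSol s Λ K ν t₀ x₀ R u Du a) [IsFiniteMeasure ν]
    {φ : ℝ × Ed d → ℝ} (hφ : ContDiff ℝ (⊤ : ℕ∞) φ) {t₁ t₂ r₂ r : ℝ}
    (hφ0 : ∀ p, p ∉ Icc t₁ t₂ ×ˢ closedBall x₀ r₂ → φ p = 0) (hφ1 : ∀ p, |φ p| ≤ 1)
    (h1 : t₀ - r ^ 2 < t₁) (h2 : t₂ < t₀) (hr2 : 0 ≤ r₂) (hr : r₂ < r) (hrR : r < R)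
    (hj : Integrable (jumpI K u φ)) :
    -(∫ p, cutU t₀ x₀ R u p * fderiv ℝ φ p (1, 0)) + (∫ p, ⟪gradx φ p, cutU t₀ x₀ R a p⟫)
      + ∫ z, jumpI K u φ z ≤ (ν (pCyl t₀ x₀ r)).toReal := by
  have hrr : r ^ 2 ≤ R ^ 2 := by nlinarith
  have hC : IsCompact (Icc t₁ t₂ ×ˢ closedBall x₀ r₂) :=
    isCompact_Icc.prod (isCompact_closedBall x₀ r₂)
  have hCr : Icc t₁ t₂ ×ˢ closedBall x₀ r₂ ⊆ pCyl t₀ x₀ r :=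
    prod_mono (fun t ht => ⟨h1.trans_le ht.1, ht.2.trans_lt h2⟩) (closedBall_subset_ball hr)
  have hrS : pCyl t₀ x₀ r ⊆ pCyl t₀ x₀ R :=
    prod_mono (fun t ht => ⟨by linarith [ht.1], ht.2⟩) (ball_subset_ball hrR.le)
  have hts : tsupport φ ⊆ Icc t₁ t₂ ×ˢ closedBall x₀ r₂ :=
    closure_minimal (fun p hp => by by_contra hc; exact hp (hφ0 p hc)) hC.isClosed
  have hcs : HasCompactSupport φ := hC.of_isClosed_subset (isClosed_tsupport φ) hts
  have hw := (abs_le.1 (h.weak φ hφ hcs (hts.trans (hCr.trans hrS)))).2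
  have hz : ∀ p, p ∉ pCyl t₀ x₀ R → fderiv ℝ φ p = 0 := fun p hp =>
    fderiv_of_notMem_tsupport ℝ fun hc => hp (hrS (hCr (hts hc)))
  have e1 : ∫ p, cutU t₀ x₀ R u p * fderiv ℝ φ p (1, 0) = ∫ p, u p * fderiv ℝ φ p (1, 0) := by
    congr 1 with p
    by_cases hp : p ∈ pCyl t₀ x₀ R
    · rw [cutU, indicator_of_mem hp]
    · simp [hz p hp]
  have e2 : ∫ p, ⟪gradx φ p, cutU t₀ x₀ R a p⟫ = ∫ p, fderiv ℝ φ p (0, a p) := by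
    congr 1 with p
    rw [inner_gradx]
    by_cases hp : p ∈ pCyl t₀ x₀ R
    · rw [cutU, indicator_of_mem hp]
    · simp [hz p hp]
  have e3 : ∫ z, jumpI K u φ z = ∫ t, ∫ x, ∫ y,
      (u (t, x) - u (t, y)) * (φ (t, x) - φ (t, y)) * K t x y := integral_triple hj
  have e4 : ∫ p, |φ p| ∂ν ≤ (ν (pCyl t₀ x₀ r)).toReal := by
    rw [← Measure.real, ← integral_indicator_one (measurableSet_pCyl t₀ x₀ r)]
    refine integral_mono_of_nonneg (Eventually.of_forall fun p => abs_nonneg _)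
      ((integrable_const 1).indicator (measurableSet_pCyl t₀ x₀ r))
      (Eventually.of_forall fun p => ?_)
    by_cases hp : p ∈ pCyl t₀ x₀ r
    · simpa [indicator_of_mem hp] using hφ1 p
    · simp [indicator_of_notMem hp, hφ0 p fun hc => hp (hCr hc)]
  rw [e1, e2, e3]
  exact hw.trans e4

lemma memLp_two_of_continuous {F : Type*} [NormedAddCommGroup F] {f : ℝ × Ed d → F}
    (hf : Continuous f) (hc : HasCompactSupport f) : MemLp f 2 :=
  hf.memLp_of_hasCompactSupport hc

/-- The energy identity, tested with a cut-off truncation of the solution. -/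
theorem CylSol.energy (h : CylSol s Λ K ν t₀ x₀ R u Du a) [IsFiniteMeasure ν]
    (hC : nearC d s ≠ ∞) (hK : KernelHyp d s Λ K) (hΛ : 1 ≤ Λ) (hs : 0 < s)
    {r r₁ t₁ t₂ : ℝ} (h1 : t₀ - r ^ 2 < t₁) (h2 : t₂ < t₀) (hr1 : 0 ≤ r₁) (hr : r₁ < r)
    (hr' : r ≤ 1) (hrR : r < R) (hZ : IsSmoothCut Z)
    (hZ0 : ∀ p, p ∉ Icc t₁ t₂ ×ˢ closedBall x₀ r₁ → Z p = 0) (hg : IsLipC1 g g' L)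
    (hg0 : ∀ v, 0 ≤ g v) (hg1 : ∀ v, g v ≤ 1) (hΨ : ∀ v, HasDerivAt Ψ (g v) v)
    (hΨ0 : Ψ 0 = 0) :
    Integrable (jumpI K u fun p => Z p * g (u p)) ∧
    Integrable (fun p => ⟪cutG Z g g' u Du p, a p⟫) ∧
    Integrable (fun p => fderiv ℝ Z p (1, 0) * Ψ (u p)) ∧
    -(∫ p, fderiv ℝ Z p (1, 0) * Ψ (u p)) + (∫ p, ⟪cutG Z g g' u Du p, a p⟫)
      + ∫ z, jumpI K u (fun p => Z p * g (u p)) z ≤ (ν (pCyl t₀ x₀ r)).toReal := by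
  have hrr : r ^ 2 ≤ R ^ 2 := by nlinarith
  set η := min (min ((t₁ - (t₀ - r ^ 2)) / 2) ((t₀ - t₂) / 2)) ((r - r₁) / 2) with hη
  have hη0 : 0 < η := lt_min (lt_min (by linarith) (by linarith)) (by linarith)
  have hηa : η ≤ (t₁ - (t₀ - r ^ 2)) / 2 := (min_le_left _ _).trans (min_le_left _ _)
  have hηb : η ≤ (t₀ - t₂) / 2 := (min_le_left _ _).trans (min_le_right _ _)
  have hηc : η ≤ (r - r₁) / 2 := min_le_right _ _
  have hJs : t₀ - r ^ 2 < t₁ - η := by linarith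
  have hJe : t₂ + η < t₀ := by linarith
  obtain ⟨w, hw⟩ := h.jumpAdm hC hK hΛ hs hJs hJe (r₂ := r₁ + η) (by linarith) (by linarith)
    hr' hrR
  have hCR : Icc t₁ t₂ ×ˢ closedBall x₀ r₁ ⊆ pCyl t₀ x₀ R :=
    prod_mono (fun t ht => ⟨by linarith [ht.1], ht.2.trans_lt h2⟩)
      (closedBall_subset_ball (hr.trans hrR))
  have hsub : ∀ p, Z p ≠ 0 → p ∈ Icc t₁ t₂ ×ˢ closedBall x₀ r₁ := fun p hp => by
    by_contra hc; exact hp (hZ0 p hc)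
  have hts : tsupport Z ⊆ Icc t₁ t₂ ×ˢ closedBall x₀ r₁ :=
    closure_minimal hsub (isClosed_Icc.prod isClosed_closedBall)
  have hnear : ∀ p ∈ Icc t₁ t₂ ×ˢ closedBall x₀ r₁, ∀ z : ℝ × Ed d, ‖z - p‖ ≤ η →
      z ∈ Icc (t₁ - η) (t₂ + η) ×ˢ closedBall x₀ (r₁ + η) := by
    intro p hp z hz
    obtain ⟨⟨a1, a2⟩, a3⟩ := hp
    have b1 := abs_le.1 ((norm_fst_le (z - p)).trans hz)
    have b2 := (norm_snd_le (z - p)).trans hz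
    simp only [Prod.fst_sub, Prod.snd_sub] at b1 b2
    refine ⟨⟨by linarith, by linarith⟩, ?_⟩
    rw [mem_closedBall] at a3 ⊢
    rw [← dist_eq_norm] at b2
    linarith [dist_triangle z.2 p.2 x₀]
  obtain ⟨e, ρ, hm0⟩ := exists_isMolSeq h.memLp_cutU h.memLp_cutD
  obtain ⟨e, ρ, hm, he⟩ := hm0.exists_le hη0
  have hin : ∀ n p, Z p ≠ 0 → closedBall p (e n) ⊆ pCyl t₀ x₀ R := fun n p hp z hz => by
    rw [mem_closedBall, dist_eq_norm] at hz
    obtain ⟨⟨c1, c2⟩, c3⟩ := hnear p (hsub p hp) z (hz.trans (he n))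
    refine ⟨⟨by linarith, by linarith⟩, ?_⟩
    rw [mem_closedBall] at c3
    rw [mem_ball]; linarith
  set U := cutU t₀ x₀ R u with hU
  set ψ : ℝ × Ed d → ℝ := fun p => Z p * g (U p) with hψ
  set ψn : ℕ → ℝ × Ed d → ℝ := fun n p => Z p * g (mol volume (ρ n) U p) with hψn
  set φ : ℕ → ℝ × Ed d → ℝ := fun n => mol volume (ρ n) (ψn n) with hφ
  have hψeq : ψ = fun p => Z p * g (u p) := by
    funext p
    by_cases hp : Z p = 0
    · simp [hψ, hp]
    · simp only [hψ, hU, cutU, indicator_of_mem (hCR (hsub p hp))]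
  have hUl := h.memLp_cutU.locallyIntegrable (by norm_num)
  have hψn1 : ∀ n, ContDiff ℝ 1 (ψn n) := fun n => h.contDiff_cut (hm.isMol n) hZ hg
  have hψnc : ∀ n, HasCompactSupport (ψn n) := fun n => hZ.supp.mul_right
  have hψnL : ∀ n, MemLp (ψn n) 2 := fun n =>
    memLp_two_of_continuous (hψn1 n).continuous (hψnc n)
  have hgL : ∀ n, MemLp (gradx (ψn n)) 2 := fun n =>
    memLp_two_of_continuous (continuous_gradx (hψn1 n)) (hasCompactSupport_gradx (hψnc n))
  have habs : ∀ (V : ℝ × Ed d → ℝ) p, |Z p * g (V p)| ≤ |Z p| := fun V p => by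
    rw [abs_mul, abs_of_nonneg (hg0 (V p))]
    exact mul_le_of_le_one_right (abs_nonneg _) (hg1 _)
  have hφs : ∀ n, ContDiff ℝ (⊤ : ℕ∞) (φ n) := fun n =>
    (hm.isMol n).contDiff_mol ((hψnL n).locallyIntegrable (by norm_num))
  have hφ1 : ∀ n p, |φ n p| ≤ 1 := fun n p =>
    (hm.isMol n).abs_mol_le (fun z => (habs _ z).trans (hZ.abs_le_one z)) p
  have hφ0 : ∀ n p, p ∉ Icc (t₁ - η) (t₂ + η) ×ˢ closedBall x₀ (r₁ + η) → φ n p = 0 := by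
    intro n p hp
    refine (hm.isMol n).mol_eq_zero fun z hz => ?_
    have : Z z = 0 := by
      by_contra hc
      exact hp (hnear z (hsub z hc) p (hz.le.trans (he n)))
    simp [hψn, this]
  have hφc : ∀ n, HasCompactSupport (φ n) := fun n =>
    HasCompactSupport.intro (isCompact_Icc.prod (isCompact_closedBall _ _)) (hφ0 n)
  have hψ0 : ∀ p, p ∉ Icc (t₁ - η) (t₂ + η) ×ˢ closedBall x₀ (r₁ + η) → ψ p = 0 := by
    intro p hp
    have : Z p = 0 := by
      by_contra hc
      exact hp (hnear p (hsub p hc) p (by simpa using hη0.le))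
    simp [hψ, this]
  have hψ1 : ∀ p, |ψ p| ≤ 1 := fun p => (habs _ p).trans (hZ.abs_le_one p)
  have hψm : Measurable ψ := hZ.smooth.continuous.measurable.mul
    (hg.continuous.measurable.comp (h.meas_u.indicator (measurableSet_pCyl _ _ _)))
  have hψL : MemLp ψ 2 :=
    MemLp.of_le (memLp_two_of_continuous hZ.smooth.continuous hZ.supp)
      hψm.aestronglyMeasurable (Eventually.of_forall fun p => habs _ p)
  have hψE : jumpE s ψ < ∞ := h.jumpE_cut_lt_top hC hZ (hts.trans hCR) hg
  -- convergence of the test functions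
  have hGL := memLp_cutG hZ hg h.memLp_cutU h.memLp_cutD
  have hG := h.tendsto_gradx_cut hm hZ hin hg
  have hGφ : Tendsto (fun n => ∫⁻ p, ‖gradx (φ n) p -
      cutG Z g g' U (cutU t₀ x₀ R Du) p‖ₑ ^ 2) atTop (𝓝 0) := by
    refine (tendsto_mol_of_tendsto hm.lim hm.isMol hgL hGL hG).congr fun n => ?_
    exact lintegral_congr fun p => by rw [(hm.isMol n).gradx_mol (hψn1 n) (hψnc n) p]
  have hψlim : Tendsto (fun n => ∫⁻ p, ‖ψn n p - ψ p‖ₑ ^ 2) atTop (𝓝 0) := by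
    have hb := ENNReal.Tendsto.const_mul (a := ENNReal.ofReal L ^ 2) hm.tendsto_f (by simp)
    simp only [mul_zero] at hb
    refine tendsto_of_tendsto_of_tendsto_of_le_of_le tendsto_const_nhds hb (fun _ => zero_le)
      fun n => ?_
    dsimp only
    rw [← lintegral_const_mul' _ _ (by simp)]
    refine lintegral_mono fun p => ?_
    rw [← mul_pow, ← ofReal_norm, ← ofReal_norm, ← ENNReal.ofReal_mul hg.nonneg]
    refine pow_le_pow_left' (ENNReal.ofReal_le_ofReal ?_) 2
    rw [← mul_sub, norm_mul]
    exact (mul_le_of_le_one_left (norm_nonneg _) (hZ.abs_le_one p)).trans (hg.abs_sub_le _ _)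
  have hφlim := tendsto_mol_of_tendsto hm.lim hm.isMol hψnL hψL hψlim
  obtain ⟨k, hk, hkae⟩ := exists_subseq_ae_tendsto
    (fun n => (hφs n).continuous.aestronglyMeasurable) hψm.aestronglyMeasurable hφlim
  have hφE : ∀ n, jumpE s (φ n) < ∞ := fun n => by
    refine jumpE_lt_top_of_tendsto (f := fun _ => φ n) (Γ := gradx (φ n)) hC
      (fun _ => (hφs n).of_le (by simp)) ?_ (by simp) (by simp)
    exact memLp_two_of_continuous (continuous_gradx ((hφs n).of_le (by simp)))
      (hasCompactSupport_gradx (hφc n))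
  have hjlim := hw.tendsto (fun n => (hφs (k n)).continuous.measurable) hψm
    (fun n => hφ0 (k n)) hψ0 (fun n => hφ1 (k n)) hψ1 (fun n => hφE (k n)) hkae
    (tendsto_jumpE_sub hC (fun n => (hφs (k n)).of_le (by simp)) hGL
      (hGφ.comp hk.tendsto_atTop) hkae)
  have hj := hw.integrable hψm hψ0 hψ1 hψE
  have haL := h.memLp_cuta
  have hfl := (tendsto_integral_inner_of_sq
    (fun n => (continuous_gradx ((hφs n).of_le (by simp))).aestronglyMeasurable) hGL
      haL hGφ).comp hk.tendsto_atTop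
  have hΨL : IsLipC1 Ψ g 1 := ⟨hΨ, hg.continuous, fun v => by
    rw [abs_of_nonneg (hg0 v)]; exact hg1 v⟩
  have hΨU : MemLp (fun p => Ψ (U p)) 2 :=
    MemLp.of_le h.memLp_cutU (hΨL.continuous.comp_aestronglyMeasurable h.memLp_cutU.1)
      (Eventually.of_forall fun p => by simpa [hΨ0] using hΨL.abs_sub_le (U p) 0)
  have hZ1 : MemLp (fun p => fderiv ℝ Z p (1, 0)) 2 :=
    memLp_two_of_continuous ((hZ.contDiff_one.continuous_fderiv one_ne_zero).clm_apply
      continuous_const) (hZ.supp.fderiv_apply ℝ _)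
  have htime : Tendsto (fun n => ∫ p, fderiv ℝ Z p (1, 0) * Ψ (mol volume (ρ n) U p)) atTop
      (𝓝 (∫ p, fderiv ℝ Z p (1, 0) * Ψ (U p))) := by
    have := tendsto_integral_inner_of_sq (f := fun n p => Ψ (mol volume (ρ n) U p))
      (fun n => hΨL.continuous.comp_aestronglyMeasurable
        ((hm.isMol n).aestronglyMeasurable_mol hUl)) hΨU hZ1
        (tendsto_of_tendsto_of_tendsto_of_le_of_le tendsto_const_nhds hm.tendsto_f
          (fun _ => zero_le) fun n => lintegral_mono fun p => ?_)
    · simpa [real_inner_eq_re_inner] using this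
    · rw [← ofReal_norm, ← ofReal_norm]
      refine pow_le_pow_left' (ENNReal.ofReal_le_ofReal ?_) 2
      simpa using hΨL.abs_sub_le (mol volume (ρ n) U p) (U p)
  have hineq : ∀ n, -(∫ p, fderiv ℝ Z p (1, 0) * Ψ (mol volume (ρ (k n)) U p))
      + (∫ p, ⟪gradx (φ (k n)) p, cutU t₀ x₀ R a p⟫) + ∫ z, jumpI K u (φ (k n)) z
        ≤ (ν (pCyl t₀ x₀ r)).toReal := by
    intro n
    have := h.weak_le (hφs (k n)) (hφ0 (k n)) (hφ1 (k n)) hJs hJe (by linarith) (by linarith) hrR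
      (hw.integrable (hφs (k n)).continuous.measurable (hφ0 (k n)) (hφ1 (k n)) (hφE (k n)))
    rwa [(hm.isMol (k n)).integral_mul_fderiv_mol h.memLp_cutU hZ hg hΨ] at this
  have hlim := le_of_tendsto' (((htime.comp hk.tendsto_atTop).neg.add hfl).add hjlim) hineq
  have hZt : ∀ p, p ∉ pCyl t₀ x₀ R → fderiv ℝ Z p = 0 := fun p hp =>
    fderiv_of_notMem_tsupport ℝ fun hc => hp (hCR (hts hc))
  have e1 : ∀ p, fderiv ℝ Z p (1, 0) * Ψ (U p) = fderiv ℝ Z p (1, 0) * Ψ (u p) := fun p => by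
    by_cases hp : p ∈ pCyl t₀ x₀ R
    · rw [hU, cutU, indicator_of_mem hp]
    · simp [hZt p hp]
  have e2 : ∀ p, ⟪cutG Z g g' U (cutU t₀ x₀ R Du) p, cutU t₀ x₀ R a p⟫ =
      ⟪cutG Z g g' u Du p, a p⟫ := fun p => by
    by_cases hp : p ∈ pCyl t₀ x₀ R
    · simp only [hU, cutG, cutU, indicator_of_mem hp]
    · have h3 : Z p = 0 := hZ0 p fun hc => hp (hCR hc)
      have h4 : gradx Z p = 0 := gradx_eq_of_inner fun v => by simp [hZt p hp]
      simp [cutG, h3, h4]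
  rw [integral_congr_ae (Eventually.of_forall e1),
    integral_congr_ae (Eventually.of_forall e2)] at hlim
  rw [hψeq] at hj hlim
  refine ⟨hj, ?_, (hZ1.integrable_mul hΨU).congr (Eventually.of_forall e1), hlim⟩
  have : Integrable fun p => ⟪cutG Z g g' U (cutU t₀ x₀ R Du) p, cutU t₀ x₀ R a p⟫ :=
    (hGL.norm.integrable_mul haL.norm).mono' (hGL.1.inner haL.1)
      (Eventually.of_forall fun p => norm_inner_le_norm _ _)
  simpa only [e2] using this

end Energy

section TruncationInequalities

lemma two_mul_mul_le_of_sq_le {k c G x y : ℝ} (hk : 0 ≤ k) (hc : 0 ≤ c) (h : G ^ 2 ≤ c * k) :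
    2 * x * y * G ≤ k * x ^ 2 + c * y ^ 2 := by
  rcases hk.eq_or_lt with rfl | hk
  · have : G = 0 := by nlinarith
    subst this; nlinarith [mul_nonneg hc (sq_nonneg y)]
  · have h1 : 0 ≤ k * (k * x ^ 2 + c * y ^ 2 - 2 * x * y * G) := by
      nlinarith [sq_nonneg (k * x - G * y), mul_nonneg (sub_nonneg.2 h) (sq_nonneg y)]
    linarith [nonneg_of_mul_nonneg_right h1 hk]

/-- The power weight `(1 + v)^(1 + ε)` on the set where `v` is positive. -/
def trW (ε v : ℝ) : ℝ := if 0 < v then (1 + v) ^ (1 + ε) else 0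

lemma measurable_trW (ε : ℝ) : Measurable (trW ε) :=
  Measurable.ite measurableSet_Ioi (by fun_prop) measurable_const

lemma trW_nonneg (ε v : ℝ) : 0 ≤ trW ε v := by
  unfold trW; split_ifs with h
  · positivity
  · rfl

variable {ε : ℝ}

lemma max_le_trW (hε : 0 < ε) (v : ℝ) : max v 0 ≤ trW ε v := by
  unfold trW; split_ifs with h
  · rw [max_eq_left h.le]
    calc v ≤ (1 + v) ^ (1 : ℝ) := by rw [Real.rpow_one]; linarith
      _ ≤ _ := Real.rpow_le_rpow_of_exponent_le (by linarith) (by linarith)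
  · rw [max_eq_right (not_lt.1 h)]

lemma trG_sq_le_trW (hε : 0 < ε) (hε1 : ε ≤ 1 / 2) (v : ℝ) :
    trG ε v ^ 2 ≤ 2 / ε * trW ε v * trG' ε v := by
  unfold trW; split_ifs with h
  · exact trG_sq_le_trG' hε hε1 h.le
  · simp [trG_of_nonpos (not_lt.1 h)]

lemma jump_lower_aux (hε : 0 < ε) (hε1 : ε ≤ 1 / 2) {a b e f : ℝ} (hab : b ≤ a) (hf : 0 ≤ f) :
    -((a - b) * (e ^ 2 * trG ε a - f ^ 2 * trG ε b)) ≤ 4 / ε * (e - f) ^ 2 * trW ε a := by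
  have hGa := trG_nonneg hε a
  have hGb := trG_nonneg hε b
  have hG := trG_monotone hε hab
  have hW := trW_nonneg ε a
  have hR : 0 ≤ 4 / ε * (e - f) ^ 2 * trW ε a := by positivity
  have hm : 0 ≤ a - b := by linarith
  rcases le_total b 0 with hb | hb
  · rw [trG_of_nonpos hb]
    have : 0 ≤ (a - b) * (e ^ 2 * trG ε a) := by positivity
    linarith
  rcases le_total f e with hfe | hfe
  · have : f ^ 2 * trG ε b ≤ e ^ 2 * trG ε a := by gcongr
    nlinarith
  have hkey : trG ε a ^ 2 * (a - b) ≤ 4 / ε * trW ε a * (trG ε a - trG ε b) := by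
    have := mul_trG_sq_le hε hε1 hb hab
    rcases (hb.trans hab).eq_or_lt with h0 | h0
    · simp [← h0, trG_of_nonpos le_rfl] at *
      have : b = 0 := by linarith
      simp [this, trG_of_nonpos le_rfl]
    · rw [trW, if_pos h0]; linarith
  have h2 := two_mul_mul_le_of_sq_le (k := (a - b) * (trG ε a - trG ε b))
    (c := 4 / ε * trW ε a) (G := (a - b) * trG ε a) (x := f) (y := f - e)
    (mul_nonneg hm (by linarith)) (by positivity) (by nlinarith)
  have h3 : (f ^ 2 - e ^ 2) * ((a - b) * trG ε a) ≤ 2 * f * (f - e) * ((a - b) * trG ε a) := by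
    apply mul_le_mul_of_nonneg_right _ (by positivity)
    nlinarith
  nlinarith

/-- Lower bound for the nonlocal energy density of a truncation. -/
lemma jump_lower (hε : 0 < ε) (hε1 : ε ≤ 1 / 2) {a b e f : ℝ} (he : 0 ≤ e) (hf : 0 ≤ f) :
    -((a - b) * (e ^ 2 * trG ε a - f ^ 2 * trG ε b)) ≤
      4 / ε * (e - f) ^ 2 * (trW ε a + trW ε b) := by
  have h1 : 0 ≤ 4 / ε * (e - f) ^ 2 := by positivity
  have ha := mul_nonneg h1 (trW_nonneg ε a)
  have hb := mul_nonneg h1 (trW_nonneg ε b)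
  rcases le_total b a with h | h
  · linarith [jump_lower_aux hε hε1 (e := e) h hf]
  · have := jump_lower_aux hε hε1 (e := f) h he
    nlinarith

lemma jump_lower_far (hε : 0 < ε) {a b e : ℝ} (he : 0 ≤ e) (he1 : e ≤ 1) :
    -((a - b) * (e ^ 2 * trG ε a)) ≤ max b 0 := by
  have h0 := trG_nonneg hε a
  have h1 := trG_le_one (ε := ε) a
  have h2 : 0 ≤ e ^ 2 := sq_nonneg e
  have h3 : e ^ 2 ≤ 1 := by nlinarith
  rcases le_total a 0 with ha | ha
  · simp [trG_of_nonpos ha]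
  have h4 : e ^ 2 * trG ε a ≤ 1 := by nlinarith
  have h5 : 0 ≤ e ^ 2 * trG ε a := by positivity
  have h6 := le_max_left b 0
  have h7 := le_max_right b 0
  nlinarith

end TruncationInequalities

section ThreeIntegrals

lemma ofReal_add_ofReal_neg_le {g F e : ℝ} (hg : 0 ≤ g) (he : 0 ≤ e) (h : g ≤ F + e) :
    ENNReal.ofReal g + ENNReal.ofReal (-F) ≤ ENNReal.ofReal F + ENNReal.ofReal e := by
  rcases le_total 0 F with hF | hF
  · rw [ENNReal.ofReal_of_nonpos (neg_nonpos.2 hF), add_zero, ← ENNReal.ofReal_add hF he]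
    exact ENNReal.ofReal_le_ofReal h
  · rw [ENNReal.ofReal_of_nonpos hF, zero_add, ← ENNReal.ofReal_add hg (by linarith)]
    exact ENNReal.ofReal_le_ofReal (by linarith)

variable {α β γ : Type*} [MeasurableSpace α] [MeasurableSpace β] [MeasurableSpace γ]

/-- Positive parts of three integrals with bounded sum are controlled by the negative parts. -/
lemma lintegral_le_of_integral_add_le {μ₁ : Measure α} {μ₂ : Measure β} {μ₃ : Measure γ}
    {F₁ : α → ℝ} {F₂ : β → ℝ} {F₃ : γ → ℝ} (h₁ : Integrable F₁ μ₁) (h₂ : Integrable F₂ μ₂)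
    (h₃ : Integrable F₃ μ₃) {m : ℝ} (hm : 0 ≤ m)
    (h : (∫ x, F₁ x ∂μ₁) + (∫ x, F₂ x ∂μ₂) + ∫ x, F₃ x ∂μ₃ ≤ m) {g₁ e₁ : α → ℝ≥0∞}
    {g₂ e₂ : β → ℝ≥0∞} {e₃ : γ → ℝ≥0∞}
    (k₁ : ∀ x, g₁ x + ENNReal.ofReal (-F₁ x) ≤ ENNReal.ofReal (F₁ x) + e₁ x)
    (k₂ : ∀ x, g₂ x + ENNReal.ofReal (-F₂ x) ≤ ENNReal.ofReal (F₂ x) + e₂ x)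
    (k₃ : ∀ x, ENNReal.ofReal (-F₃ x) ≤ ENNReal.ofReal (F₃ x) + e₃ x) :
    (∫⁻ x, g₁ x ∂μ₁) + ∫⁻ x, g₂ x ∂μ₂ ≤
      (∫⁻ x, e₁ x ∂μ₁) + (∫⁻ x, e₂ x ∂μ₂) + (∫⁻ x, e₃ x ∂μ₃) + ENNReal.ofReal m := by
  have n₁ := h₁.neg.lintegral_lt_top
  have n₂ := h₂.neg.lintegral_lt_top
  have n₃ := h₃.neg.lintegral_lt_top
  have p₁ := h₁.lintegral_lt_top
  have p₂ := h₂.lintegral_lt_top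
  have p₃ := h₃.lintegral_lt_top
  simp only [Pi.neg_apply] at n₁ n₂ n₃
  have i₁ := lintegral_mono (μ := μ₁) k₁
  have i₂ := lintegral_mono (μ := μ₂) k₂
  have i₃ := lintegral_mono (μ := μ₃) k₃
  rw [lintegral_add_right' (g := fun x => ENNReal.ofReal (-F₁ x)) _
      h₁.aestronglyMeasurable.aemeasurable.neg.ennreal_ofReal,
    lintegral_add_left' h₁.aestronglyMeasurable.aemeasurable.ennreal_ofReal] at i₁
  rw [lintegral_add_right' (g := fun x => ENNReal.ofReal (-F₂ x)) _
      h₂.aestronglyMeasurable.aemeasurable.neg.ennreal_ofReal,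
    lintegral_add_left' h₂.aestronglyMeasurable.aemeasurable.ennreal_ofReal] at i₂
  rw [lintegral_add_left' h₃.aestronglyMeasurable.aemeasurable.ennreal_ofReal] at i₃
  rw [integral_eq_lintegral_pos_part_sub_lintegral_neg_part h₁,
    integral_eq_lintegral_pos_part_sub_lintegral_neg_part h₂,
    integral_eq_lintegral_pos_part_sub_lintegral_neg_part h₃] at h
  set P₁ := ∫⁻ x, ENNReal.ofReal (F₁ x) ∂μ₁
  set P₂ := ∫⁻ x, ENNReal.ofReal (F₂ x) ∂μ₂
  set P₃ := ∫⁻ x, ENNReal.ofReal (F₃ x) ∂μ₃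
  set N₁ := ∫⁻ x, ENNReal.ofReal (-F₁ x) ∂μ₁
  set N₂ := ∫⁻ x, ENNReal.ofReal (-F₂ x) ∂μ₂
  set N₃ := ∫⁻ x, ENNReal.ofReal (-F₃ x) ∂μ₃
  have hPN : P₁ + P₂ + P₃ ≤ N₁ + N₂ + N₃ + ENNReal.ofReal m := by
    rw [← ENNReal.ofReal_toReal p₁.ne, ← ENNReal.ofReal_toReal p₂.ne,
      ← ENNReal.ofReal_toReal p₃.ne, ← ENNReal.ofReal_toReal n₁.ne,
      ← ENNReal.ofReal_toReal n₂.ne, ← ENNReal.ofReal_toReal n₃.ne,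
      ← ENNReal.ofReal_add (by positivity) (by positivity),
      ← ENNReal.ofReal_add (by positivity) (by positivity),
      ← ENNReal.ofReal_add (by positivity) (by positivity),
      ← ENNReal.ofReal_add (by positivity) (by positivity),
      ← ENNReal.ofReal_add (by positivity) hm]
    exact ENNReal.ofReal_le_ofReal (by linarith)
  have hN : N₁ + N₂ + N₃ ≠ ∞ := by finiteness
  refine (ENNReal.add_le_add_iff_right hN).1 ?_
  calc _ = ((∫⁻ x, g₁ x ∂μ₁) + N₁) + ((∫⁻ x, g₂ x ∂μ₂) + N₂) + N₃ := by ring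
    _ ≤ (P₁ + ∫⁻ x, e₁ x ∂μ₁) + (P₂ + ∫⁻ x, e₂ x ∂μ₂) + (P₃ + ∫⁻ x, e₃ x ∂μ₃) := by gcongr
    _ = (P₁ + P₂ + P₃) + ((∫⁻ x, e₁ x ∂μ₁) + (∫⁻ x, e₂ x ∂μ₂) + ∫⁻ x, e₃ x ∂μ₃) := by ring
    _ ≤ (N₁ + N₂ + N₃ + ENNReal.ofReal m) +
        ((∫⁻ x, e₁ x ∂μ₁) + (∫⁻ x, e₂ x ∂μ₂) + ∫⁻ x, e₃ x ∂μ₃) := by gcongr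
    _ = _ := by ring

end ThreeIntegrals

section NonlocalError

variable {s Λ : ℝ} {K : ℝ → Ed d → Ed d → ℝ} {t₀ r M ε : ℝ} {x₀ : Ed d}

/-- A cutoff in space adapted to the ball `B_r(x₀)`. -/
structure SpaceCut (x₀ : Ed d) (r M : ℝ) (η : Ed d → ℝ) : Prop where
  smooth : ContDiff ℝ (⊤ : ℕ∞) η
  nonneg : ∀ x, 0 ≤ η x
  le_one : ∀ x, η x ≤ 1
  zero : ∀ x, x ∉ closedBall x₀ (3 / 4 * r) → η x = 0
  one : ∀ x ∈ closedBall x₀ (5 / 8 * r), η x = 1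
  lip : ∀ x y, |η x - η y| ≤ M / r * ‖x - y‖

/-- A cutoff in time adapted to the interval `(t₀ - r², t₀)`. -/
structure TimeCut (t₀ r M t₂ : ℝ) (θ β χ : ℝ → ℝ) : Prop where
  smooth : ContDiff ℝ (⊤ : ℕ∞) θ
  deriv : ∀ t, HasDerivAt θ (β t - χ t) t
  nonneg : ∀ t, 0 ≤ θ t
  le_one : ∀ t, θ t ≤ 1
  zero : ∀ t, t ∉ Icc (t₀ - 3 / 4 * r ^ 2) t₂ → θ t = 0
  beta_le : ∀ t, β t ≤ M / r ^ 2
  beta_zero : ∀ t, t ∉ Iminus t₀ r → β t = 0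
  chi_nonneg : ∀ t, 0 ≤ χ t

/-- The weight `|x₀ - y|^{-d-2s}`. -/
def farK (s : ℝ) (x₀ y : Ed d) : ℝ≥0∞ := ENNReal.ofReal (1 / ‖x₀ - y‖ ^ ((d : ℝ) + 2 * s))

lemma measurable_farK (s : ℝ) (x₀ : Ed d) : Measurable (farK s x₀) := by
  unfold farK; fun_prop

/-- The local part of the error density. -/
def errW (ε t₀ : ℝ) (x₀ : Ed d) (r : ℝ) (V : ℝ × Ed d → ℝ) : ℝ × Ed d → ℝ≥0∞ :=
  (pCyl t₀ x₀ r).indicator fun p => ENNReal.ofReal (trW ε (V p))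

/-- The nonlocal part of the error density. -/
def errF (s t₀ : ℝ) (x₀ : Ed d) (r : ℝ) (V : ℝ × Ed d → ℝ) : ℝ × Ed d → ℝ≥0∞ :=
  (Iminus t₀ r ×ˢ (ball x₀ r)ᶜ).indicator fun p => ENNReal.ofReal (max (V p) 0) * farK s x₀ p.2

lemma measurable_errW {V : ℝ × Ed d → ℝ} (hV : Measurable V) : Measurable (errW ε t₀ x₀ r V) :=
  Measurable.indicator ((measurable_trW ε).comp hV).ennreal_ofReal (measurableSet_pCyl _ _ _)

lemma measurable_errF {V : ℝ × Ed d → ℝ} (hV : Measurable V) : Measurable (errF s t₀ x₀ r V) := by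
  refine Measurable.indicator ?_ (measurableSet_Ioo.prod measurableSet_ball.compl)
  have : Measurable fun p : ℝ × Ed d => farK s x₀ p.2 := (measurable_farK s x₀).comp measurable_snd
  exact (hV.max measurable_const).ennreal_ofReal.mul this

/-- Upper bound for the negative part of the nonlocal energy density. -/
def errJ (s ε t₀ : ℝ) (x₀ : Ed d) (r : ℝ) (V : ℝ × Ed d → ℝ) (c₁ c₂ : ℝ)
    (z : ℝ × Ed d × Ed d) : ℝ≥0∞ :=
  ENNReal.ofReal c₁ * ((errW ε t₀ x₀ r V (z.1, z.2.1) + errW ε t₀ x₀ r V (z.1, z.2.2)) *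
    (‖z.2.1 - z.2.2‖ₑ ^ 2 * nearK s (z.2.1 - z.2.2))) +
  ENNReal.ofReal c₂ * ((ball x₀ r).indicator 1 z.2.1 * errF s t₀ x₀ r V (z.1, z.2.2) +
    (ball x₀ r).indicator 1 z.2.2 * errF s t₀ x₀ r V (z.1, z.2.1))

lemma lintegral_triple_kernel_left {f : ℝ × Ed d → ℝ≥0∞} (hf : Measurable f) {k : Ed d → ℝ≥0∞}
    (hk : Measurable k) :
    ∫⁻ z : ℝ × Ed d × Ed d, f (z.1, z.2.1) * k (z.2.1 - z.2.2) = (∫⁻ h, k h) * ∫⁻ p, f p := by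
  rw [lintegral_triple (by fun_prop), Measure.volume_eq_prod, lintegral_prod _ hf.aemeasurable,
    ← lintegral_const_mul _ hf.lintegral_prod_right']
  refine lintegral_congr fun t => ?_
  rw [← lintegral_const_mul _ (by fun_prop)]
  refine lintegral_congr fun x => ?_
  dsimp only
  rw [lintegral_const_mul _ (by fun_prop), lintegral_sub_left_eq_self k x, mul_comm]

lemma lintegral_triple_kernel_right {f : ℝ × Ed d → ℝ≥0∞} (hf : Measurable f) {k : Ed d → ℝ≥0∞}
    (hk : Measurable k) :
    ∫⁻ z : ℝ × Ed d × Ed d, f (z.1, z.2.2) * k (z.2.1 - z.2.2) = (∫⁻ h, k h) * ∫⁻ p, f p := by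
  rw [lintegral_triple (by fun_prop), Measure.volume_eq_prod, lintegral_prod _ hf.aemeasurable,
    ← lintegral_const_mul _ hf.lintegral_prod_right']
  refine lintegral_congr fun t => ?_
  rw [← lintegral_const_mul _ (by fun_prop), lintegral_lintegral_swap (by fun_prop)]
  refine lintegral_congr fun y => ?_
  dsimp only
  rw [lintegral_const_mul _ (by fun_prop), lintegral_sub_right_eq_self k y, mul_comm]

lemma lintegral_triple_mul_left {f : ℝ × Ed d → ℝ≥0∞} (hf : Measurable f) {B : Ed d → ℝ≥0∞}
    (hB : Measurable B) :
    ∫⁻ z : ℝ × Ed d × Ed d, B z.2.1 * f (z.1, z.2.2) = (∫⁻ x, B x) * ∫⁻ p, f p := by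
  rw [lintegral_triple (by fun_prop), Measure.volume_eq_prod, lintegral_prod _ hf.aemeasurable,
    ← lintegral_const_mul _ hf.lintegral_prod_right']
  refine lintegral_congr fun t => ?_
  rw [← lintegral_mul_const _ hB]
  refine lintegral_congr fun x => ?_
  dsimp only
  rw [lintegral_const_mul _ (by fun_prop)]

lemma lintegral_triple_mul_right {f : ℝ × Ed d → ℝ≥0∞} (hf : Measurable f) {B : Ed d → ℝ≥0∞}
    (hB : Measurable B) :
    ∫⁻ z : ℝ × Ed d × Ed d, B z.2.2 * f (z.1, z.2.1) = (∫⁻ x, B x) * ∫⁻ p, f p := by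
  rw [lintegral_triple (by fun_prop), Measure.volume_eq_prod, lintegral_prod _ hf.aemeasurable,
    ← lintegral_const_mul _ hf.lintegral_prod_right']
  refine lintegral_congr fun t => ?_
  rw [← lintegral_const_mul _ (by fun_prop)]
  refine lintegral_congr fun x => ?_
  dsimp only
  rw [lintegral_mul_const _ hB]

lemma lintegral_errJ {V : ℝ × Ed d → ℝ} (hV : Measurable V) (c₁ c₂ : ℝ) :
    ∫⁻ z, errJ s ε t₀ x₀ r V c₁ c₂ z =
      ENNReal.ofReal c₁ * (2 * nearC d s * ∫⁻ p, errW ε t₀ x₀ r V p) +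
      ENNReal.ofReal c₂ * (2 * volume (ball x₀ r) * ∫⁻ p, errF s t₀ x₀ r V p) := by
  have hW := measurable_errW (ε := ε) (t₀ := t₀) (x₀ := x₀) (r := r) hV
  have hF := measurable_errF (s := s) (t₀ := t₀) (x₀ := x₀) (r := r) hV
  have hk : Measurable fun h : Ed d => ‖h‖ₑ ^ 2 * nearK s h :=
    (measurable_enorm.pow_const 2).mul (measurable_nearK s)
  have hB : Measurable ((ball x₀ r).indicator (1 : Ed d → ℝ≥0∞)) :=
    measurable_one.indicator measurableSet_ball
  have hBi : ∫⁻ x, (ball x₀ r).indicator (1 : Ed d → ℝ≥0∞) x = volume (ball x₀ r) := by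
    rw [lintegral_indicator_one measurableSet_ball]
  have a1 := lintegral_triple_kernel_left hW hk
  have a2 := lintegral_triple_kernel_right hW hk
  have a3 := lintegral_triple_mul_left hF hB
  have a4 := lintegral_triple_mul_right hF hB
  rw [hBi] at a3 a4
  generalize hW0 : errW ε t₀ x₀ r V = W at *
  generalize hF0 : errF s t₀ x₀ r V = F at *
  generalize hBB : (ball x₀ r).indicator (1 : Ed d → ℝ≥0∞) = B at *
  have m1 : Measurable fun z : ℝ × Ed d × Ed d =>
      ‖z.2.1 - z.2.2‖ₑ ^ 2 * nearK s (z.2.1 - z.2.2) :=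
    hk.comp (measurable_snd.fst.sub measurable_snd.snd)
  have n1 : Measurable fun z : ℝ × Ed d × Ed d => W (z.1, z.2.1) := by fun_prop
  have n2 : Measurable fun z : ℝ × Ed d × Ed d => W (z.1, z.2.2) := by fun_prop
  have n3 : Measurable fun z : ℝ × Ed d × Ed d => B z.2.1 * F (z.1, z.2.2) := by fun_prop
  have n4 : Measurable fun z : ℝ × Ed d × Ed d => B z.2.2 * F (z.1, z.2.1) := by fun_prop
  have e1 : (∫⁻ z : ℝ × Ed d × Ed d, (W (z.1, z.2.1) + W (z.1, z.2.2)) *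
      (‖z.2.1 - z.2.2‖ₑ ^ 2 * nearK s (z.2.1 - z.2.2))) = 2 * nearC d s * ∫⁻ p, W p := by
    rw [nearC, mul_assoc, two_mul]
    nth_rw 1 [← a1]
    rw [← a2, ← lintegral_add_left (by exact n1.mul m1)]
    exact lintegral_congr fun z => add_mul _ _ _
  have e2 : (∫⁻ z : ℝ × Ed d × Ed d, (B z.2.1 * F (z.1, z.2.2) + B z.2.2 * F (z.1, z.2.1))) =
      2 * volume (ball x₀ r) * ∫⁻ p, F p := by
    rw [lintegral_add_left n3, a3, a4]
    ring
  have m2 := (n1.add n2).mul m1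
  have m3 := m2.const_mul (ENNReal.ofReal c₁)
  rw [← e1, ← e2, ← lintegral_const_mul _ (by exact m2),
    ← lintegral_const_mul _ (by exact n3.add n4),
    ← lintegral_add_left (by exact m3), ← hW0, ← hF0, ← hBB]
  rfl

lemma jump_err_near (hK : KernelHyp d s Λ K) (hΛ : 1 ≤ Λ) (hε : 0 < ε) (hε1 : ε ≤ 1 / 2)
    (hr1 : r ≤ 1) {η : Ed d → ℝ} (hη : SpaceCut x₀ r M η) {θ : ℝ} (hθ0 : 0 ≤ θ)
    (hθ1 : θ ≤ 1) {a b : ℝ} (t : ℝ) {x y : Ed d} (hxy : x ≠ y) (hx : x ∈ ball x₀ r)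
    (hy : y ∈ ball x₀ r) :
    ENNReal.ofReal (-((a - b) * (θ * η x ^ 2 * trG ε a - θ * η y ^ 2 * trG ε b) * K t x y)) ≤
      ENNReal.ofReal (4 / ε * (M / r) ^ 2 * Λ) *
        ((ENNReal.ofReal (trW ε a) + ENNReal.ofReal (trW ε b)) *
          (‖x - y‖ₑ ^ 2 * nearK s (x - y))) := by
  have hn : ‖x - y‖ < 2 := by
    rw [mem_ball] at hx hy
    rw [← dist_eq_norm]
    linarith [dist_triangle_right x y x₀]
  have hpos : 0 < ‖x - y‖ := norm_pos_iff.2 (sub_ne_zero.2 hxy)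
  rw [nearK, indicator_of_mem (by simpa using hn), ← ofReal_norm, ← ENNReal.ofReal_pow hpos.le,
    ← ENNReal.ofReal_add (trW_nonneg _ _) (trW_nonneg _ _), ← ENNReal.ofReal_mul (by positivity),
    ← ENNReal.ofReal_mul (add_nonneg (trW_nonneg _ _) (trW_nonneg _ _)),
    ← ENNReal.ofReal_mul (by positivity)]
  refine ENNReal.ofReal_le_ofReal ?_
  have h1 := jump_lower hε hε1 (a := a) (b := b) (hη.nonneg x) (hη.nonneg y)
  have hW : 0 ≤ trW ε a + trW ε b := add_nonneg (trW_nonneg _ _) (trW_nonneg _ _)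
  have h2 : (η x - η y) ^ 2 ≤ (M / r) ^ 2 * ‖x - y‖ ^ 2 := by
    rw [← mul_pow, ← sq_abs]
    exact pow_le_pow_left₀ (abs_nonneg _) (hη.lip x y) 2
  have hK0 : 0 ≤ K t x y := hK.nonneg hΛ hxy t
  have hKu := hK.upper t x y hxy
  calc -((a - b) * (θ * η x ^ 2 * trG ε a - θ * η y ^ 2 * trG ε b) * K t x y)
      = (θ * -((a - b) * (η x ^ 2 * trG ε a - η y ^ 2 * trG ε b))) * K t x y := by ring
    _ ≤ (θ * (4 / ε * (η x - η y) ^ 2 * (trW ε a + trW ε b))) * K t x y := by gcongr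
    _ ≤ (1 * (4 / ε * ((M / r) ^ 2 * ‖x - y‖ ^ 2) * (trW ε a + trW ε b))) *
        (Λ / ‖x - y‖ ^ ((d : ℝ) + 2 * s)) := by gcongr
    _ = _ := by ring

lemma jump_err_far (hK : KernelHyp d s Λ K) (hΛ : 1 ≤ Λ) (hs : 0 < s) (hε : 0 < ε)
    (hr : 0 < r) {η : Ed d → ℝ} (hη : SpaceCut x₀ r M η) {θ : ℝ} (hθ0 : 0 ≤ θ)
    (hθ1 : θ ≤ 1) {a b : ℝ} (t : ℝ) {x y : Ed d} (hy : y ∉ ball x₀ r) :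
    ENNReal.ofReal (-((a - b) * (θ * η x ^ 2 * trG ε a) * K t x y)) ≤
      ENNReal.ofReal (Λ * 4 ^ ((d : ℝ) + 2 * s)) * (ENNReal.ofReal (max b 0) * farK s x₀ y) := by
  by_cases hx : x ∈ closedBall x₀ (3 / 4 * r)
  swap
  · simp [hη.zero x hx]
  rw [mem_ball, not_lt] at hy
  rw [mem_closedBall] at hx
  have h4 : ‖x₀ - y‖ / 4 ≤ ‖x - y‖ := by
    rw [← dist_eq_norm, ← dist_eq_norm]
    have := dist_triangle_left y x₀ x
    rw [dist_comm x₀ y, dist_comm x y] at *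
    linarith
  have hpos : 0 < ‖x₀ - y‖ := by rw [← dist_eq_norm, dist_comm]; linarith
  have hxy : x ≠ y := by
    rintro rfl
    linarith
  rw [farK, ← ENNReal.ofReal_mul (le_max_right _ _), ← ENNReal.ofReal_mul (by positivity)]
  refine ENNReal.ofReal_le_ofReal ?_
  have hK0 : 0 ≤ K t x y := hK.nonneg hΛ hxy t
  have hd : (0 : ℝ) ≤ (d : ℝ) + 2 * s := by positivity
  have hKu : K t x y ≤ Λ / (‖x₀ - y‖ / 4) ^ ((d : ℝ) + 2 * s) :=
    (hK.upper t x y hxy).trans (by gcongr)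
  have h1 := jump_lower_far hε (a := a) (b := b) (hη.nonneg x) (hη.le_one x)
  have hm : 0 ≤ max b 0 := le_max_right _ _
  calc -((a - b) * (θ * η x ^ 2 * trG ε a) * K t x y)
      = (θ * -((a - b) * (η x ^ 2 * trG ε a))) * K t x y := by ring
    _ ≤ (θ * max b 0) * K t x y := by gcongr
    _ ≤ (1 * max b 0) * (Λ / (‖x₀ - y‖ / 4) ^ ((d : ℝ) + 2 * s)) := by gcongr
    _ = _ := by
      rw [Real.div_rpow hpos.le (by norm_num)]
      field_simp

/-- Pointwise lower bound for the nonlocal energy density. -/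
lemma jump_err (hK : KernelHyp d s Λ K) (hΛ : 1 ≤ Λ) (hs : 0 < s) (hε : 0 < ε) (hε1 : ε ≤ 1 / 2)
    (hr : 0 < r) (hr1 : r ≤ 1) {η : Ed d → ℝ} (hη : SpaceCut x₀ r M η) {t₂ : ℝ}
    {θ β χ : ℝ → ℝ} (hθ : TimeCut t₀ r M t₂ θ β χ) (ht₂ : t₂ < t₀) (V : ℝ × Ed d → ℝ)
    (z : ℝ × Ed d × Ed d) :
    ENNReal.ofReal (-(jumpI K V (fun p => θ p.1 * η p.2 ^ 2 * trG ε (V p)) z)) ≤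
      errJ s ε t₀ x₀ r V (4 / ε * (M / r) ^ 2 * Λ) (Λ * 4 ^ ((d : ℝ) + 2 * s)) z := by
  obtain ⟨t, x, y⟩ := z
  by_cases ht : t ∈ Iminus t₀ r
  swap
  · have : θ t = 0 := hθ.zero t fun hc => ht ⟨by nlinarith [hc.1], hc.2.trans_lt ht₂⟩
    simp [jumpI, this]
  have hsub : closedBall x₀ (3 / 4 * r) ⊆ ball x₀ r := closedBall_subset_ball (by linarith)
  have h0 := hθ.nonneg t
  have h1 := hθ.le_one t
  simp only [jumpI, errJ]
  by_cases hx : x ∈ ball x₀ r <;> by_cases hy : y ∈ ball x₀ r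
  · refine le_add_right ?_
    rw [errW, indicator_of_mem (show (t, x) ∈ pCyl t₀ x₀ r from ⟨ht, hx⟩),
      indicator_of_mem (show (t, y) ∈ pCyl t₀ x₀ r from ⟨ht, hy⟩)]
    rcases eq_or_ne x y with rfl | hxy
    · simp
    exact jump_err_near hK hΛ hε hε1 hr1 hη h0 h1 t hxy hx hy
  · refine le_add_left ?_
    rw [hη.zero y fun hc => hy (hsub hc), errF,
      indicator_of_mem (show (t, y) ∈ Iminus t₀ r ×ˢ (ball x₀ r)ᶜ from ⟨ht, hy⟩),
      indicator_of_mem hx, indicator_of_notMem hy]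
    have := jump_err_far hK hΛ hs hε hr hη h0 h1 (a := V (t, x)) (b := V (t, y)) t (x := x) hy
    simpa using this
  · refine le_add_left ?_
    rw [hη.zero x fun hc => hx (hsub hc), errF,
      indicator_of_mem (show (t, x) ∈ Iminus t₀ r ×ˢ (ball x₀ r)ᶜ from ⟨ht, hx⟩),
      indicator_of_mem hy, indicator_of_notMem hx]
    have := jump_err_far hK hΛ hs hε hr hη h0 h1 (a := V (t, y)) (b := V (t, x)) t (x := y) hx
    rw [hK.symm] at this
    refine le_of_eq_of_le ?_ (this.trans_eq ?_)
    · congr 1; ring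
    · simp
  · simp [hη.zero x fun hc => hx (hsub hc), hη.zero y fun hc => hy (hsub hc)]

end NonlocalError

section CutoffExistence

/-- Space cutoffs exist with a constant independent of centre and radius. -/
lemma exists_spaceCut (d : ℕ) : ∃ M : ℝ, 0 ≤ M ∧ ∀ (x₀ : Ed d) (r : ℝ), 0 < r →
    ∃ η, SpaceCut x₀ r M η := by
  let f : ContDiffBump (0 : Ed d) := ⟨5 / 8, 3 / 4, by norm_num, by norm_num⟩
  obtain ⟨L, hL⟩ := (f.contDiff (n := 1)).lipschitzWith_of_hasCompactSupport
    f.hasCompactSupport one_ne_zero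
  refine ⟨L, L.2, fun x₀ r hr => ⟨fun x => f (r⁻¹ • (x - x₀)), ?_, ?_, ?_, ?_, ?_, ?_⟩⟩
  · exact f.contDiff.comp ((contDiff_id.sub contDiff_const).const_smul r⁻¹)
  · exact fun x => f.nonneg
  · exact fun x => f.le_one
  · intro x hx
    rw [mem_closedBall, not_le, dist_eq_norm] at hx
    refine f.zero_of_le_dist ?_
    rw [dist_zero_right, norm_smul, norm_inv, Real.norm_of_nonneg hr.le]
    change 3 / 4 ≤ _
    rw [inv_mul_eq_div, le_div_iff₀ hr]
    exact hx.le
  · intro x hx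
    rw [mem_closedBall, dist_eq_norm] at hx
    refine f.one_of_mem_closedBall ?_
    rw [mem_closedBall, dist_zero_right, norm_smul, norm_inv, Real.norm_of_nonneg hr.le]
    change _ ≤ 5 / 8
    rw [inv_mul_eq_div, div_le_iff₀ hr]
    exact hx
  · intro x y
    have := hL.dist_le_mul (r⁻¹ • (x - x₀)) (r⁻¹ • (y - x₀))
    rw [Real.dist_eq, dist_eq_norm, ← smul_sub, sub_sub_sub_cancel_right, norm_smul, norm_inv,
      Real.norm_of_nonneg hr.le] at this
    exact this.trans_eq (by ring)

lemma deriv_smoothTransition_of_neg {x : ℝ} (hx : x < 0) : deriv Real.smoothTransition x = 0 := by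
  have : Real.smoothTransition =ᶠ[𝓝 x] fun _ => 0 := by
    filter_upwards [Iio_mem_nhds hx] with y hy
    exact Real.smoothTransition.zero_of_nonpos (le_of_lt hy)
  rw [this.deriv_eq, deriv_const]

lemma deriv_smoothTransition_of_one_lt {x : ℝ} (hx : 1 < x) :
    deriv Real.smoothTransition x = 0 := by
  have : Real.smoothTransition =ᶠ[𝓝 x] fun _ => 1 := by
    filter_upwards [Ioi_mem_nhds hx] with y hy
    exact Real.smoothTransition.one_of_one_le (le_of_lt hy)
  rw [this.deriv_eq, deriv_const]

lemma exists_deriv_smoothTransition_le :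
    ∃ M : ℝ, 0 ≤ M ∧ ∀ x, |deriv Real.smoothTransition x| ≤ M := by
  have hc : Continuous (deriv Real.smoothTransition) :=
    (Real.smoothTransition.contDiff (n := 1)).continuous_deriv le_rfl
  obtain ⟨M, hM⟩ := isCompact_Icc.exists_bound_of_continuousOn (s := Icc (0 : ℝ) 1) hc.continuousOn
  refine ⟨M, (norm_nonneg _).trans (hM 0 (by simp)), fun x => ?_⟩
  by_cases hx : x ∈ Icc (0 : ℝ) 1
  · exact hM x hx
  · have h0 := (norm_nonneg _).trans (hM 0 (by simp))
    rw [mem_Icc, not_and_or, not_le, not_le] at hx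
    rcases hx with hx | hx
    · simpa [deriv_smoothTransition_of_neg hx] using h0
    · simpa [deriv_smoothTransition_of_one_lt hx] using h0

/-- Time cutoffs whose decay is a prescribed approximation of the Dirac mass exist, with a
universal constant. -/
lemma exists_timeCut : ∃ M : ℝ, 0 ≤ M ∧ ∀ (t₀ r : ℝ), 0 < r → ∀ (a b : ℝ), t₀ - 1 / 4 * r ^ 2 ≤ a →
    a < b → b < t₀ → ∀ ψ : ℝ → ℝ, ContDiff ℝ (⊤ : ℕ∞) ψ → (∀ t, 0 ≤ ψ t) →
    (∀ t, t ∉ Ioo a b → ψ t = 0) → ∫ t, ψ t = 1 →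
    ∃ θ β, TimeCut t₀ r M b θ β ψ ∧ ∀ t ∈ Icc (t₀ - 1 / 4 * r ^ 2) a, θ t = 1 := by
  obtain ⟨M, hM0, hM⟩ := exists_deriv_smoothTransition_le
  refine ⟨2 * M, by positivity, fun t₀ r hr a b ha hab hb ψ hψ hψ0 hψz hψ1 => ?_⟩
  have hr2 : 0 < r ^ 2 := by positivity
  have hψc := hψ.continuous
  have hψi : Integrable ψ := by
    refine hψc.integrable_of_hasCompactSupport (HasCompactSupport.of_support_subset_isCompact
      (isCompact_Icc (a := a) (b := b)) fun t ht => ?_)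
    by_contra hc
    exact ht (hψz t fun h => hc (Ioo_subset_Icc_self h))
  set H : ℝ → ℝ := fun t => 1 - ∫ x in a..t, ψ x with hHdef
  have hHd : ∀ t, HasDerivAt H (-ψ t) t := fun t => by
    have := (intervalIntegral.integral_hasDerivAt_right (hψc.intervalIntegrable a t)
      (hψc.stronglyMeasurableAtFilter _ _) hψc.continuousAt).const_sub 1
    simpa using this
  have hHa : ∀ t ≤ a, H t = 1 := fun t ht => by
    have : ∫ x in a..t, ψ x = 0 := by
      rw [intervalIntegral.integral_zero_ae]
      refine Eventually.of_forall fun x hx => hψz x fun h => ?_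
      rw [uIoc_of_ge ht] at hx
      exact absurd h.1 (not_lt.2 hx.2)
    simp [hHdef, this]
  have hHb : ∀ t, b ≤ t → H t = 0 := fun t ht => by
    have : ∫ x in a..t, ψ x = 1 := by
      rw [intervalIntegral.integral_eq_integral_of_support_subset, hψ1]
      intro x hx
      by_contra hc
      exact hx (hψz x fun h => hc ⟨h.1, h.2.le.trans ht⟩)
    simp [hHdef, this]
  have hHi : ∀ t, 0 ≤ H t ∧ H t ≤ 1 := fun t => by
    rcases le_total t a with h | h
    · simp [hHa t h]
    · have h1 : 0 ≤ ∫ x in a..t, ψ x := intervalIntegral.integral_nonneg h fun x _ => hψ0 x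
      have h2 : ∫ x in a..t, ψ x ≤ 1 := by
        rw [intervalIntegral.integral_of_le h, ← hψ1]
        exact setIntegral_le_integral hψi (Eventually.of_forall hψ0)
      simp only [hHdef]
      constructor <;> linarith
  have hHs : ContDiff ℝ (⊤ : ℕ∞) H := by
    rw [contDiff_infty_iff_deriv]
    refine ⟨fun t => (hHd t).differentiableAt, ?_⟩
    rw [show deriv H = fun t => -ψ t from funext fun t => (hHd t).deriv]
    exact hψ.neg
  set c : ℝ := t₀ - 3 / 4 * r ^ 2 with hc
  set e : ℝ → ℝ := fun t => Real.smoothTransition ((t - c) / (r ^ 2 / 2)) with he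
  have hes : ContDiff ℝ (⊤ : ℕ∞) e :=
    Real.smoothTransition.contDiff.comp ((contDiff_id.sub contDiff_const).div_const _)
  have hed : ∀ t, HasDerivAt e (deriv Real.smoothTransition ((t - c) / (r ^ 2 / 2)) *
      (1 / (r ^ 2 / 2))) t := fun t => by
    have h1 : HasDerivAt Real.smoothTransition
        (deriv Real.smoothTransition ((t - c) / (r ^ 2 / 2))) ((t - c) / (r ^ 2 / 2)) :=
      ((Real.smoothTransition.contDiff (n := 1)).differentiable one_ne_zero _).hasDerivAt
    exact h1.comp t (((hasDerivAt_id t).sub_const c).div_const _)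
  have he1 : ∀ t, t₀ - 1 / 4 * r ^ 2 ≤ t → e t = 1 := fun t ht =>
    Real.smoothTransition.one_of_one_le ((one_le_div (by positivity)).2 (by linarith))
  refine ⟨fun t => e t * H t, fun t => deriv Real.smoothTransition ((t - c) / (r ^ 2 / 2)) *
      (1 / (r ^ 2 / 2)) * H t, ⟨hes.mul hHs, fun t => ?_, fun t => ?_, fun t => ?_, fun t ht => ?_,
      fun t => ?_, fun t ht => ?_, hψ0⟩, fun t ht => ?_⟩
  · refine ((hed t).mul (hHd t)).congr_deriv ?_
    by_cases h : t ∈ Ioo a b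
    · rw [he1 t (ha.trans h.1.le)]; ring
    · rw [hψz t h]; ring
  · exact mul_nonneg (Real.smoothTransition.nonneg _) (hHi t).1
  · exact mul_le_one₀ (Real.smoothTransition.le_one _) (hHi t).1 (hHi t).2
  · rw [mem_Icc, not_and_or, not_le, not_le] at ht
    rcases ht with ht | ht
    · have : e t = 0 := Real.smoothTransition.zero_of_nonpos
        (div_nonpos_of_nonpos_of_nonneg (by linarith) (by positivity))
      simp [this]
    · simp [hHb t ht.le]
  · have h1 := (le_abs_self _).trans (hM ((t - c) / (r ^ 2 / 2)))
    calc _ ≤ M * (1 / (r ^ 2 / 2)) * H t := by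
            gcongr; exact (hHi t).1
      _ ≤ M * (1 / (r ^ 2 / 2)) * 1 := by gcongr; exact (hHi t).2
      _ = _ := by field_simp
  · rw [Iminus, mem_Ioo, not_and_or, not_lt, not_lt] at ht
    rcases ht with ht | ht
    · rw [deriv_smoothTransition_of_neg (div_neg_of_neg_of_pos (by linarith) (by positivity))]
      simp
    · simp [hHb t (hb.le.trans ht)]
  · simp [hHa t ht.2, he1 t ht.1]

end CutoffExistence

section Caccioppoli

variable {s Λ : ℝ} {K : ℝ → Ed d → Ed d → ℝ} {ν : Measure (ℝ × Ed d)}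
  {t₀ : ℝ} {x₀ : Ed d} {R : ℝ} {u : ℝ × Ed d → ℝ} {Du a : ℝ × Ed d → Ed d}
  {r M ε t₂ : ℝ} {η : Ed d → ℝ} {θ β χ : ℝ → ℝ}

lemma fderiv_cut_apply (hη : SpaceCut x₀ r M η) (hθ : TimeCut t₀ r M t₂ θ β χ)
    (p : ℝ × Ed d) (τ : ℝ) (v : Ed d) :
    fderiv ℝ (fun p : ℝ × Ed d => θ p.1 * η p.2 ^ 2) p (τ, v) =
      (β p.1 - χ p.1) * τ * η p.2 ^ 2 + θ p.1 * (2 * η p.2 * fderiv ℝ η p.2 v) := by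
  have h1 : HasFDerivAt (fun p : ℝ × Ed d => θ p.1) _ p :=
    (hθ.deriv p.1).hasFDerivAt.comp p hasFDerivAt_fst
  have h2 : HasFDerivAt (fun p : ℝ × Ed d => η p.2) _ p :=
    ((hη.smooth.differentiable (by simp)) p.2).hasFDerivAt.comp p hasFDerivAt_snd
  have h3 := (h1.mul (h2.pow 2)).fderiv
  change fderiv ℝ (fun p : ℝ × Ed d => θ p.1 * η p.2 ^ 2) p = _ at h3
  rw [h3]
  simp
  ring

lemma abs_fderiv_spaceCut_le (hη : SpaceCut x₀ r M η) (hM : 0 ≤ M) (hr : 0 < r) (x v : Ed d) :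
    |fderiv ℝ η x v| ≤ M / r * ‖v‖ := by
  have h0 : 0 ≤ M / r := by positivity
  have hL : LipschitzWith (M / r).toNNReal η := LipschitzWith.of_dist_le_mul fun x y => by
    rw [Real.dist_eq, dist_eq_norm, Real.coe_toNNReal _ h0]
    exact hη.lip x y
  have h1 := norm_fderiv_le_of_lipschitz ℝ hL (x₀ := x)
  rw [Real.coe_toNNReal _ h0] at h1
  exact ((fderiv ℝ η x).le_opNorm v).trans (by gcongr)

lemma isSmoothCut_cut (hη : SpaceCut x₀ r M η) (hθ : TimeCut t₀ r M t₂ θ β χ) :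
    IsSmoothCut fun p : ℝ × Ed d => θ p.1 * η p.2 ^ 2 where
  smooth := (hθ.smooth.comp contDiff_fst).mul ((hη.smooth.comp contDiff_snd).pow 2)
  supp := by
    refine HasCompactSupport.of_support_subset_isCompact
      ((isCompact_Icc (a := t₀ - 3 / 4 * r ^ 2) (b := t₂)).prod
        (isCompact_closedBall x₀ (3 / 4 * r))) fun p hp => ⟨?_, ?_⟩
    · by_contra hc
      exact hp (by simp [hθ.zero _ hc])
    · by_contra hc
      exact hp (by simp [hη.zero _ hc])
  nonneg p := mul_nonneg (hθ.nonneg _) (sq_nonneg _)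
  le_one p := mul_le_one₀ (hθ.le_one _) (sq_nonneg _) (pow_le_one₀ (hη.nonneg _) (hη.le_one _))

lemma isLipC1_trG_scaled (hε : 0 < ε) (hε1 : ε ≤ 1 / 2) (l : ℝ) {δ : ℝ} (hδ : 0 < δ) :
    IsLipC1 (fun v => trG ε ((v - l) / δ)) (fun v => trG' ε ((v - l) / δ) / δ) (1 / δ) where
  deriv v := by
    refine ((hasDerivAt_trG ε ((v - l) / δ)).comp v
      (((hasDerivAt_id v).sub_const l).div_const δ)).congr_deriv ?_
    ring
  cont := ((continuous_trG' ε).comp (by fun_prop)).div_const _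
  bound v := by
    rw [abs_div, abs_of_pos hδ, abs_of_nonneg (trG'_nonneg hε _)]
    gcongr
    exact trG'_le_one hε hε1 _

variable {V : ℝ × Ed d → ℝ}

lemma time_err (hη : SpaceCut x₀ r M η) (hθ : TimeCut t₀ r M t₂ θ β χ) (hM : 0 ≤ M) (hr : 0 < r)
    (hε : 0 < ε) (p : ℝ × Ed d) :
    ENNReal.ofReal (χ p.1 * η p.2 ^ 2 * trPsi ε (V p)) +
      ENNReal.ofReal (-(-((β p.1 - χ p.1) * η p.2 ^ 2 * trPsi ε (V p)))) ≤
    ENNReal.ofReal (-((β p.1 - χ p.1) * η p.2 ^ 2 * trPsi ε (V p))) +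
      ENNReal.ofReal (M / r ^ 2) * errW ε t₀ x₀ r V p := by
  have hP := trPsi_nonneg hε (V p)
  have hχ := hθ.chi_nonneg p.1
  have hPW := (trPsi_le (ε := ε) (V p)).trans (max_le_trW hε (V p))
  by_cases hp : p ∈ pCyl t₀ x₀ r
  · rw [errW, indicator_of_mem hp, ← ENNReal.ofReal_mul (by positivity)]
    refine ofReal_add_ofReal_neg_le (by positivity) (mul_nonneg (by positivity) (trW_nonneg _ _)) ?_
    have h1 : β p.1 * (η p.2 ^ 2 * trPsi ε (V p)) ≤ M / r ^ 2 * (1 * trW ε (V p)) := by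
      have := hθ.beta_le p.1
      have := pow_le_one₀ (n := 2) (hη.nonneg p.2) (hη.le_one p.2)
      gcongr
    linarith
  · have h0 : β p.1 * η p.2 ^ 2 = 0 := by
      by_cases ht : p.1 ∈ Iminus t₀ r
      · have : η p.2 = 0 := hη.zero _ fun hc => hp ⟨ht, closedBall_subset_ball (by linarith) hc⟩
        simp [this]
      · simp [hθ.beta_zero _ ht]
    rw [errW, indicator_of_notMem hp, mul_zero, ← ENNReal.ofReal_zero]
    refine ofReal_add_ofReal_neg_le (by positivity) le_rfl (le_of_eq ?_)
    linear_combination (trPsi ε (V p)) * h0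

lemma space_err (hη : SpaceCut x₀ r M η) (hθ : TimeCut t₀ r M t₂ θ β χ) (hM : 0 ≤ M) (hr : 0 < r)
    (hr2 : t₂ < t₀) (hε : 0 < ε) (hε1 : ε ≤ 1 / 2) (hΛ : 1 ≤ Λ) {δ : ℝ} (hδ : 0 < δ)
    (p : ℝ × Ed d) {D w : Ed d} (hg : ‖w‖ ≤ Λ * ‖D‖) (hc : Λ⁻¹ * ‖D‖ ^ 2 ≤ ⟪w, D⟫) :
    ENNReal.ofReal ((2 * Λ)⁻¹ * (θ p.1 * η p.2 ^ 2 * trG' ε (V p) * (‖D‖ / δ) ^ 2)) +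
      ENNReal.ofReal (-(δ⁻¹ * (trG ε (V p) * (θ p.1 * (2 * η p.2 * fderiv ℝ η p.2 w)) +
        θ p.1 * η p.2 ^ 2 * (trG' ε (V p) / δ) * ⟪D, w⟫))) ≤
    ENNReal.ofReal (δ⁻¹ * (trG ε (V p) * (θ p.1 * (2 * η p.2 * fderiv ℝ η p.2 w)) +
        θ p.1 * η p.2 ^ 2 * (trG' ε (V p) / δ) * ⟪D, w⟫)) +
      ENNReal.ofReal (4 * Λ ^ 3 / ε * (M / r) ^ 2) * errW ε t₀ x₀ r V p := by
  have hθ0 := hθ.nonneg p.1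
  have hG' := trG'_nonneg hε (V p)
  have hG := trG_nonneg hε (V p)
  have hη0 := hη.nonneg p.2
  have hW := trW_nonneg ε (V p)
  by_cases hp : p ∈ pCyl t₀ x₀ r
  · rw [errW, indicator_of_mem hp, ← ENNReal.ofReal_mul (by positivity)]
    refine ofReal_add_ofReal_neg_le (by positivity) (by positivity) ?_
    have h1 := (abs_le.1 (abs_fderiv_spaceCut_le hη hM hr p.2 w)).1
    have h2 : M / r * ‖w‖ ≤ M / r * (Λ * ‖D‖) := by gcongr
    have h3 : -(M / r * (Λ * ‖D‖)) ≤ fderiv ℝ η p.2 w := by linarith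
    have h4 := two_mul_mul_le_of_sq_le (k := (2 * Λ)⁻¹ * trG' ε (V p))
      (c := 4 * Λ / ε * trW ε (V p)) (G := trG ε (V p)) (x := η p.2 * (‖D‖ / δ))
      (y := M / r * Λ) (by positivity) (by positivity) ((trG_sq_le_trW hε hε1 _).trans_eq (by
        field_simp; ring))
    rw [real_inner_comm]
    have h5 : θ p.1 * (trG ε (V p) * (2 * η p.2 / δ) * -(M / r * (Λ * ‖D‖)) +
        η p.2 ^ 2 * (trG' ε (V p) / δ) / δ * (Λ⁻¹ * ‖D‖ ^ 2)) ≤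
        θ p.1 * (trG ε (V p) * (2 * η p.2 / δ) * fderiv ℝ η p.2 w +
        η p.2 ^ 2 * (trG' ε (V p) / δ) / δ * ⟪w, D⟫) := by gcongr
    have h6 : θ p.1 * (4 * Λ / ε * trW ε (V p) * (M / r * Λ) ^ 2) ≤
        1 * (4 * Λ / ε * trW ε (V p) * (M / r * Λ) ^ 2) := by
      gcongr; exact hθ.le_one _
    have h7 := mul_le_mul_of_nonneg_left h4 hθ0
    have e1 : θ p.1 * (trG ε (V p) * (2 * η p.2 / δ) * fderiv ℝ η p.2 w +
        η p.2 ^ 2 * (trG' ε (V p) / δ) / δ * ⟪w, D⟫) =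
        δ⁻¹ * (trG ε (V p) * (θ p.1 * (2 * η p.2 * fderiv ℝ η p.2 w)) +
        θ p.1 * η p.2 ^ 2 * (trG' ε (V p) / δ) * ⟪w, D⟫) := by ring
    have e2 : (2 * Λ)⁻¹ = Λ⁻¹ / 2 := by rw [mul_inv]; ring
    have e3 : 1 * (4 * Λ / ε * trW ε (V p) * (M / r * Λ) ^ 2) =
        4 * Λ ^ 3 / ε * (M / r) ^ 2 * trW ε (V p) := by ring
    have e4 : θ p.1 * (trG ε (V p) * (2 * η p.2 / δ) * -(M / r * (Λ * ‖D‖)) +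
        η p.2 ^ 2 * (trG' ε (V p) / δ) / δ * (Λ⁻¹ * ‖D‖ ^ 2)) =
        2 * (θ p.1 * (Λ⁻¹ / 2 * trG' ε (V p) * (η p.2 * (‖D‖ / δ)) ^ 2)) -
        θ p.1 * (2 * (η p.2 * (‖D‖ / δ)) * (M / r * Λ) * trG ε (V p)) := by ring
    rw [e4] at h5
    rw [e1] at h5
    rw [e3] at h6
    rw [e2] at h7 ⊢
    have e5 : Λ⁻¹ / 2 * (θ p.1 * η p.2 ^ 2 * trG' ε (V p) * (‖D‖ / δ) ^ 2) =
      θ p.1 * (Λ⁻¹ / 2 * trG' ε (V p) * (η p.2 * (‖D‖ / δ)) ^ 2) := by ring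
    rw [e5]
    linarith
  · have h0 : θ p.1 = 0 ∨ η p.2 = 0 := by
      by_cases ht : p.1 ∈ Iminus t₀ r
      · exact .inr (hη.zero _ fun hc => hp ⟨ht, closedBall_subset_ball (by linarith) hc⟩)
      · exact .inl (hθ.zero _ fun hc => ht ⟨by nlinarith [hc.1], hc.2.trans_lt hr2⟩)
    rcases h0 with h0 | h0 <;> simp [h0]

/-- The Caccioppoli inequality for the truncations of a solution. -/
theorem CylSol.caccioppoli_cut (h : CylSol s Λ K ν t₀ x₀ R u Du a) [IsFiniteMeasure ν]
    (hC : nearC d s ≠ ∞) (hK : KernelHyp d s Λ K) (hΛ : 1 ≤ Λ) (hs : 0 < s) (hε : 0 < ε)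
    (hε1 : ε ≤ 1 / 2) (hr : 0 < r) (hr1 : r ≤ 1) (hrR : r < R) (hM : 0 ≤ M)
    (hη : SpaceCut x₀ r M η) (hθ : TimeCut t₀ r M t₂ θ β χ) (ht₂ : t₂ < t₀) {l δ : ℝ} (hl : 0 ≤ l)
    (hδ : 0 < δ) (hV : ∀ p, V p = (u p - l) / δ) :
    (∫⁻ p, ENNReal.ofReal (χ p.1 * η p.2 ^ 2 * trPsi ε (V p))) +
      ∫⁻ p, ENNReal.ofReal ((2 * Λ)⁻¹ * (θ p.1 * η p.2 ^ 2 * trG' ε (V p) * (‖Du p‖ / δ) ^ 2)) ≤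
    (∫⁻ p, ENNReal.ofReal (M / r ^ 2) * errW ε t₀ x₀ r V p) +
      (∫⁻ p, ENNReal.ofReal (4 * Λ ^ 3 / ε * (M / r) ^ 2) * errW ε t₀ x₀ r V p) +
      (∫⁻ z, errJ s ε t₀ x₀ r V (4 / ε * (M / r) ^ 2 * Λ) (Λ * 4 ^ ((d : ℝ) + 2 * s)) z) +
      ENNReal.ofReal (δ⁻¹ * (ν (pCyl t₀ x₀ r)).toReal) := by
  have hVm : V = fun p => (u p - l) / δ := funext hV
  obtain ⟨i3, i2, i1, hle⟩ := h.energy hC hK hΛ hs (r := r) (r₁ := 3 / 4 * r)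
    (t₁ := t₀ - 3 / 4 * r ^ 2) (t₂ := t₂) (by nlinarith) ht₂ (by positivity) (by linarith) hr1 hrR
    (isSmoothCut_cut hη hθ) (by
      intro p hp
      rw [mem_prod, not_and_or] at hp
      rcases hp with hp | hp
      · simp [hθ.zero _ hp]
      · simp [hη.zero _ hp]) (isLipC1_trG_scaled hε hε1 l hδ) (fun v => trG_nonneg hε _)
    (fun v => trG_le_one _) (Ψ := fun v => δ * trPsi ε ((v - l) / δ)) (fun v => by
      refine (((hasDerivAt_trPsi ε ((v - l) / δ)).comp v
        (((hasDerivAt_id v).sub_const l).div_const δ)).const_mul δ).congr_deriv ?_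
      field_simp)
    (by
      rw [trPsi_of_nonpos, mul_zero]
      exact div_nonpos_of_nonpos_of_nonneg (by linarith) hδ.le)
  have hδ' : 0 ≤ δ⁻¹ := by positivity
  have i1' := (i1.const_mul δ⁻¹).neg
  have i2' := i2.const_mul δ⁻¹
  have i3' := i3.const_mul δ⁻¹
  refine lintegral_le_of_integral_add_le i1' i2' i3' (by positivity) ?_ (fun p => ?_) (fun p => ?_)
    (fun z => ?_)
  · have := mul_le_mul_of_nonneg_left hle hδ'
    simp only [Pi.neg_apply, integral_neg, integral_const_mul]
    linarith
  · have e : (-fun x : ℝ × Ed d => δ⁻¹ * (fderiv ℝ (fun p : ℝ × Ed d =>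
        θ p.1 * η p.2 ^ 2) x (1, 0) * (δ * trPsi ε ((u x - l) / δ)))) p =
        -((β p.1 - χ p.1) * η p.2 ^ 2 * trPsi ε (V p)) := by
      rw [Pi.neg_apply, fderiv_cut_apply hη hθ, hV]
      simp only [map_zero, mul_zero, add_zero, mul_one]
      field_simp
    rw [e]
    exact time_err hη hθ hM hr hε p
  · have e : δ⁻¹ * ⟪cutG (fun p : ℝ × Ed d => θ p.1 * η p.2 ^ 2) (fun v => trG ε ((v - l) / δ))
        (fun v => trG' ε ((v - l) / δ) / δ) u Du p, a p⟫ =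
        δ⁻¹ * (trG ε (V p) * (θ p.1 * (2 * η p.2 * fderiv ℝ η p.2 (a p))) +
        θ p.1 * η p.2 ^ 2 * (trG' ε (V p) / δ) * ⟪Du p, a p⟫) := by
      rw [cutG, inner_add_left, real_inner_smul_left, real_inner_smul_left, inner_gradx,
        fderiv_cut_apply hη hθ, ← hV]
      simp
    rw [e]
    exact space_err hη hθ hM hr ht₂ hε hε1 hΛ hδ p (h.growth p) (h.coercive p)
  · have e : δ⁻¹ * jumpI K u (fun p => θ p.1 * η p.2 ^ 2 * trG ε ((u p - l) / δ)) z =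
        jumpI K V (fun p => θ p.1 * η p.2 ^ 2 * trG ε (V p)) z := by
      simp only [jumpI, hVm]
      ring
    rw [e]
    refine (jump_err hK hΛ hs hε hε1 hr hr1 hη hθ ht₂ V z).trans ?_
    exact le_add_left le_rfl

end Caccioppoli

section EnergyBounds

/-- A function whose means against smooth probability densities are bounded by `B` is bounded by
`B` almost everywhere. -/
lemma ae_le_of_forall_lintegral_bump {f : ℝ → ℝ≥0∞} {c e : ℝ} (hf : Measurable f)
    (hfi : ∫⁻ t in Ioo c e, f t ≠ ∞) {B : ℝ≥0∞} (hB : B ≠ ∞)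
    (h : ∀ a b, c ≤ a → a < b → b < e → ∀ ψ : ℝ → ℝ, ContDiff ℝ (⊤ : ℕ∞) ψ → (∀ t, 0 ≤ ψ t) →
      (∀ t, t ∉ Ioo a b → ψ t = 0) → ∫ t, ψ t = 1 → ∫⁻ t, ENNReal.ofReal (ψ t) * f t ≤ B) :
    ∀ᵐ t, t ∈ Ioo c e → f t ≤ B := by
  have hfm : Measurable ((Ioo c e).indicator f) := hf.indicator measurableSet_Ioo
  rw [← lintegral_indicator measurableSet_Ioo] at hfi
  set g : ℝ → ℝ := fun t => ((Ioo c e).indicator f t).toReal with hg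
  have hgi : Integrable g := integrable_toReal_of_lintegral_ne_top hfm.aemeasurable hfi
  let φ : ℕ → ContDiffBump (0 : ℝ) := fun n =>
    ⟨1 / (2 * ((n : ℝ) + 1)), 1 / ((n : ℝ) + 1), by positivity, by
      apply one_div_lt_one_div_of_lt (by positivity); linarith [(n.cast_nonneg : (0 : ℝ) ≤ n)]⟩
  have hφ : Tendsto (fun n => (φ n).rOut) atTop (𝓝 0) := tendsto_one_div_add_atTop_nhds_zero_nat
  have hφ2 : ∀ᶠ n in atTop, (φ n).rOut ≤ 2 * (φ n).rIn := Eventually.of_forall fun n => by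
    change 1 / ((n : ℝ) + 1) ≤ 2 * (1 / (2 * ((n : ℝ) + 1)))
    apply le_of_eq; field_simp
  have hconv := ContDiffBump.ae_convolution_tendsto_right_of_locallyIntegrable (μ := volume)
    hφ hφ2 hgi.locallyIntegrable
  filter_upwards [hconv, ae_lt_top hfm hfi] with τ hτ hfin hτI
  rw [indicator_of_mem hτI] at hfin
  have hgτ : g τ = (f τ).toReal := by simp only [hg, indicator_of_mem hτI]
  suffices g τ ≤ B.toReal by
    rwa [hgτ, ENNReal.toReal_le_toReal hfin.ne hB] at this
  refine le_of_tendsto hτ ?_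
  have hsmall : 0 < min (τ - c) (e - τ) := lt_min (by linarith [hτI.1]) (by linarith [hτI.2])
  filter_upwards [hφ.eventually (gt_mem_nhds hsmall)] with n hn
  have hn1 := hn.trans_le (min_le_left _ _)
  have hn2 := hn.trans_le (min_le_right _ _)
  have hpos := (φ n).rOut_pos
  set ψ : ℝ → ℝ := fun t => (φ n).normed volume (τ - t) with hψ
  have hψ0 : ∀ t, 0 ≤ ψ t := fun t => (φ n).nonneg_normed _
  have hψi : ∫ t, ψ t = 1 := by
    rw [hψ, integral_sub_left_eq_self (fun t => (φ n).normed volume t) volume τ]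
    exact (φ n).integral_normed
  have key := h (τ - (φ n).rOut) (τ + (φ n).rOut) (by linarith) (by linarith) (by linarith) ψ
    ((φ n).contDiff_normed.comp (contDiff_const.sub contDiff_id)) hψ0 (fun t ht => by
      have : τ - t ∉ Function.support ((φ n).normed volume) := by
        rw [(φ n).support_normed_eq, mem_ball, dist_zero_right, Real.norm_eq_abs, abs_lt]
        exact fun hc => ht ⟨by linarith [hc.2], by linarith [hc.1]⟩
      simpa using this) hψi
  have e1 : (convolution ((φ n).normed volume) g (ContinuousLinearMap.lsmul ℝ ℝ) volume) τ =
      ∫ t, ψ t * g t := by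
    rw [convolution_def, ← integral_sub_left_eq_self (fun t => ψ t * g t) volume τ]
    refine integral_congr_ae (Eventually.of_forall fun t => ?_)
    simp [hψ]
  rw [e1]
  have hψc : Continuous ψ := (φ n).continuous_normed.comp (continuous_const.sub continuous_id)
  rw [integral_eq_lintegral_of_nonneg_ae (Eventually.of_forall fun t =>
    mul_nonneg (hψ0 t) ENNReal.toReal_nonneg)
    (hψc.aestronglyMeasurable.mul hgi.aestronglyMeasurable)]
  refine ENNReal.toReal_mono hB (le_trans (lintegral_mono fun t => ?_) key)
  dsimp only
  rw [ENNReal.ofReal_mul (hψ0 t)]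
  gcongr
  refine ENNReal.ofReal_toReal_le.trans ?_
  exact indicator_le_self _ _ _

/-- The total error in the Caccioppoli inequality. -/
def errY (s ε t₀ : ℝ) (x₀ : Ed d) (r δ : ℝ) (ν : Measure (ℝ × Ed d)) (V : ℝ × Ed d → ℝ) : ℝ≥0∞ :=
  ENNReal.ofReal (1 / r ^ 2) * (∫⁻ p, errW ε t₀ x₀ r V p) +
    ENNReal.ofReal (r ^ d) * (∫⁻ p, errF s t₀ x₀ r V p) +
    ENNReal.ofReal δ⁻¹ * ν (pCyl t₀ x₀ r)

lemma caccioppoli_error_le {s Λ ε M : ℝ} (hΛ : 1 ≤ Λ) (hε : 0 < ε) (hM : 0 ≤ M)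
    (hC : nearC d s ≠ ∞) :
    ∃ C : ℝ≥0∞, C ≠ ∞ ∧ ∀ (ν : Measure (ℝ × Ed d)) [IsFiniteMeasure ν] (t₀ : ℝ) (x₀ : Ed d)
      (r δ : ℝ) (V : ℝ × Ed d → ℝ), 0 < r → 0 < δ → Measurable V →
      (∫⁻ p, ENNReal.ofReal (M / r ^ 2) * errW ε t₀ x₀ r V p) +
        (∫⁻ p, ENNReal.ofReal (4 * Λ ^ 3 / ε * (M / r) ^ 2) * errW ε t₀ x₀ r V p) +
        (∫⁻ z, errJ s ε t₀ x₀ r V (4 / ε * (M / r) ^ 2 * Λ) (Λ * 4 ^ ((d : ℝ) + 2 * s)) z) +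
        ENNReal.ofReal (δ⁻¹ * (ν (pCyl t₀ x₀ r)).toReal) ≤ C * errY s ε t₀ x₀ r δ ν V := by
  set c₁ := ENNReal.ofReal M + ENNReal.ofReal (4 * Λ ^ 3 / ε * M ^ 2) +
    ENNReal.ofReal (4 / ε * M ^ 2 * Λ) * (2 * nearC d s)
  set c₂ := ENNReal.ofReal (Λ * 4 ^ ((d : ℝ) + 2 * s)) * (2 * volume (ball (0 : Ed d) 1))
  have hv : volume (ball (0 : Ed d) 1) ≠ ∞ := measure_ball_lt_top.ne
  have hc₁ : c₁ ≠ ∞ := by finiteness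
  have hc₂ : c₂ ≠ ∞ := by finiteness
  refine ⟨c₁ + c₂ + 1, by finiteness, fun ν _ t₀ x₀ r δ V hr hδ hV => ?_⟩
  have hW := measurable_errW (ε := ε) (t₀ := t₀) (x₀ := x₀) (r := r) hV
  rw [lintegral_const_mul _ hW, lintegral_const_mul _ hW, lintegral_errJ hV,
    Measure.addHaar_ball_of_pos _ _ hr, finrank_euclideanSpace_fin,
    ENNReal.ofReal_mul (inv_nonneg.2 hδ.le), ENNReal.ofReal_toReal (measure_ne_top _ _)]
  have e1 : M / r ^ 2 = M * (1 / r ^ 2) := by ring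
  have e2 : 4 * Λ ^ 3 / ε * (M / r) ^ 2 = 4 * Λ ^ 3 / ε * M ^ 2 * (1 / r ^ 2) := by ring
  have e3 : 4 / ε * (M / r) ^ 2 * Λ = 4 / ε * M ^ 2 * Λ * (1 / r ^ 2) := by ring
  rw [e1, e2, e3, ENNReal.ofReal_mul hM, ENNReal.ofReal_mul (p := 4 * Λ ^ 3 / ε * M ^ 2)
    (by positivity), ENNReal.ofReal_mul (p := 4 / ε * M ^ 2 * Λ) (by positivity)]
  unfold errY
  generalize ENNReal.ofReal (1 / r ^ 2) = A
  generalize (∫⁻ p, errW ε t₀ x₀ r V p) = W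
  generalize (∫⁻ p, errF s t₀ x₀ r V p) = F
  generalize ENNReal.ofReal (r ^ d) = P
  generalize ENNReal.ofReal δ⁻¹ * ν (pCyl t₀ x₀ r) = N
  calc _ = c₁ * (A * W) + c₂ * (P * F) + 1 * N := by simp only [c₁, c₂]; ring
    _ ≤ (c₁ + c₂ + 1) * (A * W) + (c₁ + c₂ + 1) * (P * F) + (c₁ + c₂ + 1) * N := by
      gcongr
      · exact le_add_right le_self_add
      · exact le_add_right le_add_self
      · exact le_add_self
    _ = _ := by ring

end EnergyBounds

section EnergyBounds

lemma SpaceCut.mono {x₀ : Ed d} {r M M' : ℝ} {η : Ed d → ℝ} (h : SpaceCut x₀ r M η) (hM : M ≤ M')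
    (hr : 0 < r) : SpaceCut x₀ r M' η :=
  { h with lip := fun x y => (h.lip x y).trans (by gcongr) }

lemma TimeCut.mono {t₀ r M M' t₂ : ℝ} {θ β χ : ℝ → ℝ} (h : TimeCut t₀ r M t₂ θ β χ)
    (hM : M ≤ M') (hr : 0 < r) : TimeCut t₀ r M' t₂ θ β χ :=
  { h with beta_le := fun t => (h.beta_le t).trans (by gcongr) }

lemma exists_bump_Ioo {a b : ℝ} (hab : a < b) : ∃ ψ : ℝ → ℝ, ContDiff ℝ (⊤ : ℕ∞) ψ ∧
    (∀ t, 0 ≤ ψ t) ∧ (∀ t, t ∉ Ioo a b → ψ t = 0) ∧ ∫ t, ψ t = 1 := by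
  let φ : ContDiffBump ((a + b) / 2) :=
    ⟨(b - a) / 4, (b - a) / 2, by linarith, by linarith⟩
  refine ⟨φ.normed volume, φ.contDiff_normed, fun t => φ.nonneg_normed _, fun t ht => ?_,
    φ.integral_normed⟩
  have : t ∉ Function.support (φ.normed volume) := by
    rw [φ.support_normed_eq, mem_ball, Real.dist_eq, abs_lt]
    intro hc
    have h1 : -((b - a) / 2) < t - (a + b) / 2 := hc.1
    have h2 : t - (a + b) / 2 < (b - a) / 2 := hc.2
    exact ht ⟨by linarith, by linarith⟩
  simpa using this

lemma measurable_trPsi (ε : ℝ) : Measurable (trPsi ε) := (continuous_trPsi ε).measurable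

/-- Energy bounds for the truncations of a solution on the half-size cylinder. -/
theorem exists_energy_bound {s Λ ε : ℝ} (hΛ : 1 ≤ Λ) (hs : 0 < s) (hε : 0 < ε)
    (hε1 : ε ≤ 1 / 2) (hC : nearC d s ≠ ∞) :
    ∃ C : ℝ≥0∞, C ≠ ∞ ∧ ∀ (K : ℝ → Ed d → Ed d → ℝ), KernelHyp d s Λ K →
      ∀ (ν : Measure (ℝ × Ed d)) [IsFiniteMeasure ν] (t₀ : ℝ) (x₀ : Ed d) (R : ℝ)
      (u : ℝ × Ed d → ℝ) (Du a : ℝ × Ed d → Ed d), CylSol s Λ K ν t₀ x₀ R u Du a →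
      ∀ (r l δ : ℝ), 0 < r → r ≤ 1 → r < R → 0 ≤ l → 0 < δ → ∀ V : ℝ × Ed d → ℝ,
      (∀ p, V p = (u p - l) / δ) →
      (∀ᵐ τ, τ ∈ Ioo (t₀ - 1 / 4 * r ^ 2) t₀ →
        ∫⁻ x in closedBall x₀ (5 / 8 * r), ENNReal.ofReal (trPsi ε (V (τ, x))) ≤
          C * errY s ε t₀ x₀ r δ ν V) ∧
      ∫⁻ p in Ioo (t₀ - 1 / 4 * r ^ 2) t₀ ×ˢ closedBall x₀ (5 / 8 * r),
        ENNReal.ofReal (trG' ε (V p) * (‖Du p‖ / δ) ^ 2) ≤ C * errY s ε t₀ x₀ r δ ν V := by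
  obtain ⟨M₁, hM₁, hη⟩ := exists_spaceCut d
  obtain ⟨M₂, hM₂, hθ⟩ := exists_timeCut
  set M := max M₁ M₂
  have hM : 0 ≤ M := hM₁.trans (le_max_left _ _)
  obtain ⟨C, hCf, hCb⟩ := caccioppoli_error_le (s := s) hΛ hε hM hC
  refine ⟨ENNReal.ofReal (2 * Λ) * C, by finiteness, ?_⟩
  intro K hK ν _ t₀ x₀ R u Du a h r l δ hr hr1 hrR hl hδ V hV
  have hVm : Measurable V := by
    rw [show V = fun p => (u p - l) / δ from funext hV]
    exact (h.meas_u.sub_const l).div_const δ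
  set Y := errY s ε t₀ x₀ r δ ν V with hY
  have hCC : C * Y ≤ ENNReal.ofReal (2 * Λ) * C * Y := by
    rw [mul_assoc]
    exact le_mul_of_one_le_left' (by rw [← ENNReal.ofReal_one]; gcongr; linarith)
  obtain ⟨η, hη⟩ := hη x₀ r hr
  have hη' := hη.mono (le_max_left M₁ M₂) hr
  have main : ∀ a b, t₀ - 1 / 4 * r ^ 2 ≤ a → a < b → b < t₀ → ∀ ψ : ℝ → ℝ,
      ContDiff ℝ (⊤ : ℕ∞) ψ → (∀ t, 0 ≤ ψ t) → (∀ t, t ∉ Ioo a b → ψ t = 0) → ∫ t, ψ t = 1 →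
      ∃ θ : ℝ → ℝ, (∀ t ∈ Icc (t₀ - 1 / 4 * r ^ 2) a, θ t = 1) ∧
      (∫⁻ p : ℝ × Ed d, ENNReal.ofReal (ψ p.1 * η p.2 ^ 2 * trPsi ε (V p))) +
      ∫⁻ p, ENNReal.ofReal ((2 * Λ)⁻¹ * (θ p.1 * η p.2 ^ 2 * trG' ε (V p) * (‖Du p‖ / δ) ^ 2)) ≤
      C * Y := by
    intro a b ha hab hb ψ h1 h2 h3 h4
    obtain ⟨θ, β, hcut, hone⟩ := hθ t₀ r hr a b ha hab hb ψ h1 h2 h3 h4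
    exact ⟨θ, hone, (h.caccioppoli_cut hC hK hΛ hs hε hε1 hr hr1 hrR hM hη'
      (hcut.mono (le_max_right M₁ M₂) hr) hb hl hδ hV).trans (hCb ν t₀ x₀ r δ V hr hδ hVm)⟩
  have hPm : Measurable fun p => ENNReal.ofReal (trPsi ε (V p)) :=
    ((measurable_trPsi ε).comp hVm).ennreal_ofReal
  constructor
  · rcases eq_or_ne (C * Y) ∞ with hinf | hfin
    · refine Eventually.of_forall fun τ _ => ?_
      rw [hinf, top_le_iff] at hCC
      rw [hCC]
      exact le_top
    have hfm : Measurable fun τ => ∫⁻ x in closedBall x₀ (5 / 8 * r),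
        ENNReal.ofReal (trPsi ε (V (τ, x))) := hPm.lintegral_prod_right'
    refine (ae_le_of_forall_lintegral_bump hfm ?_ hfin ?_).mono fun τ hτ hI => (hτ hI).trans hCC
    · have hsub : Ioo (t₀ - 1 / 4 * r ^ 2) t₀ ×ˢ closedBall x₀ (5 / 8 * r) ⊆ pCyl t₀ x₀ R := by
        refine prod_mono (Ioo_subset_Ioo_left ?_) (closedBall_subset_ball (by linarith))
        nlinarith
      have hprod : Integrable (fun p => u p / δ)
          ((volume.restrict (Ioo (t₀ - 1 / 4 * r ^ 2) t₀)).prod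
            (volume.restrict (closedBall x₀ (5 / 8 * r)))) := by
        rw [Measure.prod_restrict]
        exact (h.integrableOn_u.mono_set hsub).div_const δ
      refine ((?_ : _ ≤ _).trans_lt hprod.hasFiniteIntegral).ne
      rw [lintegral_prod _ hprod.aestronglyMeasurable.enorm]
      refine lintegral_mono fun t => lintegral_mono fun x => ?_
      rw [Real.enorm_eq_ofReal_abs, abs_div, abs_of_pos hδ]
      refine ENNReal.ofReal_le_ofReal ((trPsi_le (ε := ε) _).trans (max_le ?_ (by positivity)))
      rw [hV]
      gcongr
      linarith [le_abs_self (u (t, x))]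
    · intro a b ha hab hb ψ h1 h2 h3 h4
      obtain ⟨θ, -, hle⟩ := main a b ha hab hb ψ h1 h2 h3 h4
      refine le_trans ?_ (le_self_add.trans hle)
      have hm : Measurable fun p : ℝ × Ed d => ENNReal.ofReal (ψ p.1 * η p.2 ^ 2 * trPsi ε (V p)) :=
        (((h1.continuous.measurable.comp measurable_fst).mul
          ((hη.smooth.continuous.measurable.comp measurable_snd).pow_const 2)).mul
          ((measurable_trPsi ε).comp hVm)).ennreal_ofReal
      rw [Measure.volume_eq_prod, lintegral_prod _ hm.aemeasurable]
      refine lintegral_mono fun t => ?_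
      dsimp only
      rw [← lintegral_const_mul' _ _ ENNReal.ofReal_ne_top,
        ← lintegral_indicator isClosed_closedBall.measurableSet]
      refine lintegral_mono fun x => ?_
      by_cases hx : x ∈ closedBall x₀ (5 / 8 * r)
      · rw [indicator_of_mem hx, hη.one x hx, ENNReal.ofReal_mul (by simpa using h2 t)]
        simp
      · simp [indicator_of_notMem hx]
  · set S : ℕ → Set (ℝ × Ed d) := fun n => Ioc (t₀ - 1 / 4 * r ^ 2)
      (t₀ - 1 / 4 * r ^ 2 / ((n : ℝ) + 1)) ×ˢ closedBall x₀ (5 / 8 * r) with hS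
    have hSU : Ioo (t₀ - 1 / 4 * r ^ 2) t₀ ×ˢ closedBall x₀ (5 / 8 * r) ⊆ ⋃ n, S n := by
      rintro p ⟨hp1, hp2⟩
      obtain ⟨n, hn⟩ := exists_nat_gt (1 / 4 * r ^ 2 / (t₀ - p.1))
      refine mem_iUnion.2 ⟨n, ⟨hp1.1, ?_⟩, hp2⟩
      have h0 : 0 < t₀ - p.1 := by linarith [hp1.2]
      rw [div_lt_iff₀ h0] at hn
      have : 1 / 4 * r ^ 2 / ((n : ℝ) + 1) ≤ t₀ - p.1 := by
        rw [div_le_iff₀ (by positivity)]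
        nlinarith
      linarith
    have hSm : Monotone S := fun m n hmn => by
      refine prod_mono (Ioc_subset_Ioc_right ?_) Subset.rfl
      gcongr
    have hSmeas : ∀ n, MeasurableSet (S n) := fun n =>
      measurableSet_Ioc.prod isClosed_closedBall.measurableSet
    refine (lintegral_mono_set hSU).trans ?_
    rw [setLIntegral_iUnion_of_directed _ hSm.directed_le]
    refine iSup_le fun n => ?_
    set τ := t₀ - 1 / 4 * r ^ 2 / ((n : ℝ) + 1) with hτ
    have hτ1 : τ < t₀ := by
      have : 0 < 1 / 4 * r ^ 2 / ((n : ℝ) + 1) := by positivity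
      linarith
    have hτ0 : t₀ - 1 / 4 * r ^ 2 ≤ τ := by
      have : 1 / 4 * r ^ 2 / ((n : ℝ) + 1) ≤ 1 / 4 * r ^ 2 :=
        div_le_self (by positivity) (by linarith [(n.cast_nonneg : (0 : ℝ) ≤ n)])
      linarith
    have hτ2 : τ < (τ + t₀) / 2 := by linarith
    obtain ⟨ψ, h1, h2, h3, h4⟩ := exists_bump_Ioo hτ2
    obtain ⟨θ, hone, hle⟩ := main τ ((τ + t₀) / 2) hτ0 hτ2 (by linarith) ψ h1 h2 h3 h4
    have hle' := (le_add_self.trans hle)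
    rw [mul_assoc]
    refine le_trans ?_ (mul_le_mul_right hle' (ENNReal.ofReal (2 * Λ)))
    rw [← lintegral_indicator (hSmeas n), ← lintegral_const_mul' _ _ ENNReal.ofReal_ne_top]
    refine lintegral_mono fun p => ?_
    by_cases hp : p ∈ S n
    · rw [indicator_of_mem hp, hη.one _ hp.2, hone _ ⟨hp.1.1.le, hp.1.2⟩, ← ENNReal.ofReal_mul
        (by positivity)]
      refine ENNReal.ofReal_le_ofReal (le_of_eq ?_)
      field_simp
    · simp [indicator_of_notMem hp]

end EnergyBounds

section SliceSobolev

variable {s Λ : ℝ} {K : ℝ → Ed d → Ed d → ℝ} {ν : Measure (ℝ × Ed d)}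
  {t₀ : ℝ} {x₀ : Ed d} {R : ℝ} {u : ℝ × Ed d → ℝ} {Du a : ℝ × Ed d → Ed d}
  {Z : ℝ × Ed d → ℝ} {g g' : ℝ → ℝ} {L : ℝ}

lemma eLpNorm_slice_le {f : ℝ × Ed d → ℝ} (hf : ContDiff ℝ 1 f) (hc : HasCompactSupport f)
    {p : ℝ≥0} (hp : NNReal.HolderConjugate d p) (t : ℝ) :
    eLpNorm (fun x => f (t, x)) p volume ≤
      eLpNormLESNormFDerivOneConst (volume : Measure (Ed d)) p * ∫⁻ x, ‖gradx f (t, x)‖ₑ := by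
  have hfin : Module.finrank ℝ (Ed d) = d := finrank_euclideanSpace_fin
  have hcs : HasCompactSupport fun x => f (t, x) :=
    HasCompactSupport.of_support_subset_isCompact
      (hc.isCompact.image continuous_snd) fun x hx => ⟨(t, x), subset_tsupport f hx, rfl⟩
  refine (eLpNorm_le_eLpNorm_fderiv_one volume (contDiff_slice hf t) hcs
    (by rwa [hfin])).trans (le_of_eq ?_)
  rw [eLpNorm_one_eq_lintegral_enorm]
  simp_rw [enorm_fderiv_slice hf]

lemma gradx_eq_zero_of_notMem_tsupport {f : ℝ × Ed d → ℝ} {p : ℝ × Ed d} (hp : p ∉ tsupport f) :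
    gradx f p = 0 := by
  rw [gradx, image_eq_zero_of_notMem_tsupport fun h => hp (tsupport_fderiv_subset ℝ h)]
  simp

/-- The Sobolev inequality on almost every time slice of a truncated solution. -/
lemma CylSol.ae_eLpNorm_slice_le (h : CylSol s Λ K ν t₀ x₀ R u Du a) (hZ : IsSmoothCut Z)
    (hZR : tsupport Z ⊆ pCyl t₀ x₀ R) (hg : IsLipC1 g g' L)
    {p : ℝ≥0} (hp : NNReal.HolderConjugate d p) :
    ∀ᵐ t, eLpNorm (fun x => Z (t, x) * g (cutU t₀ x₀ R u (t, x))) p volume ≤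
      eLpNormLESNormFDerivOneConst (volume : Measure (Ed d)) p *
        ∫⁻ x, ‖cutG Z g g' (cutU t₀ x₀ R u) (cutU t₀ x₀ R Du) (t, x)‖ₑ := by
  obtain ⟨δ, hδ, hδV⟩ := hZ.supp.isCompact.exists_cthickening_subset_open
    (isOpen_pCyl t₀ x₀ R) hZR
  obtain ⟨e, ρ, hm0⟩ := exists_isMolSeq h.memLp_cutU h.memLp_cutD
  obtain ⟨e, ρ, hm, he⟩ := hm0.exists_le hδ
  have hin : ∀ n p, Z p ≠ 0 → closedBall p (e n) ⊆ pCyl t₀ x₀ R := fun n p hp =>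
    (closedBall_subset_closedBall (he n)).trans
      ((closedBall_subset_cthickening (subset_tsupport Z hp) δ).trans hδV)
  set U := cutU t₀ x₀ R u with hU
  set D := cutU t₀ x₀ R Du with hD
  set W : ℕ → ℝ × Ed d → ℝ := fun n p => Z p * g (mol volume (ρ n) U p) with hW
  have hWc : ∀ n, ContDiff ℝ 1 (W n) := fun n => h.contDiff_cut (hm.isMol n) hZ hg
  have hWs : ∀ n, HasCompactSupport (W n) := fun n => hZ.supp.mul_right
  have hUm : Measurable U := h.meas_u.indicator (measurableSet_pCyl _ _ _)
  have hDm : Measurable D := h.meas_D.indicator (measurableSet_pCyl _ _ _)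
  have hGm : Measurable (cutG Z g g' U D) := measurable_cutG hZ hg hUm hDm
  set f : ℕ → ℝ → ℝ≥0∞ := fun n t => ∫⁻ x, ‖gradx (W n) (t, x) - cutG Z g g' U D (t, x)‖ₑ ^ 2
  have hdm : ∀ n, Measurable fun p => ‖gradx (W n) p - cutG Z g g' U D p‖ₑ ^ 2 := fun n =>
    (((continuous_gradx (hWc n)).measurable.sub hGm).enorm.pow_const 2)
  have hfm : ∀ n, Measurable (f n) := fun n => (hdm n).lintegral_prod_right'
  have hf : Tendsto (fun n => ∫⁻ t, f n t) atTop (𝓝 0) := by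
    refine (h.tendsto_gradx_cut hm hZ hin hg).congr fun n => ?_
    exact lintegral_prod _ (hdm n).aemeasurable
  obtain ⟨k, hk, hk2⟩ := extraction_forall_of_eventually fun m : ℕ =>
    hf.eventually_le_const (ENNReal.pow_pos (by simp : (0 : ℝ≥0∞) < 2⁻¹) m)
  have hae : ∀ᵐ t, Tendsto (fun n => f (k n) t) atTop (𝓝 0) :=
    ae_tendsto_zero_of_lintegral_le (fun n => (hfm _).aemeasurable) hk2
  have hUae := Measure.ae_ae_of_ae_prod (hm.ae_tendsto h.memLp_cutU)
  filter_upwards [hae, hUae] with t ht hUt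
  have hsl : Measurable fun x : Ed d => (t, x) := measurable_prodMk_left
  set S := ball x₀ R
  have hS : volume S ^ (1 / 2 : ℝ) ≠ ∞ :=
    ENNReal.rpow_ne_top_of_nonneg (by norm_num) measure_ball_lt_top.ne
  have hb : ∀ n, ∫⁻ x, ‖gradx (W n) (t, x)‖ₑ ≤
      (∫⁻ x, ‖cutG Z g g' U D (t, x)‖ₑ) + volume S ^ (1 / 2 : ℝ) * f n t ^ (1 / 2 : ℝ) := by
    intro n
    calc ∫⁻ x, ‖gradx (W n) (t, x)‖ₑ
        ≤ ∫⁻ x, (‖cutG Z g g' U D (t, x)‖ₑ +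
          S.indicator (fun _ => 1) x * ‖gradx (W n) (t, x) - cutG Z g g' U D (t, x)‖ₑ) := by
          refine lintegral_mono fun x => ?_
          by_cases hx : x ∈ S
          · simp only [indicator_of_mem hx, one_mul]
            calc ‖gradx (W n) (t, x)‖ₑ
                = ‖cutG Z g g' U D (t, x) + (gradx (W n) (t, x) - cutG Z g g' U D (t, x))‖ₑ := by
                  rw [add_sub_cancel]
              _ ≤ _ := enorm_add_le _ _
          · have : (t, x) ∉ tsupport (W n) := fun hc =>
              hx (hZR ((tsupport_mul_subset_left) hc)).2
            simp [gradx_eq_zero_of_notMem_tsupport this]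
      _ = (∫⁻ x, ‖cutG Z g g' U D (t, x)‖ₑ) +
          ∫⁻ x, S.indicator (fun _ => 1) x * ‖gradx (W n) (t, x) - cutG Z g g' U D (t, x)‖ₑ :=
          lintegral_add_left (hGm.comp hsl).enorm _
      _ ≤ _ := by
          gcongr
          refine (ENNReal.lintegral_mul_le_Lp_mul_Lq volume Real.HolderConjugate.two_two
            (measurable_const.indicator measurableSet_ball).aemeasurable
            ((((continuous_gradx (hWc n)).measurable.sub hGm).comp
              hsl).enorm).aemeasurable).trans (le_of_eq ?_)
          congr 2
          · rw [← lintegral_indicator_one measurableSet_ball]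
            refine lintegral_congr fun x => ?_
            by_cases hx : x ∈ S <;> simp [hx, S]
          · simp [f]
  have hlim : Tendsto (fun n => (eLpNormLESNormFDerivOneConst (volume : Measure (Ed d)) p : ℝ≥0∞) *
      ((∫⁻ x, ‖cutG Z g g' U D (t, x)‖ₑ) + volume S ^ (1 / 2 : ℝ) * f (k n) t ^ (1 / 2 : ℝ)))
      atTop (𝓝 (eLpNormLESNormFDerivOneConst (volume : Measure (Ed d)) p *
        ((∫⁻ x, ‖cutG Z g g' U D (t, x)‖ₑ) + volume S ^ (1 / 2 : ℝ) * 0 ^ (1 / 2 : ℝ)))) := by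
    refine ENNReal.Tendsto.const_mul (tendsto_const_nhds.add (ENNReal.Tendsto.const_mul
      ((ENNReal.continuous_rpow_const.tendsto 0).comp ht) (Or.inr hS))) (Or.inr ENNReal.coe_ne_top)
  have hlim0 := hlim.liminf_eq
  rw [ENNReal.zero_rpow_of_pos (by norm_num), mul_zero, add_zero] at hlim0
  rw [← hlim0]
  refine (Lp.eLpNorm_lim_le_liminf_eLpNorm (f := fun n x => W (k n) (t, x)) (fun n =>
    ((hWc _).continuous.comp (by fun_prop)).aestronglyMeasurable) _ ?_).trans ?_
  · filter_upwards [hUt] with x hx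
    exact ((hg.continuous.tendsto _).comp (hx.comp hk.tendsto_atTop)).const_mul (Z (t, x))
  · refine liminf_le_liminf (Eventually.of_forall fun n => ?_)
    exact (eLpNorm_slice_le (hWc _) (hWs _) hp t).trans (by gcongr; exact hb _)

end SliceSobolev

section SliceTruncation

variable {s Λ : ℝ} {K : ℝ → Ed d → Ed d → ℝ} {ν : Measure (ℝ × Ed d)}
  {t₀ : ℝ} {x₀ : Ed d} {R : ℝ} {u : ℝ × Ed d → ℝ} {Du a : ℝ × Ed d → Ed d} {M ε : ℝ}

lemma isLipC1_trF_scaled (hε : 0 < ε) (hε1 : ε ≤ 1 / 2) (l : ℝ) {δ : ℝ} (hδ : 0 < δ) :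
    IsLipC1 (fun v => trF ε ((v - l) / δ)) (fun v => trF' ε ((v - l) / δ) / δ) (1 / δ) where
  deriv v := by
    refine ((hasDerivAt_trF ε ((v - l) / δ)).comp v
      (((hasDerivAt_id v).sub_const l).div_const δ)).congr_deriv ?_
    ring
  cont := ((continuous_trF' ε).comp (by fun_prop)).div_const _
  bound v := by
    rw [abs_div, abs_of_pos hδ, abs_of_nonneg (trF'_nonneg hε hε1 _)]
    gcongr
    exact trF'_le_one hε hε1 _

lemma norm_gradx_prod_le {η : Ed d → ℝ} {θ : ℝ → ℝ} {ρ : ℝ} (hη : SpaceCut x₀ ρ M η) (hM : 0 ≤ M)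
    (hρ : 0 < ρ) (hθ : ContDiff ℝ (⊤ : ℕ∞) θ) (h0 : ∀ t, 0 ≤ θ t) (h1 : ∀ t, θ t ≤ 1)
    (p : ℝ × Ed d) : ‖gradx (fun p : ℝ × Ed d => θ p.1 * η p.2) p‖ ≤ M / ρ := by
  have hd1 : HasFDerivAt (fun p : ℝ × Ed d => θ p.1) _ p :=
    ((hθ.differentiable (by simp)) p.1).hasFDerivAt.comp p hasFDerivAt_fst
  have hd2 : HasFDerivAt (fun p : ℝ × Ed d => η p.2) _ p :=
    ((hη.smooth.differentiable (by simp)) p.2).hasFDerivAt.comp p hasFDerivAt_snd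
  have hd := (hd1.mul hd2).fderiv
  change fderiv ℝ (fun p : ℝ × Ed d => θ p.1 * η p.2) p = _ at hd
  rw [gradx, LinearIsometryEquiv.norm_map]
  refine ContinuousLinearMap.opNorm_le_bound _ (by positivity) fun v => ?_
  have hv : fderiv ℝ (fun p : ℝ × Ed d => θ p.1 * η p.2) p (0, v) = θ p.1 * fderiv ℝ η p.2 v := by
    rw [hd]; simp
  simp only [ContinuousLinearMap.comp_apply, ContinuousLinearMap.inr_apply, hv, norm_mul,
    Real.norm_eq_abs, abs_of_nonneg (h0 _)]
  calc θ p.1 * |fderiv ℝ η p.2 v| ≤ 1 * (M / ρ * ‖v‖) := by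
        gcongr
        · exact h1 _
        · exact abs_fderiv_spaceCut_le hη hM hρ _ _
    _ = _ := one_mul _

/-- The Sobolev inequality for the truncations `trF` on almost every time slice. -/
lemma CylSol.ae_eLpNorm_trF_le (h : CylSol s Λ K ν t₀ x₀ R u Du a) (hε : 0 < ε) (hε1 : ε ≤ 1 / 2)
    {r l δ : ℝ} (hr : 0 < r) (hrR : r < R) (hδ : 0 < δ) (hM : 0 ≤ M) {η : Ed d → ℝ}
    (hη : SpaceCut x₀ (5 / 6 * r) M η) {V : ℝ × Ed d → ℝ} (hV : ∀ p, V p = (u p - l) / δ)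
    {p : ℝ≥0} (hp : NNReal.HolderConjugate d p) :
    ∀ᵐ t, t ∈ Ioo (t₀ - 1 / 4 * r ^ 2) t₀ →
      eLpNorm (fun x => η x * trF ε (V (t, x))) p volume ≤
      eLpNormLESNormFDerivOneConst (volume : Measure (Ed d)) p *
        ((∫⁻ x in closedBall x₀ (5 / 8 * r), ENNReal.ofReal (M / (5 / 6 * r) * trF ε (V (t, x)))) +
        ∫⁻ x in closedBall x₀ (5 / 8 * r),
          ENNReal.ofReal (trF' ε (V (t, x)) * (‖Du (t, x)‖ / δ))) := by
  set J := Ioo (t₀ - 1 / 4 * r ^ 2) t₀ with hJ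
  have hJR : J ⊆ Iminus t₀ R := Ioo_subset_Ioo_left (by nlinarith)
  have hBR : closedBall x₀ (5 / 8 * r) ⊆ ball x₀ R := closedBall_subset_ball (by linarith)
  have hθ : ∀ n : ℕ, ∃ f : ℝ → ℝ, ContDiff ℝ (⊤ : ℕ∞) f ∧ HasCompactSupport f ∧ (∀ p, 0 ≤ f p) ∧
      (∀ p, f p ≤ 1) ∧ (∀ p ∈ Icc (t₀ - 1 / 4 * r ^ 2 + 1 / ((n : ℝ) + 1))
        (t₀ - 1 / ((n : ℝ) + 1)), f p = 1) ∧ tsupport f ⊆ J := fun n => by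
    refine exists_smooth_cutoff isCompact_Icc isOpen_Ioo fun x hx => ?_
    have : 0 < 1 / ((n : ℝ) + 1) := by positivity
    exact ⟨by linarith [hx.1], by linarith [hx.2]⟩
  choose θ hθs hθc hθ0 hθ1 hθone hθJ using hθ
  have hVm : Measurable V := by
    rw [show V = fun p => (u p - l) / δ from funext hV]
    exact (h.meas_u.sub_const l).div_const δ
  have hg := isLipC1_trF_scaled hε hε1 l hδ
  have hts : ∀ n, tsupport (fun p : ℝ × Ed d => θ n p.1 * η p.2) ⊆
      tsupport (θ n) ×ˢ closedBall x₀ (5 / 8 * r) := fun n => by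
    refine closure_minimal (fun p hp => ⟨subset_tsupport _ fun hc => hp (by simp [hc]), ?_⟩)
      ((isClosed_tsupport _).prod isClosed_closedBall)
    by_contra hc
    refine hp ?_
    simp [hη.zero p.2 (by rwa [show 3 / 4 * (5 / 6 * r) = 5 / 8 * r by ring])]
  have hZ : ∀ n, IsSmoothCut fun p : ℝ × Ed d => θ n p.1 * η p.2 := fun n =>
    { smooth := ((hθs n).comp contDiff_fst).mul (hη.smooth.comp contDiff_snd)
      supp := ((hθc n).isCompact.prod (isCompact_closedBall x₀ _)).of_isClosed_subset
        (isClosed_tsupport _) (hts n)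
      nonneg := fun p => mul_nonneg (hθ0 _ _) (hη.nonneg _)
      le_one := fun p => mul_le_one₀ (hθ1 _ _) (hη.nonneg _) (hη.le_one _) }
  have hall := ae_all_iff.2 fun n => h.ae_eLpNorm_slice_le (hZ n)
    ((hts n).trans (prod_mono ((hθJ n).trans hJR) hBR)) hg hp
  filter_upwards [hall] with t ht htJ
  obtain ⟨n, hn⟩ := exists_nat_one_div_lt
    (show 0 < min (t - (t₀ - 1 / 4 * r ^ 2)) (t₀ - t) from
      lt_min (by linarith [htJ.1]) (by linarith [htJ.2]))
  have hθt : θ n t = 1 := hθone n t ⟨by linarith [hn.trans_le (min_le_left _ _)],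
    by linarith [hn.trans_le (min_le_right _ _)]⟩
  have hcut : ∀ x ∈ closedBall x₀ (5 / 8 * r), cutU t₀ x₀ R u (t, x) = u (t, x) ∧
      cutU t₀ x₀ R Du (t, x) = Du (t, x) := fun x hx => by
    have : (t, x) ∈ pCyl t₀ x₀ R := ⟨hJR htJ, hBR hx⟩
    exact ⟨indicator_of_mem this _, indicator_of_mem this _⟩
  have hη0 : ∀ x ∉ closedBall x₀ (5 / 8 * r), η x = 0 := fun x hx =>
    hη.zero x (by rwa [show 3 / 4 * (5 / 6 * r) = 5 / 8 * r by ring])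
  have e1 : (fun x => η x * trF ε (V (t, x))) =
      fun x => θ n t * η x * trF ε ((cutU t₀ x₀ R u (t, x) - l) / δ) := by
    ext x
    by_cases hx : x ∈ closedBall x₀ (5 / 8 * r)
    · rw [(hcut x hx).1, hV, hθt, one_mul]
    · simp [hη0 x hx]
  rw [e1]
  refine (ht n).trans ?_
  gcongr
  have hm1 : Measurable fun x => ENNReal.ofReal (M / (5 / 6 * r) * trF ε (V (t, x))) :=
    (measurable_const.mul (((continuous_trF ε).measurable.comp hVm).comp
      measurable_prodMk_left)).ennreal_ofReal
  rw [← lintegral_add_left hm1, ← lintegral_indicator isClosed_closedBall.measurableSet]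
  refine lintegral_mono fun x => ?_
  by_cases hx : x ∈ closedBall x₀ (5 / 8 * r)
  · have hF := trF_nonneg hε hε1 (V (t, x))
    have hF' := trF'_nonneg hε hε1 (V (t, x))
    rw [indicator_of_mem hx, ← ENNReal.ofReal_add (by positivity) (by positivity), ← ofReal_norm]
    refine ENNReal.ofReal_le_ofReal ?_
    rw [cutG, (hcut x hx).1, (hcut x hx).2, ← hV]
    refine (norm_add_le _ _).trans ?_
    rw [norm_smul, norm_smul, Real.norm_of_nonneg hF, Real.norm_of_nonneg
      (mul_nonneg (mul_nonneg (hθ0 _ _) (hη.nonneg _)) (by positivity)), hθt, one_mul]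
    refine add_le_add ?_ ?_
    · rw [mul_comm]
      gcongr
      exact norm_gradx_prod_le hη hM (by positivity) (hθs n) (hθ0 n) (hθ1 n) _
    · calc η x * (trF' ε (V (t, x)) / δ) * ‖Du (t, x)‖
          ≤ 1 * (trF' ε (V (t, x)) / δ) * ‖Du (t, x)‖ := by
            gcongr
            exact hη.le_one x
        _ = _ := by ring
  · have : (t, x) ∉ tsupport (fun p : ℝ × Ed d => θ n p.1 * η p.2) := fun hc => hx (hts n hc).2
    simp [cutG, gradx_eq_zero_of_notMem_tsupport this, hη0 x hx]

end SliceTruncation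

section SobolevGain

lemma rpow_add_le_of_sq_le {A B N c X : ℝ≥0∞} {p : ℝ} (hp0 : 0 ≤ p) (hp : p ≤ 2) (hc : 1 ≤ c)
    (hA : A ≤ N * c) (hB : B ^ 2 ≤ N ^ 2 * c ^ 2 * X) :
    (A + B) ^ p ≤ N ^ p * (2 * c ^ 2 * (1 + X)) := by
  set Y := X ^ (1 / 2 : ℝ) with hY
  have hYX : Y ^ 2 = X := by
    rw [hY, ← ENNReal.rpow_natCast, ← ENNReal.rpow_mul]; norm_num
  have hB' : B ≤ N * c * Y := by
    rw [← ENNReal.pow_le_pow_left_iff two_ne_zero]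
    calc B ^ 2 ≤ N ^ 2 * c ^ 2 * X := hB
      _ = _ := by rw [← hYX]; ring
  have h2 : (1 + Y) ^ (2 : ℝ) ≤ 2 * (1 + X) := by
    have := ENNReal.rpow_add_le_mul_rpow_add_rpow 1 Y (p := 2) (by norm_num)
    refine this.trans (le_of_eq ?_)
    rw [ENNReal.rpow_two Y, hYX]
    norm_num
  calc (A + B) ^ p ≤ (N * (c * (1 + Y))) ^ p := by
        refine ENNReal.rpow_le_rpow ?_ hp0
        calc A + B ≤ N * c + N * c * Y := add_le_add hA hB'
          _ = _ := by ring
    _ = N ^ p * (c * (1 + Y)) ^ p := ENNReal.mul_rpow_of_nonneg _ _ hp0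
    _ ≤ N ^ p * (c * (1 + Y)) ^ (2 : ℝ) := by
        gcongr
        exact one_le_mul hc le_self_add
    _ = N ^ p * (c ^ 2 * (1 + Y) ^ (2 : ℝ)) := by
        rw [ENNReal.mul_rpow_of_nonneg _ _ (by norm_num), ENNReal.rpow_two c]
    _ ≤ N ^ p * (c ^ 2 * (2 * (1 + X))) := by gcongr
    _ = _ := by ring

variable {s Λ : ℝ} {K : ℝ → Ed d → Ed d → ℝ} {ν : Measure (ℝ × Ed d)}
  {t₀ : ℝ} {x₀ : Ed d} {R : ℝ} {u : ℝ × Ed d → ℝ} {Du a : ℝ × Ed d → Ed d}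

lemma lintegral_trF'_sq_le {α : Type*} [MeasurableSpace α] {μ : Measure α} {ε : ℝ} (hε : 0 < ε)
    (hε1 : ε ≤ 1 / 2) {v y : α → ℝ} (hv : Measurable v) (hy : Measurable y) :
    (∫⁻ x, ENNReal.ofReal (trF' ε (v x) * y x) ∂μ) ^ 2 ≤
      ENNReal.ofReal (9 / (ε * trG ε 1)) * (∫⁻ x, ENNReal.ofReal (trPsi ε (v x)) ∂μ) *
        ∫⁻ x, ENNReal.ofReal (trG' ε (v x) * y x ^ 2) ∂μ := by
  have hG := trG_one_pos hε
  have hk : 0 ≤ 9 / (ε * trG ε 1) := by positivity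
  have hP := fun x => trPsi_nonneg hε (v x)
  have hG' := fun x => trG'_nonneg hε (v x)
  have m1 : Measurable fun x => ENNReal.ofReal (√(9 / (ε * trG ε 1) * trPsi ε (v x))) :=
    (measurable_const.mul ((measurable_trPsi ε).comp hv)).sqrt.ennreal_ofReal
  have m2 : Measurable fun x => ENNReal.ofReal (√(trG' ε (v x) * y x ^ 2)) :=
    ((((continuous_trG' ε).measurable.comp hv).mul (hy.pow_const 2))).sqrt.ennreal_ofReal
  calc _ ≤ (∫⁻ x, ENNReal.ofReal (√(9 / (ε * trG ε 1) * trPsi ε (v x))) *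
        ENNReal.ofReal (√(trG' ε (v x) * y x ^ 2)) ∂μ) ^ 2 := by
        gcongr with x
        rw [← ENNReal.ofReal_mul (Real.sqrt_nonneg _), ← Real.sqrt_mul (mul_nonneg hk (hP x))]
        refine ENNReal.ofReal_le_ofReal (Real.le_sqrt_of_sq_le ?_)
        rw [mul_pow, ← mul_assoc]
        gcongr
        rw [mul_assoc]
        exact trF'_sq_le hε hε1 _
    _ ≤ _ := lintegral_mul_sq_le μ m1.aemeasurable m2.aemeasurable
    _ = _ := by
        simp_rw [← ENNReal.ofReal_pow (Real.sqrt_nonneg _)]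
        rw [← lintegral_const_mul' _ _ ENNReal.ofReal_ne_top]
        congr 1
        · refine lintegral_congr fun x => ?_
          rw [Real.sq_sqrt (mul_nonneg hk (hP x)), ENNReal.ofReal_mul hk]
        · refine lintegral_congr fun x => ?_
          rw [Real.sq_sqrt (mul_nonneg (hG' x) (sq_nonneg _))]

/-- The gain of integrability for truncations of a solution with bounded energy. -/
theorem exists_trF_bound (hd : 2 ≤ d) {ε : ℝ} (hε : 0 < ε) (hε1 : ε ≤ 1 / 2) {p : ℝ≥0}
    (hp : NNReal.HolderConjugate d p) :
    ∃ C : ℝ≥0∞, C ≠ ∞ ∧ ∀ (s Λ : ℝ) (K : ℝ → Ed d → Ed d → ℝ) (ν : Measure (ℝ × Ed d))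
      (t₀ : ℝ) (x₀ : Ed d) (R : ℝ) (u : ℝ × Ed d → ℝ) (Du a : ℝ × Ed d → Ed d),
      CylSol s Λ K ν t₀ x₀ R u Du a → ∀ (r l δ e : ℝ), 0 < r → r < R → 0 < δ → 0 < e →
      ∀ V : ℝ × Ed d → ℝ, (∀ p, V p = (u p - l) / δ) →
      (∀ᵐ τ, τ ∈ Ioo (t₀ - 1 / 4 * r ^ 2) t₀ →
        ∫⁻ x in closedBall x₀ (5 / 8 * r), ENNReal.ofReal (trPsi ε (V (τ, x))) ≤
          ENNReal.ofReal e) →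
      ∫⁻ p in Ioo (t₀ - 1 / 4 * r ^ 2) t₀ ×ˢ closedBall x₀ (5 / 8 * r),
        ENNReal.ofReal (trG' ε (V p) * (‖Du p‖ / δ) ^ 2) ≤ ENNReal.ofReal e →
      ∫⁻ z in pCyl t₀ x₀ (r / 2), ENNReal.ofReal (trF ε (V z) ^ (p : ℝ)) ≤
        C * ENNReal.ofReal ((e / r) ^ (p : ℝ) * r ^ 2) := by
  obtain ⟨M, hM, hη⟩ := exists_spaceCut d
  have hG := trG_one_pos hε
  have hp0 : (0 : ℝ) < p := hp.coe.symm.pos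
  have hp2 : (p : ℝ) ≤ 2 := by
    have h1 := hp.coe.conjugate_eq
    have h2 : (2 : ℝ) ≤ d := by exact_mod_cast hd
    have h3 : (p : ℝ) = d / (d - 1) := by simpa using h1
    rw [h3, div_le_iff₀ (by linarith)]
    linarith
  set S : ℝ≥0∞ := ((eLpNormLESNormFDerivOneConst (volume : Measure (Ed d)) (p : ℝ) : ℝ≥0) : ℝ≥0∞)
    with hS
  set c : ℝ≥0∞ := 1 + ENNReal.ofReal (M / (5 / 6) * (1 / trG ε 1)) +
    ENNReal.ofReal (9 / (ε * trG ε 1)) with hc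
  have hc1 : 1 ≤ c := by rw [hc, add_assoc]; exact le_self_add
  have hcf : c ≠ ∞ := by finiteness
  have hSf : S ≠ ∞ := ENNReal.coe_ne_top
  refine ⟨S ^ (p : ℝ) * (2 * c ^ 2) * 2, by finiteness, ?_⟩
  intro s Λ K ν t₀ x₀ R u Du a h r l δ e hr hrR hδ he V hV hE hD
  have hVm : Measurable V := by
    rw [show V = fun p => (u p - l) / δ from funext hV]
    exact (h.meas_u.sub_const l).div_const δ
  obtain ⟨η, hη⟩ := hη x₀ (5 / 6 * r) (by positivity)
  set J := Ioo (t₀ - 1 / 4 * r ^ 2) t₀ with hJ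
  set B := closedBall x₀ (5 / 8 * r) with hB
  set Dt : ℝ → ℝ≥0∞ := fun t => ∫⁻ x in B, ENNReal.ofReal (trG' ε (V (t, x)) *
    (‖Du (t, x)‖ / δ) ^ 2) with hDt
  set N := ENNReal.ofReal (e / r) with hN
  have hDm : Measurable fun p => ENNReal.ofReal (trG' ε (V p) * (‖Du p‖ / δ) ^ 2) :=
    (((continuous_trG' ε).measurable.comp hVm).mul
      ((h.meas_D.norm.div_const δ).pow_const 2)).ennreal_ofReal
  have hDtm : Measurable Dt := hDm.lintegral_prod_right'
  have hDI : ∫⁻ t in J, Dt t ≤ ENNReal.ofReal e := by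
    rw [Measure.volume_eq_prod, ← Measure.prod_restrict, lintegral_prod _ hDm.aemeasurable] at hD
    exact hD
  have hslice : ∀ᵐ t, t ∈ J → ∫⁻ x in ball x₀ (r / 2), ENNReal.ofReal (trF ε (V (t, x)) ^ (p : ℝ)) ≤
      S ^ (p : ℝ) * (N ^ (p : ℝ) * (2 * c ^ 2 * (1 + ENNReal.ofReal (r ^ 2 / e) * Dt t))) := by
    filter_upwards [hE, h.ae_eLpNorm_trF_le hε hε1 hr hrR hδ hM hη hV hp] with t ht1 ht2 htJ
    specialize ht1 htJ
    specialize ht2 htJ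
    have hVt : Measurable fun x => V (t, x) := hVm.comp measurable_prodMk_left
    have hA : ∫⁻ x in B, ENNReal.ofReal (M / (5 / 6 * r) * trF ε (V (t, x))) ≤ N * c := by
      calc _ ≤ ∫⁻ x in B, ENNReal.ofReal (M / (5 / 6) * (1 / trG ε 1) / r) *
            ENNReal.ofReal (trPsi ε (V (t, x))) := by
            refine lintegral_mono fun x => ?_
            rw [← ENNReal.ofReal_mul (by positivity)]
            refine ENNReal.ofReal_le_ofReal ?_
            calc M / (5 / 6 * r) * trF ε (V (t, x))
                ≤ M / (5 / 6 * r) * (1 / trG ε 1 * trPsi ε (V (t, x))) := by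
                  gcongr
                  exact trF_le_trPsi hε hε1 _
              _ = _ := by field_simp
        _ ≤ ENNReal.ofReal (M / (5 / 6) * (1 / trG ε 1) / r) * ENNReal.ofReal e := by
            rw [lintegral_const_mul' _ _ ENNReal.ofReal_ne_top]
            gcongr
        _ = N * ENNReal.ofReal (M / (5 / 6) * (1 / trG ε 1)) := by
            rw [hN, ← ENNReal.ofReal_mul (by positivity), ← ENNReal.ofReal_mul (by positivity)]
            congr 1
            ring
        _ ≤ _ := by
            gcongr
            exact le_add_right le_add_self
    have hB2 : (∫⁻ x in B, ENNReal.ofReal (trF' ε (V (t, x)) * (‖Du (t, x)‖ / δ))) ^ 2 ≤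
        N ^ 2 * c ^ 2 * (ENNReal.ofReal (r ^ 2 / e) * Dt t) := by
      refine (lintegral_trF'_sq_le hε hε1 hVt
        ((h.meas_D.comp measurable_prodMk_left).norm.div_const δ)).trans ?_
      calc _ ≤ c ^ 2 * ENNReal.ofReal e * Dt t := by
            gcongr
            · calc ENNReal.ofReal (9 / (ε * trG ε 1)) ≤ c := le_add_self
                _ ≤ c ^ 2 := le_self_pow₀ hc1 two_ne_zero
            · exact le_rfl
        _ = _ := by
            have : N ^ 2 * ENNReal.ofReal (r ^ 2 / e) = ENNReal.ofReal e := by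
              rw [hN, ← ENNReal.ofReal_pow (by positivity), ← ENNReal.ofReal_mul (by positivity)]
              congr 1
              field_simp
            rw [← this]
            ring
    calc ∫⁻ x in ball x₀ (r / 2), ENNReal.ofReal (trF ε (V (t, x)) ^ (p : ℝ))
        ≤ ∫⁻ x, ‖η x * trF ε (V (t, x))‖ₑ ^ (p : ℝ) := by
          rw [← lintegral_indicator measurableSet_ball]
          refine lintegral_mono fun x => ?_
          by_cases hx : x ∈ ball x₀ (r / 2)
          · have hF := trF_nonneg hε hε1 (V (t, x))
            rw [indicator_of_mem hx, hη.one x, one_mul, Real.enorm_of_nonneg hF,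
              ENNReal.ofReal_rpow_of_nonneg hF hp0.le]
            exact closedBall_subset_closedBall (by linarith) (ball_subset_closedBall hx)
          · simp [hx]
      _ = eLpNorm (fun x => η x * trF ε (V (t, x))) p volume ^ (p : ℝ) :=
          (eLpNorm_nnreal_pow_eq_lintegral (by exact_mod_cast hp0.ne')).symm
      _ ≤ _ := by
          refine (ENNReal.rpow_le_rpow ht2 hp0.le).trans ?_
          rw [ENNReal.mul_rpow_of_nonneg _ _ hp0.le]
          gcongr
          exact rpow_add_le_of_sq_le hp0.le hp2 hc1 hA hB2
  have hFm : Measurable fun z => ENNReal.ofReal (trF ε (V z) ^ (p : ℝ)) :=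
    (((continuous_trF ε).measurable.comp hVm).pow_const _).ennreal_ofReal
  have hQ : pCyl t₀ x₀ (r / 2) = J ×ˢ ball x₀ (r / 2) := by
    rw [pCyl, Iminus, hJ]; congr 3; ring
  rw [hQ, Measure.volume_eq_prod, ← Measure.prod_restrict, lintegral_prod _ hFm.aemeasurable]
  refine (lintegral_mono_ae ((ae_restrict_iff' measurableSet_Ioo).2 hslice)).trans ?_
  have hDr : Measurable fun t => ENNReal.ofReal (r ^ 2 / e) * Dt t := hDtm.const_mul _
  rw [lintegral_const_mul _ (((hDr.const_add 1).const_mul _).const_mul _),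
    lintegral_const_mul _ ((hDr.const_add 1).const_mul _), lintegral_const_mul _ (hDr.const_add 1),
    lintegral_add_left measurable_const, lintegral_const_mul _ hDtm, setLIntegral_one,
    Real.volume_Ioo]
  have hsum : ENNReal.ofReal (t₀ - (t₀ - 1 / 4 * r ^ 2)) +
      ENNReal.ofReal (r ^ 2 / e) * ∫⁻ t in J, Dt t ≤ 2 * ENNReal.ofReal (r ^ 2) := by
    calc _ ≤ ENNReal.ofReal (r ^ 2) + ENNReal.ofReal (r ^ 2 / e) * ENNReal.ofReal e := by
          gcongr
          nlinarith
      _ = _ := by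
          rw [← ENNReal.ofReal_mul (by positivity), div_mul_cancel₀ _ he.ne', two_mul]
  calc _ ≤ S ^ (p : ℝ) * (N ^ (p : ℝ) * (2 * c ^ 2 * (2 * ENNReal.ofReal (r ^ 2)))) := by gcongr
    _ = _ := by
      rw [ENNReal.ofReal_mul (by positivity),
        ← ENNReal.ofReal_rpow_of_nonneg (by positivity) hp0.le, ← hN]
      ring

end SobolevGain

section LevelDecay

lemma ofReal_rpow_le_of_trF {ε p C : ℝ} (hε : 0 < ε) (hε1 : ε ≤ 1 / 2) (hC : 0 < C)
    (hb : ∀ v, 2 ≤ v → v ^ (1 + ε) ≤ C * trF ε v ^ p) (v : ℝ) :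
    ENNReal.ofReal v ^ (1 + ε) ≤
      (if 0 < v then 4 else 0) + ENNReal.ofReal C * ENNReal.ofReal (trF ε v ^ p) := by
  have hF := trF_nonneg hε hε1 v
  rcases le_or_gt v 0 with h0 | h0
  · rw [ENNReal.ofReal_of_nonpos h0, ENNReal.zero_rpow_of_pos (by linarith)]
    exact zero_le
  rw [if_pos h0]
  rcases le_or_gt 2 v with h2 | h2
  · rw [ENNReal.ofReal_rpow_of_nonneg h0.le (by linarith), ← ENNReal.ofReal_mul hC.le]
    exact (ENNReal.ofReal_le_ofReal (hb v h2)).trans le_add_self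
  · refine le_add_right ?_
    calc ENNReal.ofReal v ^ (1 + ε) ≤ (2 : ℝ≥0∞) ^ (1 + ε) := by
          gcongr
          exact ENNReal.ofReal_le_of_le_toReal (by simpa using h2.le)
      _ ≤ (2 : ℝ≥0∞) ^ (2 : ℝ) := by
          gcongr
          · norm_num
          · linarith
      _ = 4 := by
          rw [ENNReal.rpow_two]; norm_num

/-- Decay of the superlevel energy of a solution whose normalised error is small. -/
theorem exists_level_decay {s Λ ε : ℝ} (hd : 2 ≤ d) (hΛ : 1 ≤ Λ) (hs : 0 < s) (hs1 : s < 1)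
    (hε : 0 < ε) (hε1 : ε ≤ 1 / 2) {p : ℝ≥0} (hp : NNReal.HolderConjugate d p)
    (hεp : 1 + ε ≤ (1 - ε) * p) :
    ∃ C : ℝ, 0 < C ∧ ∀ (K : ℝ → Ed d → Ed d → ℝ), KernelHyp d s Λ K →
      ∀ (ν : Measure (ℝ × Ed d)) [IsFiniteMeasure ν] (t₀ : ℝ) (x₀ : Ed d) (R : ℝ)
      (u : ℝ × Ed d → ℝ) (Du a : ℝ × Ed d → Ed d), CylSol s Λ K ν t₀ x₀ R u Du a →
      ∀ (r l δ M : ℝ), 0 < r → r ≤ 1 → r < R → 0 ≤ l → 0 < δ → 0 < M →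
      errY s ε t₀ x₀ r δ ν (fun p => (u p - l) / δ) ≤ ENNReal.ofReal (M * r ^ d) →
      ∫⁻ z in pCyl t₀ x₀ (r / 2), ENNReal.ofReal ((u z - l) / δ) ^ (1 + ε) ≤
        4 * volume (pCyl t₀ x₀ (r / 2) ∩ {z | 0 < (u z - l) / δ}) +
          ENNReal.ofReal (C * M ^ (p : ℝ) * r ^ (d + 2)) := by
  obtain ⟨C₁, hC₁, hb₁⟩ := exists_energy_bound (d := d) hΛ hs hε hε1 (nearC_lt_top hd hs1).ne
  obtain ⟨C₂, hC₂, hb₂⟩ := exists_trF_bound hd hε hε1 hp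
  obtain ⟨C₃, hC₃, hb₃⟩ := exists_rpow_le_trF hε hε1 hεp
  set c₁ := C₁.toReal + 1 with hc₁
  have hc₁0 : 0 < c₁ := by positivity
  have hC₁c : C₁ ≤ ENNReal.ofReal c₁ := by
    rw [hc₁, ENNReal.ofReal_add ENNReal.toReal_nonneg zero_le_one, ENNReal.ofReal_toReal hC₁]
    exact le_self_add
  refine ⟨C₃ * (C₂.toReal + 1) * c₁ ^ (p : ℝ), by positivity, ?_⟩
  intro K hK ν _ t₀ x₀ R u Du a h r l δ M hr hr1 hrR hl hδ hM hY
  set V : ℝ × Ed d → ℝ := fun p => (u p - l) / δ with hV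
  have hVm : Measurable V := (h.meas_u.sub_const l).div_const δ
  obtain ⟨e₁, e₂⟩ := hb₁ K hK ν t₀ x₀ R u Du a h r l δ hr hr1 hrR hl hδ V fun _ => rfl
  have hYe : C₁ * errY s ε t₀ x₀ r δ ν V ≤ ENNReal.ofReal (c₁ * (M * r ^ d)) := by
    rw [ENNReal.ofReal_mul hc₁0.le]
    exact mul_le_mul' hC₁c hY
  have hF := hb₂ s Λ K ν t₀ x₀ R u Du a h r l δ (c₁ * (M * r ^ d)) hr hrR hδ (by positivity) V
    (fun _ => rfl) (e₁.mono fun τ hτ hJ => (hτ hJ).trans hYe) (e₂.trans hYe)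
  have hFm : Measurable fun z => ENNReal.ofReal (trF ε (V z) ^ (p : ℝ)) :=
    (((continuous_trF ε).measurable.comp hVm).pow_const _).ennreal_ofReal
  have hS : MeasurableSet {z | 0 < V z} := measurableSet_lt measurable_const hVm
  calc _ ≤ ∫⁻ z in pCyl t₀ x₀ (r / 2), (({z | 0 < V z}.indicator (fun _ => (4 : ℝ≥0∞)) z) +
        ENNReal.ofReal C₃ * ENNReal.ofReal (trF ε (V z) ^ (p : ℝ))) := by
        refine lintegral_mono fun z => ?_
        simpa [indicator_apply] using ofReal_rpow_le_of_trF hε hε1 hC₃ hb₃ (V z)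
    _ = 4 * volume (pCyl t₀ x₀ (r / 2) ∩ {z | 0 < V z}) +
        ENNReal.ofReal C₃ * ∫⁻ z in pCyl t₀ x₀ (r / 2), ENNReal.ofReal (trF ε (V z) ^ (p : ℝ)) := by
        rw [lintegral_add_left (measurable_const.indicator hS), lintegral_const_mul _ hFm,
          lintegral_indicator_const hS, Measure.restrict_apply hS, inter_comm]
    _ ≤ _ := by
        gcongr
        calc _ ≤ ENNReal.ofReal C₃ * (C₂ *
              ENNReal.ofReal ((c₁ * (M * r ^ d) / r) ^ (p : ℝ) * r ^ 2)) := by gcongr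
          _ ≤ ENNReal.ofReal C₃ * (ENNReal.ofReal (C₂.toReal + 1) *
              ENNReal.ofReal ((c₁ * (M * r ^ d) / r) ^ (p : ℝ) * r ^ 2)) := by
              gcongr
              rw [ENNReal.ofReal_add ENNReal.toReal_nonneg zero_le_one, ENNReal.ofReal_toReal hC₂]
              exact le_self_add
          _ = _ := by
              rw [← ENNReal.ofReal_mul (by positivity), ← ENNReal.ofReal_mul (by positivity)]
              congr 1
              have hrp : (r ^ d / r) ^ (p : ℝ) = r ^ d := by
                have h1 : ((d : ℝ) - 1) * p = d := by
                  have := hp.coe.mul_eq_add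
                  push_cast at this
                  linarith
                have : r ^ d / r = r ^ ((d : ℝ) - 1) := by
                  rw [Real.rpow_sub_one hr.ne', Real.rpow_natCast]
                rw [this, ← Real.rpow_mul hr.le, h1, Real.rpow_natCast]
              have : c₁ * (M * r ^ d) / r = c₁ * (M * (r ^ d / r)) := by ring
              rw [this, Real.mul_rpow hc₁0.le (by positivity), Real.mul_rpow hM.le (by positivity),
                hrp]
              ring

end LevelDecay

section IterationStep

variable {s Λ ε : ℝ} {K : ℝ → Ed d → Ed d → ℝ} {ν : Measure (ℝ × Ed d)}
  {t₀ : ℝ} {x₀ : Ed d} {R : ℝ} {u : ℝ × Ed d → ℝ} {Du a : ℝ × Ed d → Ed d}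

/-- The normalised superlevel `(u - l)₊ / δ`. -/
def lvl (u : ℝ × Ed d → ℝ) (l δ : ℝ) (p : ℝ × Ed d) : ℝ≥0∞ := ENNReal.ofReal ((u p - l) / δ)

lemma measurable_lvl (hu : Measurable u) (l δ : ℝ) : Measurable (lvl u l δ) :=
  ((hu.sub_const l).div_const δ).ennreal_ofReal

/-- The tail of the normalised superlevel at time `t`. -/
def lvlTail (s : ℝ) (x₀ : Ed d) (u : ℝ × Ed d → ℝ) (l δ r t : ℝ) : ℝ≥0∞ :=
  ENNReal.ofReal (r ^ 2) * ∫⁻ y in (ball x₀ r)ᶜ, lvl u l δ (t, y) * farK s x₀ y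

lemma measurable_lvl_mul_farK (hu : Measurable u) (l δ : ℝ) :
    Measurable fun p : ℝ × Ed d => lvl u l δ p * farK s x₀ p.2 :=
  (measurable_lvl hu l δ).mul ((measurable_farK s x₀).comp measurable_snd)

lemma measurable_lvlTail (hu : Measurable u) (l δ r : ℝ) :
    Measurable (lvlTail s x₀ u l δ r) :=
  (Measurable.lintegral_prod_right' (ν := volume.restrict (ball x₀ r)ᶜ)
    (measurable_lvl_mul_farK hu l δ)).const_mul _

lemma lvl_add_le {l m δ δ' k : ℝ} (hm : 0 ≤ m) (hδ : 0 < δ) (hk : 0 < k) (h : k * δ ≤ δ')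
    (p : ℝ × Ed d) : lvl u (l + m) δ' p ≤ ENNReal.ofReal k⁻¹ * lvl u l δ p := by
  have hδ' : 0 < δ' := (mul_pos hk hδ).trans_le h
  unfold lvl
  rw [← ENNReal.ofReal_mul (by positivity)]
  rcases le_or_gt (u p - (l + m)) 0 with h0 | h0
  · rw [ENNReal.ofReal_of_nonpos (div_nonpos_of_nonpos_of_nonneg h0 hδ'.le)]
    exact zero_le
  · refine ENNReal.ofReal_le_ofReal ?_
    calc (u p - (l + m)) / δ' ≤ (u p - (l + m)) / (k * δ) := by gcongr
      _ ≤ (u p - l) / (k * δ) := by gcongr; linarith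
      _ = _ := by field_simp

lemma trW_shift_le (hε : 0 < ε) (hε1 : ε ≤ 1) {θ w : ℝ} (hθ : 0 < θ) (hθ1 : θ ≤ 1) :
    ENNReal.ofReal (trW ε ((w - 1) / θ)) ≤
      ENNReal.ofReal (θ ^ 2)⁻¹ * ENNReal.ofReal w ^ (1 + ε) := by
  unfold trW
  split_ifs with h
  · have hw : 1 < w := by
      by_contra! hw
      exact absurd h (not_lt.2 (div_nonpos_of_nonpos_of_nonneg (by linarith) hθ.le))
    have hw0 : 0 < w := by linarith
    rw [ENNReal.ofReal_rpow_of_nonneg hw0.le (by linarith), ← ENNReal.ofReal_mul (by positivity)]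
    refine ENNReal.ofReal_le_ofReal ?_
    calc (1 + (w - 1) / θ) ^ (1 + ε) ≤ (w / θ) ^ (1 + ε) := by
          refine Real.rpow_le_rpow (by positivity) ?_ (by linarith)
          rw [← sub_nonneg]
          have : w / θ - (1 + (w - 1) / θ) = (1 - θ) / θ := by field_simp; ring
          rw [this]
          exact div_nonneg (by linarith) hθ.le
      _ = (θ ^ (1 + ε))⁻¹ * w ^ (1 + ε) := by
          rw [Real.div_rpow hw0.le hθ.le]; field_simp
      _ ≤ (θ ^ 2)⁻¹ * w ^ (1 + ε) := by
          gcongr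
          rw [← Real.rpow_two]
          exact Real.rpow_le_rpow_of_exponent_ge hθ hθ1 (by linarith)
  · simp

lemma le_add_rpow_mul_rpow (hε : 0 < ε) {b : ℝ} (hb : 0 < b) (T : ℝ≥0∞) :
    T ≤ ENNReal.ofReal b + ENNReal.ofReal (b ^ (-ε)) * T ^ (1 + ε) := by
  rcases eq_or_ne T ∞ with rfl | hT
  · rw [ENNReal.top_rpow_of_pos (by linarith), ENNReal.mul_top]
    · simp
    · rw [Ne, ENNReal.ofReal_eq_zero, not_le]; positivity
  lift T to ℝ≥0 using hT
  rcases le_total (T : ℝ) b with h | h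
  · refine le_add_right ?_
    rw [← ENNReal.ofReal_coe_nnreal]
    exact ENNReal.ofReal_le_ofReal h
  · refine le_add_left ?_
    have hT0 : (0 : ℝ) < T := hb.trans_le h
    rw [← ENNReal.ofReal_coe_nnreal, ENNReal.ofReal_rpow_of_nonneg hT0.le (by linarith),
      ← ENNReal.ofReal_mul (by positivity)]
    refine ENNReal.ofReal_le_ofReal ?_
    calc (T : ℝ) = 1 * T := (one_mul _).symm
      _ ≤ (b ^ (-ε) * (T : ℝ) ^ ε) * T := by
          gcongr
          rw [Real.rpow_neg hb.le, ← div_eq_inv_mul, one_le_div (by positivity)]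
          exact Real.rpow_le_rpow hb.le h hε.le
      _ = _ := by rw [Real.rpow_one_add' hT0.le (by linarith)]; ring

lemma errY_lvl_le (hε : 0 < ε) (hε1 : ε ≤ 1) (hu : Measurable u) {r l δ θ b D : ℝ} (hr : 0 < r)
    (hδ : 0 < δ) (hθ : 0 < θ) (hθ1 : θ ≤ 1) (hb : 0 < b) (hb1 : b ≤ 1) (hD : 0 ≤ D)
    (hA : ∫⁻ z in pCyl t₀ x₀ r, lvl u l δ z ^ (1 + ε) ≤
      ENNReal.ofReal (b ^ (1 + ε) * r ^ (d + 2)))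
    (hT : ∫⁻ t in Iminus t₀ r, lvlTail s x₀ u l δ r t ^ (1 + ε) ≤
      ENNReal.ofReal (D * b ^ (1 + ε) * r ^ 2))
    (hν : ν (pCyl t₀ x₀ r) ≤ ENNReal.ofReal (b * δ * r ^ d)) :
    errY s ε t₀ x₀ r (θ * δ) ν (fun p => (u p - (l + δ)) / (θ * δ)) ≤
      ENNReal.ofReal ((3 + D) * b / θ ^ 2 * r ^ d) := by
  have e0 : ∀ p, (u p - (l + δ)) / (θ * δ) = ((u p - l) / δ - 1) / θ := fun p => by
    field_simp; ring
  have hθ2 : θ ^ 2 ≤ θ := by nlinarith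
  have hbb : b ^ (1 + ε) ≤ b := by
    simpa using Real.rpow_le_rpow_of_exponent_ge hb hb1 (show (1 : ℝ) ≤ 1 + ε by linarith)
  have h1 : ENNReal.ofReal (1 / r ^ 2) *
      (∫⁻ p, errW ε t₀ x₀ r (fun p => (u p - (l + δ)) / (θ * δ)) p) ≤
      ENNReal.ofReal (b / θ ^ 2 * r ^ d) := by
    calc _ ≤ ENNReal.ofReal (1 / r ^ 2) * (ENNReal.ofReal (θ ^ 2)⁻¹ *
          ENNReal.ofReal (b ^ (1 + ε) * r ^ (d + 2))) := by
          gcongr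
          unfold errW
          rw [lintegral_indicator (measurableSet_pCyl _ _ _)]
          refine le_trans ?_ (mul_le_mul_right hA _)
          rw [← lintegral_const_mul' _ _ ENNReal.ofReal_ne_top]
          refine lintegral_mono fun p => ?_
          dsimp only
          rw [e0]
          exact trW_shift_le hε hε1 hθ hθ1
      _ = ENNReal.ofReal (b ^ (1 + ε) / θ ^ 2 * r ^ d) := by
          rw [← ENNReal.ofReal_mul (by positivity), ← ENNReal.ofReal_mul (by positivity)]
          congr 1
          field_simp
          ring
      _ ≤ _ := by gcongr
  have h2 : ENNReal.ofReal (r ^ d) *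
      (∫⁻ p, errF s t₀ x₀ r (fun p => (u p - (l + δ)) / (θ * δ)) p) ≤
      ENNReal.ofReal ((1 + D) * b / θ ^ 2 * r ^ d) := by
    have hm := measurable_lvl_mul_farK (s := s) (x₀ := x₀) hu l δ
    have e1 : ∫⁻ t in Iminus t₀ r, lvlTail s x₀ u l δ r t ≤
        ENNReal.ofReal ((1 + D) * b * r ^ 2) := by
      calc _ ≤ ∫⁻ t in Iminus t₀ r, (ENNReal.ofReal b + ENNReal.ofReal (b ^ (-ε)) *
            lvlTail s x₀ u l δ r t ^ (1 + ε)) :=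
            lintegral_mono fun t => le_add_rpow_mul_rpow hε hb _
        _ = ENNReal.ofReal b * ENNReal.ofReal (r ^ 2) + ENNReal.ofReal (b ^ (-ε)) *
            ∫⁻ t in Iminus t₀ r, lvlTail s x₀ u l δ r t ^ (1 + ε) := by
            rw [lintegral_add_left measurable_const,
              lintegral_const_mul' _ _ ENNReal.ofReal_ne_top, setLIntegral_const, Iminus,
              Real.volume_Ioo, sub_sub_cancel]
        _ ≤ ENNReal.ofReal b * ENNReal.ofReal (r ^ 2) + ENNReal.ofReal (b ^ (-ε)) *
            ENNReal.ofReal (D * b ^ (1 + ε) * r ^ 2) := by gcongr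
        _ = _ := by
            rw [← ENNReal.ofReal_mul (by positivity), ← ENNReal.ofReal_mul (by positivity),
              ← ENNReal.ofReal_add (by positivity) (by positivity)]
            congr 1
            have : b ^ (-ε) * b ^ (1 + ε) = b := by
              rw [← Real.rpow_add hb]; simp
            linear_combination D * r ^ 2 * this
    calc _ ≤ ENNReal.ofReal (r ^ d) * (ENNReal.ofReal (θ⁻¹ * (r ^ 2)⁻¹) *
          ENNReal.ofReal ((1 + D) * b * r ^ 2)) := by
          gcongr
          refine le_trans ?_ (mul_le_mul_right e1 _)
          rw [← lintegral_const_mul' _ _ ENNReal.ofReal_ne_top]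
          unfold errF
          rw [Iminus, lintegral_indicator (measurableSet_Ioo.prod measurableSet_ball.compl),
            Measure.volume_eq_prod, ← Measure.prod_restrict]
          calc _ ≤ ∫⁻ p, ENNReal.ofReal θ⁻¹ * (lvl u l δ p * farK s x₀ p.2)
                ∂((volume.restrict (Ioo (t₀ - r ^ 2) t₀)).prod (volume.restrict (ball x₀ r)ᶜ)) := by
                refine lintegral_mono fun p => ?_
                rw [← mul_assoc]
                gcongr
                simpa [lvl] using lvl_add_le (u := u) (l := l) hδ.le hδ hθ le_rfl p
            _ = ∫⁻ t in Ioo (t₀ - r ^ 2) t₀, ∫⁻ y in (ball x₀ r)ᶜ,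
                ENNReal.ofReal θ⁻¹ * (lvl u l δ (t, y) * farK s x₀ y) :=
                lintegral_prod _ (hm.const_mul _).aemeasurable
            _ = _ := by
                refine lintegral_congr fun t => ?_
                rw [lintegral_const_mul' _ _ ENNReal.ofReal_ne_top, lvlTail, ← mul_assoc,
                  ← ENNReal.ofReal_mul (by positivity)]
                congr 2
                field_simp
      _ = ENNReal.ofReal ((1 + D) * b / θ * r ^ d) := by
          rw [← ENNReal.ofReal_mul (by positivity), ← ENNReal.ofReal_mul (by positivity)]
          congr 1
          field_simp
      _ ≤ _ := by gcongr
  have h3 : ENNReal.ofReal (θ * δ)⁻¹ * ν (pCyl t₀ x₀ r) ≤ ENNReal.ofReal (b / θ ^ 2 * r ^ d) := by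
    calc _ ≤ ENNReal.ofReal (θ * δ)⁻¹ * ENNReal.ofReal (b * δ * r ^ d) := by gcongr
      _ = ENNReal.ofReal (b / θ * r ^ d) := by
          rw [← ENNReal.ofReal_mul (by positivity)]
          congr 1
          field_simp
      _ ≤ _ := by gcongr
  unfold errY
  refine (add_le_add (add_le_add h1 h2) h3).trans (le_of_eq ?_)
  rw [← ENNReal.ofReal_add (by positivity) (by positivity),
    ← ENNReal.ofReal_add (by positivity) (by positivity)]
  congr 1
  ring

end IterationStep

section IterationStep

variable {s Λ ε : ℝ} {K : ℝ → Ed d → Ed d → ℝ} {ν : Measure (ℝ × Ed d)}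
  {t₀ : ℝ} {x₀ : Ed d} {R : ℝ} {u : ℝ × Ed d → ℝ} {Du a : ℝ × Ed d → Ed d}

lemma pCyl_mono {t₀ : ℝ} {x₀ : Ed d} {r R : ℝ} (hr : 0 ≤ r) (h : r ≤ R) :
    pCyl t₀ x₀ r ⊆ pCyl t₀ x₀ R :=
  prod_mono (Ioo_subset_Ioo_left (by nlinarith)) (ball_subset_ball h)

lemma volume_superlevel_le (hε : 0 < ε) (hu : Measurable u) {r l δ k : ℝ} (hr : 0 < r)
    (hδ : 0 < δ) (hk : 0 < k) :
    volume (pCyl t₀ x₀ (r / 2) ∩ {z | 0 < (u z - (l + δ)) / k}) ≤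
      ∫⁻ z in pCyl t₀ x₀ r, lvl u l δ z ^ (1 + ε) := by
  have hS : MeasurableSet {z | 0 < (u z - (l + δ)) / k} :=
    measurableSet_lt measurable_const ((hu.sub_const _).div_const _)
  rw [← setLIntegral_one]
  refine (setLIntegral_mono' ((measurableSet_pCyl _ _ _).inter hS) fun z hz => ?_).trans
    (lintegral_mono_set (inter_subset_left.trans (pCyl_mono (by linarith) (by linarith))))
  refine ENNReal.one_le_rpow ?_ (by linarith)
  rw [lvl, ENNReal.one_le_ofReal, one_le_div hδ]
  have := (div_pos_iff_of_pos_right hk).1 hz.2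
  linarith

lemma lintegral_lvl_step (hε : 0 < ε) (hu : Measurable u) {p : ℝ} {r l δ δ' θ b D C : ℝ}
    (hr : 0 < r) (hδ : 0 < δ) (hδ' : δ / 2 ≤ δ') (hθ : 0 < θ) (hθd : θ ≤ (1 / 2) ^ (d + 6))
    (hC : 0 < C) (hb : 0 < b) (hD : 0 ≤ D)
    (hbp : C * ((3 + D) * b / θ ^ 2) ^ p ≤ (1 / 2) ^ (d + 3) * b ^ (1 + ε))
    (hA : ∫⁻ z in pCyl t₀ x₀ r, lvl u l δ z ^ (1 + ε) ≤
      ENNReal.ofReal (b ^ (1 + ε) * r ^ (d + 2)))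
    (hdec : ∫⁻ z in pCyl t₀ x₀ (r / 2), ENNReal.ofReal ((u z - (l + δ)) / (θ * δ)) ^ (1 + ε) ≤
        4 * volume (pCyl t₀ x₀ (r / 2) ∩ {z | 0 < (u z - (l + δ)) / (θ * δ)}) +
          ENNReal.ofReal (C * ((3 + D) * b / θ ^ 2) ^ p * r ^ (d + 2))) :
    ∫⁻ z in pCyl t₀ x₀ (r / 2), lvl u (l + δ) δ' z ^ (1 + ε) ≤
      ENNReal.ofReal (b ^ (1 + ε) * (r / 2) ^ (d + 2)) := by
  have hθ2 : 2 * θ ≤ 1 := by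
    have : (1 / 2 : ℝ) ^ (d + 6) ≤ 1 / 2 := by
      rw [pow_succ]
      have : (1 / 2 : ℝ) ^ (d + 5) ≤ 1 := pow_le_one₀ (by norm_num) (by norm_num)
      linarith
    linarith
  have hpw : (1 / 2 : ℝ) ^ (d + 6) = (1 / 2) ^ (d + 3) / 8 := by ring
  calc ∫⁻ z in pCyl t₀ x₀ (r / 2), lvl u (l + δ) δ' z ^ (1 + ε)
      ≤ ∫⁻ z in pCyl t₀ x₀ (r / 2), ENNReal.ofReal (2 * θ) *
          ENNReal.ofReal ((u z - (l + δ)) / (θ * δ)) ^ (1 + ε) := by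
        refine lintegral_mono fun z => ?_
        have h1 := lvl_add_le (u := u) (l := l + δ) (m := 0) (δ := θ * δ) (δ' := δ')
          (k := (2 * θ)⁻¹) le_rfl (by positivity) (by positivity)
          (by refine le_trans (le_of_eq ?_) hδ'; field_simp) z
        rw [add_zero, inv_inv] at h1
        calc lvl u (l + δ) δ' z ^ (1 + ε)
            ≤ (ENNReal.ofReal (2 * θ) * lvl u (l + δ) (θ * δ) z) ^ (1 + ε) := by gcongr
          _ = ENNReal.ofReal (2 * θ) ^ (1 + ε) * lvl u (l + δ) (θ * δ) z ^ (1 + ε) :=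
              ENNReal.mul_rpow_of_nonneg _ _ (by linarith)
          _ ≤ ENNReal.ofReal (2 * θ) * lvl u (l + δ) (θ * δ) z ^ (1 + ε) := by
              gcongr
              exact ENNReal.rpow_le_self_of_le_one (ENNReal.ofReal_le_one.2 hθ2) (by linarith)
    _ ≤ ENNReal.ofReal (2 * θ) * (4 * ENNReal.ofReal (b ^ (1 + ε) * r ^ (d + 2)) +
          ENNReal.ofReal (C * ((3 + D) * b / θ ^ 2) ^ p * r ^ (d + 2))) := by
        rw [lintegral_const_mul' _ _ ENNReal.ofReal_ne_top]
        gcongr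
        refine hdec.trans ?_
        gcongr
        exact (volume_superlevel_le hε hu hr hδ (by positivity)).trans hA
    _ = ENNReal.ofReal (2 * θ * (4 * (b ^ (1 + ε) * r ^ (d + 2)) +
          C * ((3 + D) * b / θ ^ 2) ^ p * r ^ (d + 2))) := by
        rw [ENNReal.ofReal_mul (p := 2 * θ) (by positivity),
          ENNReal.ofReal_add (by positivity) (by positivity),
          ENNReal.ofReal_mul (show (0 : ℝ) ≤ 4 by norm_num)]
        simp
    _ ≤ _ := by
        refine ENNReal.ofReal_le_ofReal ?_
        have e1 : 2 * θ * (4 * (b ^ (1 + ε) * r ^ (d + 2))) ≤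
            (1 / 2) ^ (d + 3) * (b ^ (1 + ε) * r ^ (d + 2)) := by
          rw [← mul_assoc]
          gcongr
          linarith
        have e2 : 2 * θ * (C * ((3 + D) * b / θ ^ 2) ^ p * r ^ (d + 2)) ≤
            (1 / 2) ^ (d + 3) * (b ^ (1 + ε) * r ^ (d + 2)) := by
          calc _ ≤ 1 * (((1 / 2) ^ (d + 3) * b ^ (1 + ε)) * r ^ (d + 2)) := by gcongr
            _ = _ := by ring
        calc _ ≤ (1 / 2) ^ (d + 3) * (b ^ (1 + ε) * r ^ (d + 2)) +
              (1 / 2) ^ (d + 3) * (b ^ (1 + ε) * r ^ (d + 2)) := by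
              rw [mul_add]
              exact add_le_add e1 e2
          _ = _ := by rw [div_eq_mul_one_div r 2, mul_pow]; ring

lemma lintegral_rpow_le_measure_mul {α : Type*} [MeasurableSpace α] {μ : Measure α} (hε : 0 < ε)
    {f : α → ℝ≥0∞} (hf : AEMeasurable f μ) :
    (∫⁻ x, f x ∂μ) ^ (1 + ε) ≤ μ univ ^ ε * ∫⁻ x, f x ^ (1 + ε) ∂μ := by
  have hq : (1 + ε).HolderConjugate ((1 + ε) / ε) := by
    rw [Real.holderConjugate_iff]
    constructor
    · linarith
    · field_simp
  have h := ENNReal.lintegral_mul_le_Lp_mul_Lq μ hq hf (g := fun _ => 1) aemeasurable_const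
  simp only [Pi.mul_apply, mul_one, ENNReal.one_rpow, lintegral_one] at h
  calc _ ≤ _ := ENNReal.rpow_le_rpow h (by linarith)
    _ = _ := by
      rw [ENNReal.mul_rpow_of_nonneg _ _ (by linarith), ← ENNReal.rpow_mul, ← ENNReal.rpow_mul,
        mul_comm]
      congr 2
      · field_simp
      · rw [one_div_mul_cancel (by linarith), ENNReal.rpow_one]

end IterationStep

section TailStep

variable {s ε : ℝ} {t₀ : ℝ} {x₀ : Ed d} {u : ℝ × Ed d → ℝ}

lemma lvlTail_step (hs : s < 1) (hs0 : 0 < s) {r l δ δ' ω : ℝ} (hr : 0 < r)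
    (hr1 : r ≤ 1) (hδ : 0 < δ) (hω : 0 < ω) (hδ' : ω * δ ≤ δ') (t : ℝ) :
    lvlTail s x₀ u (l + δ) δ' (r / 2) t ≤ ENNReal.ofReal (4 * ω)⁻¹ *
      (lvlTail s x₀ u l δ r t + ENNReal.ofReal (2 ^ (d + 2) * (r ^ d)⁻¹) *
        ∫⁻ y in ball x₀ r, lvl u l δ (t, y)) := by
  have hk : ∀ y ∈ ball x₀ r \ ball x₀ (r / 2),
      farK s x₀ y ≤ ENNReal.ofReal ((r / 2) ^ (d + 2))⁻¹ := by
    intro y hy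
    have h1 : r / 2 ≤ ‖x₀ - y‖ := by simpa [dist_eq_norm, norm_sub_rev] using hy.2
    unfold farK
    refine ENNReal.ofReal_le_ofReal ?_
    rw [← one_div]
    refine one_div_le_one_div_of_le (by positivity) ?_
    calc (r / 2) ^ (d + 2) = (r / 2) ^ ((d : ℝ) + 2) := by
          rw [← Real.rpow_natCast]; push_cast; rfl
      _ ≤ (r / 2) ^ ((d : ℝ) + 2 * s) :=
          Real.rpow_le_rpow_of_exponent_ge (by positivity) (by linarith) (by linarith)
      _ ≤ _ := by gcongr
  have hsub : (ball x₀ (r / 2))ᶜ ⊆ (ball x₀ r)ᶜ ∪ (ball x₀ r \ ball x₀ (r / 2)) := fun y hy => by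
    by_cases h : y ∈ ball x₀ r
    · exact Or.inr ⟨h, hy⟩
    · exact Or.inl h
  calc lvlTail s x₀ u (l + δ) δ' (r / 2) t
      ≤ ENNReal.ofReal ((r / 2) ^ 2) * (ENNReal.ofReal ω⁻¹ *
          ∫⁻ y in (ball x₀ (r / 2))ᶜ, lvl u l δ (t, y) * farK s x₀ y) := by
        refine mul_le_mul_right ?_ _
        rw [← lintegral_const_mul' _ _ ENNReal.ofReal_ne_top]
        refine lintegral_mono fun y => ?_
        rw [← mul_assoc]
        gcongr
        exact lvl_add_le hδ.le hδ hω hδ' _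
    _ ≤ ENNReal.ofReal ((r / 2) ^ 2) * (ENNReal.ofReal ω⁻¹ *
          ((∫⁻ y in (ball x₀ r)ᶜ, lvl u l δ (t, y) * farK s x₀ y) +
            ENNReal.ofReal ((r / 2) ^ (d + 2))⁻¹ * ∫⁻ y in ball x₀ r, lvl u l δ (t, y))) := by
        gcongr
        refine ((lintegral_mono_set hsub).trans (lintegral_union_le _ _ _)).trans ?_
        gcongr
        rw [← lintegral_const_mul' _ _ ENNReal.ofReal_ne_top]
        refine (setLIntegral_mono' (measurableSet_ball.diff measurableSet_ball)
          fun y hy => ?_).trans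
          (lintegral_mono_set sdiff_subset)
        rw [mul_comm]
        gcongr
        exact hk y hy
    _ = _ := by
        unfold lvlTail
        rw [mul_add, mul_add, mul_add, ← mul_assoc, ← mul_assoc, ← mul_assoc, ← mul_assoc,
          ← mul_assoc, ← ENNReal.ofReal_mul (by positivity), ← ENNReal.ofReal_mul (by positivity),
          ← ENNReal.ofReal_mul (by positivity), ← ENNReal.ofReal_mul (by positivity)]
        congr 3
        · field_simp
          norm_num
        · rw [div_pow, div_pow]
          field_simp
          ring

lemma lintegral_lvlTail_step (hs : s < 1) (hs0 : 0 < s) (hε : 0 < ε) (hε1 : ε ≤ 1)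
    (hu : Measurable u) {β : ℝ} (hβ : volume (ball (0 : Ed d) 1) ≤ ENNReal.ofReal β) (hβ1 : 1 ≤ β)
    {r l δ δ' ω b D : ℝ} (hr : 0 < r) (hr1 : r ≤ 1) (hδ : 0 < δ) (hω : 0 < ω) (hδ' : ω * δ ≤ δ')
    (hb : 0 < b) (hD : 0 ≤ D)
    (hωD : ((4 * ω)⁻¹) ^ (1 + ε) * 2 ^ ε * (D + 4 ^ (d + 2) * β) ≤ D / 4)
    (hA : ∫⁻ z in pCyl t₀ x₀ r, lvl u l δ z ^ (1 + ε) ≤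
      ENNReal.ofReal (b ^ (1 + ε) * r ^ (d + 2)))
    (hT : ∫⁻ t in Iminus t₀ r, lvlTail s x₀ u l δ r t ^ (1 + ε) ≤
      ENNReal.ofReal (D * b ^ (1 + ε) * r ^ 2)) :
    ∫⁻ t in Iminus t₀ (r / 2), lvlTail s x₀ u (l + δ) δ' (r / 2) t ^ (1 + ε) ≤
      ENNReal.ofReal (D * b ^ (1 + ε) * (r / 2) ^ 2) := by
  have hq : 0 ≤ 1 + ε := by linarith
  have hm := measurable_lvl hu l δ
  have hqm : Measurable fun p => lvl u l δ p ^ (1 + ε) := hm.pow_const _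
  have hTm : Measurable fun t => lvlTail s x₀ u l δ r t ^ (1 + ε) :=
    (measurable_lvlTail hu l δ r).pow_const _
  have hvol : volume (ball x₀ r) ≤ ENNReal.ofReal (r ^ d * β) := by
    rw [Measure.addHaar_ball_of_pos _ _ hr, finrank_euclideanSpace_fin,
      ENNReal.ofReal_mul (by positivity)]
    gcongr
  have hI : ∀ t, (ENNReal.ofReal (2 ^ (d + 2) * (r ^ d)⁻¹) *
      ∫⁻ y in ball x₀ r, lvl u l δ (t, y)) ^ (1 + ε) ≤
      ENNReal.ofReal (4 ^ (d + 2) * β * (r ^ d)⁻¹) *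
        ∫⁻ y in ball x₀ r, lvl u l δ (t, y) ^ (1 + ε) := by
    intro t
    have h1 := lintegral_rpow_le_measure_mul (μ := volume.restrict (ball x₀ r)) hε
      (f := fun y => lvl u l δ (t, y)) (hm.comp measurable_prodMk_left).aemeasurable
    rw [Measure.restrict_apply_univ] at h1
    calc _ ≤ ENNReal.ofReal (2 ^ (d + 2) * (r ^ d)⁻¹) ^ (1 + ε) * (ENNReal.ofReal (r ^ d * β) ^ ε *
          ∫⁻ y in ball x₀ r, lvl u l δ (t, y) ^ (1 + ε)) := by
          rw [ENNReal.mul_rpow_of_nonneg _ _ hq]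
          gcongr
          exact h1.trans (by gcongr)
      _ ≤ _ := by
          rw [← mul_assoc]
          gcongr
          rw [ENNReal.ofReal_rpow_of_nonneg (by positivity) hq,
            ENNReal.ofReal_rpow_of_nonneg (by positivity) hε.le,
            ← ENNReal.ofReal_mul (by positivity)]
          refine ENNReal.ofReal_le_ofReal ?_
          have h2 : (1 : ℝ) ≤ 2 ^ (d + 2) * β :=
            one_le_mul_of_one_le_of_one_le (one_le_pow₀ (by norm_num)) hβ1
          calc _ = 2 ^ (d + 2) * (r ^ d)⁻¹ * (2 ^ (d + 2) * β) ^ ε := by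
                rw [Real.rpow_one_add' (by positivity) (by linarith), mul_assoc,
                  ← Real.mul_rpow (by positivity) (by positivity)]
                congr 2
                field_simp
            _ ≤ 2 ^ (d + 2) * (r ^ d)⁻¹ * (2 ^ (d + 2) * β) := by
                gcongr
                simpa using Real.rpow_le_rpow_of_exponent_le h2 hε1
            _ = _ := by
                rw [show (4 : ℝ) = 2 * 2 by norm_num, mul_pow]; ring
  calc ∫⁻ t in Iminus t₀ (r / 2), lvlTail s x₀ u (l + δ) δ' (r / 2) t ^ (1 + ε)
      ≤ ∫⁻ t in Iminus t₀ r, ENNReal.ofReal (((4 * ω)⁻¹) ^ (1 + ε) * 2 ^ ε) *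
          (lvlTail s x₀ u l δ r t ^ (1 + ε) + ENNReal.ofReal (4 ^ (d + 2) * β * (r ^ d)⁻¹) *
            ∫⁻ y in ball x₀ r, lvl u l δ (t, y) ^ (1 + ε)) := by
        have hsub : Iminus t₀ (r / 2) ⊆ Iminus t₀ r :=
          Ioo_subset_Ioo_left (by nlinarith [sq_nonneg r])
        refine (lintegral_mono_set hsub).trans (lintegral_mono fun t => ?_)
        refine (ENNReal.rpow_le_rpow (lvlTail_step hs hs0 hr hr1 hδ hω hδ' t) hq).trans ?_
        rw [ENNReal.mul_rpow_of_nonneg _ _ hq,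
          ENNReal.ofReal_mul (p := ((4 * ω)⁻¹) ^ (1 + ε)) (by positivity),
          mul_assoc (ENNReal.ofReal (((4 * ω)⁻¹) ^ (1 + ε))),
          ENNReal.ofReal_rpow_of_nonneg (by positivity) hq]
        refine mul_le_mul_right ?_ _
        refine (ENNReal.rpow_add_le_mul_rpow_add_rpow _ _ (by linarith)).trans ?_
        rw [← ENNReal.ofReal_rpow_of_nonneg zero_le_two hε.le, ENNReal.ofReal_ofNat,
          add_sub_cancel_left]
        gcongr
        exact hI t
    _ = ENNReal.ofReal (((4 * ω)⁻¹) ^ (1 + ε) * 2 ^ ε) *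
          ((∫⁻ t in Iminus t₀ r, lvlTail s x₀ u l δ r t ^ (1 + ε)) +
            ENNReal.ofReal (4 ^ (d + 2) * β * (r ^ d)⁻¹) *
            ∫⁻ z in pCyl t₀ x₀ r, lvl u l δ z ^ (1 + ε)) := by
        rw [lintegral_const_mul' _ _ ENNReal.ofReal_ne_top, lintegral_add_left hTm,
          lintegral_const_mul' _ _ ENNReal.ofReal_ne_top, pCyl, Measure.volume_eq_prod,
          ← Measure.prod_restrict, lintegral_prod _ hqm.aemeasurable]
    _ ≤ ENNReal.ofReal (((4 * ω)⁻¹) ^ (1 + ε) * 2 ^ ε) *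
          (ENNReal.ofReal (D * b ^ (1 + ε) * r ^ 2) +
            ENNReal.ofReal (4 ^ (d + 2) * β * (r ^ d)⁻¹) *
            ENNReal.ofReal (b ^ (1 + ε) * r ^ (d + 2))) := by gcongr
    _ = ENNReal.ofReal (((4 * ω)⁻¹) ^ (1 + ε) * 2 ^ ε * (D + 4 ^ (d + 2) * β) *
          (b ^ (1 + ε) * r ^ 2)) := by
        rw [← ENNReal.ofReal_mul (by positivity),
          ← ENNReal.ofReal_add (by positivity) (by positivity),
          ← ENNReal.ofReal_mul (by positivity)]
        congr 1
        rw [pow_add r d 2]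
        field_simp
    _ ≤ _ := by
        refine ENNReal.ofReal_le_ofReal ?_
        calc _ ≤ D / 4 * (b ^ (1 + ε) * r ^ 2) := by gcongr
          _ = _ := by ring

end TailStep

section Iteration

lemma exists_iteration_constants (d : ℕ) {ε p C β : ℝ} (hε : 0 < ε) (hε1 : ε ≤ 1) (hp : 1 + ε < p)
    (hC : 0 < C) (hβ : 1 ≤ β) :
    ∃ ω θ b D : ℝ, 1 / 2 ≤ ω ∧ ω < 1 ∧ 0 < θ ∧ θ ≤ (1 / 2) ^ (d + 6) ∧ 0 < b ∧ b ≤ 1 ∧ 1 ≤ D ∧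
      ((4 * ω)⁻¹) ^ (1 + ε) * 2 ^ ε * (D + 4 ^ (d + 2) * β) ≤ D / 4 ∧
      C * ((3 + D) * b / θ ^ 2) ^ p ≤ (1 / 2) ^ (d + 3) * b ^ (1 + ε) := by
  set lam : ℝ := 2 ^ (-(ε / 2)) with hlam
  have hlam0 : 0 < lam := by positivity
  have hlam1 : lam < 1 := Real.rpow_lt_one_of_one_lt_of_neg one_lt_two (by linarith)
  have hl1 : 0 < 1 - lam := by linarith
  set B : ℝ := 4 ^ (d + 2) * β
  have hB : 0 < B := by positivity
  set D : ℝ := lam * B / (1 - lam) + 1 with hD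
  have hD1 : 1 ≤ D := by
    have : 0 ≤ lam * B / (1 - lam) := by positivity
    linarith
  set θ : ℝ := (1 / 2) ^ (d + 6)
  have hθ : 0 < θ := by positivity
  set c : ℝ := (1 / 2) ^ (d + 3) / (C * ((3 + D) / θ ^ 2) ^ p) with hc
  have hc0 : 0 < c := by positivity
  have hp' : 0 < p - (1 + ε) := by linarith
  refine ⟨2 ^ (-(ε / 4)), θ, min 1 (c ^ (1 / (p - (1 + ε)))), D, ?_, ?_, hθ, le_rfl,
    lt_min one_pos (by positivity), min_le_left _ _, hD1, ?_, ?_⟩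
  · calc (1 / 2 : ℝ) = 2 ^ (-1 : ℝ) := by rw [Real.rpow_neg_one]; norm_num
      _ ≤ _ := Real.rpow_le_rpow_of_exponent_le one_le_two (by linarith)
  · exact Real.rpow_lt_one_of_one_lt_of_neg one_lt_two (by linarith)
  · have h1 : ((4 * (2 : ℝ) ^ (-(ε / 4)))⁻¹) ^ (1 + ε) * 2 ^ ε ≤ lam / 4 := by
      have e1 : ((4 * (2 : ℝ) ^ (-(ε / 4)))⁻¹) = 2 ^ (-2 + ε / 4) := by
        rw [show (4 : ℝ) = 2 ^ (2 : ℝ) by norm_num, ← Real.rpow_add two_pos,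
          ← Real.rpow_neg zero_le_two]
        congr 1
        ring
      have e2 : lam / 4 = 2 ^ (-(ε / 2) - 2) := by
        rw [Real.rpow_sub two_pos, hlam]; norm_num
      rw [e1, e2, ← Real.rpow_mul zero_le_two, ← Real.rpow_add two_pos]
      exact Real.rpow_le_rpow_of_exponent_le one_le_two (by nlinarith)
    have h2 : lam * (D + B) ≤ D := by
      have : lam * (lam * B / (1 - lam)) + lam * B = lam * B / (1 - lam) := by field_simp; ring
      rw [hD]
      linarith
    calc _ ≤ lam / 4 * (D + B) := by gcongr
      _ ≤ _ := by linarith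
  · set b := min 1 (c ^ (1 / (p - (1 + ε)))) with hb
    have hb0 : 0 < b := lt_min one_pos (by positivity)
    have h1 : b ^ (p - (1 + ε)) ≤ c := by
      calc _ ≤ (c ^ (1 / (p - (1 + ε)))) ^ (p - (1 + ε)) :=
            Real.rpow_le_rpow hb0.le (min_le_right _ _) hp'.le
        _ = c := by rw [← Real.rpow_mul hc0.le, one_div_mul_cancel hp'.ne', Real.rpow_one]
    have h2 : ((3 + D) * b / θ ^ 2) ^ p =
        ((3 + D) / θ ^ 2) ^ p * (b ^ (p - (1 + ε)) * b ^ (1 + ε)) := by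
      rw [← Real.rpow_add hb0, sub_add_cancel, ← Real.mul_rpow (by positivity) hb0.le]
      congr 1
      ring
    rw [h2]
    calc _ ≤ C * (((3 + D) / θ ^ 2) ^ p * (c * b ^ (1 + ε))) := by gcongr
      _ = _ := by
        rw [hc]
        field_simp

lemma volume_pCyl_le {β : ℝ} (hβ : volume (ball (0 : Ed d) 1) ≤ ENNReal.ofReal β) {r : ℝ}
    (hr : 0 < r) (t₀ : ℝ) (x₀ : Ed d) :
    volume (pCyl t₀ x₀ r) ≤ ENNReal.ofReal (r ^ (d + 2) * β) := by
  rw [pCyl, Iminus, Measure.volume_eq_prod, Measure.prod_prod, Real.volume_Ioo, sub_sub_cancel,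
    Measure.addHaar_ball_of_pos _ _ hr, finrank_euclideanSpace_fin, ← mul_assoc,
    ← ENNReal.ofReal_mul (by positivity), ← pow_add, add_comm 2 d,
    ENNReal.ofReal_mul (by positivity)]
  gcongr

lemma ofReal_sub_le_lvl {u : ℝ × Ed d → ℝ} {l L δ : ℝ} (hl : l ≤ L) (hδ : 0 < δ) {ε : ℝ}
    (hε : 0 < ε) (p : ℝ × Ed d) :
    ENNReal.ofReal (u p - L) ≤ ENNReal.ofReal δ * (1 + lvl u l δ p ^ (1 + ε)) := by
  calc ENNReal.ofReal (u p - L) ≤ ENNReal.ofReal (δ * ((u p - l) / δ)) := by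
        refine ENNReal.ofReal_le_ofReal ?_
        rw [mul_div_cancel₀ _ hδ.ne']
        linarith
    _ = ENNReal.ofReal δ * lvl u l δ p := ENNReal.ofReal_mul hδ.le
    _ ≤ _ := by
        gcongr
        simpa using le_add_rpow_mul_rpow hε one_pos (lvl u l δ p)

/-- Solutions are bounded from above, in the limiting averaged sense, by their size on a cylinder
and the dyadic sum of the normalised masses of the right-hand side. -/
theorem exists_level_bound {s Λ ε : ℝ} (hd : 2 ≤ d) (hΛ : 1 ≤ Λ) (hs : 0 < s) (hs1 : s < 1)
    (hε : 0 < ε) (hεd : ε * (2 * d) ≤ 1) :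
    ∃ C : ℝ, 0 < C ∧ ∀ (K : ℝ → Ed d → Ed d → ℝ), KernelHyp d s Λ K →
      ∀ (ν : Measure (ℝ × Ed d)) [IsFiniteMeasure ν] (t₀ : ℝ) (x₀ : Ed d) (R : ℝ)
      (u : ℝ × Ed d → ℝ) (Du a : ℝ × Ed d → Ed d), 0 < R → R ≤ 1 →
      CylSol s Λ K ν t₀ x₀ (2 * R) u Du a → ∀ δ₀ : ℝ, 0 < δ₀ →
      ∫⁻ z in pCyl t₀ x₀ R, ENNReal.ofReal (u z) ^ (1 + ε) ≤
        ENNReal.ofReal (δ₀ ^ (1 + ε) * R ^ (d + 2)) →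
      ∫⁻ t in Iminus t₀ R, (ENNReal.ofReal (R ^ 2) *
        ∫⁻ y in (ball x₀ R)ᶜ, ENNReal.ofReal (u (t, y)) * farK s x₀ y) ^ (1 + ε) ≤
        ENNReal.ofReal (δ₀ ^ (1 + ε) * R ^ 2) →
      ∀ m : ℕ → ℝ, (∀ j, m j = (ν (pCyl t₀ x₀ (R / 2 ^ j))).toReal / (R / 2 ^ j) ^ d) →
      Summable m → ∃ δ : ℕ → ℝ, Tendsto δ atTop (𝓝 0) ∧
        ∀ j, ∫⁻ z in pCyl t₀ x₀ (R / 2 ^ j), ENNReal.ofReal (u z - C * (δ₀ + ∑' i, m i)) ≤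
          ENNReal.ofReal (δ j * (R / 2 ^ j) ^ (d + 2)) := by
  have hd' : (2 : ℝ) ≤ d := by exact_mod_cast hd
  have hε1 : ε ≤ 1 / 2 := by nlinarith
  obtain ⟨p, hp⟩ : ∃ p : ℝ≥0, NNReal.HolderConjugate d p :=
    ⟨_, NNReal.HolderConjugate.conjExponent (by exact_mod_cast hd)⟩
  have hpd : ((d : ℝ) - 1) * p = d := by
    have := hp.coe.mul_eq_add
    push_cast at this
    linarith
  have hεp : 1 + ε ≤ (1 - ε) * p := by
    have hd1 : (0 : ℝ) < d - 1 := by linarith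
    rw [← mul_le_mul_iff_right₀ hd1]
    nlinarith
  have hp1 : 1 + ε < p := by
    have : (0 : ℝ) < p := hp.coe.symm.pos
    nlinarith
  obtain ⟨C₀, hC₀, hdec⟩ := exists_level_decay hd hΛ hs hs1 hε hε1 hp hεp
  set β : ℝ := (volume (ball (0 : Ed d) 1)).toReal + 1 with hβd
  have hβ1 : 1 ≤ β := by simp [hβd]
  have hβ : volume (ball (0 : Ed d) 1) ≤ ENNReal.ofReal β := by
    rw [hβd, ENNReal.ofReal_add ENNReal.toReal_nonneg zero_le_one,
      ENNReal.ofReal_toReal measure_ball_lt_top.ne]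
    exact le_self_add
  obtain ⟨ω, θ, b, D, hω, hω1, hθ, hθd, hb, hb1, hD, hωD, hbp⟩ :=
    exists_iteration_constants d hε (by linarith) hp1 hC₀ hβ1
  have hω0 : 0 < ω := by linarith
  have hω1' : 0 < 1 - ω := by linarith
  have hθ1 : θ ≤ 1 := hθd.trans (pow_le_one₀ (by norm_num) (by norm_num))
  refine ⟨b⁻¹ / (1 - ω), by positivity, ?_⟩
  intro K hK ν _ t₀ x₀ R u Du a hR hR1 h δ₀ hδ₀ hA0 hT0 m hm hsum
  have hm0 : ∀ j, 0 ≤ m j := fun j => by rw [hm]; positivity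
  obtain ⟨δ, hδz, hδs⟩ : ∃ δ : ℕ → ℝ, δ 0 = b⁻¹ * (δ₀ + m 0) ∧
      ∀ j, δ (j + 1) = ω * δ j + b⁻¹ * m (j + 1) :=
    ⟨fun n => Nat.rec (b⁻¹ * (δ₀ + m 0)) (fun j x => ω * x + b⁻¹ * m (j + 1)) n, rfl, fun _ => rfl⟩
  have hδ : ∀ j, 0 < δ j := by
    intro j
    induction j with
    | zero => rw [hδz]; have := hm0 0; positivity
    | succ j ih => rw [hδs]; have := hm0 (j + 1); positivity
  have hδm : ∀ j, b⁻¹ * m j ≤ δ j := by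
    intro j
    cases j with
    | zero => rw [hδz]; gcongr; linarith
    | succ j => rw [hδs]; have := hδ j; have : 0 < ω * δ j := by positivity
                linarith
  have hωδ : ∀ j, ω * δ j ≤ δ (j + 1) := fun j => by
    rw [hδs]; have := hm0 (j + 1); have : 0 ≤ b⁻¹ * m (j + 1) := by positivity
    linarith
  set l : ℕ → ℝ := fun j => ∑ i ∈ Finset.range j, δ i with hl
  have hl0 : ∀ j, 0 ≤ l j := fun j => Finset.sum_nonneg fun i _ => (hδ i).le
  have hls : ∀ j, l (j + 1) = l j + δ j := fun j => Finset.sum_range_succ _ _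
  have hlid : ∀ j, (1 - ω) * l (j + 1) + ω * δ j =
      b⁻¹ * (δ₀ + ∑ i ∈ Finset.range (j + 1), m i) := by
    intro j
    induction j with
    | zero => simp [hl, hδz]; ring
    | succ j ih =>
      rw [Finset.sum_range_succ, hls (j + 1), ← add_assoc, mul_add b⁻¹, ← ih, hδs]
      ring
  have hlL : ∀ j, l j ≤ b⁻¹ / (1 - ω) * (δ₀ + ∑' i, m i) := by
    intro j
    have h1 : l j ≤ l (j + 1) := by rw [hls]; linarith [hδ j]
    refine h1.trans ?_
    rw [div_mul_eq_mul_div, le_div_iff₀ hω1', mul_comm]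
    have h2 : ∑ i ∈ Finset.range (j + 1), m i ≤ ∑' i, m i :=
      hsum.sum_le_tsum _ fun i _ => hm0 i
    have h3 : 0 < ω * δ j := mul_pos hω0 (hδ j)
    calc _ ≤ (1 - ω) * l (j + 1) + ω * δ j := by linarith
      _ = _ := hlid j
      _ ≤ _ := by gcongr
  have hiter : ∀ j, (∫⁻ z in pCyl t₀ x₀ (R / 2 ^ j), lvl u (l j) (δ j) z ^ (1 + ε) ≤
      ENNReal.ofReal (b ^ (1 + ε) * (R / 2 ^ j) ^ (d + 2))) ∧
      ∫⁻ t in Iminus t₀ (R / 2 ^ j), lvlTail s x₀ u (l j) (δ j) (R / 2 ^ j) t ^ (1 + ε) ≤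
      ENNReal.ofReal (D * b ^ (1 + ε) * (R / 2 ^ j) ^ 2) := by
    intro j
    induction j with
    | zero =>
      have hδ00 : b⁻¹ * δ₀ ≤ δ 0 := by rw [hδz]; have := hm0 0; gcongr; linarith
      have hl : ∀ p, lvl u (l 0) (δ 0) p ≤ ENNReal.ofReal (b / δ₀) * ENNReal.ofReal (u p) := by
        intro p
        simpa [lvl, hl, div_eq_mul_inv, mul_comm b] using
          lvl_add_le (u := u) (l := 0) (m := 0) (k := b⁻¹ * δ₀) le_rfl one_pos (by positivity)
            (by simpa using hδ00) p
      have hc : ENNReal.ofReal (b / δ₀) ^ (1 + ε) * ENNReal.ofReal (δ₀ ^ (1 + ε)) =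
          ENNReal.ofReal (b ^ (1 + ε)) := by
        rw [ENNReal.ofReal_rpow_of_pos (by positivity), ← ENNReal.ofReal_mul (by positivity),
          ← Real.mul_rpow (by positivity) hδ₀.le, div_mul_cancel₀ _ hδ₀.ne']
      have hcf : ENNReal.ofReal (b / δ₀) ^ (1 + ε) ≠ ∞ := by finiteness
      simp only [pow_zero, div_one]
      constructor
      · rw [ENNReal.ofReal_mul (by positivity), ← hc, mul_assoc,
          ← ENNReal.ofReal_mul (by positivity)]
        refine le_trans ?_ (mul_le_mul_right hA0 _)
        rw [← lintegral_const_mul' _ _ hcf]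
        refine lintegral_mono fun z => ?_
        rw [← ENNReal.mul_rpow_of_nonneg _ _ (by linarith)]
        exact ENNReal.rpow_le_rpow (hl z) (by linarith)
      · calc _ ≤ ENNReal.ofReal (b ^ (1 + ε) * R ^ 2) := by
              rw [ENNReal.ofReal_mul (by positivity), ← hc, mul_assoc,
                ← ENNReal.ofReal_mul (by positivity)]
              refine le_trans ?_ (mul_le_mul_right hT0 _)
              rw [← lintegral_const_mul' _ _ hcf]
              refine lintegral_mono fun t => ?_
              rw [← ENNReal.mul_rpow_of_nonneg _ _ (by linarith), lvlTail, mul_left_comm]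
              refine ENNReal.rpow_le_rpow (mul_le_mul_right ?_ _) (by linarith)
              rw [← lintegral_const_mul' _ _ ENNReal.ofReal_ne_top]
              refine lintegral_mono fun y => ?_
              rw [← mul_assoc]
              exact mul_le_mul_left (hl _) _
          _ ≤ _ := by
              rw [mul_assoc]
              refine ENNReal.ofReal_le_ofReal (le_mul_of_one_le_left (by positivity) hD)
    | succ j ih =>
      obtain ⟨hA, hT⟩ := ih
      have hr2 : R / 2 ^ (j + 1) = R / 2 ^ j / 2 := by rw [pow_succ, div_div]
      set r := R / 2 ^ j with hr
      have hr0 : 0 < r := by positivity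
      have hrR : r ≤ R := div_le_self hR.le (one_le_pow₀ one_le_two)
      rw [hr2, hls]
      have hνr : ν (pCyl t₀ x₀ r) ≤ ENNReal.ofReal (b * δ j * r ^ d) := by
        rw [← ENNReal.ofReal_toReal (measure_ne_top ν _)]
        refine ENNReal.ofReal_le_ofReal ?_
        have h1 : b * (b⁻¹ * m j) ≤ b * δ j := mul_le_mul_of_nonneg_left (hδm j) hb.le
        rw [mul_inv_cancel_left₀ hb.ne', hm, ← hr, div_le_iff₀ (by positivity)] at h1
        exact h1
      have hE := errY_lvl_le hε (by linarith) h.meas_u hr0 (hδ j) hθ hθ1 hb hb1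
        (by linarith) hA hT hνr
      exact ⟨lintegral_lvl_step hε h.meas_u hr0 (hδ j) (by nlinarith [hωδ j, hδ j]) hθ hθd hC₀ hb
          (by linarith) hbp hA (hdec K hK ν t₀ x₀ (2 * R) u Du a h r (l j + δ j) (θ * δ j) _ hr0
            (hrR.trans hR1) (by linarith) (by have := hl0 j; have := hδ j; linarith)
            (mul_pos hθ (hδ j)) (by positivity) hE),
        lintegral_lvlTail_step hs1 hs hε (by linarith) h.meas_u hβ hβ1 hr0 (hrR.trans hR1) (hδ j)
          hω0 (hωδ j) hb (by linarith) hωD hA hT⟩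
  have hδsum : Summable δ := summable_of_sum_range_le (fun j => (hδ j).le) hlL
  refine ⟨fun j => (β + 1) * δ j, by simpa using hδsum.tendsto_atTop_zero.const_mul (β + 1), ?_⟩
  intro j
  set r := R / 2 ^ j with hr
  have hr0 : 0 < r := by positivity
  calc _ ≤ ∫⁻ z in pCyl t₀ x₀ r, ENNReal.ofReal (δ j) * (1 + lvl u (l j) (δ j) z ^ (1 + ε)) :=
        lintegral_mono fun z => ofReal_sub_le_lvl (hlL j) (hδ j) hε z
    _ = ENNReal.ofReal (δ j) * (volume (pCyl t₀ x₀ r) +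
        ∫⁻ z in pCyl t₀ x₀ r, lvl u (l j) (δ j) z ^ (1 + ε)) := by
        rw [lintegral_const_mul' _ _ ENNReal.ofReal_ne_top, lintegral_add_left measurable_const,
          setLIntegral_one]
    _ ≤ ENNReal.ofReal (δ j) * (ENNReal.ofReal (r ^ (d + 2) * β) +
        ENNReal.ofReal (r ^ (d + 2))) := by
        gcongr
        · exact volume_pCyl_le hβ hr0 _ _
        · refine (hiter j).1.trans (ENNReal.ofReal_le_ofReal ?_)
          exact mul_le_of_le_one_left (by positivity) (Real.rpow_le_one hb.le hb1 (by linarith))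
    _ = _ := by
        rw [← ENNReal.ofReal_add (by positivity) (by positivity),
          ← ENNReal.ofReal_mul (hδ j).le]
        congr 1
        ring

end Iteration

section LebesguePoints

lemma volume_pCyl {r : ℝ} (hr : 0 < r) (t₀ : ℝ) (x₀ : Ed d) :
    volume (pCyl t₀ x₀ r) = ENNReal.ofReal (r ^ (d + 2)) * volume (ball (0 : Ed d) 1) := by
  rw [pCyl, Iminus, Measure.volume_eq_prod, Measure.prod_prod, Real.volume_Ioo, sub_sub_cancel,
    Measure.addHaar_ball_of_pos _ _ hr, finrank_euclideanSpace_fin, ← mul_assoc,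
    ← ENNReal.ofReal_mul (by positivity), ← pow_add, add_comm 2 d]

lemma sub_mem_pCyl_iff {r : ℝ} (p w : ℝ × Ed d) :
    p - w ∈ pCyl p.1 p.2 r ↔ w ∈ pCyl (r ^ 2) (0 : Ed d) r := by
  simp [pCyl, Iminus, dist_eq_norm, and_comm]

lemma setLIntegral_pCyl_eq (F : ℝ × Ed d → ℝ≥0∞) (p : ℝ × Ed d) (r : ℝ) :
    ∫⁻ z in pCyl p.1 p.2 r, F z = ∫⁻ w in pCyl (r ^ 2) (0 : Ed d) r, F (p - w) := by
  rw [← lintegral_indicator (measurableSet_pCyl _ _ _),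
    ← lintegral_indicator (measurableSet_pCyl _ _ _), ← lintegral_sub_left_eq_self _ p]
  refine lintegral_congr fun w => ?_
  by_cases h : w ∈ pCyl (r ^ 2) (0 : Ed d) r
  · rw [indicator_of_mem h, indicator_of_mem ((sub_mem_pCyl_iff p w).2 h)]
  · rw [indicator_of_notMem h, indicator_of_notMem (mt (sub_mem_pCyl_iff p w).1 h)]

lemma lintegral_setLIntegral_pCyl_sub {f : ℝ × Ed d → ℝ} (hf : Measurable f) (r : ℝ) :
    ∫⁻ p : ℝ × Ed d, ∫⁻ z in pCyl p.1 p.2 r, ‖f z - f p‖ₑ =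
      ∫⁻ w in pCyl (r ^ 2) (0 : Ed d) r, eLpNorm (fun p => f (p - w) - f p) 1 volume := by
  simp_rw [setLIntegral_pCyl_eq, eLpNorm_one_eq_lintegral_enorm]
  refine lintegral_lintegral_swap ?_
  exact (by fun_prop : Measurable _).aemeasurable

lemma measurable_setLIntegral_pCyl_sub {f : ℝ × Ed d → ℝ} (hf : Measurable f) (r : ℝ) :
    Measurable fun p : ℝ × Ed d => ∫⁻ z in pCyl p.1 p.2 r, ‖f z - f p‖ₑ := by
  simp_rw [setLIntegral_pCyl_eq]
  exact Measurable.lintegral_prod_right'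
    (f := fun q : (ℝ × Ed d) × (ℝ × Ed d) => ‖f (q.1 - q.2) - f q.1‖ₑ) (by fun_prop)

lemma pCyl_subset_ball {r ρ : ℝ} (hr1 : r ≤ 1) (hr0 : 0 < r) (hrρ : r ≤ ρ) (p : ℝ × Ed d) :
    pCyl p.1 p.2 r ⊆ ball p ρ := by
  rintro ⟨t, x⟩ ⟨⟨ht, ht'⟩, hx⟩
  rw [mem_ball, Prod.dist_eq, max_lt_iff]
  refine ⟨?_, (mem_ball.1 hx).trans_le hrρ⟩
  dsimp only at ht ht' ⊢
  rw [Real.dist_eq, abs_lt]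
  constructor <;> nlinarith

/-- Almost every point is, along a subsequence of radii, a Lebesgue point with respect to
parabolic cylinders. -/
lemma ae_frequently_setLIntegral_pCyl_sub_lt {f : ℝ × Ed d → ℝ} (hf : Measurable f)
    (hfi : Integrable f) {r : ℕ → ℝ} (hr0 : ∀ j, 0 < r j) (hr : Tendsto r atTop (𝓝 0)) :
    ∀ᵐ p : ℝ × Ed d, ∀ η : ℝ, 0 < η → ∃ᶠ j in atTop,
      ∫⁻ z in pCyl p.1 p.2 (r j), ‖f z - f p‖ₑ < ENNReal.ofReal (η * r j ^ (d + 2)) := by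
  set κ := volume (ball (0 : Ed d) 1)
  set g : ℕ → ℝ × Ed d → ℝ≥0∞ := fun j p =>
    ENNReal.ofReal ((r j ^ (d + 2))⁻¹) * ∫⁻ z in pCyl p.1 p.2 (r j), ‖f z - f p‖ₑ with hg
  have hgm : ∀ j, Measurable (g j) := fun j =>
    (measurable_setLIntegral_pCyl_sub hf (r j)).const_mul _
  have hgt : Tendsto (fun j => ∫⁻ p, g j p) atTop (𝓝 0) := by
    rw [ENNReal.tendsto_nhds_zero]
    intro η hη
    have hκ : κ ≠ ∞ := measure_ball_lt_top.ne
    have : Fact ((1 : ℝ≥0∞) ≤ 1) := ⟨le_rfl⟩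
    have ht := tendsto_eLpNorm_translation_sub (volume : Measure (ℝ × Ed d)) (q := 1) (by simp)
      (memLp_one_iff_integrable.2 hfi)
    have hη' : 0 < η / κ := ENNReal.div_pos hη.ne' hκ
    obtain ⟨ρ, hρ, hρt⟩ := Metric.eventually_nhds_iff.1 (ht.eventually (ge_mem_nhds hη'))
    have hsm : ∀ᶠ j in atTop, r j < min 1 ρ := hr.eventually (gt_mem_nhds (lt_min one_pos hρ))
    filter_upwards [hsm] with j hj
    have hj1 : r j < 1 := hj.trans_le (min_le_left _ _)
    have hjρ : r j < ρ := hj.trans_le (min_le_right _ _)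
    have hp : 0 < r j ^ (d + 2) := pow_pos (hr0 j) _
    rw [hg]
    dsimp only
    rw [lintegral_const_mul' _ _ ENNReal.ofReal_ne_top, lintegral_setLIntegral_pCyl_sub hf]
    calc _ ≤ ENNReal.ofReal ((r j ^ (d + 2))⁻¹) *
            ∫⁻ w in pCyl (r j ^ 2) (0 : Ed d) (r j), η / κ := by
          refine mul_le_mul_right (setLIntegral_mono measurable_const fun w hw => hρt ?_) _
          rcases hw with ⟨⟨h1, h2⟩, h3⟩
          rw [dist_zero_right, Prod.norm_def, max_lt_iff]
          constructor
          · rw [Real.norm_eq_abs, abs_lt]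
            have := hr0 j
            constructor <;> nlinarith
          · rw [mem_ball, dist_zero_right] at h3
            linarith
      _ = η / κ * κ := by
          rw [setLIntegral_const, volume_pCyl (hr0 j), mul_left_comm,
            ← mul_assoc (ENNReal.ofReal _), ← ENNReal.ofReal_mul (by positivity),
            inv_mul_cancel₀ hp.ne', ENNReal.ofReal_one, one_mul]
      _ ≤ η := by rw [mul_comm]; exact ENNReal.mul_div_le
  have h0 : ∫⁻ p, liminf (fun j => g j p) atTop = 0 := by
    have := lintegral_liminf_le hgm (μ := volume) (u := atTop)
    rw [hgt.liminf_eq] at this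
    exact le_antisymm this bot_le
  rw [lintegral_eq_zero_iff (Measurable.liminf hgm)] at h0
  filter_upwards [h0] with p hp η hη
  have hlt : liminf (fun j => g j p) atTop < ENNReal.ofReal η := by
    rw [hp]
    simpa using hη
  refine (frequently_lt_of_liminf_lt (by isBoundedDefault) hlt).mono fun j hj => ?_
  have hp : 0 < r j ^ (d + 2) := pow_pos (hr0 j) _
  have h1 := ENNReal.mul_lt_mul_left (ENNReal.ofReal_pos.2 hp).ne' ENNReal.ofReal_ne_top hj
  rw [← ENNReal.ofReal_mul hη.le, hg] at h1
  dsimp only at h1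
  rwa [mul_right_comm, ← ENNReal.ofReal_mul (by positivity), inv_mul_cancel₀ hp.ne',
    ENNReal.ofReal_one, one_mul] at h1

lemma ae_frequently_setLIntegral_pCyl_sub_lt_of_locallyIntegrableOn {f : ℝ × Ed d → ℝ}
    (hf : Measurable f) {U : Set (ℝ × Ed d)} (hU : IsOpen U) (hfi : LocallyIntegrableOn f U)
    {r : ℕ → ℝ} (hr0 : ∀ j, 0 < r j) (hr : Tendsto r atTop (𝓝 0)) :
    ∀ᵐ p : ℝ × Ed d, p ∈ U → ∀ η : ℝ, 0 < η → ∃ᶠ j in atTop,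
      ∫⁻ z in pCyl p.1 p.2 (r j), ‖f z - f p‖ₑ < ENNReal.ofReal (η * r j ^ (d + 2)) := by
  rw [ae_iff]
  refine measure_null_of_locally_null _ fun p hp => ?_
  simp only [mem_ofPred_eq, Classical.not_imp] at hp
  obtain ⟨t, ht, hti⟩ := hfi p hp.1
  rw [hU.nhdsWithin_eq hp.1] at ht
  obtain ⟨ρ, hρ, hρt⟩ := Metric.mem_nhds_iff.1 ht
  have hae := ae_frequently_setLIntegral_pCyl_sub_lt
    (hf.indicator (measurableSet_ball (x := p) (ε := ρ)))
    ((integrable_indicator_iff measurableSet_ball).2 (hti.mono_set hρt)) hr0 hr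
  refine ⟨_, inter_mem self_mem_nhdsWithin (mem_nhdsWithin_of_mem_nhds (ball_mem_nhds p hρ)), ?_⟩
  refine measure_mono_null ?_ (ae_iff.1 hae)
  rintro z ⟨hz, hzρ⟩ hg
  simp only [mem_ofPred_eq, Classical.not_imp] at hz
  refine hz.2 fun η hη => ?_
  obtain ⟨σ, hσ, hσt⟩ := Metric.isOpen_iff.1 isOpen_ball z hzρ
  refine ((hg η hη).and_eventually (hr.eventually (gt_mem_nhds (lt_min one_pos hσ)))).mono ?_
  rintro j ⟨hj, hjσ⟩
  refine lt_of_le_of_lt (setLIntegral_mono' (measurableSet_pCyl _ _ _) fun w hw => ?_) hj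
  have := hσt (pCyl_subset_ball (hjσ.le.trans (min_le_left _ _)) (hr0 j)
    (hjσ.le.trans (min_le_right _ _)) z hw)
  rw [indicator_of_mem this, indicator_of_mem hzρ]

/-- Averaged upper bounds on shrinking cylinders pass to the centre at Lebesgue points. -/
lemma le_of_frequently_setLIntegral_lt {f : ℝ × Ed d → ℝ} (hf : Measurable f) {p : ℝ × Ed d}
    {r : ℕ → ℝ} (hr0 : ∀ j, 0 < r j) (h : ∀ η : ℝ, 0 < η → ∃ᶠ j in atTop,
      ∫⁻ z in pCyl p.1 p.2 (r j), ‖f z - f p‖ₑ < ENNReal.ofReal (η * r j ^ (d + 2)))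
    {L : ℝ} {δ : ℕ → ℝ} (hδ : Tendsto δ atTop (𝓝 0))
    (hL : ∀ j, ∫⁻ z in pCyl p.1 p.2 (r j), ENNReal.ofReal (f z - L) ≤
      ENNReal.ofReal (δ j * r j ^ (d + 2))) : f p ≤ L := by
  set κ := (volume (ball (0 : Ed d) 1)).toReal
  have hκ' : volume (ball (0 : Ed d) 1) = ENNReal.ofReal κ :=
    (ENNReal.ofReal_toReal measure_ball_lt_top.ne).symm
  have hκ : 0 < κ := ENNReal.toReal_pos (measure_ball_pos _ _ one_pos).ne' measure_ball_lt_top.ne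
  by_contra! hlt
  obtain ⟨j, hj1, hj2⟩ :=
    ((h (κ * (f p - L) / 2) (by have := sub_pos.2 hlt; positivity)).and_eventually
    (hδ.eventually (gt_mem_nhds (show 0 < κ * (f p - L) / 2 by
      have := sub_pos.2 hlt; positivity)))).exists
  have hp : 0 < r j ^ (d + 2) := pow_pos (hr0 j) _
  have h1 : ENNReal.ofReal (κ * (f p - L) * r j ^ (d + 2)) <
      ENNReal.ofReal (κ * (f p - L) / 2 * r j ^ (d + 2)) +
        ENNReal.ofReal (κ * (f p - L) / 2 * r j ^ (d + 2)) := by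
    calc ENNReal.ofReal (κ * (f p - L) * r j ^ (d + 2)) =
          ∫⁻ _ in pCyl p.1 p.2 (r j), ENNReal.ofReal (f p - L) := by
          rw [setLIntegral_const, volume_pCyl (hr0 j), hκ', ← ENNReal.ofReal_mul hp.le,
            ← ENNReal.ofReal_mul (sub_pos.2 hlt).le]
          congr 1
          ring
      _ ≤ ∫⁻ z in pCyl p.1 p.2 (r j), (‖f z - f p‖ₑ + ENNReal.ofReal (f z - L)) := by
          refine lintegral_mono fun z => ?_
          rw [← ofReal_norm]
          refine (ENNReal.ofReal_le_ofReal ?_).trans ENNReal.ofReal_add_le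
          have := neg_abs_le (f z - f p)
          rw [Real.norm_eq_abs]
          linarith
      _ = (∫⁻ z in pCyl p.1 p.2 (r j), ‖f z - f p‖ₑ) +
          ∫⁻ z in pCyl p.1 p.2 (r j), ENNReal.ofReal (f z - L) :=
          lintegral_add_right _ (by fun_prop)
      _ < _ := ENNReal.add_lt_add_of_lt_of_le (ne_top_of_le_ne_top ENNReal.ofReal_ne_top (hL j)) hj1
          ((hL j).trans (ENNReal.ofReal_le_ofReal (by gcongr)))
  rw [← ENNReal.ofReal_add (by have := sub_pos.2 hlt; positivity)
    (by have := sub_pos.2 hlt; positivity)] at h1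
  refine h1.ne ?_
  congr 1
  ring

end LebesguePoints

section RieszPotential

lemma isOpen_mem_pCyl :
    IsOpen {q : ((ℝ × Ed d) × ℝ) × (ℝ × Ed d) | q.2 ∈ pCyl q.1.1.1 q.1.1.2 q.1.2} := by
  simp only [pCyl, Iminus, mem_prod, mem_Ioo, mem_ball]
  exact ((isOpen_lt (by fun_prop) (by fun_prop)).and (isOpen_lt (by fun_prop) (by fun_prop))).and
    (isOpen_lt (by fun_prop) (by fun_prop))

lemma measurable_measure_pCyl (ν : Measure (ℝ × Ed d)) [SFinite ν] :
    Measurable fun q : (ℝ × Ed d) × ℝ => ν (pCyl q.1.1 q.1.2 q.2) :=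
  measurable_measure_prodMk_left (ν := ν) isOpen_mem_pCyl.measurableSet

lemma lintegral_measure_pCyl (ν : Measure (ℝ × Ed d)) [SFinite ν] {ρ : ℝ} (hρ : 0 < ρ) :
    ∫⁻ p : ℝ × Ed d, ν (pCyl p.1 p.2 ρ) =
      ENNReal.ofReal (ρ ^ (d + 2)) * volume (ball (0 : Ed d) 1) * ν univ := by
  have ho : MeasurableSet {q : (ℝ × Ed d) × (ℝ × Ed d) | q.2 ∈ pCyl q.1.1 q.1.2 ρ} :=
    (isOpen_mem_pCyl.preimage (by fun_prop : Continuous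
      fun q : (ℝ × Ed d) × (ℝ × Ed d) => ((q.1, ρ), q.2))).measurableSet
  have h1 := Measure.prod_apply (μ := (volume : Measure (ℝ × Ed d))) (ν := ν) ho
  rw [Measure.prod_apply_symm ho] at h1
  have h3 : ∀ z : ℝ × Ed d, (fun p => (p, z)) ⁻¹' {q : (ℝ × Ed d) × (ℝ × Ed d) |
      q.2 ∈ pCyl q.1.1 q.1.2 ρ} = pCyl (z.1 + ρ ^ 2) z.2 ρ := by
    intro z
    ext p
    simp only [mem_preimage, mem_ofPred_eq, pCyl, Iminus, mem_prod, mem_Ioo, mem_ball,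
      dist_comm z.2, add_sub_cancel_right, sub_lt_iff_lt_add]
    tauto
  simp only [h3, volume_pCyl hρ, lintegral_const] at h1
  exact h1.symm

/-- The Riesz potential of order two of a finite measure converges at almost every point. -/
lemma ae_integrableOn_rieszPot (ν : Measure (ℝ × Ed d)) [IsFiniteMeasure ν] (R : ℝ) :
    ∀ᵐ p : ℝ × Ed d, IntegrableOn
      (fun ρ => (ν (pCyl p.1 p.2 ρ)).toReal / ρ ^ ((d : ℝ) + 2 - 2) / ρ) (Ioo 0 R) := by
  have hm := measurable_measure_pCyl ν
  have hfin : ∫⁻ p : ℝ × Ed d, ∫⁻ ρ in Ioo 0 R,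
      ν (pCyl p.1 p.2 ρ) * ENNReal.ofReal ((ρ ^ (d + 1))⁻¹) ≠ ∞ := by
    rw [lintegral_lintegral_swap
      (by exact (hm.mul (by fun_prop : Measurable fun q : (ℝ × Ed d) × ℝ =>
        ENNReal.ofReal ((q.2 ^ (d + 1))⁻¹))).aemeasurable)]
    refine ne_top_of_le_ne_top (b := ∫⁻ ρ in Ioo 0 R,
      ENNReal.ofReal R * (volume (ball (0 : Ed d) 1) * ν univ)) ?_ ?_
    · rw [setLIntegral_const, Real.volume_Ioo]
      have : volume (ball (0 : Ed d) 1) ≠ ∞ := measure_ball_lt_top.ne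
      finiteness
    · refine setLIntegral_mono measurable_const fun ρ hρ => ?_
      have h0 := hρ.1
      rw [lintegral_mul_const' _ _ ENNReal.ofReal_ne_top, lintegral_measure_pCyl ν hρ.1, mul_comm,
        mul_assoc (ENNReal.ofReal _), ← mul_assoc, ← ENNReal.ofReal_mul (by positivity)]
      gcongr
      rw [show ρ ^ (d + 2) = ρ ^ (d + 1) * ρ by ring, inv_mul_cancel_left₀ (by positivity)]
      exact hρ.2.le
  have hae := ae_lt_top (Measurable.lintegral_prod_right'
    (f := fun q : (ℝ × Ed d) × ℝ => ν (pCyl q.1.1 q.1.2 q.2) * ENNReal.ofReal ((q.2 ^ (d + 1))⁻¹))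
    (ν := volume.restrict (Ioo 0 R))
    (hm.mul (by fun_prop))) hfin
  filter_upwards [hae] with p hp
  have hmp : Measurable fun ρ : ℝ => ν (pCyl p.1 p.2 ρ) :=
    hm.comp (measurable_const.prodMk measurable_id)
  refine ⟨((hmp.ennreal_toReal.div (by fun_prop)).div measurable_id).aestronglyMeasurable, ?_⟩
  rw [hasFiniteIntegral_iff_enorm]
  refine lt_of_le_of_lt (setLIntegral_mono' measurableSet_Ioo fun ρ hρ => ?_) hp
  have h0 := hρ.1
  rw [Real.enorm_of_nonneg (by positivity), add_sub_cancel_right, Real.rpow_natCast, div_div,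
    ← pow_succ, div_eq_mul_inv, ENNReal.ofReal_mul ENNReal.toReal_nonneg,
    ENNReal.ofReal_toReal (measure_ne_top _ _)]

/-- The dyadic sum of normalised masses is controlled by the Riesz potential. -/
lemma summable_dyadic_rieszPot {ν : Measure (ℝ × Ed d)} [IsFiniteMeasure ν] {t₀ : ℝ} {x₀ : Ed d}
    {R : ℝ} (hR : 0 < R) (hi : IntegrableOn
      (fun ρ => (ν (pCyl t₀ x₀ ρ)).toReal / ρ ^ ((d : ℝ) + 2 - 2) / ρ) (Ioo 0 (2 * R))) :
    Summable (fun j : ℕ => (ν (pCyl t₀ x₀ (R / 2 ^ j))).toReal / (R / 2 ^ j) ^ d) ∧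
      ∑' j : ℕ, (ν (pCyl t₀ x₀ (R / 2 ^ j))).toReal / (R / 2 ^ j) ^ d ≤
        2 ^ (d + 1) * RieszPot ν 2 t₀ x₀ (2 * R) := by
  set F : ℝ → ℝ := fun ρ => (ν (pCyl t₀ x₀ ρ)).toReal / ρ ^ ((d : ℝ) + 2 - 2) / ρ with hF
  set m : ℕ → ℝ := fun j => (ν (pCyl t₀ x₀ (R / 2 ^ j))).toReal / (R / 2 ^ j) ^ d
  have hm0 : ∀ j, 0 ≤ m j := fun j => by positivity
  have hF0 : ∀ ρ ∈ Ioo 0 (2 * R), 0 ≤ F ρ := fun ρ hρ => by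
    have := hρ.1
    simp only [hF]
    positivity
  have hstep : ∀ r : ℝ, 0 < r → r ≤ R → (ν (pCyl t₀ x₀ r)).toReal / r ^ d ≤
      2 ^ (d + 1) * ∫ ρ in Ico r (2 * r), F ρ := by
    intro r hr hrR
    have hsub : Ico r (2 * r) ⊆ Ioo 0 (2 * R) := fun ρ hρ =>
      ⟨hr.trans_le hρ.1, hρ.2.trans_le (by linarith)⟩
    have h1 : ∫ _ in Ico r (2 * r), (ν (pCyl t₀ x₀ r)).toReal / (2 * r) ^ (d + 1) ≤
        ∫ ρ in Ico r (2 * r), F ρ := by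
      refine setIntegral_mono_on (by simp) (hi.mono_set hsub) measurableSet_Ico
        fun ρ hρ => ?_
      have hρ0 := hr.trans_le hρ.1
      simp only [hF]
      rw [add_sub_cancel_right, Real.rpow_natCast, div_div, ← pow_succ]
      refine div_le_div₀ ENNReal.toReal_nonneg (ENNReal.toReal_mono (measure_ne_top _ _)
        (measure_mono (pCyl_mono hr.le hρ.1))) (by positivity) ?_
      exact pow_le_pow_left₀ hρ0.le hρ.2.le _
    rw [setIntegral_const, measureReal_def, Real.volume_Ico, ENNReal.toReal_ofReal (by linarith),
      smul_eq_mul] at h1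
    refine le_trans (le_of_eq ?_) (mul_le_mul_of_nonneg_left h1 (by positivity))
    rw [mul_pow]
    field_simp
    ring
  have hsum : ∀ n, ∑ j ∈ Finset.range n, m j ≤
      2 ^ (d + 1) * ∫ ρ in Ico (2 * R / 2 ^ n) (2 * R), F ρ := by
    intro n
    induction n with
    | zero => simp
    | succ n ih =>
      have hn : (0 : ℝ) < 2 * R / 2 ^ (n + 1) := by positivity
      have e1 : 2 * R / 2 ^ (n + 1) = R / 2 ^ n := by rw [pow_succ]; field_simp
      have e2 : 2 * R / 2 ^ n = 2 * (R / 2 ^ n) := by ring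
      have hRn : R / 2 ^ n ≤ R := div_le_self hR.le (one_le_pow₀ one_le_two)
      have hRp : 0 < R / 2 ^ n := by positivity
      rw [Finset.sum_range_succ, e1, ← Ico_union_Ico_eq_Ico
        (show R / 2 ^ n ≤ 2 * (R / 2 ^ n) by linarith) (by linarith : 2 * (R / 2 ^ n) ≤ 2 * R),
        setIntegral_union (Ico_disjoint_Ico_same) measurableSet_Ico, mul_add, add_comm]
      · exact add_le_add (hstep _ hRp hRn) (e2 ▸ ih)
      · exact hi.mono_set fun ρ hρ => ⟨hRp.trans_le hρ.1, hρ.2.trans_le (by linarith)⟩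
      · exact hi.mono_set fun ρ hρ => ⟨(by linarith : 0 < 2 * (R / 2 ^ n)).trans_le hρ.1, hρ.2⟩
  have hle : ∀ n, ∑ j ∈ Finset.range n, m j ≤ 2 ^ (d + 1) * RieszPot ν 2 t₀ x₀ (2 * R) := by
    intro n
    refine (hsum n).trans (mul_le_mul_of_nonneg_left ?_ (by positivity))
    refine setIntegral_mono_set hi ?_ (Eventually.of_forall fun ρ hρ => ?_)
    · exact (ae_restrict_mem measurableSet_Ioo).mono hF0
    · exact ⟨(by positivity : 0 < 2 * R / 2 ^ n).trans_le hρ.1, hρ.2⟩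
  exact ⟨summable_of_sum_range_le hm0 hle, Real.tsum_le_of_sum_range_le hm0 hle⟩

end RieszPotential

section WeakSolutions

lemma closure_pCyl {r : ℝ} (hr : r ≠ 0) (t₀ : ℝ) (x₀ : Ed d) :
    closure (pCyl t₀ x₀ r) = Icc (t₀ - r ^ 2) t₀ ×ˢ closedBall x₀ r := by
  have : 0 < r ^ 2 := by positivity
  rw [pCyl, Iminus, closure_prod_eq, closure_Ioo (by linarith), closure_ball _ hr]

lemma setIntegral_setIntegral_eq_integral {F : ℝ × Ed d → ℝ} {S : Set ℝ} {Ω : Set (Ed d)}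
    (hF : Integrable F) (h0 : ∀ t x, (t, x) ∉ S ×ˢ Ω → F (t, x) = 0) :
    ∫ t in S, ∫ x in Ω, F (t, x) = ∫ p, F p := by
  have h1 : ∀ t, ∫ x in Ω, F (t, x) = ∫ x, F (t, x) := fun t =>
    setIntegral_eq_integral_of_forall_compl_eq_zero fun x hx => h0 t x fun h => hx h.2
  simp_rw [h1]
  rw [setIntegral_eq_integral_of_forall_compl_eq_zero, Measure.volume_eq_prod]
  · exact (integral_prod _ hF).symm
  · intro t ht
    simp [h0 t _ fun h => ht h.1]

lemma integrable_fderiv_apply {φ : ℝ × Ed d → ℝ} (hφ : ContDiff ℝ (⊤ : ℕ∞) φ)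
    (hφc : HasCompactSupport φ) {Q : Set (ℝ × Ed d)} (hQ : MeasurableSet Q)
    (hφQ : tsupport φ ⊆ Q) {v : ℝ × Ed d → ℝ × Ed d} (hv : Measurable v) (hvQ : IntegrableOn v Q) :
    Integrable fun p => fderiv ℝ φ p (v p) := by
  have hc : Continuous (fderiv ℝ φ) := hφ.continuous_fderiv (by simp)
  obtain ⟨M, hM⟩ := (hφc.fderiv ℝ).exists_bound_of_continuous hc
  refine Integrable.mono' (g := Q.indicator fun p => M * ‖v p‖)
    ((integrable_indicator_iff hQ).2 (hvQ.norm.const_mul M)) ?_ (Eventually.of_forall fun p => ?_)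
  · have : Continuous fun q : (ℝ × Ed d) × (ℝ × Ed d) => fderiv ℝ φ q.1 q.2 :=
      (hc.comp continuous_fst).clm_apply continuous_snd
    exact (this.measurable.comp (measurable_id.prodMk hv)).aestronglyMeasurable
  · by_cases hp : p ∈ Q
    · rw [indicator_of_mem hp]
      exact (ContinuousLinearMap.le_opNorm _ _).trans (by gcongr; exact hM p)
    · rw [indicator_of_notMem hp, image_eq_zero_of_notMem_tsupport
        fun h => hp (hφQ (tsupport_fderiv_subset ℝ h))]
      simp

lemma fderiv_apply_eq_zero {φ : ℝ × Ed d → ℝ} {p : ℝ × Ed d} (hp : p ∉ tsupport φ)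
    (v : ℝ × Ed d) : fderiv ℝ φ p v = 0 := by
  rw [image_eq_zero_of_notMem_tsupport fun h => hp (tsupport_fderiv_subset ℝ h)]
  rfl

lemma mul_deriv_eq_fderiv {φ : ℝ × Ed d → ℝ} (hφ : Differentiable ℝ φ) (c t : ℝ) (x : Ed d) :
    c * deriv (fun τ => φ (τ, x)) t = fderiv ℝ φ (t, x) (c, 0) := by
  have h : HasDerivAt (fun τ => φ (τ, x)) (fderiv ℝ φ (t, x) (1, 0)) t :=
    (hφ (t, x)).hasFDerivAt.comp_hasDerivAt t ((hasDerivAt_id t).prodMk (hasDerivAt_const t x))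
  rw [h.deriv, ← smul_eq_mul, ← map_smul]
  simp

lemma inner_gradient_eq_fderiv {φ : ℝ × Ed d → ℝ} (hφ : Differentiable ℝ φ) (t : ℝ) (a x : Ed d) :
    ⟪a, gradient (fun y => φ (t, y)) x⟫ = fderiv ℝ φ (t, x) (0, a) := by
  have h : HasFDerivAt (fun y => φ (t, y)) ((fderiv ℝ φ (t, x)).comp
      (ContinuousLinearMap.inr ℝ ℝ (Ed d))) x :=
    (hφ (t, x)).hasFDerivAt.comp x (hasFDerivAt_prodMk_right t x)
  rw [real_inner_comm, gradient, InnerProductSpace.toDual_symm_apply, h.fderiv]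
  rfl

lemma IsTestFunction.of_tsupport_subset {φ : ℝ × Ed d → ℝ} (hφ : ContDiff ℝ (⊤ : ℕ∞) φ)
    (hφc : HasCompactSupport φ) {Ω : Set (Ed d)} (hΩ : ∀ p ∈ tsupport φ, p.2 ∈ Ω) :
    IsTestFunction Ω fun t x => φ (t, x) := by
  have hK : IsCompact (Prod.snd '' tsupport φ) := hφc.isCompact.image continuous_snd
  refine ⟨hφ, _, hK, ?_, fun t => closure_minimal ?_ hK.isClosed⟩
  · rintro _ ⟨p, hp, rfl⟩
    exact hΩ p hp
  · exact fun x hx => ⟨(t, x), subset_tsupport _ hx, rfl⟩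

lemma abs_signedIntegral_le (μ : SignedMeasure (ℝ × Ed d)) {f : ℝ × Ed d → ℝ}
    (hf : ∀ ν : Measure (ℝ × Ed d), IsFiniteMeasure ν → Integrable f ν) :
    |signedIntegral μ f| ≤ ∫ p, |f p| ∂μ.totalVariation := by
  have h1 := hf μ.toJordanDecomposition.posPart inferInstance
  have h2 := hf μ.toJordanDecomposition.negPart inferInstance
  rw [SignedMeasure.totalVariation, integral_add_measure h1.abs h2.abs, signedIntegral]
  exact (abs_sub _ _).trans
    (add_le_add (abs_integral_le_integral_abs) (abs_integral_le_integral_abs))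

/-- Local weak solutions are solutions, in the sense of `CylSol`, on each cylinder compactly
contained in the domain. -/
theorem cylSol_of_isLocalWeakSolution {s Λ T : ℝ} {Ω : Set (Ed d)}
    {A : ℝ → Ed d → Ed d → Ed d} (hA : VectorFieldHyp d Λ A) {K : ℝ → Ed d → Ed d → ℝ}
    {μ : SignedMeasure (ℝ × Ed d)} {u : ℝ → Ed d → ℝ} {Du : ℝ → Ed d → Ed d}
    (hu : LocalWeakReg d s (Ioo 0 T) Ω u Du) (hsol : IsLocalWeakSolution A K (Ioo 0 T) Ω μ u Du)
    {t₀ : ℝ} {x₀ : Ed d} {R : ℝ} (hR : 0 < R) (hQ : closure (pCyl t₀ x₀ R) ⊆ Ioo 0 T ×ˢ Ω) :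
    CylSol s Λ K μ.totalVariation t₀ x₀ R (Function.uncurry u) (Function.uncurry Du)
      (fun p => A p.1 p.2 (Du p.1 p.2)) := by
  have hR2 : 0 < R ^ 2 := by positivity
  rw [closure_pCyl hR.ne', prod_subset_prod_iff] at hQ
  obtain ⟨hJ, hB⟩ : Icc (t₀ - R ^ 2) t₀ ⊆ Ioo 0 T ∧ closedBall x₀ R ⊆ Ω := by
    rcases hQ with h | h | h
    · exact h
    · exact absurd h (nonempty_Icc.2 (by linarith)).ne_empty
    · exact absurd h (nonempty_closedBall.2 hR.le).ne_empty
  have hA0 : ∀ t x, A t x 0 = 0 := fun t x => by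
    simpa using hA.growth t x 0
  have hma : Measurable fun p : ℝ × Ed d => A p.1 p.2 (Du p.1 p.2) := by
    have h1 : Measurable (Function.uncurry fun (ξ : Ed d) (p : ℝ × Ed d) => A p.1 p.2 ξ) :=
      measurable_uncurry_of_continuous_of_measurable (fun p => hA.cont p.1 p.2) hA.meas
    exact h1.comp (hu.measD.prodMk measurable_id)
  have hQ2 := (hu.l2w12 _ _ hJ _ (isCompact_closedBall x₀ R) hB).mono_set
    (prod_mono le_rfl ball_subset_closedBall)
  have hu2 : MemLp (Function.uncurry u) 2 (volume.restrict (pCyl t₀ x₀ R)) := by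
    refine (memLp_two_iff_integrable_sq hu.meas.aestronglyMeasurable).2 (hQ2.mono'
      (hu.meas.pow_const 2).aestronglyMeasurable (Eventually.of_forall fun p => ?_))
    rw [Real.norm_of_nonneg (sq_nonneg _)]
    exact le_add_of_nonneg_right (sq_nonneg _)
  have hD2 : MemLp (Function.uncurry Du) 2 (volume.restrict (pCyl t₀ x₀ R)) := by
    refine (memLp_two_iff_integrable_sq_norm hu.measD.aestronglyMeasurable).2 (hQ2.mono'
      (hu.measD.norm.pow_const 2).aestronglyMeasurable (Eventually.of_forall fun p => ?_))
    rw [Real.norm_of_nonneg (sq_nonneg _)]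
    exact le_add_of_nonneg_left (sq_nonneg _)
  refine ⟨hu.meas, hu.measD, hma, fun p => hA.growth _ _ _, fun p => ?_, hu2, hD2, ?_, ?_, ?_⟩
  · simpa [hA0, Function.uncurry_def] using hA.monotone p.1 p.2 0 (Du p.1 p.2)
  · have hm : Measurable fun p : ℝ × Ed d =>
        |Function.uncurry u p| / (1 + ‖p.2‖ ^ ((d : ℝ) + 2 * s)) := by
      have := hu.meas
      fun_prop
    have : Integrable (fun p : ℝ × Ed d =>
        |Function.uncurry u p| / (1 + ‖p.2‖ ^ ((d : ℝ) + 2 * s)))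
        ((volume.restrict (Iminus t₀ R)).prod (volume.restrict univ)) := by
      rw [integrable_prod_iff hm.aestronglyMeasurable, Measure.restrict_univ]
      constructor
      · filter_upwards [ae_restrict_of_ae hu.tail_ae,
          ae_restrict_mem measurableSet_Ioo] with t h1 h2
        exact h1 (hJ (Ioo_subset_Icc_self h2))
      · have h1 := hu.tail_l2 _ _ hJ
        have h2 : MemLp (fun t => ∫ y : Ed d, |u t y| / (1 + ‖y‖ ^ ((d : ℝ) + 2 * s))) 2
            (volume.restrict (Iminus t₀ R)) :=
          (memLp_two_iff_integrable_sq
            (hm.stronglyMeasurable.integral_prod_right').aestronglyMeasurable).2 h1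
        have : IsFiniteMeasure (volume.restrict (Iminus t₀ R)) :=
          ⟨by rw [Measure.restrict_apply_univ, Iminus]; exact measure_Ioo_lt_top⟩
        refine (h2.integrable one_le_two).congr (Eventually.of_forall fun t => ?_)
        refine integral_congr_ae (Eventually.of_forall fun y => ?_)
        dsimp only [Function.uncurry]
        rw [Real.norm_of_nonneg (by positivity)]
    rwa [Measure.prod_restrict] at this
  · intro t ht φ hφ hφc hφs e
    exact hu.grad t (hJ (Ioo_subset_Icc_self ht)) φ hφ hφc
      (hφs.trans (ball_subset_closedBall.trans hB)) e
  · intro φ hφ hφc hφs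
    have hφd : Differentiable ℝ φ := hφ.differentiable (by simp)
    have hφ0 : ∀ t x, t ∉ Iminus t₀ R ∨ x ∉ ball x₀ R → φ (t, x) = 0 := fun t x h =>
      image_eq_zero_of_notMem_tsupport fun h' =>
        h.elim (fun h => h (hφs h').1) fun h => h (hφs h').2
    have hsub : pCyl t₀ x₀ R ⊆ Ioc (t₀ - R ^ 2) t₀ ×ˢ Ω :=
      prod_mono Ioo_subset_Ioc_self (ball_subset_closedBall.trans hB)
    have hns : ∀ t x, (t, x) ∉ Ioc (t₀ - R ^ 2) t₀ ×ˢ Ω → (t, x) ∉ tsupport φ := fun t x h h' =>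
      h (hsub (hφs h'))
    have hfin : IsFiniteMeasure (volume.restrict (pCyl t₀ x₀ R)) := by
      refine ⟨?_⟩
      rw [Measure.restrict_apply_univ, volume_pCyl hR]
      exact ENNReal.mul_lt_top ENNReal.ofReal_lt_top measure_ball_lt_top
    have hui : IntegrableOn (fun p => ((Function.uncurry u p, 0) : ℝ × Ed d)) (pCyl t₀ x₀ R) :=
      (hu2.integrable one_le_two).prodMk (integrable_zero _ _ _)
    have hai : IntegrableOn (fun p => ((0, A p.1 p.2 (Du p.1 p.2)) : ℝ × Ed d)) (pCyl t₀ x₀ R) := by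
      refine (integrable_zero _ _ _).prodMk (((hD2.integrable one_le_two).norm.const_mul Λ).mono'
        hma.aestronglyMeasurable (Eventually.of_forall fun p => hA.growth _ _ _))
    have key := hsol (t₀ - R ^ 2) t₀ (by linarith) hJ (fun t x => φ (t, x))
      (.of_tsupport_subset hφ hφc fun p hp => hB (ball_subset_closedBall (hφs hp).2))
    have e1 : ∫ t in Ioc (t₀ - R ^ 2) t₀, ∫ x in Ω, u t x * deriv (fun τ => φ (τ, x)) t =
        ∫ p, Function.uncurry u p * fderiv ℝ φ p (1, 0) := by
      simp_rw [mul_deriv_eq_fderiv hφd]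
      refine (setIntegral_setIntegral_eq_integral (integrable_fderiv_apply hφ hφc
        (measurableSet_pCyl _ _ _) hφs (hu.meas.prodMk measurable_const) hui) fun t x h =>
          fderiv_apply_eq_zero (hns t x h) _).trans ?_
      refine integral_congr_ae (Eventually.of_forall fun p => ?_)
      dsimp only
      rw [← smul_eq_mul, ← map_smul]
      simp
    have e2 : ∫ t in Ioc (t₀ - R ^ 2) t₀, ∫ x in Ω,
        ⟪A t x (Du t x), gradient (fun y => φ (t, y)) x⟫ =
        ∫ p, fderiv ℝ φ p (0, A p.1 p.2 (Du p.1 p.2)) := by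
      simp_rw [inner_gradient_eq_fderiv hφd]
      exact setIntegral_setIntegral_eq_integral (integrable_fderiv_apply hφ hφc
        (measurableSet_pCyl _ _ _) hφs (measurable_const.prodMk hma) hai) fun t x h =>
          fderiv_apply_eq_zero (hns t x h) _
    have e3 : ∫ t in Ioc (t₀ - R ^ 2) t₀, ∫ x, ∫ y,
        (u t x - u t y) * (φ (t, x) - φ (t, y)) * K t x y =
        ∫ t, ∫ x, ∫ y, (u t x - u t y) * (φ (t, x) - φ (t, y)) * K t x y := by
      refine setIntegral_eq_integral_of_forall_compl_eq_zero fun t ht => ?_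
      have : ∀ x, φ (t, x) = 0 := fun x => hφ0 t x (Or.inl fun h => ht (Ioo_subset_Ioc_self h))
      simp [this]
    have e4 : (Ioc (t₀ - R ^ 2) t₀ ×ˢ Ω).indicator (fun p => φ (p.1, p.2)) = φ := by
      funext p
      by_cases hp : p ∈ Ioc (t₀ - R ^ 2) t₀ ×ˢ Ω
      · rw [indicator_of_mem hp]
      · rw [indicator_of_notMem hp, image_eq_zero_of_notMem_tsupport (hns p.1 p.2 hp)]
    have e5 : ∀ x, φ (t₀, x) = 0 := fun x => hφ0 _ _ (Or.inl fun h => lt_irrefl _ h.2)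
    have e6 : ∀ x, φ (t₀ - R ^ 2, x) = 0 := fun x => hφ0 _ _ (Or.inl fun h => lt_irrefl _ h.1)
    rw [mixedLHS, e1, e2, e3, e4] at key
    simp only [e5, e6, mul_zero, integral_zero, add_zero, sub_zero] at key
    simp only [Function.uncurry_apply_pair]
    rw [key]
    exact abs_signedIntegral_le μ fun ν _ => hφ.continuous.integrable_of_hasCompactSupport hφc

end WeakSolutions

section Averages

variable {α : Type*} [MeasurableSpace α] {μ : Measure α}

lemma integrable_rpow_of_sq [IsFiniteMeasure μ] {f : α → ℝ} (hf : Measurable f)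
    (hf0 : ∀ x, 0 ≤ f x) (hi : Integrable (fun x => f x ^ 2) μ) {q : ℝ} (hq0 : 0 ≤ q)
    (hq2 : q ≤ 2) : Integrable (fun x => f x ^ q) μ := by
  refine ((integrable_const (1 : ℝ)).add hi).mono' (hf.pow_const q).aestronglyMeasurable
    (Eventually.of_forall fun x => ?_)
  rw [Real.norm_of_nonneg (Real.rpow_nonneg (hf0 x) q), Pi.add_apply]
  rcases le_total (f x) 1 with h | h
  · exact (Real.rpow_le_one (hf0 x) h hq0).trans (le_add_of_nonneg_right (sq_nonneg _))
  · rw [← Real.rpow_natCast]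
    exact (Real.rpow_le_rpow_of_exponent_le h (by simpa using hq2)).trans
      (le_add_of_nonneg_left zero_le_one)

lemma setLIntegral_rpow_le_of_setAverage_le {S : Set α} (hS0 : μ S ≠ 0) (hS : μ S ≠ ∞)
    {f : α → ℝ} (hf : Measurable f) (hf0 : ∀ x, 0 ≤ f x) {p q δ : ℝ} (hp : 0 < p) (hpq : p ≤ q)
    (hi : IntegrableOn (fun x => f x ^ q) S μ) (hδ : (⨍ x in S, f x ^ q ∂μ) ^ (1 / q) ≤ δ) :
    ∫⁻ x in S, ENNReal.ofReal (f x) ^ p ∂μ ≤ ENNReal.ofReal (δ ^ p) * μ S := by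
  have hq : 0 < q := hp.trans_le hpq
  have hfq : ∀ x, 0 ≤ f x ^ q := fun x => Real.rpow_nonneg (hf0 x) q
  have havg : 0 ≤ ⨍ x in S, f x ^ q ∂μ := by
    rw [setAverage_eq]
    exact smul_nonneg (by positivity) (integral_nonneg hfq)
  have hδ0 : 0 ≤ δ := (Real.rpow_nonneg havg _).trans hδ
  have he : ∀ x r, ‖f x‖ₑ ^ (r : ℝ) = ENNReal.ofReal (f x) ^ r := fun x r => by
    rw [Real.enorm_of_nonneg (hf0 x)]
  have h := eLpNorm'_le_eLpNorm'_mul_rpow_measure_univ hp hpq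
    (hf.aestronglyMeasurable (μ := μ.restrict S))
  simp only [eLpNorm', he, Measure.restrict_apply_univ] at h
  have h1 : ∫⁻ x in S, ENNReal.ofReal (f x) ^ q ∂μ =
      μ S * ENNReal.ofReal (⨍ x in S, f x ^ q ∂μ) := by
    rw [setAverage_eq, smul_eq_mul, ENNReal.ofReal_mul (by positivity), measureReal_def,
      ENNReal.ofReal_inv_of_pos (ENNReal.toReal_pos hS0 hS), ENNReal.ofReal_toReal hS, ← mul_assoc,
      ENNReal.mul_inv_cancel hS0 hS, one_mul,
      ofReal_integral_eq_lintegral_ofReal hi (Eventually.of_forall hfq)]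
    exact lintegral_congr fun x => ENNReal.ofReal_rpow_of_nonneg (hf0 x) hq.le
  have h2 : (∫⁻ x in S, ENNReal.ofReal (f x) ^ p ∂μ) ^ (1 / p) ≤
      ENNReal.ofReal δ * μ S ^ (1 / p) := by
    refine h.trans ?_
    rw [h1, ENNReal.mul_rpow_of_nonneg _ _ (by positivity),
      ENNReal.ofReal_rpow_of_nonneg havg (by positivity), mul_right_comm,
      ← ENNReal.rpow_add _ _ hS0 hS, add_sub_cancel, mul_comm]
    gcongr
  calc _ = ((∫⁻ x in S, ENNReal.ofReal (f x) ^ p ∂μ) ^ (1 / p)) ^ p := by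
        rw [← ENNReal.rpow_mul, one_div_mul_cancel hp.ne', ENNReal.rpow_one]
    _ ≤ (ENNReal.ofReal δ * μ S ^ (1 / p)) ^ p := ENNReal.rpow_le_rpow h2 hp.le
    _ = _ := by
        rw [ENNReal.mul_rpow_of_nonneg _ _ hp.le, ← ENNReal.rpow_mul, one_div_mul_cancel hp.ne',
          ENNReal.rpow_one, ENNReal.ofReal_rpow_of_nonneg hδ0 hp.le]

end Averages

section Tails

variable {s : ℝ}

lemma tail_nonneg (s : ℝ) (v : Ed d → ℝ) (x₀ : Ed d) (R : ℝ) : 0 ≤ Tail s v x₀ R := by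
  rw [Tail]
  exact mul_nonneg (sq_nonneg _) (integral_nonneg fun y => by positivity)

lemma ofReal_tail {v : Ed d → ℝ} {x₀ : Ed d} {R : ℝ}
    (hv : IntegrableOn (fun y => |v y| / ‖x₀ - y‖ ^ ((d : ℝ) + 2 * s)) (ball x₀ R)ᶜ) :
    ENNReal.ofReal (R ^ 2) * ∫⁻ y in (ball x₀ R)ᶜ, ENNReal.ofReal |v y| * farK s x₀ y =
      ENNReal.ofReal (Tail s v x₀ R) := by
  rw [Tail, ENNReal.ofReal_mul (sq_nonneg R),
    ofReal_integral_eq_lintegral_ofReal hv (Eventually.of_forall fun y => by positivity)]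
  congr 1
  refine lintegral_congr fun y => ?_
  rw [farK, ← ENNReal.ofReal_mul (abs_nonneg _), mul_one_div]

lemma exists_tail_le (hs : 0 < s) (x₀ : Ed d) {R : ℝ} (hR : 0 < R) :
    ∃ C : ℝ, 0 ≤ C ∧ ∀ v : Ed d → ℝ, Measurable v →
      Integrable (fun y => |v y| / (1 + ‖y‖ ^ ((d : ℝ) + 2 * s))) →
      IntegrableOn (fun y => |v y| / ‖x₀ - y‖ ^ ((d : ℝ) + 2 * s)) (ball x₀ R)ᶜ ∧
      Tail s v x₀ R ≤ C * ∫ y, |v y| / (1 + ‖y‖ ^ ((d : ℝ) + 2 * s)) := by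
  obtain ⟨C, hC, h⟩ := exists_far_const hs x₀ le_rfl hR
  refine ⟨R ^ 2 * C, by positivity, fun v hm hv => ?_⟩
  have hle : ∀ y ∈ (ball x₀ R)ᶜ, |v y| / ‖x₀ - y‖ ^ ((d : ℝ) + 2 * s) ≤
      C * (|v y| / (1 + ‖y‖ ^ ((d : ℝ) + 2 * s))) := fun y hy => by
    have := mul_le_mul_of_nonneg_left (h x₀ (mem_closedBall_self le_rfl) y hy) (abs_nonneg (v y))
    rw [mul_left_comm, mul_one_div, mul_one_div] at this
    exact this
  have hi : IntegrableOn (fun y => |v y| / ‖x₀ - y‖ ^ ((d : ℝ) + 2 * s)) (ball x₀ R)ᶜ := by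
    refine (hv.integrableOn.const_mul C).mono' (by
      have : Measurable fun y => |v y| / ‖x₀ - y‖ ^ ((d : ℝ) + 2 * s) := by fun_prop
      exact this.aestronglyMeasurable) ?_
    filter_upwards [ae_restrict_mem measurableSet_ball.compl] with y hy
    rw [Real.norm_of_nonneg (by positivity)]
    exact hle y hy
  refine ⟨hi, ?_⟩
  rw [Tail, mul_assoc]
  refine mul_le_mul_of_nonneg_left ?_ (sq_nonneg R)
  calc _ ≤ ∫ y in (ball x₀ R)ᶜ, C * (|v y| / (1 + ‖y‖ ^ ((d : ℝ) + 2 * s))) :=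
        setIntegral_mono_on hi (hv.integrableOn.const_mul C) measurableSet_ball.compl hle
    _ = C * ∫ y in (ball x₀ R)ᶜ, |v y| / (1 + ‖y‖ ^ ((d : ℝ) + 2 * s)) := integral_const_mul _ _
    _ ≤ _ := mul_le_mul_of_nonneg_left
        (setIntegral_le_integral hv (Eventually.of_forall fun y => by positivity)) hC

lemma measurable_tail {u : ℝ → Ed d → ℝ} (hu : Measurable (Function.uncurry u)) (x₀ : Ed d)
    (R : ℝ) : Measurable fun t => Tail s (u t) x₀ R := by
  have h : Measurable fun p : ℝ × Ed d =>
      |Function.uncurry u p| / ‖x₀ - p.2‖ ^ ((d : ℝ) + 2 * s) := by fun_prop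
  exact (h.stronglyMeasurable.integral_prod_right'
    (ν := volume.restrict (ball x₀ R)ᶜ)).measurable.const_mul _

lemma LocalWeakReg.integrable_tail_sq {J : Set ℝ} {Ω : Set (Ed d)} {u : ℝ → Ed d → ℝ}
    {Du : ℝ → Ed d → Ed d} (hu : LocalWeakReg d s J Ω u Du) (hs : 0 < s) {t₀ R r : ℝ} (hr : 0 < r)
    (hJ : Icc (t₀ - R ^ 2) t₀ ⊆ J) (x₀ : Ed d) :
    (∀ᵐ t ∂volume.restrict (Iminus t₀ R),
      ENNReal.ofReal (r ^ 2) * ∫⁻ y in (ball x₀ r)ᶜ, ENNReal.ofReal |u t y| * farK s x₀ y =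
      ENNReal.ofReal (Tail s (u t) x₀ r)) ∧
      IntegrableOn (fun t => Tail s (u t) x₀ r ^ 2) (Iminus t₀ R) := by
  obtain ⟨C, hC, h⟩ := exists_tail_le hs x₀ hr
  have hae : ∀ᵐ t ∂volume.restrict (Iminus t₀ R),
      Integrable fun y : Ed d => |u t y| / (1 + ‖y‖ ^ ((d : ℝ) + 2 * s)) := by
    filter_upwards [ae_restrict_of_ae hu.tail_ae, ae_restrict_mem measurableSet_Ioo] with t h1 h2
    exact h1 (hJ (Ioo_subset_Icc_self h2))
  have hm : ∀ t, Measurable (u t) := fun t => hu.meas.comp measurable_prodMk_left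
  refine ⟨hae.mono fun t ht => ofReal_tail (h _ (hm t) ht).1, ?_⟩
  refine ((hu.tail_l2 _ _ hJ).const_mul (C ^ 2)).mono'
    ((measurable_tail hu.meas x₀ r).pow_const 2).aestronglyMeasurable (hae.mono fun t ht => ?_)
  rw [Real.norm_of_nonneg (sq_nonneg _), ← mul_pow]
  exact pow_le_pow_left₀ (tail_nonneg _ _ _ _) (h _ (hm t) ht).2 2

lemma LocalWeakReg.locallyIntegrableOn {J : Set ℝ} {Ω : Set (Ed d)} {u : ℝ → Ed d → ℝ}
    {Du : ℝ → Ed d → Ed d} (hu : LocalWeakReg d s J Ω u Du) (hJ : IsOpen J) (hΩ : IsOpen Ω) :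
    LocallyIntegrableOn (Function.uncurry u) (J ×ˢ Ω) := by
  rintro ⟨t, x⟩ ⟨ht, hx⟩
  obtain ⟨a, ha, haJ⟩ := Metric.nhds_basis_closedBall.mem_iff.1 (hJ.mem_nhds ht)
  obtain ⟨b, hb, hbΩ⟩ := Metric.nhds_basis_closedBall.mem_iff.1 (hΩ.mem_nhds hx)
  rw [Real.closedBall_eq_Icc] at haJ
  refine ⟨Ioo (t - a) (t + a) ×ˢ closedBall x b, mem_nhdsWithin_of_mem_nhds
    (prod_mem_nhds (Ioo_mem_nhds (by linarith) (by linarith)) (closedBall_mem_nhds x hb)), ?_⟩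
  have h := hu.l2w12 _ _ haJ _ (isCompact_closedBall x b) hbΩ
  have hfin : IsFiniteMeasure (volume.restrict (Ioo (t - a) (t + a) ×ˢ closedBall x b)) := by
    refine ⟨?_⟩
    rw [Measure.restrict_apply_univ, Measure.volume_eq_prod, Measure.prod_prod]
    exact ENNReal.mul_lt_top measure_Ioo_lt_top measure_closedBall_lt_top
  refine ((integrable_const (1 : ℝ)).add h).mono' hu.meas.aestronglyMeasurable
    (Eventually.of_forall fun p => ?_)
  rw [Pi.add_apply, Real.norm_eq_abs, Function.uncurry]
  nlinarith [sq_nonneg (|u p.1 p.2| - 1), sq_abs (u p.1 p.2), sq_nonneg ‖Du p.1 p.2‖]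

end Tails

/-- A subsolution bound at every Lebesgue point in terms of `L^q` averages and a dyadic sum. -/
lemma exists_pointwise_bound {s Λ q : ℝ} (hd : 2 ≤ d) (hΛ : 1 ≤ Λ) (hs : 0 < s) (hs1 : s < 1)
    (hq1 : 1 < q) (hq2 : q ≤ 2) :
    ∃ C : ℝ, 0 < C ∧ ∀ (K : ℝ → Ed d → Ed d → ℝ), KernelHyp d s Λ K →
      ∀ (ν : Measure (ℝ × Ed d)) [IsFiniteMeasure ν] (p : ℝ × Ed d) (R : ℝ)
      (u : ℝ × Ed d → ℝ) (Du a : ℝ × Ed d → Ed d) (τ : ℝ → ℝ), 0 < R → R ≤ 1 →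
      CylSol s Λ K ν p.1 p.2 (2 * R) u Du a → Measurable τ → (∀ t, 0 ≤ τ t) →
      IntegrableOn (fun t => τ t ^ 2) (Iminus p.1 R) →
      (∀ᵐ t ∂volume.restrict (Iminus p.1 R), ENNReal.ofReal (R ^ 2) *
        ∫⁻ y in (ball p.2 R)ᶜ, ENNReal.ofReal |u (t, y)| * farK s p.2 y = ENNReal.ofReal (τ t)) →
      Summable (fun j : ℕ => (ν (pCyl p.1 p.2 (R / 2 ^ j))).toReal / (R / 2 ^ j) ^ d) →
      (∀ η : ℝ, 0 < η → ∃ᶠ j : ℕ in atTop, ∫⁻ z in pCyl p.1 p.2 (R / 2 ^ j), ‖u z - u p‖ₑ <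
        ENNReal.ofReal (η * (R / 2 ^ j) ^ (d + 2))) →
      u p ≤ C * ((⨍ z in pCyl p.1 p.2 R, |u z| ^ q) ^ (1 / q)
        + (⨍ t in Iminus p.1 R, τ t ^ q) ^ (1 / q)
        + ∑' j : ℕ, (ν (pCyl p.1 p.2 (R / 2 ^ j))).toReal / (R / 2 ^ j) ^ d) := by
  have hd0 : (0 : ℝ) < d := by exact_mod_cast (by omega : 0 < d)
  set ε : ℝ := min (q - 1) (1 / (2 * d)) with hεdef
  have hε : 0 < ε := lt_min (by linarith) (by positivity)
  have hεd : ε * (2 * d) ≤ 1 := by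
    rw [← le_div_iff₀ (by positivity)]
    exact min_le_right _ _
  have hεq : 1 + ε ≤ q := by linarith [min_le_left (q - 1) (1 / (2 * (d : ℝ)))]
  obtain ⟨C, hC, H⟩ := exists_level_bound hd hΛ hs hs1 hε hεd
  set κ : ℝ := max 1 (volume (ball (0 : Ed d) 1)).toReal with hκ
  have hκ1 : 1 ≤ κ := le_max_left _ _
  refine ⟨C * κ, by positivity, fun K hK ν _ p R u Du a τ hR hR1 hu hτ hτ0 hτi hτt hm hleb => ?_⟩
  set X := (⨍ z in pCyl p.1 p.2 R, |u z| ^ q) ^ (1 / q) with hX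
  set Y := (⨍ t in Iminus p.1 R, τ t ^ q) ^ (1 / q) with hY
  set M := ∑' j : ℕ, (ν (pCyl p.1 p.2 (R / 2 ^ j))).toReal / (R / 2 ^ j) ^ d with hM
  have hX0 : 0 ≤ X := Real.rpow_nonneg (by
    rw [setAverage_eq]
    exact smul_nonneg (by positivity) (integral_nonneg fun z => by positivity)) _
  have hY0 : 0 ≤ Y := Real.rpow_nonneg (by
    rw [setAverage_eq]
    exact smul_nonneg (by positivity) (integral_nonneg fun t => Real.rpow_nonneg (hτ0 t) q)) _
  have hM0 : 0 ≤ M := tsum_nonneg fun j => by positivity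
  have hvI : volume (Iminus p.1 R) = ENNReal.ofReal (R ^ 2) := by
    rw [Iminus, Real.volume_Ioo, sub_sub_cancel]
  have hB0 : volume (ball (0 : Ed d) 1) ≠ 0 := (measure_ball_pos _ _ one_pos).ne'
  have hBt : volume (ball (0 : Ed d) 1) ≠ ∞ := measure_ball_lt_top.ne
  have hvQ := volume_pCyl hR p.1 p.2
  have hQ0 : volume (pCyl p.1 p.2 R) ≠ 0 := by
    rw [hvQ]
    exact mul_ne_zero (ENNReal.ofReal_pos.2 (by positivity)).ne' hB0
  have hQt : volume (pCyl p.1 p.2 R) ≠ ∞ := by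
    rw [hvQ]
    exact ENNReal.mul_ne_top ENNReal.ofReal_ne_top hBt
  have hI0 : volume (Iminus p.1 R) ≠ 0 := by
    rw [hvI]
    exact (ENNReal.ofReal_pos.2 (by positivity)).ne'
  have hIt : volume (Iminus p.1 R) ≠ ∞ := by
    rw [hvI]
    exact ENNReal.ofReal_ne_top
  have : IsFiniteMeasure (volume.restrict (pCyl p.1 p.2 R)) :=
    ⟨by rw [Measure.restrict_apply_univ]; exact hQt.lt_top⟩
  have : IsFiniteMeasure (volume.restrict (Iminus p.1 R)) :=
    ⟨by rw [Measure.restrict_apply_univ]; exact hIt.lt_top⟩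
  have hui : IntegrableOn (fun z => |u z| ^ q) (pCyl p.1 p.2 R) := by
    refine integrable_rpow_of_sq hu.meas_u.abs (fun z => abs_nonneg _) ?_ (by linarith) hq2
    simp_rw [sq_abs]
    exact (hu.memLp_u.mono_measure
      (Measure.restrict_mono (pCyl_mono hR.le (by linarith)) le_rfl)).integrable_sq
  have hτq : IntegrableOn (fun t => τ t ^ q) (Iminus p.1 R) :=
    integrable_rpow_of_sq hτ hτ0 hτi (by linarith) hq2
  have h1ε : 0 < 1 + ε := by linarith
  suffices h : ∀ η : ℝ, 0 < η → u p ≤ C * ((κ * X + Y + η) + M) by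
    have h0 : u p ≤ C * (κ * X + Y + M) := by
      refine le_of_forall_pos_le_add fun η hη => ?_
      have := h (η / C) (by positivity)
      have e : C * ((κ * X + Y + η / C) + M) = C * (κ * X + Y + M) + η := by
        field_simp
        ring
      linarith
    have h1 : κ * X + Y + M ≤ κ * (X + Y + M) := by nlinarith
    rw [mul_assoc]
    exact h0.trans (mul_le_mul_of_nonneg_left h1 hC.le)
  intro η hη
  set δ₀ := κ * X + Y + η with hδ₀
  have hδ0 : 0 < δ₀ := by positivity
  suffices h : _ ∧ _ by
    obtain ⟨δ, hδ, hL⟩ := H K hK ν p.1 p.2 R u Du a hR hR1 hu δ₀ hδ0 h.1 h.2 _ (fun j => rfl) hm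
    exact le_of_frequently_setLIntegral_lt hu.meas_u (fun j => by positivity) hleb hδ hL
  constructor
  · calc ∫⁻ z in pCyl p.1 p.2 R, ENNReal.ofReal (u z) ^ (1 + ε)
        ≤ ∫⁻ z in pCyl p.1 p.2 R, ENNReal.ofReal |u z| ^ (1 + ε) :=
          lintegral_mono fun z => ENNReal.rpow_le_rpow
            (ENNReal.ofReal_le_ofReal (le_abs_self _)) h1ε.le
      _ ≤ ENNReal.ofReal (X ^ (1 + ε)) * volume (pCyl p.1 p.2 R) :=
          setLIntegral_rpow_le_of_setAverage_le hQ0 hQt hu.meas_u.abs (fun z => abs_nonneg _)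
            h1ε hεq hui le_rfl
      _ ≤ ENNReal.ofReal (X ^ (1 + ε)) * ENNReal.ofReal (R ^ (d + 2) * κ) := by
          rw [hvQ, ENNReal.ofReal_mul (by positivity)]
          gcongr
          rw [ENNReal.le_ofReal_iff_toReal_le hBt (by positivity)]
          exact le_max_right _ _
      _ ≤ ENNReal.ofReal (δ₀ ^ (1 + ε) * R ^ (d + 2)) := by
          rw [← ENNReal.ofReal_mul (by positivity)]
          refine ENNReal.ofReal_le_ofReal ?_
          have e1 : κ ≤ κ ^ (1 + ε) := Real.self_le_rpow_of_one_le hκ1 (by linarith)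
          have e2 : κ * X ^ (1 + ε) ≤ δ₀ ^ (1 + ε) :=
            calc κ * X ^ (1 + ε) ≤ κ ^ (1 + ε) * X ^ (1 + ε) := by gcongr
              _ = (κ * X) ^ (1 + ε) := (Real.mul_rpow (by positivity) hX0).symm
              _ ≤ δ₀ ^ (1 + ε) := Real.rpow_le_rpow (by positivity) (by linarith) h1ε.le
          calc X ^ (1 + ε) * (R ^ (d + 2) * κ) = (κ * X ^ (1 + ε)) * R ^ (d + 2) := by ring
            _ ≤ _ := by gcongr
  · have hδY : Y ≤ δ₀ := by
      have := mul_nonneg (zero_le_one.trans hκ1) hX0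
      linarith
    calc _ ≤ ∫⁻ t in Iminus p.1 R, ENNReal.ofReal (τ t) ^ (1 + ε) := by
          refine lintegral_mono_ae (hτt.mono fun t ht => ?_)
          rw [← ht]
          gcongr
          exact le_abs_self _
      _ ≤ ENNReal.ofReal (δ₀ ^ (1 + ε)) * volume (Iminus p.1 R) :=
          setLIntegral_rpow_le_of_setAverage_le hI0 hIt hτ hτ0 h1ε hεq hτq hδY
      _ = _ := by rw [hvI, ← ENNReal.ofReal_mul (by positivity)]
/-- **Theorem 1.1 (Pointwise Riesz potential estimate).** -/
theorem pointwise_riesz_potential_estimate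
    (d : ℕ) (hd : 2 ≤ d) (s Λ q : ℝ)
    (hs : s ∈ Set.Ioo (0 : ℝ) 1) (hΛ : 1 ≤ Λ) (hq : q ∈ Set.Ioc (1 : ℝ) 2) :
    ∃ C : ℝ, 0 < C ∧
      ∀ (T : ℝ), 0 < T → ∀ (Ω : Set (Ed d)), IsOpen Ω → Bornology.IsBounded Ω →
      ∀ (A : ℝ → Ed d → Ed d → Ed d), VectorFieldHyp d Λ A →
      ∀ (K : ℝ → Ed d → Ed d → ℝ), KernelHyp d s Λ K →
      ∀ (μ : MeasureTheory.SignedMeasure (ℝ × Ed d)),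
      ∀ (u : ℝ → Ed d → ℝ) (Du : ℝ → Ed d → Ed d),
        LocalWeakReg d s (Set.Ioo 0 T) Ω u Du →
        IsLocalWeakSolution A K (Set.Ioo 0 T) Ω μ u Du →
        ∀ R ∈ Set.Ioc (0 : ℝ) 1,
          ∀ᵐ p ∂(volume : Measure (ℝ × Ed d)),
            p ∈ (Set.Ioo 0 T) ×ˢ Ω →
            closure (pCyl p.1 p.2 (2 * R)) ⊆ (Set.Ioo 0 T) ×ˢ Ω →
            |u p.1 p.2| ≤
              C * ((⨍ z in pCyl p.1 p.2 R, |u z.1 z.2| ^ q) ^ (1 / q)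
                + (⨍ t in Iminus p.1 R, (Tail s (u t) p.2 R) ^ q) ^ (1 / q)
                + RieszPot μ.totalVariation 2 p.1 p.2 (2 * R)) := by
  obtain ⟨hs0, hs1⟩ := hs
  obtain ⟨C, hC, H⟩ := exists_pointwise_bound hd hΛ hs0 hs1 hq.1 hq.2
  refine ⟨C * 2 ^ (d + 1), by positivity, fun T _ Ω hΩ _ A hA K hK μ u Du hu hsol R hR => ?_⟩
  have hR0 : 0 < R := hR.1
  have hr : Tendsto (fun j : ℕ => R / 2 ^ j) atTop (𝓝 0) :=
    tendsto_const_nhds.div_atTop (tendsto_pow_atTop_atTop_of_one_lt one_lt_two)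
  filter_upwards [ae_frequently_setLIntegral_pCyl_sub_lt_of_locallyIntegrableOn
    hu.meas (isOpen_Ioo.prod hΩ) (hu.locallyIntegrableOn isOpen_Ioo hΩ)
    (fun j => by positivity : ∀ j : ℕ, 0 < R / 2 ^ j) hr,
    ae_integrableOn_rieszPot μ.totalVariation (2 * R)] with p hleb hries hpU hpQ
  have hsolC := cylSol_of_isLocalWeakSolution hA hu hsol (by positivity : 0 < 2 * R) hpQ
  have hJ : Icc (p.1 - R ^ 2) p.1 ⊆ Ioo 0 T := fun t ht => by
    have : (t, p.2) ∈ closure (pCyl p.1 p.2 (2 * R)) := by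
      rw [closure_pCyl (by positivity)]
      exact ⟨⟨by nlinarith [ht.1], ht.2⟩, mem_closedBall_self (by positivity)⟩
    exact (hpQ this).1
  obtain ⟨hτe, hτi⟩ := hu.integrable_tail_sq hs0 hR0 hJ p.2
  obtain ⟨hsum, hsumle⟩ := summable_dyadic_rieszPot hR0 hries
  have hτm : Measurable fun t => Tail s (u t) p.2 R := measurable_tail hu.meas p.2 R
  have hup := H K hK μ.totalVariation p R _ _ _ _ hR0 hR.2 hsolC hτm
    (fun t => tail_nonneg s (u t) p.2 R) hτi hτe hsum (hleb hpU)
  have hun := H K hK μ.totalVariation p R _ _ _ _ hR0 hR.2 hsolC.neg hτm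
    (fun t => tail_nonneg s (u t) p.2 R) hτi
    (by simpa only [abs_neg, Function.uncurry_apply_pair] using hτe) hsum (by
      simpa only [neg_sub_neg, enorm_sub_rev] using hleb hpU)
  simp only [abs_neg, Function.uncurry_def] at hup hun
  have hX0 : 0 ≤ (⨍ z in pCyl p.1 p.2 R, |u z.1 z.2| ^ q) ^ (1 / q) := Real.rpow_nonneg (by
    rw [setAverage_eq]
    exact smul_nonneg (by positivity) (integral_nonneg fun z => by positivity)) _
  have hY0 : 0 ≤ (⨍ t in Iminus p.1 R, (Tail s (u t) p.2 R) ^ q) ^ (1 / q) :=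
    Real.rpow_nonneg (by
      rw [setAverage_eq]
      exact smul_nonneg (by positivity)
        (integral_nonneg fun t => Real.rpow_nonneg (tail_nonneg s (u t) p.2 R) q)) _
  have h2 : (1 : ℝ) ≤ 2 ^ (d + 1) := one_le_pow₀ one_le_two
  refine (abs_le'.2 ⟨hup, hun⟩).trans ?_
  rw [mul_assoc]
  refine mul_le_mul_of_nonneg_left ?_ hC.le
  nlinarith
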